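/- For every complete Bernstein function ψ there exist a unique R ∈ (0,∞] and a unique locally finite nonnegative Borel measure a on [0,R) (a Krein string) such that for every ξ > 0, ψ(ξ) = −φ_ξ′(0⁺) + a({0}) ξ, where φ_ξ is the unique solution of the string equation for the data (R, a, ξ). -/

import Mathlib

open MeasureTheory Filter Set
open scoped ENNReal Topology

noncomputable section

/-- The interval `[0, R)` as a subset of `ℝ`, where `R ∈ (0, ∞]`. -/
def IsetOf (R : ℝ≥0∞) : Set ℝ := {y : ℝ | 0 ≤ y ∧ ENNReal.ofReal y < R}

/-- `a` is a locally finite nonnegative Borel measure on `[0, R)`: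
it is carried by `[0, R)` and finite on compact subsets of `[0, R)`. -/
def LocallyFiniteOnHalf (R : ℝ≥0∞) (a : MeasureTheory.Measure ℝ) : Prop :=
  a ((IsetOf R)ᶜ) = 0 ∧ ∀ y ∈ IsetOf R, a (Set.Icc 0 y) < ⊤

/-- `b` is locally square-integrable on `[0, R)`. -/
def LocL2OnHalf (R : ℝ≥0∞) (b : ℝ → ℝ) : Prop :=
  ∀ y ∈ IsetOf R, MeasureTheory.IntegrableOn (fun t => (b t) ^ 2) (Set.Icc 0 y)

/-- A solution `φ` (with right-continuous locally-BV version `v` of `φ′`) of Krein's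
string equation `φ″(dy) = ξ φ(y) a(dy)` on `(0, R)`, with `φ(0) = 1`, `φ` locally
absolutely continuous and bounded on `[0, R)`, and `φ(y) → 0` as `y → R⁻` when `R < ∞`. -/
structure IsStringSolution (R : ℝ≥0∞) (a : MeasureTheory.Measure ℝ) (ξ : ℝ)
    (φ : ℝ → ℝ) (v : ℝ → ℝ) : Prop where
  init : φ 0 = 1
  deriv_integrable : ∀ y ∈ IsetOf R, MeasureTheory.IntegrableOn v (Set.Icc 0 y)
  locAC : ∀ y ∈ IsetOf R, φ y = 1 + ∫ t in (0:ℝ)..y, v t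
  right_cont : ∀ y ∈ IsetOf R, 0 < y → ContinuousWithinAt v (Set.Ici y) y
  bounded : ∃ M : ℝ, ∀ y ∈ IsetOf R, |φ y| ≤ M
  boundary : R ≠ ⊤ →
    Filter.Tendsto φ (nhdsWithin R.toReal (Set.Iio R.toReal)) (nhds 0)
  integ_a : ∀ y ∈ IsetOf R, MeasureTheory.IntegrableOn φ (Set.Icc 0 y) a
  eqn : ∀ y₁ y₂ : ℝ, 0 < y₁ → y₁ ≤ y₂ → y₂ ∈ IsetOf R →
    v y₂ - v y₁ = ξ * ∫ y in Set.Ioc y₁ y₂, φ y ∂a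

/-- A *complete Bernstein function*: `Φ(ξ) = c₁ + c₂ ξ + ∫_{(0,∞)} ξ/(ξ+s) μ(ds)` for
some `c₁, c₂ ≥ 0` and a nonnegative Borel measure `μ` on `(0, ∞)` with
`∫_{(0,∞)} (1+s)⁻¹ μ(ds) < ∞`. -/
def IsCompleteBernstein (Φ : ℝ → ℝ) : Prop :=
  ∃ (c₁ c₂ : ℝ) (μ : MeasureTheory.Measure ℝ), 0 ≤ c₁ ∧ 0 ≤ c₂ ∧
    μ (Set.Iic 0) = 0 ∧ (∫⁻ s, ENNReal.ofReal ((1 + s)⁻¹) ∂μ) < ⊤ ∧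
    ∀ ξ : ℝ, 0 < ξ →
      MeasureTheory.Integrable (fun s : ℝ => ξ / (ξ + s)) μ ∧
      Φ ξ = c₁ + c₂ * ξ + ∫ s : ℝ, ξ / (ξ + s) ∂μ

namespace Krein

/-! ### Mass distribution functions and Volterra iterates -/

/-- `F` is a nonnegative, nondecreasing, right-continuous function on `[0, X]`. -/
structure Str (F : ℝ → ℝ) (X : ℝ) : Prop where
  mono : MonotoneOn F (Icc 0 X)
  nonneg : 0 ≤ F 0
  rc : ∀ t ∈ Ico 0 X, ContinuousWithinAt F (Ici t) t

namespace Str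

variable {F g : ℝ → ℝ} {X Y t s : ℝ}

theorem restrict (h : Str F X) (hY : Y ≤ X) : Str F Y where
  mono := h.mono.mono (Icc_subset_Icc_right hY)
  nonneg := h.nonneg
  rc t ht := h.rc t ⟨ht.1, ht.2.trans_le hY⟩

theorem const {c : ℝ} (hc : 0 ≤ c) : Str (fun _ => c) X where
  mono := monotoneOn_const
  nonneg := hc
  rc _ _ := continuousWithinAt_const

theorem pos (h : Str F X) (ht : t ∈ Icc 0 X) : 0 ≤ F t :=
  h.nonneg.trans (h.mono ⟨le_rfl, ht.1.trans ht.2⟩ ht ht.1)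

theorem le (h : Str F X) (hs : 0 ≤ s) (hst : s ≤ t) (ht : t ≤ X) : F s ≤ F t :=
  h.mono ⟨hs, hst.trans ht⟩ ⟨hs.trans hst, ht⟩ hst

theorem mul (h : Str F X) (h' : Str g X) : Str (fun t => F t * g t) X where
  mono a ha b hb hab := mul_le_mul (h.mono ha hb hab) (h'.mono ha hb hab) (h'.pos ha) (h.pos hb)
  nonneg := mul_nonneg h.nonneg h'.nonneg
  rc t ht := (h.rc t ht).mul (h'.rc t ht)

theorem intable (h : Str F X) (hs : 0 ≤ s) (hst : s ≤ t) (ht : t ≤ X) :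
    IntervalIntegrable F volume s t := by
  apply MonotoneOn.intervalIntegrable
  rw [uIcc_of_le hst]
  exact h.mono.mono (Icc_subset_Icc hs ht)

end Str

theorem continuousOn_prim {E : Type*} [NormedAddCommGroup E] [NormedSpace ℝ E]
    {v : ℝ → E} {X : ℝ} (hX : 0 ≤ X) (hv : IntervalIntegrable v volume 0 X) :
    ContinuousOn (fun t => ∫ s in (0:ℝ)..t, v s) (Icc 0 X) := by
  have := intervalIntegral.continuousOn_primitive_interval' hv (a := 0) (by simp)
  rwa [uIcc_of_le hX] at this

theorem ici_of_icc {E : Type*} [TopologicalSpace E] {f : ℝ → E} {X t : ℝ}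
    (h : ContinuousOn f (Icc 0 X)) (ht : t ∈ Ico 0 X) : ContinuousWithinAt f (Ici t) t := by
  have h1 : ContinuousWithinAt f (Icc t X) t :=
    (h t ⟨ht.1, ht.2.le⟩).mono (Icc_subset_Icc_left ht.1)
  exact h1.mono_of_mem_nhdsWithin (Icc_mem_nhdsGE ht.2)

theorem sub_int {E : Type*} [NormedAddCommGroup E]
    {v : ℝ → E} {X s t : ℝ} (hv : IntervalIntegrable v volume 0 X)
    (hs : 0 ≤ s) (hst : s ≤ t) (ht : t ≤ X) : IntervalIntegrable v volume s t := by
  apply hv.mono_set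
  rw [uIcc_of_le hst, uIcc_of_le (hs.trans (hst.trans ht))]
  exact Icc_subset_Icc hs ht

theorem deriv_prim {E : Type*} [NormedAddCommGroup E] [NormedSpace ℝ E] [CompleteSpace E]
    {v : ℝ → E} {X t : ℝ} (hv : IntervalIntegrable v volume 0 X)
    (ht : t ∈ Ico 0 X) (hc : ContinuousWithinAt v (Ici t) t) :
    HasDerivWithinAt (fun t => ∫ s in (0:ℝ)..t, v s) (v t) (Ici t) t := by
  have hm : StronglyMeasurableAtFilter v (𝓝[>] t) volume := by
    refine ⟨Ioc t X, Ioc_mem_nhdsGT ht.2, ?_⟩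
    have := (sub_int hv ht.1 ht.2.le le_rfl).1
    exact this.aestronglyMeasurable
  exact intervalIntegral.integral_hasDerivWithinAt_right
    (sub_int hv le_rfl ht.1 ht.2.le) hm (hc.mono Ioi_subset_Ici_self)

/-- Iterates of the Volterra operator `g ↦ ∫₀ᵗ (F t - F s) g s ds`. -/
def vit (F g : ℝ → ℝ) : ℕ → ℝ → ℝ
  | 0 => g
  | n + 1 => fun t => ∫ s in (0:ℝ)..t, (F t - F s) * vit F g n s

section
variable {F g : ℝ → ℝ} {X Y t s : ℝ}

theorem Str.step_eq (hF : Str F X) (hg : Str g X) (ht : t ∈ Icc 0 X) :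
    ∫ s in (0:ℝ)..t, (F t - F s) * g s =
      F t * (∫ s in (0:ℝ)..t, g s) - ∫ s in (0:ℝ)..t, F s * g s := by
  rw [← intervalIntegral.integral_const_mul, ← intervalIntegral.integral_sub]
  · simp [sub_mul]
  · exact (hg.intable le_rfl ht.1 ht.2).const_mul _
  · exact (hF.mul hg).intable le_rfl ht.1 ht.2

theorem Str.step_intable (hF : Str F X) (hg : Str g X) {r : ℝ} (ht : t ∈ Icc 0 X)
    (hr : r ∈ Icc 0 X) : IntervalIntegrable (fun s => (F r - F s) * g s) volume 0 t := by
  simp only [sub_mul]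
  exact ((hg.intable le_rfl ht.1 ht.2).const_mul _).sub ((hF.mul hg).intable le_rfl ht.1 ht.2)

theorem Str.step (hF : Str F X) (hg : Str g X) :
    Str (fun t => ∫ s in (0:ℝ)..t, (F t - F s) * g s) X where
  nonneg := by simp
  mono a ha b hb hab := by
    calc ∫ s in (0:ℝ)..a, (F a - F s) * g s ≤ ∫ s in (0:ℝ)..a, (F b - F s) * g s := by
          apply intervalIntegral.integral_mono_on ha.1 (hF.step_intable hg ha ha)
            (hF.step_intable hg ha hb)
          intro s hs
          have := hg.pos (t := s) ⟨hs.1, hs.2.trans ha.2⟩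
          have := hF.mono ha hb hab
          gcongr
      _ ≤ ∫ s in (0:ℝ)..b, (F b - F s) * g s := by
          apply intervalIntegral.integral_mono_interval le_rfl ha.1 hab _
            (hF.step_intable hg hb hb)
          filter_upwards [ae_restrict_mem measurableSet_Ioc] with s hs
          exact mul_nonneg (sub_nonneg.2 (hF.le hs.1.le hs.2 hb.2))
            (hg.pos ⟨hs.1.le, hs.2.trans hb.2⟩)
  rc t ht := by
    have hX : 0 ≤ X := ht.1.trans ht.2.le
    have h1 : ContinuousWithinAt (fun t => F t * (∫ s in (0:ℝ)..t, g s) -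
        ∫ s in (0:ℝ)..t, F s * g s) (Ici t) t :=
      ((hF.rc t ht).mul (ici_of_icc (continuousOn_prim hX (hg.intable le_rfl hX le_rfl)) ht)).sub
        (ici_of_icc (continuousOn_prim hX ((hF.mul hg).intable le_rfl hX le_rfl)) ht)
    refine h1.congr_of_eventuallyEq ?_ (hF.step_eq hg ⟨ht.1, ht.2.le⟩)
    filter_upwards [Icc_mem_nhdsGE ht.2] with s hs
    exact hF.step_eq hg ⟨ht.1.trans hs.1, hs.2⟩

theorem Str.iter (hF : Str F X) (hg : Str g X) (n : ℕ) : Str (vit F g n) X := by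
  induction n with
  | zero => exact hg
  | succ n ih => exact hF.step ih

theorem sub_mul_pow_le {x y : ℝ} (n : ℕ) (hy : 0 ≤ y) (hxy : y ≤ x) :
    (x - y) * y ^ n * (n + 1) ≤ x ^ (n + 1) := by
  induction n with
  | zero => simp; linarith
  | succ n ih =>
    have h1 : y ^ (n + 1) ≤ x ^ (n + 1) := pow_le_pow_left₀ hy hxy _
    have h2 := mul_le_mul_of_nonneg_left ih hy
    have h3 := mul_le_mul_of_nonneg_left h1 (sub_nonneg.2 hxy)
    push_cast
    calc (x - y) * y ^ (n + 1) * (n + 1 + 1)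
        = y * ((x - y) * y ^ n * (n + 1)) + (x - y) * y ^ (n + 1) := by ring
      _ ≤ y * x ^ (n + 1) + (x - y) * x ^ (n + 1) := add_le_add h2 h3
      _ = x ^ (n + 1 + 1) := by ring

theorem Str.it_le (hF : Str F X) (hg : Str g X) (n : ℕ) (ht : t ∈ Icc 0 X) :
    vit F g n t ≤ g t * ((F t * t) ^ n / (n.factorial : ℝ) ^ 2) := by
  induction n generalizing t with
  | zero => simp [vit]
  | succ n ih =>
    have hgt := hg.pos ht
    have hFt := hF.pos ht
    calc vit F g (n + 1) t
        ≤ ∫ s in (0:ℝ)..t, g t * (F t ^ (n + 1) / (n + 1) / (n.factorial : ℝ) ^ 2) * s ^ n := by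
          apply intervalIntegral.integral_mono_on ht.1 (hF.step_intable (hF.iter hg n) ht ht)
          · exact Continuous.intervalIntegrable (by fun_prop) _ _
          intro s hs
          have hs' : s ∈ Icc 0 X := ⟨hs.1, hs.2.trans ht.2⟩
          have h1 := ih hs'
          have h2 : g s ≤ g t := hg.mono hs' ht hs.2
          have h3 : F s ≤ F t := hF.mono hs' ht hs.2
          have h4 := sub_mul_pow_le n (hF.pos hs') h3
          have h5 := hF.pos hs'
          have hs0 := hs.1
          calc (F t - F s) * vit F g n s
              ≤ (F t - F s) * (g t * ((F s * s) ^ n / (n.factorial : ℝ) ^ 2)) := by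
                apply mul_le_mul_of_nonneg_left _ (sub_nonneg.2 h3)
                exact h1.trans (mul_le_mul_of_nonneg_right h2 (by positivity))
            _ = g t * (((F t - F s) * F s ^ n * (n + 1)) / (n + 1) / (n.factorial : ℝ) ^ 2) *
                  s ^ n := by rw [mul_pow]; field_simp
            _ ≤ _ := by gcongr
      _ = g t * ((F t * t) ^ (n + 1) / ((n + 1).factorial : ℝ) ^ 2) := by
          rw [intervalIntegral.integral_const_mul, integral_pow, Nat.factorial_succ, mul_pow]
          push_cast
          field_simp
          simp

theorem Str.it_le' (hF : Str F X) (hg : Str g X) (n : ℕ) (ht : t ∈ Icc 0 X) :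
    vit F g n t ≤ g X * ((F X * X) ^ n / (n.factorial : ℝ) ^ 2) := by
  have hX : X ∈ Icc 0 X := ⟨ht.1.trans ht.2, le_rfl⟩
  exact ((hF.iter hg n).mono ht hX ht.2).trans (hF.it_le hg n hX)

theorem summable_fact (r : ℝ) : Summable fun n : ℕ => r ^ n / (n.factorial : ℝ) ^ 2 := by
  refine Summable.of_norm_bounded (Real.summable_pow_div_factorial |r|) fun n => ?_
  rw [norm_div, norm_pow, norm_pow, Real.norm_natCast, Real.norm_eq_abs]
  have h1 : (1:ℝ) ≤ n.factorial := by exact_mod_cast Nat.one_le_iff_ne_zero.2 n.factorial_ne_zero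
  have h2 : (n.factorial : ℝ) ≤ (n.factorial : ℝ) ^ 2 := by nlinarith
  gcongr

variable {𝕜 : Type*} [RCLike 𝕜] {ζ c f₀ : 𝕜}

/-- The Neumann series of the Volterra operator with seed `g`. -/
def ser (F g : ℝ → ℝ) (ζ : 𝕜) (t : ℝ) : 𝕜 := ∑' n, ζ ^ n * ((vit F g n t : ℝ) : 𝕜)

theorem Str.norm_it_le (hF : Str F X) (hg : Str g X) (ζ : 𝕜) (n : ℕ) (ht : t ∈ Icc 0 X) :
    ‖ζ ^ n * ((vit F g n t : ℝ) : 𝕜)‖ ≤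
      g X * ((‖ζ‖ * (F X * X)) ^ n / (n.factorial : ℝ) ^ 2) := by
  have h1 := hF.it_le' hg n ht
  rw [norm_mul, norm_pow, RCLike.norm_ofReal, abs_of_nonneg ((hF.iter hg n).pos ht)]
  calc _ ≤ ‖ζ‖ ^ n * (g X * ((F X * X) ^ n / (n.factorial : ℝ) ^ 2)) := by gcongr
    _ = _ := by rw [mul_pow]; ring

theorem Str.summable_bd (g : ℝ → ℝ) (ζ : 𝕜) :
    Summable fun n : ℕ => g X * ((‖ζ‖ * (F X * X)) ^ n / (n.factorial : ℝ) ^ 2) :=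
  (summable_fact _).mul_left _

theorem Str.hasSum_ser (hF : Str F X) (hg : Str g X) (ζ : 𝕜) (ht : t ∈ Icc 0 X) :
    HasSum (fun n => ζ ^ n * ((vit F g n t : ℝ) : 𝕜)) (ser F g ζ t) :=
  (Summable.of_norm_bounded (Str.summable_bd (F := F) (X := X) g ζ)
    fun n => hF.norm_it_le hg ζ n ht).hasSum

theorem Str.norm_ser_le (hF : Str F X) (hg : Str g X) (ζ : 𝕜) (ht : t ∈ Icc 0 X) :
    ‖ser F g ζ t‖ ≤ ∑' n : ℕ, g X * ((‖ζ‖ * (F X * X)) ^ n / (n.factorial : ℝ) ^ 2) :=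
  tsum_of_norm_bounded (Str.summable_bd (F := F) (X := X) g ζ).hasSum
    fun n => hF.norm_it_le hg ζ n ht

theorem Str.cast_intable (hg : Str g X) (ht : t ∈ Icc 0 X) :
    IntervalIntegrable (fun s => ((g s : ℝ) : 𝕜)) volume 0 t := by
  have := hg.intable le_rfl ht.1 ht.2
  exact ⟨this.1.ofReal, this.2.ofReal⟩

theorem Str.ser_intable (hF : Str F X) (hg : Str g X) (ζ : 𝕜) (ht : t ∈ Icc 0 X) :
    IntervalIntegrable (ser F g ζ) volume 0 t := by
  rw [intervalIntegrable_iff_integrableOn_Ioc_of_le ht.1]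
  have hm : AEStronglyMeasurable (ser F g ζ) (volume.restrict (Ioc 0 t)) := by
    refine aestronglyMeasurable_of_tendsto_ae atTop
      (f := fun N s => ∑ n ∈ Finset.range N, ζ ^ n * ((vit F g n s : ℝ) : 𝕜)) ?_ ?_
    · intro N
      apply Finset.aestronglyMeasurable_fun_sum
      intro n _
      exact (((hF.iter hg n).cast_intable ht).1.aestronglyMeasurable).const_mul _
    · filter_upwards [ae_restrict_mem measurableSet_Ioc] with s hs
      exact (hF.hasSum_ser hg ζ ⟨hs.1.le, hs.2.trans ht.2⟩).tendsto_sum_nat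
  refine Integrable.of_bound hm (∑' n : ℕ, g X *
    ((‖ζ‖ * (F X * X)) ^ n / (n.factorial : ℝ) ^ 2)) ?_
  filter_upwards [ae_restrict_mem measurableSet_Ioc] with s hs
  exact hF.norm_ser_le hg ζ ⟨hs.1.le, hs.2.trans ht.2⟩

theorem ii_ofReal (w : ℝ → ℝ) (a b : ℝ) :
    ∫ s in a..b, ((w s : ℝ) : 𝕜) = ((∫ s in a..b, w s : ℝ) : 𝕜) := by
  simp [intervalIntegral, integral_ofReal]

theorem Str.hasSum_int (hF : Str F X) (hg : Str g X) (ζ : 𝕜) (ht : t ∈ Icc 0 X)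
    {w : ℝ → ℝ} {B : ℝ} (hw : IntervalIntegrable w volume 0 t) (hB : ∀ s ∈ Icc 0 t, |w s| ≤ B) :
    HasSum (fun n => ζ ^ n * ((∫ s in (0:ℝ)..t, w s * vit F g n s : ℝ) : 𝕜))
      (∫ s in (0:ℝ)..t, (w s : 𝕜) * ser F g ζ s) := by
  have key : HasSum (fun n => ∫ s in (0:ℝ)..t, (w s : 𝕜) * (ζ ^ n * ((vit F g n s : ℝ) : 𝕜)))
      (∫ s in (0:ℝ)..t, (w s : 𝕜) * ser F g ζ s) := by
    apply intervalIntegral.hasSum_integral_of_dominated_convergence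
      (fun n _ => B * (g X * ((‖ζ‖ * (F X * X)) ^ n / (n.factorial : ℝ) ^ 2)))
    · intro n
      rw [uIoc_of_le ht.1]
      refine AEStronglyMeasurable.mul ?_ ?_
      · exact hw.1.ofReal.aestronglyMeasurable
      · exact (((hF.iter hg n).cast_intable ht).1.aestronglyMeasurable).const_mul _
    · intro n
      refine ae_of_all _ fun s hs => ?_
      rw [uIoc_of_le ht.1] at hs
      rw [norm_mul, RCLike.norm_ofReal]
      exact mul_le_mul (hB s ⟨hs.1.le, hs.2⟩) (hF.norm_it_le hg ζ n ⟨hs.1.le, hs.2.trans ht.2⟩)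
        (norm_nonneg _) ((abs_nonneg _).trans (hB s ⟨hs.1.le, hs.2⟩))
    · exact ae_of_all _ fun s _ => (Str.summable_bd (F := F) (X := X) g ζ).mul_left _
    · exact intervalIntegrable_const
    · refine ae_of_all _ fun s hs => ?_
      rw [uIoc_of_le ht.1] at hs
      exact (hF.hasSum_ser hg ζ ⟨hs.1.le, hs.2.trans ht.2⟩).mul_left _
  convert key using 2 with n
  rw [← ii_ofReal, ← intervalIntegral.integral_const_mul]
  congr 1; ext s; push_cast; ring

theorem Str.ser_eq (hF : Str F X) (hg : Str g X) (ζ : 𝕜) (ht : t ∈ Icc 0 X) :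
    ser F g ζ t = g t + ζ * ∫ s in (0:ℝ)..t, ((F t - F s : ℝ) : 𝕜) * ser F g ζ s := by
  have h1 := (hF.hasSum_int hg ζ ht (w := fun s => F t - F s) (B := F t)
    ((intervalIntegrable_const).sub (hF.intable le_rfl ht.1 ht.2)) (fun s hs => by
      have := hF.mono ⟨hs.1, hs.2.trans ht.2⟩ ht hs.2
      have := hF.pos ⟨hs.1, hs.2.trans ht.2⟩
      rw [abs_of_nonneg] <;> linarith)).mul_left ζ
  have h2 := hF.hasSum_ser hg ζ ht
  rw [← hasSum_nat_add_iff' 1] at h2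
  have h4 : (fun n => ζ ^ (n + 1) * ((vit F g (n + 1) t : ℝ) : 𝕜)) = fun n =>
      ζ * (ζ ^ n * ((∫ s in (0:ℝ)..t, (F t - F s) * vit F g n s : ℝ) : 𝕜)) := by
    ext n
    rw [← mul_assoc, ← pow_succ']; rfl
  rw [h4] at h2
  have h3 := h2.unique h1
  simp only [Finset.range_one, Finset.sum_singleton, pow_zero, one_mul] at h3
  rw [← h3, vit]; ring

/-- `f` solves the string equation with parameter `ζ` on `[0, X]`, has right derivative `v`,
`f 0 = f₀`, and initial quasi-derivative `c`. -/
structure Sol (F : ℝ → ℝ) (X : ℝ) (ζ c f₀ : 𝕜) (f v : ℝ → 𝕜) : Prop where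
  int : IntervalIntegrable v volume 0 X
  f_eq : ∀ t ∈ Icc 0 X, f t = f₀ + ∫ s in (0:ℝ)..t, v s
  v_eq : ∀ t ∈ Icc 0 X, v t = c + ζ * (F t * f t - ∫ s in (0:ℝ)..t, (F s : 𝕜) * v s)

end

section
variable {F : ℝ → ℝ} {X Y t s : ℝ} {𝕜 : Type*} [RCLike 𝕜] {ζ c f₀ c₁ c₂ f₁ f₂ : 𝕜}

/-- Right derivative of the solution with data `f 0 = f₀`, quasi-derivative `c`. -/
def solV (F : ℝ → ℝ) (ζ c f₀ : 𝕜) (t : ℝ) : 𝕜 :=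
  c * ser F (fun _ => 1) ζ t + ζ * f₀ * ser F F ζ t

/-- The solution with data `f 0 = f₀`, quasi-derivative `c`. -/
def solF (F : ℝ → ℝ) (ζ c f₀ : 𝕜) (x : ℝ) : 𝕜 := f₀ + ∫ t in (0:ℝ)..x, solV F ζ c f₀ t

theorem Str.one : Str (fun _ => (1:ℝ)) X := Str.const zero_le_one

theorem Str.mul_intable (hF : Str F X) {v : ℝ → 𝕜} (hv : IntervalIntegrable v volume 0 X)
    (ht : t ∈ Icc 0 X) : IntervalIntegrable (fun s => (F s : 𝕜) * v s) volume 0 t := by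
  have h1 := sub_int hv le_rfl ht.1 ht.2
  rw [intervalIntegrable_iff_integrableOn_Ioc_of_le ht.1] at h1 ⊢
  refine Integrable.bdd_mul (c := F t) h1 ?_ ?_
  · exact (hF.intable le_rfl ht.1 ht.2).1.ofReal.aestronglyMeasurable
  · filter_upwards [ae_restrict_mem measurableSet_Ioc] with s hs
    rw [RCLike.norm_ofReal, abs_of_nonneg (hF.pos ⟨hs.1.le, hs.2.trans ht.2⟩)]
    exact hF.le hs.1.le hs.2 ht.2

theorem Str.solV_intable (hF : Str F X) (hX : 0 ≤ X) :
    IntervalIntegrable (solV F ζ c f₀) volume 0 X :=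
  ((hF.ser_intable Str.one ζ ⟨hX, le_rfl⟩).const_mul _).add
    ((hF.ser_intable hF ζ ⟨hX, le_rfl⟩).const_mul _)

theorem Str.sol (hF : Str F X) (hX : 0 ≤ X) :
    Sol F X ζ c f₀ (solF F ζ c f₀) (solV F ζ c f₀) where
  int := hF.solV_intable hX
  f_eq _ _ := rfl
  v_eq t ht := by
    have i1 := hF.ser_intable Str.one ζ ht
    have i2 := hF.ser_intable hF ζ ht
    have j1 := (hF.mul_intable (hF.ser_intable Str.one ζ ⟨hX, le_rfl⟩) ht)
    have j2 := (hF.mul_intable (hF.ser_intable hF ζ ⟨hX, le_rfl⟩) ht)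
    have e1 := hF.ser_eq Str.one ζ ht
    have e2 := hF.ser_eq hF ζ ht
    have k : ∀ {u : ℝ → 𝕜}, IntervalIntegrable u volume 0 t →
        IntervalIntegrable (fun s => (F s : 𝕜) * u s) volume 0 t →
        ∫ s in (0:ℝ)..t, ((F t - F s : ℝ) : 𝕜) * u s =
          F t * (∫ s in (0:ℝ)..t, u s) - ∫ s in (0:ℝ)..t, (F s : 𝕜) * u s := by
      intro u hu hu'
      rw [← intervalIntegral.integral_const_mul, ← intervalIntegral.integral_sub
        (hu.const_mul _) hu']
      congr 1; ext s; push_cast; ring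
    rw [k i1 j1] at e1
    rw [k i2 j2] at e2
    have m1 : ∫ s in (0:ℝ)..t, solV F ζ c f₀ s = c * (∫ s in (0:ℝ)..t, ser F (fun _ => 1) ζ s) +
        ζ * f₀ * ∫ s in (0:ℝ)..t, ser F F ζ s := by
      rw [← intervalIntegral.integral_const_mul, ← intervalIntegral.integral_const_mul,
        ← intervalIntegral.integral_add (i1.const_mul _) (i2.const_mul _)]
      rfl
    have m2 : ∫ s in (0:ℝ)..t, (F s : 𝕜) * solV F ζ c f₀ s =
        c * (∫ s in (0:ℝ)..t, (F s : 𝕜) * ser F (fun _ => 1) ζ s) +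
        ζ * f₀ * ∫ s in (0:ℝ)..t, (F s : 𝕜) * ser F F ζ s := by
      rw [← intervalIntegral.integral_const_mul, ← intervalIntegral.integral_const_mul,
        ← intervalIntegral.integral_add (j1.const_mul _) (j2.const_mul _)]
      congr 1; ext s; rw [solV]; ring
    rw [m2, solF, m1]
    rw [solV, e1, e2]
    push_cast
    ring

namespace Sol

variable {f v f' v' : ℝ → 𝕜}

theorem restrict (h : Sol F X ζ c f₀ f v) (hY : 0 ≤ Y) (hYX : Y ≤ X) : Sol F Y ζ c f₀ f v where
  int := sub_int h.int le_rfl hY hYX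
  f_eq t ht := h.f_eq t ⟨ht.1, ht.2.trans hYX⟩
  v_eq t ht := h.v_eq t ⟨ht.1, ht.2.trans hYX⟩

theorem f_zero (h : Sol F X ζ c f₀ f v) (hX : 0 ≤ X) : f 0 = f₀ := by
  simp [h.f_eq 0 ⟨le_rfl, hX⟩]

theorem v_zero (h : Sol F X ζ c f₀ f v) (hX : 0 ≤ X) : v 0 = c + ζ * (F 0 * f₀) := by
  simp [h.v_eq 0 ⟨le_rfl, hX⟩, h.f_zero hX]

theorem f_cont (h : Sol F X ζ c f₀ f v) (hX : 0 ≤ X) : ContinuousOn f (Icc 0 X) :=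
  (continuousOn_const.add (continuousOn_prim hX h.int)).congr h.f_eq

theorem p_eq (h : Sol F X ζ c f₀ f v) (ht : t ∈ Icc 0 X) :
    v t - ζ * (F t * f t) = c - ζ * ∫ s in (0:ℝ)..t, (F s : 𝕜) * v s := by
  rw [h.v_eq t ht]; ring

theorem p_cont (h : Sol F X ζ c f₀ f v) (hF : Str F X) (hX : 0 ≤ X) :
    ContinuousOn (fun t => v t - ζ * (F t * f t)) (Icc 0 X) :=
  (continuousOn_const.sub (continuousOn_const.mul (continuousOn_prim hX
    (hF.mul_intable h.int ⟨hX, le_rfl⟩)))).congr fun _ ht => h.p_eq ht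

theorem _root_.Krein.Str.rc_cast (hF : Str F X) (ht : t ∈ Ico 0 X) :
    ContinuousWithinAt (fun t => (F t : 𝕜)) (Ici t) t :=
  (RCLike.continuous_ofReal.continuousAt.comp_continuousWithinAt (hF.rc t ht))

theorem v_rc (h : Sol F X ζ c f₀ f v) (hF : Str F X) (ht : t ∈ Ico 0 X) :
    ContinuousWithinAt v (Ici t) t := by
  have hX : 0 ≤ X := ht.1.trans ht.2.le
  have h1 := (ici_of_icc (h.p_cont hF hX) ht).add
    ((continuousWithinAt_const (b := ζ)).mul ((hF.rc_cast ht).mul (ici_of_icc (h.f_cont hX) ht)))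
  exact h1.congr (fun _ _ => by simp) (by simp)

theorem f_deriv (h : Sol F X ζ c f₀ f v) (hF : Str F X) (ht : t ∈ Ico 0 X) :
    HasDerivWithinAt f (v t) (Ici t) t := by
  have h1 := (deriv_prim h.int ht (h.v_rc hF ht)).const_add f₀
  refine h1.congr_of_eventuallyEq ?_ (h.f_eq t ⟨ht.1, ht.2.le⟩)
  filter_upwards [Icc_mem_nhdsGE ht.2] with s hs
  exact h.f_eq s ⟨ht.1.trans hs.1, hs.2⟩

theorem p_deriv (h : Sol F X ζ c f₀ f v) (hF : Str F X) (ht : t ∈ Ico 0 X) :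
    HasDerivWithinAt (fun t => v t - ζ * (F t * f t)) (-(ζ * (F t * v t))) (Ici t) t := by
  have hX : 0 ≤ X := ht.1.trans ht.2.le
  have h1 := ((deriv_prim (hF.mul_intable h.int ⟨hX, le_rfl⟩) ht
    ((hF.rc_cast ht).mul (h.v_rc hF ht))).const_mul ζ).const_sub c
  refine h1.congr_of_eventuallyEq ?_ (h.p_eq ⟨ht.1, ht.2.le⟩)
  filter_upwards [Icc_mem_nhdsGE ht.2] with s hs
  exact h.p_eq ⟨ht.1.trans hs.1, hs.2⟩

theorem wronskian (h : Sol F X ζ c₁ f₁ f v) (h' : Sol F X ζ c₂ f₂ f' v') (hF : Str F X)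
    (ht : t ∈ Icc 0 X) : v t * f' t - f t * v' t = c₁ * f₂ - f₁ * c₂ := by
  have hX : 0 ≤ X := ht.1.trans ht.2
  have key := constant_of_has_deriv_right_zero (a := 0) (b := X)
    (f := fun t => (v t - ζ * (F t * f t)) * f' t - f t * (v' t - ζ * (F t * f' t)))
    (((h.p_cont hF hX).mul (h'.f_cont hX)).sub ((h.f_cont hX).mul (h'.p_cont hF hX)))
    (fun t ht => by
      refine (((h.p_deriv hF ht).mul (h'.f_deriv hF ht)).sub
        ((h.f_deriv hF ht).mul (h'.p_deriv hF ht))).congr_deriv ?_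
      ring) t ht
  simp only [h.f_zero hX, h'.f_zero hX, h.v_zero hX, h'.v_zero hX] at key
  linear_combination key

theorem v_bdd (h : Sol F X ζ c f₀ f v) (hF : Str F X) (hX : 0 ≤ X) :
    ∃ B, ∀ t ∈ Icc 0 X, ‖v t‖ ≤ B := by
  obtain ⟨B₁, h₁⟩ := isCompact_Icc.exists_bound_of_continuousOn (h.p_cont hF hX)
  obtain ⟨B₂, h₂⟩ := isCompact_Icc.exists_bound_of_continuousOn (h.f_cont hX)
  refine ⟨B₁ + ‖ζ‖ * (F X * B₂), fun t ht => ?_⟩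
  have e : v t = (v t - ζ * (F t * f t)) + ζ * (F t * f t) := by ring
  rw [e]
  refine (norm_add_le _ _).trans (add_le_add (h₁ t ht) ?_)
  rw [norm_mul, norm_mul, RCLike.norm_ofReal, abs_of_nonneg (hF.pos ht)]
  have := hF.mono ht ⟨hX, le_rfl⟩ ht.2
  have := hF.pos ⟨hX, le_rfl⟩
  have := h₂ t ht
  gcongr

end Sol
end

theorem le_of_rderiv {f f' : ℝ → ℝ} {a b : ℝ} (hab : a ≤ b) (hc : ContinuousOn f (Icc a b))
    (hd : ∀ x ∈ Ico a b, HasDerivWithinAt f (f' x) (Ici x) x) (h0 : ∀ x ∈ Ico a b, 0 ≤ f' x) :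
    f a ≤ f b :=
  image_le_of_deriv_right_le_deriv_boundary (f := fun _ => f a) (f' := fun _ => 0) (B := f)
    (B' := f') continuousOn_const (fun _ _ => hasDerivWithinAt_const _ _ _) le_rfl hc hd h0
    ⟨hab, le_rfl⟩

/-! ### The interval `[0, R)` -/

section
variable {R : ℝ≥0∞} {x y : ℝ}

theorem iset_down (hy : y ∈ IsetOf R) (hx : 0 ≤ x) (hxy : x ≤ y) : x ∈ IsetOf R :=
  ⟨hx, (ENNReal.ofReal_le_ofReal hxy).trans_lt hy.2⟩

theorem zero_mem_iset (hR : 0 < R) : (0:ℝ) ∈ IsetOf R := ⟨le_rfl, by simpa using hR⟩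

theorem iset_top : IsetOf ⊤ = Ici 0 := by
  ext y; simp [IsetOf]

theorem iset_fin (hR : R ≠ ⊤) : IsetOf R = Ico 0 R.toReal := by
  ext y
  simp only [IsetOf, mem_setOf_eq, mem_Ico]
  refine and_congr_right fun hy => ?_
  rw [← ENNReal.ofReal_toReal hR, ENNReal.ofReal_lt_ofReal_iff_of_nonneg hy,
    ENNReal.ofReal_toReal hR]

theorem measurableSet_iset : MeasurableSet (IsetOf R) := by
  by_cases hR : R = ⊤
  · rw [hR, iset_top]; exact measurableSet_Ici
  · rw [iset_fin hR]; exact measurableSet_Ico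

theorem iset_succ (hx : x ∈ IsetOf R) : ∃ y ∈ IsetOf R, x < y := by
  by_cases hR : R = ⊤
  · subst hR
    rw [iset_top] at hx ⊢
    exact ⟨x + 1, by simp at hx ⊢; linarith, by linarith⟩
  · rw [iset_fin hR] at *
    obtain ⟨y, h1, h2⟩ := exists_between hx.2
    exact ⟨y, ⟨hx.1.trans h1.le, h2⟩, h1⟩

/-- An increasing sequence exhausting `[0, R)`. -/
structure Exh (R : ℝ≥0∞) (x : ℕ → ℝ) : Prop where
  mono : Monotone x
  mem : ∀ n, x n ∈ IsetOf R
  ev : ∀ y ∈ IsetOf R, ∀ᶠ n in atTop, y ≤ x n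

theorem exists_exh (hR : 0 < R) : ∃ x, Exh R x := by
  by_cases hR' : R = ⊤
  · refine ⟨fun n => n, Nat.mono_cast, fun n => ?_, fun y _ => ?_⟩
    · rw [hR', iset_top]; simp
    · exact tendsto_natCast_atTop_atTop.eventually_ge_atTop y
  · have hr : 0 < R.toReal := ENNReal.toReal_pos hR.ne' hR'
    obtain ⟨x, h1, h2, h3⟩ := exists_seq_strictMono_tendsto' hr
    refine ⟨x, h1.monotone, fun n => ?_, fun y hy => ?_⟩
    · rw [iset_fin hR']; exact ⟨(h2 n).1.le, (h2 n).2⟩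
    · rw [iset_fin hR'] at hy
      exact (h3.eventually (lt_mem_nhds hy.2)).mono fun _ h => h.le

theorem Exh.iUnion {x : ℕ → ℝ} (h : Exh R x) : ⋃ n, Icc 0 (x n) = IsetOf R := by
  ext y
  simp only [mem_iUnion]
  constructor
  · rintro ⟨n, hn⟩
    exact iset_down (h.mem n) hn.1 hn.2
  · intro hy
    obtain ⟨n, hn⟩ := (h.ev y hy).exists
    exact ⟨n, hy.1, hn⟩

theorem Exh.tendsto_fin {x : ℕ → ℝ} (h : Exh R x) (hR : R ≠ ⊤) :
    Tendsto x atTop (𝓝[<] R.toReal) := by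
  have hm := fun n => (iset_fin hR) ▸ h.mem n
  refine tendsto_nhdsWithin_iff.2 ⟨?_, Eventually.of_forall fun n => (hm n).2⟩
  rw [tendsto_order]
  refine ⟨fun a ha => ?_, fun a ha => Eventually.of_forall fun n => (hm n).2.trans ha⟩
  have h0 : max a 0 < R.toReal := max_lt ha ((hm 0).1.trans_lt (hm 0).2)
  obtain ⟨b, hb1, hb2⟩ := exists_between h0
  have : b ∈ IsetOf R := by
    rw [iset_fin hR]; exact ⟨(le_max_right _ _).trans hb1.le, hb2⟩
  exact (h.ev b this).mono fun n hn => (le_max_left _ _).trans_lt (hb1.trans_le hn)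

theorem Exh.tendsto_top {x : ℕ → ℝ} (h : Exh ⊤ x) : Tendsto x atTop atTop := by
  refine tendsto_atTop.2 fun b => ?_
  exact (h.ev (max b 0) (by rw [iset_top]; simp)).mono fun n hn => (le_max_left _ _).trans hn

end

/-! ### The reference solution with zero initial slope and Weyl solutions -/

section
variable {F : ℝ → ℝ} {X Y t s ξ ψ : ℝ} {R : ℝ≥0∞}

theorem Str.ser_ge (hF : Str F X) {g : ℝ → ℝ} (hg : Str g X) (hξ : 0 ≤ ξ) (ht : t ∈ Icc 0 X) :
    g t ≤ ser F g ξ t := by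
  have h := hF.hasSum_ser hg ξ ht
  have := le_hasSum h 0 (fun n _ => by
    have := (hF.iter hg n).pos ht
    simp only [RCLike.ofReal_real_eq_id, id]
    positivity)
  simpa [vit] using this

/-- The solution with `M 0 = 1` and zero initial quasi-derivative. -/
abbrev mF (F : ℝ → ℝ) (ξ : ℝ) : ℝ → ℝ := solF F ξ 0 1
/-- Right derivative of `mF`. -/
abbrev mV (F : ℝ → ℝ) (ξ : ℝ) : ℝ → ℝ := solV F ξ 0 1

theorem Str.mV_ge (hF : Str F X) (hξ : 0 ≤ ξ) (ht : t ∈ Icc 0 X) : ξ * F t ≤ mV F ξ t := by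
  simp only [mV, solV, zero_mul, zero_add, mul_one]
  exact mul_le_mul_of_nonneg_left (hF.ser_ge hF hξ ht) hξ

theorem Str.mF_mono (hF : Str F X) (hξ : 0 ≤ ξ) (hs : 0 ≤ s) (hst : s ≤ t) (ht : t ≤ X) :
    mF F ξ s ≤ mF F ξ t := by
  have hX : 0 ≤ X := hs.trans (hst.trans ht)
  have S := hF.sol hX (ζ := ξ) (c := 0) (f₀ := 1)
  refine le_of_rderiv hst ((S.f_cont hX).mono (Icc_subset_Icc hs ht))
    (fun y hy => S.f_deriv hF ⟨hs.trans hy.1, hy.2.trans_le ht⟩) fun y hy => ?_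
  have hy' : y ∈ Icc 0 X := ⟨hs.trans hy.1, hy.2.le.trans ht⟩
  exact (mul_nonneg hξ (hF.pos hy')).trans (hF.mV_ge hξ hy')

theorem mF_zero : mF F ξ 0 = 1 := by simp [mF, solF]

theorem Str.mF_ge (hF : Str F X) (hξ : 0 ≤ ξ) (ht : t ∈ Icc 0 X) : 1 ≤ mF F ξ t := by
  have := hF.mF_mono hξ le_rfl ht.1 ht.2
  rwa [mF_zero] at this

theorem Str.mF_ge_lin (hF : Str F X) (hξ : 0 ≤ ξ) (hs : 0 ≤ s) (hst : s ≤ t) (ht : t ≤ X) :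
    1 + ξ * F s * (t - s) ≤ mF F ξ t := by
  have hX : 0 ≤ X := hs.trans (hst.trans ht)
  have S := hF.sol hX (ζ := ξ) (c := 0) (f₀ := 1)
  have h1 := le_of_rderiv (f := fun t => mF F ξ t - ξ * F s * t)
    (f' := fun t => mV F ξ t - ξ * F s) hst
    (((S.f_cont hX).mono (Icc_subset_Icc hs ht)).sub (by fun_prop))
    (fun y hy => (S.f_deriv hF ⟨hs.trans hy.1, hy.2.trans_le ht⟩).sub (by
      simpa using ((hasDerivAt_id y).const_mul (ξ * F s)).hasDerivWithinAt)) fun y hy => by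
      have hy' : y ∈ Icc 0 X := ⟨hs.trans hy.1, hy.2.le.trans ht⟩
      have h2 := mul_le_mul_of_nonneg_left (hF.le hs hy.1 hy'.2) hξ
      have h3 := hF.mV_ge hξ hy'
      linarith
  have h4 := hF.mF_ge hξ ⟨hs, hst.trans ht⟩
  try simp only at h1
  linarith

/-- `∫₀ˣ M⁻²`. -/
def hF (F : ℝ → ℝ) (ξ : ℝ) (x : ℝ) : ℝ := ∫ t in (0:ℝ)..x, (mF F ξ t ^ 2)⁻¹

theorem Str.inv_cont (hF : Str F X) (hX : 0 ≤ X) (hξ : 0 ≤ ξ) :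
    ContinuousOn (fun t => (mF F ξ t ^ 2)⁻¹) (Icc 0 X) := by
  refine (((hF.sol hX).f_cont hX).pow 2).inv₀ fun t ht => ?_
  have := hF.mF_ge hξ ht
  have : mF F ξ t ≠ 0 := by positivity
  exact pow_ne_zero 2 this

theorem Str.inv_intable (hF : Str F X) (hX : 0 ≤ X) (hξ : 0 ≤ ξ) :
    IntervalIntegrable (fun t => (mF F ξ t ^ 2)⁻¹) volume 0 X := by
  apply ContinuousOn.intervalIntegrable
  rw [uIcc_of_le hX]
  exact hF.inv_cont hX hξ

theorem Str.hF_cont (h : Str F X) (hX : 0 ≤ X) (hξ : 0 ≤ ξ) :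
    ContinuousOn (hF F ξ) (Icc 0 X) := continuousOn_prim hX (h.inv_intable hX hξ)

theorem Str.hF_deriv (h : Str F X) (hξ : 0 ≤ ξ) (ht : t ∈ Ico 0 X) :
    HasDerivWithinAt (hF F ξ) ((mF F ξ t ^ 2)⁻¹) (Ici t) t :=
  have hX : 0 ≤ X := ht.1.trans ht.2.le
  deriv_prim (h.inv_intable hX hξ) ht (ici_of_icc (h.inv_cont hX hξ) ht)

theorem Str.hF_sub_le (h : Str F X) (hξ : 0 ≤ ξ) (hs : 0 ≤ s) (hst : s ≤ t) (ht : t ≤ X) :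
    hF F ξ t - hF F ξ s ≤ (mF F ξ s)⁻¹ * (t - s) := by
  have hX : 0 ≤ X := hs.trans (hst.trans ht)
  have h1 := le_of_rderiv (f := fun t => (mF F ξ s)⁻¹ * t - hF F ξ t)
    (f' := fun t => (mF F ξ s)⁻¹ - (mF F ξ t ^ 2)⁻¹) hst
    (ContinuousOn.sub (by fun_prop) ((h.hF_cont hX hξ).mono (Icc_subset_Icc hs ht)))
    (fun y hy => HasDerivWithinAt.sub (by
      simpa using ((hasDerivAt_id y).const_mul ((mF F ξ s)⁻¹)).hasDerivWithinAt)
      (h.hF_deriv hξ ⟨hs.trans hy.1, hy.2.trans_le ht⟩)) fun y hy => by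
      have h2 := h.mF_mono hξ hs hy.1 (hy.2.le.trans ht)
      have h3 := h.mF_ge hξ ⟨hs, hst.trans ht⟩
      rw [sub_nonneg]
      apply inv_anti₀ (by linarith)
      nlinarith
  try simp only at h1
  linarith

theorem Str.hF_sub_le' (h : Str F X) (hξ : 0 < ξ) (hs : 0 ≤ s) (hst : s ≤ t) (ht : t ≤ X)
    (hpos : 0 < F s) : hF F ξ t - hF F ξ s ≤ (ξ * F s * mF F ξ s)⁻¹ := by
  have hX : 0 ≤ X := hs.trans (hst.trans ht)
  have S := h.sol hX (ζ := ξ) (c := 0) (f₀ := 1)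
  have hm : ∀ y ∈ Icc s t, 1 ≤ mF F ξ y := fun y hy =>
    h.mF_ge hξ.le ⟨hs.trans hy.1, hy.2.trans ht⟩
  have h1 := le_of_rderiv (f := fun t => -(hF F ξ t + (ξ * F s)⁻¹ * (mF F ξ t)⁻¹))
    (f' := fun t => -((mF F ξ t ^ 2)⁻¹ + (ξ * F s)⁻¹ * (-mV F ξ t / mF F ξ t ^ 2))) hst
    (((h.hF_cont hX hξ.le).mono (Icc_subset_Icc hs ht)).add (continuousOn_const.mul
      (((S.f_cont hX).mono (Icc_subset_Icc hs ht)).inv₀ fun y hy => by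
        have := hm y hy; positivity))).neg
    (fun y hy => ((h.hF_deriv hξ.le ⟨hs.trans hy.1, hy.2.trans_le ht⟩).add
      (((S.f_deriv h ⟨hs.trans hy.1, hy.2.trans_le ht⟩).inv (by
        have := hm y ⟨hy.1, hy.2.le⟩; positivity)).const_mul _)).neg) fun y hy => by
      have hy' : y ∈ Icc 0 X := ⟨hs.trans hy.1, hy.2.le.trans ht⟩
      have h2 := mul_le_mul_of_nonneg_left (h.le hs hy.1 hy'.2) hξ.le
      have h3 := h.mV_ge hξ.le hy'
      have h4 := hm y ⟨hy.1, hy.2.le⟩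
      have h5 : 0 < ξ * F s := by positivity
      have h6 : 1 ≤ (ξ * F s)⁻¹ * mV F ξ y := by
        rw [inv_mul_eq_div, le_div_iff₀ h5]; linarith
      have h7 : 0 ≤ ((ξ * F s)⁻¹ * mV F ξ y - 1) * (mF F ξ y ^ 2)⁻¹ :=
        mul_nonneg (by linarith) (by positivity)
      calc (0:ℝ) ≤ _ := h7
        _ = _ := by rw [div_eq_mul_inv]; ring
  try simp only at h1
  have h8 : 0 ≤ (ξ * F s)⁻¹ * (mF F ξ t)⁻¹ := by
    have := hm t ⟨hst, le_rfl⟩; positivity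
  rw [mul_inv (ξ * F s)]
  linarith

theorem Str.hF_mono (h : Str F X) (hξ : 0 ≤ ξ) (hs : 0 ≤ s) (hst : s ≤ t) (ht : t ≤ X) :
    hF F ξ s ≤ hF F ξ t := by
  have hX : 0 ≤ X := hs.trans (hst.trans ht)
  exact le_of_rderiv hst ((h.hF_cont hX hξ).mono (Icc_subset_Icc hs ht))
    (fun y hy => h.hF_deriv hξ ⟨hs.trans hy.1, hy.2.trans_le ht⟩) fun y _ => by positivity

theorem Sol.eq_mul {φ v : ℝ → ℝ} (S : Sol F X ξ (-ψ) 1 φ v) (h : Str F X) (hξ : 0 ≤ ξ)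
    (ht : t ∈ Icc 0 X) : φ t = mF F ξ t * (1 - ψ * hF F ξ t) := by
  have hX : 0 ≤ X := ht.1.trans ht.2
  have T := h.sol hX (ζ := ξ) (c := 0) (f₀ := 1)
  have hm : ∀ y ∈ Icc 0 X, 1 ≤ mF F ξ y := fun y hy => h.mF_ge hξ hy
  have key := constant_of_has_deriv_right_zero (a := 0) (b := X)
    (f := fun t => φ t / mF F ξ t + ψ * hF F ξ t)
    (((S.f_cont hX).div (T.f_cont hX) fun y hy => by have := hm y hy; positivity).add
      (continuousOn_const.mul (h.hF_cont hX hξ)))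
    (fun y hy => by
      have hy' : y ∈ Icc 0 X := ⟨hy.1, hy.2.le⟩
      have h1 := hm y hy'
      refine (((S.f_deriv h hy).div (T.f_deriv h hy) (by positivity)).add
        ((h.hF_deriv hξ hy).const_mul ψ)).congr_deriv ?_
      have h2 := S.wronskian T h hy'
      rw [h2, div_eq_mul_inv]; ring) t ht
  have h1 := hm t ht
  simp only [S.f_zero hX, mF_zero, hF, intervalIntegral.integral_same] at key
  have h2 : φ t / mF F ξ t = 1 - ψ * hF F ξ t := by rw [hF]; linarith
  rw [← h2]; field_simp

end

section
variable {F : ℝ → ℝ} {X Y t s ξ ψ : ℝ} {R : ℝ≥0∞} {φ v : ℝ → ℝ} {x : ℕ → ℝ}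

/-- A solution on `[0, R)`, normalised at `0`, bounded and vanishing at a finite right end. -/
structure Weyl (R : ℝ≥0∞) (F : ℝ → ℝ) (ξ ψ : ℝ) (φ v : ℝ → ℝ) : Prop where
  sol : ∀ X ∈ IsetOf R, Sol F X ξ (-ψ) 1 φ v
  bdd : ∃ B, ∀ y ∈ IsetOf R, |φ y| ≤ B
  bdry : R ≠ ⊤ → Tendsto φ (𝓝[<] R.toReal) (𝓝 0)

/-- `∫₀ᴿ M⁻²` as an extended number. -/
def hTot (F : ℝ → ℝ) (R : ℝ≥0∞) (ξ : ℝ) : ℝ≥0∞ :=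
  ∫⁻ t in IsetOf R, ENNReal.ofReal ((mF F ξ t ^ 2)⁻¹)

theorem Str.ofReal_hF (h : Str F X) (hX : 0 ≤ X) (hξ : 0 ≤ ξ) :
    ENNReal.ofReal (hF F ξ X) = ∫⁻ t in Icc 0 X, ENNReal.ofReal ((mF F ξ t ^ 2)⁻¹) := by
  rw [hF, intervalIntegral.integral_of_le hX, ← integral_Icc_eq_integral_Ioc,
    ofReal_integral_eq_lintegral_ofReal]
  · rw [← IntegrableOn, integrableOn_Icc_iff_integrableOn_Ioc]
    exact (h.inv_intable hX hξ).1
  · exact ae_of_all _ fun t => by positivity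

theorem Exh.hTot_tendsto (hx : Exh R x) (h : ∀ X ∈ IsetOf R, Str F X) (hξ : 0 ≤ ξ) :
    Tendsto (fun n => ENNReal.ofReal (hF F ξ (x n))) atTop (𝓝 (hTot F R ξ)) := by
  have h1 : hTot F R ξ = ⨆ n, ENNReal.ofReal (hF F ξ (x n)) := by
    rw [hTot, ← hx.iUnion, setLIntegral_iUnion_of_directed]
    · congr 1; ext n
      rw [(h _ (hx.mem n)).ofReal_hF (hx.mem n).1 hξ]
    · exact (monotone_nat_of_le_succ fun n =>
        Icc_subset_Icc_right (hx.mono n.le_succ)).directed_le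
  rw [h1]
  exact tendsto_atTop_iSup fun m n hmn =>
    ENNReal.ofReal_le_ofReal ((h _ (hx.mem n)).hF_mono hξ (hx.mem m).1 (hx.mono hmn) le_rfl)

theorem Str.mF_of_zero (h : Str F X) (hz : F X = 0) (ht : t ∈ Icc 0 X) : mF F ξ t = 1 := by
  have hX : 0 ≤ X := ht.1.trans ht.2
  have S := h.sol hX (ζ := ξ) (c := 0) (f₀ := 1)
  have hF0 : ∀ s ∈ Icc 0 X, F s = 0 := fun s hs =>
    le_antisymm (hz ▸ h.mono hs ⟨hX, le_rfl⟩ hs.2) (h.pos hs)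
  have hv : ∀ s ∈ Icc 0 X, solV F ξ 0 1 s = 0 := fun s hs => by
    rw [S.v_eq s hs, hF0 s hs]
    have : ∫ r in (0:ℝ)..s, ((F r : ℝ) : ℝ) * solV F ξ 0 1 r = ∫ r in (0:ℝ)..s, (0:ℝ) := by
      apply intervalIntegral.integral_congr
      intro r hr
      rw [uIcc_of_le hs.1] at hr
      simp [hF0 r ⟨hr.1, hr.2.trans hs.2⟩]
    simp only [RCLike.ofReal_real_eq_id, id] at *
    rw [this]; simp
  have : mF F ξ t = 1 + ∫ s in (0:ℝ)..t, (0:ℝ) := by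
    rw [mF, S.f_eq t ht]; congr 1
    apply intervalIntegral.integral_congr
    intro r hr
    rw [uIcc_of_le ht.1] at hr
    exact hv r ⟨hr.1, hr.2.trans ht.2⟩
  simpa using this

theorem Str.hF_of_zero (h : Str F X) (hz : F X = 0) (ht : t ∈ Icc 0 X) : hF F ξ t = t := by
  have : hF F ξ t = ∫ s in (0:ℝ)..t, (1:ℝ) := by
    apply intervalIntegral.integral_congr
    intro r hr
    rw [uIcc_of_le ht.1] at hr
    simp [h.mF_of_zero hz ⟨hr.1, hr.2.trans ht.2⟩]
  simpa using this

theorem Weyl.decay (hx : Exh R x) (h : ∀ X ∈ IsetOf R, Str F X) (hξ : 0 < ξ)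
    (w : Weyl R F ξ ψ φ v) (hne : R = ⊤ → ∃ y ∈ IsetOf R, 0 < F y) :
    Tendsto (fun n => ψ * hF F ξ (x n)) atTop (𝓝 1) := by
  have e : ∀ n, φ (x n) / mF F ξ (x n) = 1 - ψ * hF F ξ (x n) := fun n => by
    have h1 := h _ (hx.mem n)
    have hm : x n ∈ Icc 0 (x n) := ⟨(hx.mem n).1, le_rfl⟩
    rw [(w.sol _ (hx.mem n)).eq_mul h1 hξ.le hm]
    have := h1.mF_ge hξ.le hm
    field_simp
  have key : Tendsto (fun n => φ (x n) / mF F ξ (x n)) atTop (𝓝 0) := by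
    by_cases hR : R = ⊤
    · obtain ⟨y, hy, hpos⟩ := hne hR
      obtain ⟨B, hB⟩ := w.bdd
      have hxt : Tendsto x atTop atTop := by subst hR; exact hx.tendsto_top
      have hm : Tendsto (fun n => mF F ξ (x n)) atTop atTop := by
        refine tendsto_atTop_mono' (f₁ := fun n => 1 + ξ * F y * (x n - y)) _ ?_ ?_
        · filter_upwards [hx.ev y hy] with n hn
          exact (h _ (hx.mem n)).mF_ge_lin hξ.le hy.1 hn le_rfl
        · refine tendsto_atTop_add_const_left _ _ (Tendsto.const_mul_atTop (by positivity) ?_)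
          exact tendsto_atTop_add_const_right _ _ hxt
      have h2 : Tendsto (fun n => B * (mF F ξ (x n))⁻¹) atTop (𝓝 0) := by
        simpa using (tendsto_inv_atTop_zero.comp hm).const_mul B
      refine squeeze_zero_norm (fun n => ?_) h2
      have := (h _ (hx.mem n)).mF_ge hξ.le ⟨(hx.mem n).1, le_rfl⟩
      rw [norm_div, Real.norm_eq_abs, Real.norm_eq_abs, abs_of_pos (a := mF F ξ (x n)) (by linarith),
        div_eq_mul_inv]
      exact mul_le_mul_of_nonneg_right (hB _ (hx.mem n)) (by positivity)
    · have h2 := ((w.bdry hR).comp (hx.tendsto_fin hR)).norm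
      rw [norm_zero] at h2
      refine squeeze_zero_norm (fun n => ?_) h2
      have := (h _ (hx.mem n)).mF_ge hξ.le ⟨(hx.mem n).1, le_rfl⟩
      rw [norm_div, Real.norm_eq_abs, Real.norm_eq_abs, abs_of_pos (a := mF F ξ (x n)) (by linarith)]
      exact div_le_self (abs_nonneg _) this
  have := (tendsto_const_nhds (x := (1:ℝ))).sub key
  simp only [e, sub_zero] at this
  simpa using this

theorem Weyl.hTot_eq (hR : 0 < R) (h : ∀ X ∈ IsetOf R, Str F X) (hξ : 0 < ξ)
    (w : Weyl R F ξ ψ φ v) : 0 ≤ ψ ∧ hTot F R ξ = (ENNReal.ofReal ψ)⁻¹ := by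
  obtain ⟨x, hx⟩ := exists_exh hR
  have hH := hx.hTot_tendsto h hξ.le
  by_cases hne : R = ⊤ → ∃ y ∈ IsetOf R, 0 < F y
  · have h1 := w.decay hx h hξ hne
    have hpos : ∀ n, 0 ≤ hF F ξ (x n) := fun n => by
      have := (h _ (hx.mem n)).hF_mono hξ.le le_rfl (hx.mem n).1 le_rfl
      simpa [hF] using this
    have hψ : 0 < ψ := by
      by_contra hcon
      have := le_of_tendsto h1 (Eventually.of_forall fun n =>
        mul_nonpos_of_nonpos_of_nonneg (not_lt.1 hcon) (hpos n))
      linarith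
    refine ⟨hψ.le, tendsto_nhds_unique hH ?_⟩
    have h2 : Tendsto (fun n => hF F ξ (x n)) atTop (𝓝 ψ⁻¹) := by
      have := h1.const_mul ψ⁻¹
      simpa [← mul_assoc, inv_mul_cancel₀ hψ.ne'] using this
    rw [← ENNReal.ofReal_inv_of_pos hψ]
    exact ENNReal.tendsto_ofReal h2
  · push Not at hne
    obtain ⟨hR', hz⟩ := hne
    subst hR'
    have hz' : ∀ y ∈ IsetOf ⊤, F y = 0 := fun y hy =>
      le_antisymm (hz y hy) ((h y hy).pos ⟨hy.1, le_rfl⟩)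
    have hxt := hx.tendsto_top
    have hh : ∀ n, hF F ξ (x n) = x n := fun n =>
      (h _ (hx.mem n)).hF_of_zero (hz' _ (hx.mem n)) ⟨(hx.mem n).1, le_rfl⟩
    have hψ : ψ = 0 := by
      by_contra hne
      obtain ⟨B, hB⟩ := w.bdd
      obtain ⟨n, hn⟩ := (hxt.eventually_gt_atTop ((B + 1) / |ψ|)).exists
      have h1 := hB _ (hx.mem n)
      rw [(w.sol _ (hx.mem n)).eq_mul (h _ (hx.mem n)) hξ.le ⟨(hx.mem n).1, le_rfl⟩, hh,
        (h _ (hx.mem n)).mF_of_zero (hz' _ (hx.mem n)) ⟨(hx.mem n).1, le_rfl⟩, one_mul] at h1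
      rw [div_lt_iff₀ (abs_pos.2 hne)] at hn
      have h2 := abs_sub_abs_le_abs_sub (ψ * x n) 1
      rw [abs_sub_comm, abs_mul, abs_of_nonneg (hx.mem n).1, abs_one] at h2
      nlinarith
    refine ⟨hψ.ge, tendsto_nhds_unique hH ?_⟩
    simp only [hh, hψ, ENNReal.ofReal_zero, ENNReal.inv_zero]
    exact ENNReal.tendsto_ofReal_atTop.comp hxt

theorem weyl_of_hTot (hR : 0 < R) (h : ∀ X ∈ IsetOf R, Str F X) (hξ : 0 < ξ) (hψ : 0 ≤ ψ)
    (hH : hTot F R ξ = (ENNReal.ofReal ψ)⁻¹) :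
    Weyl R F ξ ψ (solF F ξ (-ψ) 1) (solV F ξ (-ψ) 1) := by
  obtain ⟨x, hx⟩ := exists_exh hR
  have hT := hx.hTot_tendsto h hξ.le
  have hS : ∀ X ∈ IsetOf R, Sol F X ξ (-ψ) 1 (solF F ξ (-ψ) 1) (solV F ξ (-ψ) 1) :=
    fun X hX => (h X hX).sol hX.1
  have hφ : ∀ t ∈ IsetOf R, solF F ξ (-ψ) 1 t = mF F ξ t * (1 - ψ * hF F ξ t) := fun t ht =>
    (hS t ht).eq_mul (h t ht) hξ.le ⟨ht.1, le_rfl⟩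
  have hne : ∀ (hR' : R = ⊤) (hfin : hTot F R ξ ≠ ⊤), ∃ y ∈ IsetOf R, 0 < F y := by
    intro hR' hfin
    by_contra! hz
    subst hR'
    have hz' : ∀ y ∈ IsetOf ⊤, F y = 0 := fun y hy =>
      le_antisymm (hz y hy) ((h y hy).pos ⟨hy.1, le_rfl⟩)
    have hh : ∀ n, hF F ξ (x n) = x n := fun n =>
      (h _ (hx.mem n)).hF_of_zero (hz' _ (hx.mem n)) ⟨(hx.mem n).1, le_rfl⟩
    simp only [hh] at hT
    exact hfin (tendsto_nhds_unique hT (ENNReal.tendsto_ofReal_atTop.comp hx.tendsto_top))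
  have hfin : ∀ C : ℝ, (∀ᶠ n in atTop, hF F ξ (x n) ≤ C) → hTot F R ξ ≠ ⊤ := fun C hC =>
    ((le_of_tendsto hT (hC.mono fun n hn => ENNReal.ofReal_le_ofReal hn)).trans_lt
      ENNReal.ofReal_lt_top).ne
  rcases hψ.eq_or_lt with rfl | hψ
  · have htop : hTot F R ξ = ⊤ := by rw [hH]; simp
    have hR' : R = ⊤ := by
      by_contra hR'
      refine hfin R.toReal (Eventually.of_forall fun n => ?_) htop
      have h1 := (h _ (hx.mem n)).hF_sub_le hξ.le le_rfl (hx.mem n).1 le_rfl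
      have h2 := hx.mem n
      rw [iset_fin hR'] at h2
      simp [mF_zero, hF] at h1
      exact h1.trans h2.2.le
    have hz : ∀ y ∈ IsetOf R, F y = 0 := by
      by_contra! hz
      obtain ⟨y, hy, hy'⟩ := hz
      have hpos := lt_of_le_of_ne ((h y hy).pos ⟨hy.1, le_rfl⟩) hy'.symm
      refine hfin (hF F ξ y + (ξ * F y * mF F ξ y)⁻¹) ?_ htop
      filter_upwards [hx.ev y hy] with n hn
      have := (h _ (hx.mem n)).hF_sub_le' hξ hy.1 hn le_rfl hpos
      linarith
    refine ⟨hS, ⟨1, fun y hy => ?_⟩, fun hc => (hc hR').elim⟩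
    rw [hφ y hy, (h y hy).mF_of_zero (hz y hy) ⟨hy.1, le_rfl⟩]
    simp
  · have hft : hTot F R ξ ≠ ⊤ := by
      rw [hH]; simp [hψ]
    have hlim : Tendsto (fun n => hF F ξ (x n)) atTop (𝓝 ψ⁻¹) := by
      have h1 := (ENNReal.tendsto_toReal hft).comp hT
      rw [hH, ENNReal.toReal_inv, ENNReal.toReal_ofReal hψ.le] at h1
      refine h1.congr fun n => ENNReal.toReal_ofReal ?_
      have := (h _ (hx.mem n)).hF_mono hξ.le le_rfl (hx.mem n).1 le_rfl
      simpa [hF] using this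
    have hbd : ∀ t ∈ IsetOf R, ∀ C, (∀ X ∈ IsetOf R, t ≤ X → hF F ξ X - hF F ξ t ≤ C) →
        0 ≤ solF F ξ (-ψ) 1 t ∧ solF F ξ (-ψ) 1 t ≤ mF F ξ t * (ψ * C) := by
      intro t ht C hC
      have h1 : hF F ξ t ≤ ψ⁻¹ := ge_of_tendsto hlim <| (hx.ev t ht).mono fun n hn =>
        (h _ (hx.mem n)).hF_mono hξ.le ht.1 hn le_rfl
      have h2 : ψ⁻¹ - hF F ξ t ≤ C := le_of_tendsto (hlim.sub_const _) <|
        (hx.ev t ht).mono fun n hn => hC _ (hx.mem n) hn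
      have h3 := (h t ht).mF_ge hξ.le ⟨ht.1, le_rfl⟩
      have h4 : 1 - ψ * hF F ξ t = ψ * (ψ⁻¹ - hF F ξ t) := by field_simp
      rw [hφ t ht, h4]
      have h5 : 0 ≤ ψ⁻¹ - hF F ξ t := by linarith
      exact ⟨by positivity, by gcongr⟩
    by_cases hR' : R = ⊤
    · obtain ⟨y, hy, hpos⟩ := hne hR' hft
      refine ⟨hS, ⟨max (mF F ξ y * (ψ * ψ⁻¹)) (ψ * (ξ * F y)⁻¹), fun t ht => ?_⟩,
        fun hc => (hc hR').elim⟩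
      rcases le_total t y with hty | hty
      · obtain ⟨h1, h2⟩ := hbd t ht ψ⁻¹ fun X hX hX' => by
          have h3 := (h X hX).hF_mono hξ.le le_rfl ht.1 hX'
          have h4 : hF F ξ X ≤ ψ⁻¹ := ge_of_tendsto hlim <| (hx.ev X hX).mono fun n hn =>
            (h _ (hx.mem n)).hF_mono hξ.le hX.1 hn le_rfl
          simp only [hF, intervalIntegral.integral_same] at h3 h4 ⊢
          linarith
        rw [abs_of_nonneg h1]
        refine h2.trans (le_max_of_le_left ?_)
        have := (h y hy).mF_mono hξ.le ht.1 hty le_rfl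
        gcongr
      · have hFt : F y ≤ F t := (h t ht).le hy.1 hty le_rfl
        have hm := (h t ht).mF_ge hξ.le ⟨ht.1, le_rfl⟩
        obtain ⟨h1, h2⟩ := hbd t ht (ξ * F t * mF F ξ t)⁻¹ fun X hX hX' =>
          (h X hX).hF_sub_le' hξ ht.1 hX' le_rfl (hpos.trans_le hFt)
        rw [abs_of_nonneg h1]
        refine h2.trans (le_max_of_le_right ?_)
        have : mF F ξ t * (ψ * (ξ * F t * mF F ξ t)⁻¹) = ψ * (ξ * F t)⁻¹ := by
          have := hpos.trans_le hFt
          field_simp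
        rw [this]
        gcongr
    · have h1 : ∀ t ∈ IsetOf R, 0 ≤ solF F ξ (-ψ) 1 t ∧
          solF F ξ (-ψ) 1 t ≤ ψ * (R.toReal - t) := by
        intro t ht
        have hm := (h t ht).mF_ge hξ.le ⟨ht.1, le_rfl⟩
        obtain ⟨h1, h2⟩ := hbd t ht ((mF F ξ t)⁻¹ * (R.toReal - t)) fun X hX hX' => by
          refine ((h X hX).hF_sub_le hξ.le ht.1 hX' le_rfl).trans ?_
          rw [iset_fin hR'] at hX
          have := hX.2
          gcongr
        refine ⟨h1, h2.trans (le_of_eq ?_)⟩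
        field_simp
      refine ⟨hS, ⟨ψ * R.toReal, fun t ht => ?_⟩, fun _ => ?_⟩
      · rw [abs_of_nonneg (h1 t ht).1]
        refine (h1 t ht).2.trans ?_
        have := ht.1
        gcongr; linarith
      · have h2 : Tendsto (fun t => ψ * (R.toReal - t)) (𝓝[<] R.toReal) (𝓝 0) := by
          have : Tendsto (fun t => ψ * (R.toReal - t)) (𝓝 R.toReal) (𝓝 (ψ * (R.toReal - R.toReal))) :=
            Continuous.tendsto (by fun_prop) _
          simp only [sub_self, mul_zero] at this
          exact this.mono_left nhdsWithin_le_nhds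
        have hev : ∀ᶠ t in 𝓝[<] R.toReal, t ∈ IsetOf R := by
          rw [iset_fin hR']
          exact Ico_mem_nhdsLT (ENNReal.toReal_pos hR.ne' hR')
        exact tendsto_of_tendsto_of_tendsto_of_le_of_le' tendsto_const_nhds h2
          (hev.mono fun t ht => (h1 t ht).1) (hev.mono fun t ht => (h1 t ht).2)

end

section
variable {F : ℝ → ℝ} {X Y t s ξ ψ l m : ℝ} {R : ℝ≥0∞} {φ v : ℝ → ℝ}

/-- The string `(R, F)` realises the function `ψ`. -/
def Realizes (R : ℝ≥0∞) (F : ℝ → ℝ) (ξ ψ : ℝ) : Prop := ∃ φ v, Weyl R F ξ ψ φ v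

theorem Sol.addMass (S : Sol F X ξ (-ψ) 1 φ v) (hF : Str F X) (m : ℝ) :
    Sol (fun x => m + F x) X ξ (-(m * ξ + ψ)) 1 φ v where
  int := S.int
  f_eq := S.f_eq
  v_eq t ht := by
    have h1 := S.v_eq t ht
    have h2 := hF.mul_intable S.int ht
    have h3 := sub_int S.int le_rfl ht.1 ht.2
    have h4 := S.f_eq t ht
    simp only [RCLike.ofReal_real_eq_id, id] at *
    simp only [add_mul]
    rw [intervalIntegral.integral_add (h3.const_mul m) h2, intervalIntegral.integral_const_mul, h1]
    linear_combination -(m * ξ) * h4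

theorem Str.addMass (hF : Str F X) (hm : 0 ≤ m) : Str (fun x => m + F x) X where
  mono _ ha _ hb hab := by
    have := hF.mono ha hb hab
    simpa
  nonneg := add_nonneg hm hF.nonneg
  rc t ht := continuousWithinAt_const.add (hF.rc t ht)

theorem Realizes.addMass (h : ∀ X ∈ IsetOf R, Str F X) (w : Realizes R F ξ ψ) (m : ℝ) :
    Realizes R (fun x => m + F x) ξ (m * ξ + ψ) := by
  obtain ⟨φ, v, w⟩ := w
  exact ⟨φ, v, fun X hX => (w.sol X hX).addMass (h X hX) m, w.bdd, w.bdry⟩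

/-- Prepend a massless gap of length `l`. -/
def gap (l : ℝ) (F : ℝ → ℝ) (x : ℝ) : ℝ := if x < l then 0 else F (x - l)

theorem gap_lt (h : t < l) : gap l F t = 0 := if_pos h
theorem gap_ge (h : l ≤ t) : gap l F t = F (t - l) := if_neg (not_lt.2 h)

theorem iset_gap (hl : 0 < l) (hX : X ∈ IsetOf (ENNReal.ofReal l + R)) (h : l ≤ X) :
    X - l ∈ IsetOf R := by
  refine ⟨sub_nonneg.2 h, ?_⟩
  have h1 := hX.2
  have h2 : X = l + (X - l) := by ring
  rw [h2, ENNReal.ofReal_add hl.le (by linarith)] at h1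
  exact (ENNReal.add_lt_add_iff_left ENNReal.ofReal_ne_top).1 h1

theorem Str.gap (h : ∀ X ∈ IsetOf R, Str F X) (hl : 0 < l)
    (hX : X ∈ IsetOf (ENNReal.ofReal l + R)) : Str (gap l F) X where
  nonneg := by rw [gap_lt hl]
  mono a ha b hb hab := by
    rcases lt_or_ge a l with h1 | h1
    · rw [gap_lt h1]
      rcases lt_or_ge b l with h2 | h2
      · rw [gap_lt h2]
      · rw [gap_ge h2]
        exact (h _ (iset_gap hl (iset_down hX hb.1 hb.2) h2)).pos ⟨sub_nonneg.2 h2, le_rfl⟩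
    · rw [gap_ge h1, gap_ge (h1.trans hab)]
      exact (h _ (iset_gap hl (iset_down hX hb.1 hb.2) (h1.trans hab))).le (by linarith)
        (by linarith) le_rfl
  rc t ht := by
    rcases lt_or_ge t l with h1 | h1
    · have : Krein.gap l F =ᶠ[𝓝 t] fun _ => 0 := by
        filter_upwards [gt_mem_nhds h1] with s hs using gap_lt hs
      exact (continuousAt_const.congr this.symm).continuousWithinAt
    · have h2 : ContinuousWithinAt (fun x => F (x - l)) (Ici t) t := by
        have h3 := (h _ (iset_gap hl hX (h1.trans ht.2.le))).rc (t - l)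
          ⟨by linarith, by linarith [ht.2]⟩
        exact ContinuousWithinAt.comp (t := Ici (t - l)) h3 (by fun_prop)
          fun x hx => by simpa using hx
      exact h2.congr (fun x hx => gap_ge (h1.trans hx)) (gap_ge h1)

theorem int_piece {u w : ℝ → ℝ} {c : ℝ} (hl : 0 < l) (hu1 : ∀ x < l, u x = c)
    (hu2 : ∀ x, l ≤ x → u x = w (x - l)) {t : ℝ} (ht : l ≤ t)
    (hw : IntervalIntegrable w volume 0 (t - l)) :
    IntervalIntegrable u volume 0 t ∧
      ∫ s in (0:ℝ)..t, u s = c * l + ∫ s in (0:ℝ)..(t - l), w s := by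
  have e1 : ∀ᵐ x, x ∈ uIoc (0:ℝ) l → c = u x := by
    have : ∀ᵐ x : ℝ, x ≠ l := by simp [ae_iff]
    filter_upwards [this] with x hx hx'
    rw [uIoc_of_le hl.le] at hx'
    exact (hu1 x (lt_of_le_of_ne hx'.2 hx)).symm
  have e2 : ∀ x ∈ uIoc l t, w (x - l) = u x := fun x hx => by
    rw [uIoc_of_le ht] at hx
    exact (hu2 x hx.1.le).symm
  have i1 : IntervalIntegrable u volume 0 l :=
    (intervalIntegrable_const (c := c)).congr_ae ((ae_restrict_iff' measurableSet_uIoc).2 e1)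
  have i2' : IntervalIntegrable (fun x => w (x - l)) volume l t := by
    have := hw.comp_sub_right l
    simpa using this
  have i2 : IntervalIntegrable u volume l t := i2'.congr e2
  refine ⟨i1.trans i2, ?_⟩
  rw [← intervalIntegral.integral_add_adjacent_intervals i1 i2]
  congr 1
  · rw [← intervalIntegral.integral_congr_ae e1]; simp [mul_comm]
  · rw [← intervalIntegral.integral_congr_ae (ae_of_all _ e2),
      intervalIntegral.integral_comp_sub_right (f := w)]
    simp

theorem Realizes.gap (hR0 : R ≠ 0) (hl : 0 < l) (h : ∀ X ∈ IsetOf R, Str F X) (hψ : 0 ≤ ψ)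
    (w : Realizes R F ξ ψ) :
    Realizes (ENNReal.ofReal l + R) (gap l F) ξ (ψ / (1 + l * ψ)) := by
  obtain ⟨φ, v, w⟩ := w
  set ψ' := ψ / (1 + l * ψ) with hψ'
  have hd : 0 < 1 + l * ψ := by positivity
  set κ := (1 + l * ψ)⁻¹ with hκ
  have hκ1 : κ = 1 - ψ' * l := by rw [hκ, hψ']; field_simp; ring
  have hκ2 : κ * ψ = ψ' := by rw [hκ, hψ']; field_simp
  set φ' : ℝ → ℝ := fun x => if x < l then 1 - ψ' * x else κ * φ (x - l) with hφ'
  set v' : ℝ → ℝ := fun x => if x < l then -ψ' else κ * v (x - l) with hv'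
  have p1 : ∀ x < l, φ' x = 1 - ψ' * x := fun x hx => if_pos hx
  have p2 : ∀ x, l ≤ x → φ' x = κ * φ (x - l) := fun x hx => if_neg (not_lt.2 hx)
  have v1 : ∀ x < l, v' x = -ψ' := fun x hx => if_pos hx
  have v2 : ∀ x, l ≤ x → v' x = κ * v (x - l) := fun x hx => if_neg (not_lt.2 hx)
  have iv : ∀ t, 0 ≤ t → t < l → IntervalIntegrable v' volume 0 t ∧
      (∫ s in (0:ℝ)..t, v' s) = -ψ' * t ∧ ∫ s in (0:ℝ)..t, Krein.gap l F s * v' s = 0 := by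
    intro t ht0 htl
    have e1 : ∀ x ∈ uIcc 0 t, v' x = -ψ' := fun x hx => by
      rw [uIcc_of_le ht0] at hx; exact v1 x (hx.2.trans_lt htl)
    refine ⟨?_, ?_, ?_⟩
    · exact (intervalIntegrable_const (c := -ψ')).congr fun x hx => (e1 x (uIoc_subset_uIcc hx)).symm
    · rw [intervalIntegral.integral_congr e1]; simp [mul_comm]
    · rw [intervalIntegral.integral_congr (g := fun _ => 0)]
      · simp
      · intro x hx
        rw [uIcc_of_le ht0] at hx
        simp [gap_lt (F := F) (hx.2.trans_lt htl)]
  have key : ∀ t ∈ IsetOf (ENNReal.ofReal l + R), IntervalIntegrable v' volume 0 t ∧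
      φ' t = 1 + ∫ s in (0:ℝ)..t, v' s ∧
      v' t = -ψ' + ξ * (Krein.gap l F t * φ' t - ∫ s in (0:ℝ)..t, Krein.gap l F s * v' s) := by
    intro t ht
    rcases lt_or_ge t l with htl | htl
    · obtain ⟨i, j, k⟩ := iv t ht.1 htl
      refine ⟨i, ?_, ?_⟩
      · rw [j, p1 t htl]; ring
      · rw [k, gap_lt htl, v1 t htl]; ring
    · have ht' := iset_gap hl ht htl
      have S := w.sol _ ht'
      have hm : t - l ∈ Icc 0 (t - l) := ⟨ht'.1, le_rfl⟩
      obtain ⟨i, j⟩ := int_piece (w := fun x => κ * v x) hl v1 v2 htl (S.int.const_mul κ)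
      have hi2 := (h _ ht').mul_intable S.int hm
      simp only [RCLike.ofReal_real_eq_id, id] at hi2
      obtain ⟨_, k⟩ := int_piece (u := fun s => Krein.gap l F s * v' s) (c := 0)
        (w := fun x => κ * (F x * v x)) hl (fun x hx => by simp [gap_lt hx])
        (fun x hx => by simp only [gap_ge hx, v2 x hx]; ring) htl (hi2.const_mul κ)
      rw [intervalIntegral.integral_const_mul] at j k
      refine ⟨i, ?_, ?_⟩
      · rw [j, p2 t htl, S.f_eq _ hm, mul_add, hκ1]; ring
      · rw [k, v2 t htl, p2 t htl, gap_ge htl, S.v_eq _ hm, ← hκ2]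
        simp only [RCLike.ofReal_real_eq_id, id]
        ring
  refine ⟨φ', v', ?_, ?_, ?_⟩
  · intro X hX
    exact ⟨(key X hX).1, fun t ht => (key t (iset_down hX ht.1 ht.2)).2.1,
      fun t ht => (key t (iset_down hX ht.1 ht.2)).2.2⟩
  · obtain ⟨B, hB⟩ := w.bdd
    refine ⟨max (1 + |ψ'| * l) (|κ| * B), fun t ht => ?_⟩
    rcases lt_or_ge t l with htl | htl
    · refine le_max_of_le_left ?_
      rw [p1 t htl]
      refine (abs_sub _ _).trans ?_
      rw [abs_one, abs_mul, abs_of_nonneg ht.1]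
      gcongr
    · refine le_max_of_le_right ?_
      rw [p2 t htl, abs_mul]
      exact mul_le_mul_of_nonneg_left (hB _ (iset_gap hl ht htl)) (abs_nonneg _)
  · intro hR
    have hR' : R ≠ ⊤ := fun h => hR (by simp [h])
    have hRe : (ENNReal.ofReal l + R).toReal = l + R.toReal := by
      rw [ENNReal.toReal_add ENNReal.ofReal_ne_top hR', ENNReal.toReal_ofReal hl.le]
    rw [hRe]
    have hRp := ENNReal.toReal_pos hR0 hR'
    have h1 : Tendsto (fun x => x - l) (𝓝[<] (l + R.toReal)) (𝓝[<] R.toReal) := by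
      refine tendsto_nhdsWithin_iff.2 ⟨?_, ?_⟩
      · have : Tendsto (fun x : ℝ => x - l) (𝓝 (l + R.toReal)) (𝓝 (l + R.toReal - l)) :=
          Continuous.tendsto (by fun_prop) _
        rw [add_sub_cancel_left] at this
        exact this.mono_left nhdsWithin_le_nhds
      · filter_upwards [self_mem_nhdsWithin] with x hx
        simp only [mem_Iio] at *
        linarith
    have h2 := ((w.bdry hR').comp h1).const_mul κ
    rw [mul_zero] at h2
    refine h2.congr' ?_
    filter_upwards [Ico_mem_nhdsLT (show l < l + R.toReal by linarith)] with x hx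
    exact (p2 x hx.1).symm

end

section
variable {F : ℝ → ℝ} {X Y t s ξ ψ l m : ℝ} {R : ℝ≥0∞} {φ v : ℝ → ℝ}

theorem Str.zero : Str (fun _ => 0) X where
  mono _ _ _ _ _ := le_rfl
  nonneg := le_rfl
  rc _ _ := continuousWithinAt_const

theorem realizes_free : Realizes ⊤ (fun _ => 0) ξ 0 := by
  refine ⟨fun _ => 1, fun _ => 0, fun X _ => ⟨?_, fun t _ => by simp, fun t _ => by simp⟩,
    ⟨1, fun _ _ => by simp⟩, fun h => absurd rfl h⟩
  simp

theorem realizes_segment (hl : 0 < l) : Realizes (ENNReal.ofReal l) (fun _ => 0) ξ (1 / l) := by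
  refine ⟨fun x => 1 - x / l, fun _ => -(1 / l), fun X _ => ⟨?_, fun t _ => ?_, fun t _ => ?_⟩,
    ⟨1, fun y hy => ?_⟩, fun _ => ?_⟩
  · simp
  · simp; ring
  · simp
  · have h1 := hy.1
    have h2 : y ≤ l := ((ENNReal.ofReal_lt_ofReal_iff hl).1 hy.2).le
    have h3 : 0 ≤ y / l := by positivity
    have h4 : y / l ≤ 1 := (div_le_one hl).2 h2
    rw [abs_le]; constructor <;> linarith
  · rw [ENNReal.toReal_ofReal hl.le]
    have : Tendsto (fun x : ℝ => 1 - x / l) (𝓝 l) (𝓝 (1 - l / l)) :=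
      Continuous.tendsto (by fun_prop) _
    rw [div_self hl.ne', sub_self] at this
    exact this.mono_left nhdsWithin_le_nhds

open scoped InnerProductSpace in
/-- Stieltjes continued fraction: a positive semidefinite form with a distinguished vector is
realised by a string with finitely many masses. -/
theorem exists_discrete (n : ℕ) : ∀ (V : Type) [NormedAddCommGroup V] [InnerProductSpace ℝ V]
    [FiniteDimensional ℝ V] (B : V →ₗ[ℝ] V →ₗ[ℝ] ℝ) (e : V), Module.finrank ℝ V = n →
    (∀ x y, B x y = B y x) → (∀ x, 0 ≤ B x x) → e ≠ 0 →
    ∃ R F, 0 < R ∧ (∀ X ∈ IsetOf R, Str F X) ∧ ∀ ξ > 0, ∀ f : V,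
      (∀ w, B f w + ξ * ⟪f, w⟫_ℝ = ⟪e, w⟫_ℝ) → Realizes R F ξ (1 / ⟪e, f⟫_ℝ) := by
  induction n with
  | zero =>
    intro V _ _ _ B e hn _ _ he
    have := Module.finrank_zero_iff.1 hn
    exact absurd (Subsingleton.elim e 0) he
  | succ n ih =>
  intro V _ _ _ B e hn hs hp he
  set N := ⟪e, e⟫_ℝ with hN
  have hN0 : 0 < N := real_inner_self_pos.2 he
  set b := B e e with hb
  rcases (hp e).eq_or_lt with hb0 | hb0
  · have hBe : ∀ w, B e w = 0 := by
      intro w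
      by_contra hne
      obtain ⟨c, hc⟩ : ∃ c, c * B e w = -(B w w + 1) / 2 :=
        ⟨-(B w w + 1) / 2 / B e w, div_mul_cancel₀ _ hne⟩
      have := hp (w + c • e)
      simp only [map_add, map_smul, LinearMap.add_apply, LinearMap.smul_apply, smul_eq_mul,
        ← hb, hs w e] at this
      have h0 : b = 0 := hb0.symm
      rw [h0] at this
      linarith
    refine ⟨⊤, fun x => N⁻¹ + 0, by simp,
      fun X _ => Str.zero.addMass (inv_nonneg.2 hN0.le), fun ξ hξ f hf => ?_⟩
    have h1 := hf e
    rw [hs, hBe, zero_add, ← hN, real_inner_comm] at h1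
    have h2 : 1 / ⟪e, f⟫_ℝ = N⁻¹ * ξ + 0 := by
      rw [← h1]
      have : ⟪e, f⟫_ℝ ≠ 0 := fun h => by rw [h] at h1; linarith
      field_simp; ring
    rw [h2]
    exact realizes_free.addMass (fun X _ => Str.zero) _
  · replace hb0 : 0 < b := hb0
    set W := (ℝ ∙ e)ᗮ with hW
    have hWd : Module.finrank ℝ W = n := by
      have := Submodule.finrank_add_finrank_orthogonal (ℝ ∙ e)
      rw [finrank_span_singleton he, hn] at this
      rw [hW]; omega
    set l := N ^ 2 / b with hl
    have hl0 : 0 < l := by positivity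
    let B' : W →ₗ[ℝ] W →ₗ[ℝ] ℝ := LinearMap.mk₂ ℝ (fun g w => B g w - B e g * B e w / b)
      (fun _ _ _ => by simp only [Submodule.coe_add, map_add, LinearMap.add_apply]; ring)
      (fun _ _ _ => by
        simp only [Submodule.coe_smul, map_smul, LinearMap.smul_apply, smul_eq_mul]; ring)
      (fun _ _ _ => by simp only [Submodule.coe_add, map_add]; ring)
      (fun _ _ _ => by simp only [Submodule.coe_smul, map_smul, smul_eq_mul]; ring)
    have hB' : ∀ g w : W, B' g w = B g w - B e g * B e w / b := fun _ _ => rfl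
    let e' : W := (InnerProductSpace.toDual ℝ W).symm
      (LinearMap.toContinuousLinearMap ((N / b) • (B e) ∘ₗ W.subtype))
    have he' : ∀ w : W, ⟪e', w⟫_ℝ = N / b * B e w := fun w => by
      rw [InnerProductSpace.toDual_symm_apply]; rfl
    have hs' : ∀ x y, B' x y = B' y x := fun x y => by
      rw [hB', hB', hs x y]; ring
    have hp' : ∀ x, 0 ≤ B' x x := fun x => by
      have := hp ((x : V) - (B e x / b) • e)
      simp only [map_sub, map_smul, LinearMap.sub_apply, LinearMap.smul_apply, smul_eq_mul,
        hs x e] at this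
      rw [hB']
      convert this using 1
      rw [← hb]
      field_simp
      ring
    have key : ∀ ξ > 0, ∀ f : V, (∀ w, B f w + ξ * ⟪f, w⟫_ℝ = ⟪e, w⟫_ℝ) → ∃ k : W,
        (∀ w, B' k w + ξ * ⟪k, w⟫_ℝ = ⟪e', w⟫_ℝ) ∧ 0 ≤ ⟪e', k⟫_ℝ ∧
        1 / ⟪e, f⟫_ℝ = N⁻¹ * ξ + 1 / (l + ⟪e', k⟫_ℝ) := by
      intro ξ hξ f hf
      set α := ⟪e, f⟫_ℝ / N with hα
      have hg0 : f - α • e ∈ W := by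
        rw [hW, Submodule.mem_orthogonal_singleton_iff_inner_right, inner_sub_right,
          inner_smul_right, ← hN, hα]
        field_simp; ring
      set g : W := ⟨f - α • e, hg0⟩ with hg
      have hgc : (g : V) = f - α • e := rfl
      have hfe : f = α • e + (g : V) := by rw [hgc]; abel
      have horth : ∀ w : W, ⟪e, (w : V)⟫_ℝ = 0 := fun w =>
        (Submodule.mem_orthogonal_singleton_iff_inner_right).1 w.2
      set β := 1 - α * ξ with hβ
      have h1 : B e g = N * β - α * b := by
        have := hf e
        rw [hfe] at this
        simp only [map_add, map_smul, LinearMap.add_apply, LinearMap.smul_apply, smul_eq_mul,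
          inner_add_left, inner_smul_left, hs g e, real_inner_comm e (g : V), horth] at this
        simp only [conj_trivial, ← hN, ← hb] at this
        rw [hβ]; linarith
      have h2 : ∀ w : W, B' g w + ξ * ⟪g, w⟫_ℝ = -β * ⟪e', w⟫_ℝ := fun w => by
        have := hf w
        rw [hfe] at this
        simp only [map_add, map_smul, LinearMap.add_apply, LinearMap.smul_apply, smul_eq_mul,
          inner_add_left, inner_smul_left, horth] at this
        rw [hB', he', h1, Submodule.coe_inner]
        field_simp
        linear_combination b * this
      have hβ0 : β ≠ 0 := by
        intro h0
        have := h2 g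
        rw [h0, neg_zero, zero_mul] at this
        have h3 := hp' g
        have h4 : 0 ≤ ⟪g, g⟫_ℝ := real_inner_self_nonneg
        have h5 : ⟪g, g⟫_ℝ = 0 := by nlinarith
        have h6 : g = 0 := inner_self_eq_zero.1 h5
        rw [h6, h0] at h1
        simp at h1
        rcases h1 with h1 | h1
        · rw [hβ, h1] at h0; simp at h0
        · exact hb0.ne' h1
      refine ⟨-β⁻¹ • g, fun w => ?_, ?_, ?_⟩
      · have := h2 w
        simp only [map_smul, LinearMap.smul_apply, smul_eq_mul, inner_smul_left, conj_trivial]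
        field_simp
        linear_combination -this
      · have := h2 (-β⁻¹ • g)
        simp only [map_smul, smul_eq_mul, inner_smul_right] at this ⊢
        have h3 := h2 g
        have h4 : ⟪e', g⟫_ℝ = -(B' g g + ξ * ⟪g, g⟫_ℝ) / β := by
          rw [h3]; field_simp
        rw [h4]
        have h5 : 0 ≤ B' g g + ξ * ⟪g, g⟫_ℝ :=
          add_nonneg (hp' g) (mul_nonneg hξ.le real_inner_self_nonneg)
        have : -β⁻¹ * (-(B' g g + ξ * ⟪g, g⟫_ℝ) / β) = (B' g g + ξ * ⟪g, g⟫_ℝ) / β ^ 2 := by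
          field_simp
        rw [this]; positivity
      · rw [inner_smul_right, he', h1]
        have hαN : ⟪e, f⟫_ℝ = α * N := by rw [hα]; field_simp
        have h3 : l + -β⁻¹ * (N / b * (N * β - α * b)) = α * N / β := by
          rw [hl]; field_simp; ring
        rw [h3, hαN]
        have hα0 : α ≠ 0 := by
          intro h0
          have hff : ⟪e, f⟫_ℝ = 0 := by rw [hαN, h0, zero_mul]
          have h4 := hf f
          rw [hff] at h4
          have h5 : ⟪f, f⟫_ℝ = 0 := by
            have := hp f
            have : 0 ≤ ⟪f, f⟫_ℝ := real_inner_self_nonneg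
            nlinarith
          have h6 := hf e
          rw [inner_self_eq_zero.1 h5] at h6
          simp only [map_zero, LinearMap.zero_apply, inner_zero_left] at h6
          linarith
        field_simp
        rw [hβ]; ring
    have hm : 0 ≤ N⁻¹ := inv_nonneg.2 hN0.le
    by_cases he0 : e' = 0
    · refine ⟨ENNReal.ofReal l, fun x => N⁻¹ + 0, by simpa using hl0,
        fun X _ => Str.zero.addMass hm, fun ξ hξ f hf => ?_⟩
      obtain ⟨k, -, -, h3⟩ := key ξ hξ f hf
      rw [h3, he0, inner_zero_left, add_zero l]
      exact (realizes_segment hl0).addMass (fun X _ => Str.zero) _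
    · obtain ⟨R, F, hR, hF, hR'⟩ := ih W B' e' hWd hs' hp' he0
      refine ⟨ENNReal.ofReal l + R, fun x => N⁻¹ + gap l F x, by simp [hl0],
        fun X hX => (Str.gap hF hl0 hX).addMass hm, fun ξ hξ f hf => ?_⟩
      obtain ⟨k, h1, h2, h3⟩ := key ξ hξ f hf
      have h4 : 0 < ⟪e', k⟫_ℝ := by
        refine h2.lt_of_ne fun h0 => he0 ?_
        have h4 := h1 k
        have h5 : ⟪k, k⟫_ℝ = 0 := by
          have := hp' k
          have : 0 ≤ ⟪k, k⟫_ℝ := real_inner_self_nonneg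
          nlinarith
        have h6 := h1 e'
        rw [inner_self_eq_zero.1 h5] at h6
        rw [map_zero, LinearMap.zero_apply, inner_zero_left, mul_zero, zero_add] at h6
        exact inner_self_eq_zero.1 h6.symm
      have h5 : 1 / (l + ⟪e', k⟫_ℝ) = 1 / ⟪e', k⟫_ℝ / (1 + l * (1 / ⟪e', k⟫_ℝ)) := by
        field_simp; ring
      rw [h3, h5]
      exact ((hR' ξ hξ k h1).gap hR.ne' hl0 hF (by positivity)).addMass
        (fun X hX => Str.gap hF hl0 hX) _

/-- Rational complete Bernstein functions are realised by strings. -/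
theorem exists_rational {k : ℕ} {c₁ c₂ : ℝ} (hc₁ : 0 ≤ c₁) (hc₂ : 0 < c₂) (w s : Fin k → ℝ)
    (hw : ∀ i, 0 ≤ w i) (hs : ∀ i, 0 < s i) :
    ∃ R F, 0 < R ∧ (∀ X ∈ IsetOf R, Str F X) ∧ ∀ ξ > 0,
      Realizes R F ξ (c₁ + c₂ * ξ + ∑ i, w i * (ξ / (ξ + s i))) := by
  let V := EuclideanSpace ℝ (Option (Fin k))
  let r : Fin k → ℝ := fun i => √(w i / c₂)
  let q : Fin k → ℝ := fun i => √(s i)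
  have hr : ∀ i, r i * r i = w i / c₂ := fun i => Real.mul_self_sqrt (div_nonneg (hw i) hc₂.le)
  have hq : ∀ i, q i * q i = s i := fun i => Real.mul_self_sqrt (hs i).le
  let t := √c₂⁻¹
  have ht : t * t = c₂⁻¹ := Real.mul_self_sqrt (inv_nonneg.2 hc₂.le)
  have ht0 : t ≠ 0 := (Real.sqrt_pos.2 (inv_pos.2 hc₂)).ne'
  have ha : ∀ (x y : V) o, (x + y) o = x o + y o := fun _ _ _ => rfl
  have hsm : ∀ (c : ℝ) (x : V) o, (c • x) o = c * x o := fun _ _ _ => rfl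
  let B : V →ₗ[ℝ] V →ₗ[ℝ] ℝ := LinearMap.mk₂ ℝ
    (fun f g => c₁ / c₂ * f none * g none +
      ∑ i, (r i * f none - q i * f (some i)) * (r i * g none - q i * g (some i)))
    (fun _ _ _ => by
      simp only [ha]
      rw [add_add_add_comm, ← Finset.sum_add_distrib]
      congr 1
      · ring
      · exact Finset.sum_congr rfl fun i _ => by ring)
    (fun _ _ _ => by
      simp only [hsm, smul_eq_mul, mul_add, Finset.mul_sum]
      congr 1
      · ring
      · exact Finset.sum_congr rfl fun i _ => by ring)
    (fun _ _ _ => by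
      simp only [ha]
      rw [add_add_add_comm, ← Finset.sum_add_distrib]
      congr 1
      · ring
      · exact Finset.sum_congr rfl fun i _ => by ring)
    (fun _ _ _ => by
      simp only [hsm, smul_eq_mul, mul_add, Finset.mul_sum]
      congr 1
      · ring
      · exact Finset.sum_congr rfl fun i _ => by ring)
  have hB : ∀ f g, B f g = c₁ / c₂ * f none * g none +
      ∑ i, (r i * f none - q i * f (some i)) * (r i * g none - q i * g (some i)) :=
    fun _ _ => rfl
  let e : V := EuclideanSpace.single none t
  have hinner : ∀ f g : V, inner ℝ f g = f none * g none + ∑ i, f (some i) * g (some i) :=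
    fun f g => by
      rw [PiLp.inner_apply, Fintype.sum_option]
      simp [mul_comm]
  have he : ∀ f : V, inner ℝ e f = t * f none := fun f => by
    rw [hinner]; simp [e]
  obtain ⟨R, F, hR, hF, h⟩ := exists_discrete _ V B e rfl
    (fun x y => by
      rw [hB, hB]; congr 1
      · ring
      · exact Finset.sum_congr rfl fun i _ => by ring)
    (fun x => by
      rw [hB, mul_assoc]
      exact add_nonneg (mul_nonneg (by positivity) (mul_self_nonneg _))
        (Finset.sum_nonneg fun i _ => mul_self_nonneg _))
    (fun h => ht0 (by simpa [e] using congrArg (fun f : V => f none) h))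
  refine ⟨R, F, hR, hF, fun ξ hξ => ?_⟩
  set ψ := c₁ + c₂ * ξ + ∑ i, w i * (ξ / (ξ + s i)) with hψ
  have hsξ : ∀ i, 0 < s i + ξ := fun i => add_pos (hs i) hξ
  have hψ0 : 0 < ψ := add_pos_of_pos_of_nonneg (by positivity) (Finset.sum_nonneg fun i _ =>
    mul_nonneg (hw i) (div_nonneg hξ.le (by linarith [hsξ i])))
  let f : V := WithLp.toLp 2 fun o => o.elim (t * c₂ / ψ)
    fun i => t * c₂ / ψ * (r i * q i / (s i + ξ))
  have f0 : f none = t * c₂ / ψ := rfl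
  have f1 : ∀ i, f (some i) = t * c₂ / ψ * (r i * q i / (s i + ξ)) := fun _ => rfl
  have := h ξ hξ f fun g => by
    rw [hB, hinner, he, mul_add, Finset.mul_sum, add_add_add_comm,
      ← Finset.sum_add_distrib]
    have : ∀ i, (r i * f none - q i * f (some i)) * (r i * g none - q i * g (some i)) +
        ξ * (f (some i) * g (some i)) = w i * (ξ / (ξ + s i)) * (t / ψ * g none) := fun i => by
      have h1 := (hsξ i).ne'
      have h2 : r i * f none - q i * f (some i) = t * c₂ / ψ * (r i * (ξ / (s i + ξ))) := by
        rw [f0, f1]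
        field_simp
        linear_combination -(r i) * hq i
      rw [h2, f1, add_comm ξ]
      have h3 : c₂ * (r i * r i) = w i := by rw [hr]; field_simp
      linear_combination (t / ψ * (ξ / (s i + ξ)) * g none) * h3
    rw [Finset.sum_congr rfl fun i _ => this i, ← Finset.sum_mul]
    rw [f0]
    have : ∑ i, w i * (ξ / (ξ + s i)) = ψ - c₁ - c₂ * ξ := by rw [hψ]; ring
    rw [this]
    field_simp
    ring
  rw [he, f0] at this
  convert this using 1
  rw [eq_div_iff (by positivity)]
  field_simp
  rw [pow_two, ht]
  field_simp

end

/-- Riemann-sum approximation of `∫ ξ/(ξ+s) dμ`. -/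
theorem riemann_tendsto {μ : Measure ℝ} (hμ : μ (Iic 0) = 0) {ξ : ℝ} (hξ : 0 < ξ)
    (hi : Integrable (fun s : ℝ => ξ / (ξ + s)) μ) :
    Tendsto (fun n : ℕ => ∑ j : Fin (n ^ 2), μ.real (Ioc (j / n : ℝ) ((j + 1) / n)) *
      (ξ / (ξ + (j + 1) / n))) atTop (𝓝 (∫ s, ξ / (ξ + s) ∂μ)) := by
  have hpos : ∀ᵐ s ∂μ, 0 < s := by
    rw [ae_iff]; convert hμ using 2; ext; simp
  let f : ℕ → ℝ → ℝ := fun n s => ∑ j : Fin (n ^ 2),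
    (Ioc (j / n : ℝ) ((j + 1) / n)).indicator (fun _ => ξ / (ξ + (j + 1) / n)) s
  have hfin : ∀ a b : ℝ, 0 ≤ a → μ (Ioc a b) ≠ ⊤ := by
    intro a b ha
    rcases le_or_gt b a with hab | hab
    · simp [hab]
    have hb : 0 < b := ha.trans_lt hab
    have h1 := hi.measure_ge_lt_top (ε := ξ / (ξ + b)) (by positivity)
    refine ((measure_mono ?_).trans_lt h1).ne
    intro s hs
    have : 0 < s := ha.trans_lt hs.1
    simp only [mem_setOf_eq]
    gcongr
    exact hs.2
  have hterm : ∀ n : ℕ, ∀ j : Fin (n ^ 2), Integrable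
      ((Ioc (j / n : ℝ) ((j + 1) / n)).indicator (fun _ => ξ / (ξ + (j + 1) / n))) μ := by
    intro n j
    exact (integrable_indicator_iff measurableSet_Ioc).2
      (integrableOn_const (hfin _ _ (by positivity)))
  have hint : ∀ n, ∫ s, f n s ∂μ = ∑ j : Fin (n ^ 2), μ.real (Ioc (j / n : ℝ) ((j + 1) / n)) *
      (ξ / (ξ + (j + 1) / n)) := by
    intro n
    rw [integral_finset_sum _ fun j _ => hterm n j]
    refine Finset.sum_congr rfl fun j _ => ?_
    rw [integral_indicator measurableSet_Ioc, setIntegral_const, smul_eq_mul]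
  have hmem : ∀ n : ℕ, 0 < n → ∀ s : ℝ, ∀ j : ℕ,
      s ∈ Ioc (j / n : ℝ) ((j + 1) / n) ↔ ⌈s * n⌉₊ = j + 1 := by
    intro n hn s j
    have hn' : (0:ℝ) < n := by exact_mod_cast hn
    rw [Nat.ceil_eq_iff (by omega), mem_Ioc, div_lt_iff₀ hn', le_div_iff₀ hn']
    push_cast
    simp
  have hf : ∀ n : ℕ, 0 < n → ∀ s : ℝ, 0 < s → f n s =
      if ⌈s * n⌉₊ ≤ n ^ 2 then ξ / (ξ + ⌈s * n⌉₊ / n) else 0 := by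
    intro n hn s hs
    have hn' : (0:ℝ) < n := by exact_mod_cast hn
    have hk : 0 < ⌈s * n⌉₊ := Nat.ceil_pos.2 (by positivity)
    split_ifs with h
    · rw [show f n s = _ from Finset.sum_eq_single (⟨⌈s * n⌉₊ - 1, by omega⟩ : Fin (n ^ 2)) ?_ ?_]
      · rw [indicator_of_mem]
        · simp only
          rw [Nat.cast_sub hk]; simp
        · rw [hmem n hn]; simp only; omega
      · intro j _ hj
        refine indicator_of_notMem (fun h' => hj ?_) _
        rw [hmem n hn] at h'
        ext; simp only; omega
      · simp
    · refine Finset.sum_eq_zero fun j _ => indicator_of_notMem (fun h' => h ?_) _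
      rw [hmem n hn] at h'
      have := j.2
      omega
  simp only [← hint]
  refine tendsto_integral_of_dominated_convergence (fun s => ξ / (ξ + s))
    (fun n => (integrable_finset_sum _ fun j _ => hterm n j).aestronglyMeasurable) hi ?_ ?_
  · intro n
    filter_upwards [hpos] with s hs
    rcases Nat.eq_zero_or_pos n with rfl | hn
    · simp [f]; positivity
    rw [hf n hn s hs]
    have hn' : (0:ℝ) < n := by exact_mod_cast hn
    split_ifs
    · have : s ≤ ⌈s * n⌉₊ / n := by rw [le_div_iff₀ hn']; exact Nat.le_ceil _
      rw [Real.norm_of_nonneg (by positivity)]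
      gcongr
    · rw [norm_zero]; positivity
  · filter_upwards [hpos] with s hs
    have h1 : Tendsto (fun n : ℕ => (⌈s * n⌉₊ : ℝ) / n) atTop (𝓝 s) :=
      (tendsto_nat_ceil_mul_div_atTop hs.le).comp tendsto_natCast_atTop_atTop
    have h2 : Tendsto (fun n : ℕ => ξ / (ξ + (⌈s * n⌉₊ : ℝ) / n)) atTop (𝓝 (ξ / (ξ + s))) :=
      tendsto_const_nhds.div (tendsto_const_nhds.add h1) (by positivity)
    refine h2.congr' ?_
    filter_upwards [eventually_ge_atTop (⌈s⌉₊), eventually_gt_atTop 0] with n hn hn0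
    rw [hf n hn0 s hs, if_pos]
    rw [Nat.ceil_le]
    have : s ≤ n := (Nat.le_ceil s).trans (by exact_mod_cast hn)
    push_cast
    rw [pow_two]
    gcongr

theorem exists_approx {ψ : ℝ → ℝ} (hψ : IsCompleteBernstein ψ) :
    ∃ (ρ : ℕ → ℝ≥0∞) (F : ℕ → ℝ → ℝ) (χ : ℕ → ℝ → ℝ), (∀ n, 0 < ρ n) ∧
      (∀ n, ∀ X ∈ IsetOf (ρ n), Str (F n) X) ∧ (∀ n, ∀ ξ > 0, Realizes (ρ n) (F n) ξ (χ n ξ)) ∧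
      ∀ ξ > 0, Tendsto (fun n => χ n ξ) atTop (𝓝 (ψ ξ)) := by
  obtain ⟨c₁, c₂, μ, hc₁, hc₂, hμ, -, h⟩ := hψ
  have key := fun n : ℕ => exists_rational (k := n ^ 2) (c₁ := c₁) (c₂ := c₂ + 1 / ((n:ℝ) + 1)) hc₁
    (by positivity) (fun j => μ.real (Ioc (j / n : ℝ) ((j + 1) / n))) (fun j => (j + 1) / n)
    (fun _ => measureReal_nonneg) (fun j => by
      have : 0 < n := Nat.pos_of_ne_zero (by rintro rfl; exact absurd j.2 (by simp))
      positivity)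
  choose ρ F h1 h2 h3 using key
  refine ⟨ρ, F, _, h1, h2, h3, fun ξ hξ => ?_⟩
  obtain ⟨hi, he⟩ := h ξ hξ
  rw [he]
  refine Tendsto.add (tendsto_const_nhds.add (Tendsto.mul_const _ ?_)) (riemann_tendsto hμ hξ hi)
  have := (tendsto_const_nhds (x := c₂)).add (tendsto_one_div_add_atTop_nhds_zero_nat (𝕜 := ℝ))
  rwa [add_zero] at this

section
variable {F : ℕ → ℝ → ℝ} {G : ℝ → ℝ} {X K ξ t : ℝ}

/-- Uniformly bounded strings on `[0, X]` converging almost everywhere. -/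
structure Conv (F : ℕ → ℝ → ℝ) (G : ℝ → ℝ) (X K : ℝ) : Prop where
  X0 : 0 ≤ X
  str : ∀ n, Str (F n) X
  lim : Str G X
  bd : ∀ n, F n X ≤ K
  ae : ∀ᵐ t, t ∈ Icc 0 X → Tendsto (fun n => F n t) atTop (𝓝 (G t))

namespace Conv
variable (h : Conv F G X K)
include h

theorem le (n : ℕ) (ht : t ∈ Icc 0 X) : F n t ≤ K :=
  ((h.str n).mono ht ⟨h.X0, le_rfl⟩ ht.2).trans (h.bd n)

theorem K0 : 0 ≤ K := ((h.str 0).pos ⟨h.X0, le_rfl⟩).trans (h.bd 0)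

theorem vit_le (n k : ℕ) (ht : t ∈ Icc 0 X) :
    vit (F n) (F n) k t ≤ K * ((K * X) ^ k / (k.factorial : ℝ) ^ 2) := by
  refine ((h.str n).it_le' (h.str n) k ht).trans ?_
  have h1 := (h.str n).pos ⟨h.X0, le_rfl⟩
  have h2 := h.bd n
  have h3 := h.X0
  have h4 := h.K0
  gcongr

theorem tendsto_vit (k : ℕ) (ht : t ∈ Icc 0 X)
    (hc : Tendsto (fun n => F n t) atTop (𝓝 (G t))) :
    Tendsto (fun n => vit (F n) (F n) k t) atTop (𝓝 (vit G G k t)) := by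
  induction k generalizing t with
  | zero => exact hc
  | succ k ih =>
    have h4 := h.K0
    have h5 := h.X0
    refine intervalIntegral.tendsto_integral_filter_of_dominated_convergence
      (fun _ => K * (K * ((K * X) ^ k / (k.factorial : ℝ) ^ 2)))
      (Eventually.of_forall fun n => ?_) (Eventually.of_forall fun n => ae_of_all _ fun s hs => ?_)
      intervalIntegrable_const ?_
    · rw [uIoc_of_le ht.1]
      exact ((h.str n).step_intable ((h.str n).iter (h.str n) k) ht ht).1.aestronglyMeasurable
    · rw [uIoc_of_le ht.1] at hs
      have hs' : s ∈ Icc 0 X := ⟨hs.1.le, hs.2.trans ht.2⟩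
      have h1 := (h.str n).mono hs' ht hs.2
      have h2 := (h.str n).pos hs'
      have h3 := ((h.str n).iter (h.str n) k).pos hs'
      rw [Real.norm_of_nonneg (mul_nonneg (by linarith) h3)]
      have h6 := h.le n ht
      have h7 := h.vit_le n k hs'
      refine mul_le_mul (by linarith) h7 h3 h4
    · filter_upwards [h.ae] with s hs hs'
      rw [uIoc_of_le ht.1] at hs'
      have hm : s ∈ Icc 0 X := ⟨hs'.1.le, hs'.2.trans ht.2⟩
      exact (hc.sub (hs hm)).mul (ih hm (hs hm))

theorem norm_mV_le (hξ : 0 ≤ ξ) (n : ℕ) (ht : t ∈ Icc 0 X) : ‖mV (F n) ξ t‖ ≤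
    ξ * ∑' k : ℕ, K * ((ξ * (K * X)) ^ k / (k.factorial : ℝ) ^ 2) := by
  rw [mV, solV, zero_mul, zero_add, mul_one, norm_mul, Real.norm_of_nonneg hξ]
  refine mul_le_mul_of_nonneg_left (tsum_of_norm_bounded
    ((summable_fact _).mul_left _).hasSum fun k => ?_) hξ
  have := h.vit_le n k ht
  rw [norm_mul, norm_pow, Real.norm_of_nonneg hξ]
  simp only [RCLike.ofReal_real_eq_id, id]
  rw [Real.norm_of_nonneg (((h.str n).iter (h.str n) k).pos ht)]
  calc _ ≤ ξ ^ k * (K * ((K * X) ^ k / (k.factorial : ℝ) ^ 2)) := by gcongr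
    _ = _ := by rw [mul_pow]; ring

theorem tendsto_mV (hξ : 0 ≤ ξ) (ht : t ∈ Icc 0 X)
    (hc : Tendsto (fun n => F n t) atTop (𝓝 (G t))) :
    Tendsto (fun n => mV (F n) ξ t) atTop (𝓝 (mV G ξ t)) := by
  simp only [mV, solV, zero_mul, zero_add, mul_one]
  refine Tendsto.const_mul _ (tendsto_tsum_of_dominated_convergence
    (bound := fun k => K * ((ξ * (K * X)) ^ k / (k.factorial : ℝ) ^ 2))
    ((summable_fact _).mul_left _) (fun k => ?_) (Eventually.of_forall fun n k => ?_))
  · simp only [RCLike.ofReal_real_eq_id, id]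
    exact (h.tendsto_vit k ht hc).const_mul _
  · have := h.vit_le n k ht
    rw [norm_mul, norm_pow, Real.norm_of_nonneg hξ]
    simp only [RCLike.ofReal_real_eq_id, id]
    rw [Real.norm_of_nonneg (((h.str n).iter (h.str n) k).pos ht)]
    calc _ ≤ ξ ^ k * (K * ((K * X) ^ k / (k.factorial : ℝ) ^ 2)) := by gcongr
      _ = _ := by rw [mul_pow]; ring

theorem tendsto_mF (hξ : 0 ≤ ξ) (ht : t ∈ Icc 0 X) :
    Tendsto (fun n => mF (F n) ξ t) atTop (𝓝 (mF G ξ t)) := by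
  refine Tendsto.const_add _ (intervalIntegral.tendsto_integral_filter_of_dominated_convergence
      (fun _ => ξ * ∑' k : ℕ, K * ((ξ * (K * X)) ^ k / (k.factorial : ℝ) ^ 2))
      (Eventually.of_forall fun n => ?_) (Eventually.of_forall fun n => ae_of_all _ fun s hs => ?_)
      intervalIntegrable_const ?_)
  · rw [uIoc_of_le ht.1]
    exact (((h.str n).restrict ht.2).solV_intable ht.1).1.aestronglyMeasurable
  · rw [uIoc_of_le ht.1] at hs
    exact h.norm_mV_le hξ n ⟨hs.1.le, hs.2.trans ht.2⟩
  · filter_upwards [h.ae] with s hs hs'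
    rw [uIoc_of_le ht.1] at hs'
    have hm : s ∈ Icc 0 X := ⟨hs'.1.le, hs'.2.trans ht.2⟩
    exact h.tendsto_mV hξ hm (hs hm)

theorem tendsto_hF (hξ : 0 ≤ ξ) (ht : t ∈ Icc 0 X) :
    Tendsto (fun n => hF (F n) ξ t) atTop (𝓝 (hF G ξ t)) := by
  refine intervalIntegral.tendsto_integral_filter_of_dominated_convergence
      (fun _ => 1)
      (Eventually.of_forall fun n => ?_) (Eventually.of_forall fun n => ae_of_all _ fun s hs => ?_)
      intervalIntegrable_const (ae_of_all _ fun s hs => ?_)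
  · rw [uIoc_of_le ht.1]
    exact (((h.str n).restrict ht.2).inv_intable ht.1 hξ).1.aestronglyMeasurable
  · rw [uIoc_of_le ht.1] at hs
    have := (h.str n).mF_ge hξ ⟨hs.1.le, hs.2.trans ht.2⟩
    rw [Real.norm_of_nonneg (by positivity)]
    exact inv_le_one_of_one_le₀ (one_le_pow₀ this)
  · rw [uIoc_of_le ht.1] at hs
    have hm : s ∈ Icc 0 X := ⟨hs.1.le, hs.2.trans ht.2⟩
    have := h.lim.mF_ge hξ hm
    exact ((h.tendsto_mF hξ hm).pow 2).inv₀ (by positivity)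

end Conv

end

/-- Helly selection for monotone functions with values in `[0, ∞]`. -/
theorem helly (E : ℕ → ℝ → ℝ≥0∞) (hE : ∀ n, Monotone (E n)) :
    ∃ (σ : ℕ → ℕ) (H : ℝ → ℝ≥0∞), StrictMono σ ∧ Monotone H ∧
      (∀ x, ContinuousWithinAt H (Ici x) x) ∧
      (∀ x, ContinuousAt H x → Tendsto (fun n => E (σ n) x) atTop (𝓝 (H x))) ∧
      ∀ x c, H x < c → ∃ y > x, ∀ᶠ n in atTop, E (σ n) y < c := by
  obtain ⟨g, -, σ, hσ, hg⟩ := isCompact_univ.tendsto_subseq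
    (x := fun n (q : ℚ) => E n q) (fun n => mem_univ _)
  rw [tendsto_pi_nhds] at hg
  set H : ℝ → ℝ≥0∞ := fun x => ⨅ q : {q : ℚ // x < q}, g q with hH
  have hlt : ∀ (x : ℝ) c, H x < c → ∃ q : ℚ, x < q ∧ g q < c := fun x c h => by
    obtain ⟨⟨q, hq⟩, h⟩ := iInf_lt_iff.1 h
    exact ⟨q, hq, h⟩
  have hle : ∀ (x : ℝ) (q : ℚ), x < q → H x ≤ g q := fun x q h =>
    iInf_le (fun q : {q : ℚ // x < q} => g q) ⟨q, h⟩
  have hmono : Monotone H := fun x y hxy => le_iInf fun ⟨q, hq⟩ => hle x q (hxy.trans_lt hq)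
  refine ⟨σ, H, hσ, hmono, fun x => ?_, fun x hx => ?_, fun x c h => ?_⟩
  · rw [ContinuousWithinAt, tendsto_order]
    refine ⟨fun a ha => ?_, fun a ha => ?_⟩
    · filter_upwards [self_mem_nhdsWithin] with y hy using ha.trans_le (hmono hy)
    · obtain ⟨q, hq, h⟩ := hlt x a ha
      filter_upwards [Ico_mem_nhdsGE hq] with y hy using (hle y q hy.2).trans_lt h
  · rw [tendsto_order]
    refine ⟨fun a ha => ?_, fun a ha => ?_⟩
    · have h1 := (hx.tendsto.eventually (lt_mem_nhds ha)).filter_mono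
        (nhdsWithin_le_nhds (s := Iio x))
      obtain ⟨y, hy, hyx⟩ := (h1.and self_mem_nhdsWithin).exists
      obtain ⟨q, hq1, hq2⟩ := exists_rat_btwn (show y < x from hyx)
      filter_upwards [(hg q).eventually (lt_mem_nhds (hy.trans_le (hle y q hq1)))] with n hn
      exact hn.trans_le (hE _ hq2.le)
    · obtain ⟨q, hq, h⟩ := hlt x a ha
      filter_upwards [(hg q).eventually (gt_mem_nhds h)] with n hn
      exact (hE _ hq.le).trans_lt hn
  · obtain ⟨q, hq, h⟩ := hlt x c h
    exact ⟨q, hq, (hg q).eventually (gt_mem_nhds h)⟩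

section
variable {F : ℝ → ℝ} {X Y x y q ξ ψ : ℝ} {R : ℝ≥0∞}

/-- Extension of the mass function by `0` to the left and by `∞` to the right of `[0, R)`. -/
def ext (R : ℝ≥0∞) (F : ℝ → ℝ) (y : ℝ) : ℝ≥0∞ :=
  if y < 0 then 0 else if ENNReal.ofReal y < R then ENNReal.ofReal (F y) else ⊤

theorem ext_of_mem (h : y ∈ IsetOf R) : ext R F y = ENNReal.ofReal (F y) := by
  rw [ext, if_neg (not_lt.2 h.1), if_pos h.2]

theorem mem_of_ext (hy : 0 ≤ y) (h : ext R F y < ⊤) : y ∈ IsetOf R := by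
  refine ⟨hy, ?_⟩
  by_contra h'
  rw [ext, if_neg (not_lt.2 hy), if_neg h'] at h
  exact lt_irrefl _ h

theorem ext_mono (h : ∀ X ∈ IsetOf R, Str F X) : Monotone (ext R F) := by
  intro x y hxy
  rcases lt_or_ge x 0 with hx | hx
  · simp [ext, hx]
  by_cases hy : y ∈ IsetOf R
  · rw [ext_of_mem hy, ext_of_mem (iset_down hy hx hxy)]
    exact ENNReal.ofReal_le_ofReal ((h y hy).le hx hxy le_rfl)
  · have : ext R F y = ⊤ := by
      by_contra h'
      exact hy (mem_of_ext (hx.trans hxy) (lt_top_iff_ne_top.2 h'))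
    rw [this]; exact le_top

theorem hTot_ge (h : ∀ X ∈ IsetOf R, Str F X) (hξ : 0 ≤ ξ) (hx : x ∈ IsetOf R) :
    ENNReal.ofReal (hF F ξ x) ≤ hTot F R ξ := by
  rw [(h x hx).ofReal_hF hx.1 hξ]
  exact lintegral_mono_set fun t ht => iset_down hx ht.1 ht.2

theorem hTot_le (h : ∀ X ∈ IsetOf R, Str F X) (hξ : 0 < ξ) (hx : x ∈ IsetOf R) (hxq : x ≤ q) :
    hTot F R ξ ≤ ENNReal.ofReal (hF F ξ x) + ENNReal.ofReal (q - x) +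
      (ENNReal.ofReal ξ * ext R F q)⁻¹ := by
  have hR : 0 < R := bot_le.trans_lt hx.2
  obtain ⟨e, he⟩ := exists_exh hR
  have hq0 : 0 ≤ q := hx.1.trans hxq
  have hpos : ∀ y ∈ IsetOf R, 0 ≤ hF F ξ y := fun y hy =>
    (show hF F ξ 0 = 0 by simp [hF]) ▸ (h y hy).hF_mono hξ.le le_rfl hy.1 le_rfl
  have h1 : ∀ y ∈ IsetOf R, x ≤ y → y ≤ q → hF F ξ y ≤ hF F ξ x + (q - x) := fun y hy hxy hyq => by
    have h1 := (h y hy).hF_sub_le hξ.le hx.1 hxy le_rfl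
    have h2 := (h y hy).mF_ge hξ.le ⟨hx.1, hxy⟩
    have h3 : (mF F ξ x)⁻¹ * (y - x) ≤ 1 * (y - x) :=
      mul_le_mul_of_nonneg_right (inv_le_one_of_one_le₀ h2) (by linarith)
    linarith
  refine le_of_tendsto (he.hTot_tendsto h hξ.le) ?_
  filter_upwards [he.ev x hx] with n hn
  have hm := he.mem n
  rcases le_or_gt (e n) q with hq | hq
  · refine le_add_right ?_
    rw [← ENNReal.ofReal_add (hpos x hx) (by linarith)]
    exact ENNReal.ofReal_le_ofReal (h1 _ hm hn hq)
  · have hqm : q ∈ IsetOf R := iset_down hm hq0 hq.le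
    rw [ext_of_mem hqm, ← ENNReal.ofReal_mul hξ.le]
    rcases ((h q hqm).pos ⟨hq0, le_rfl⟩).eq_or_lt with hz | hz
    · simp [← hz]
    have h2 := (h _ hm).hF_sub_le' hξ hq0 hq.le le_rfl hz
    have h3 := h1 q hqm hxq le_rfl
    have h4 := (h _ hm).mF_ge hξ.le ⟨hq0, hq.le⟩
    have h5 : (ξ * F q * mF F ξ q)⁻¹ ≤ (ξ * F q)⁻¹ :=
      inv_anti₀ (by positivity) (le_mul_of_one_le_right (by positivity) h4)
    rw [← ENNReal.ofReal_inv_of_pos (by positivity), ← ENNReal.ofReal_add (hpos x hx) (by linarith),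
      ← ENNReal.ofReal_add (by linarith [hpos x hx]) (by positivity)]
    exact ENNReal.ofReal_le_ofReal (by linarith)

theorem hTot_le_tail (h : ∀ X ∈ IsetOf R, Str F X) (hξ : 0 < ξ) (hx : x ∈ IsetOf R) (hq : 0 ≤ q)
    (hqx : q ≤ x) (hpos : 0 < F q) : hTot F R ξ ≤ ENNReal.ofReal (hF F ξ x) +
      ENNReal.ofReal ((ξ * F q * (1 + ξ * F q * (x - q)))⁻¹) := by
  have hR : 0 < R := bot_le.trans_lt hx.2
  obtain ⟨e, he⟩ := exists_exh hR
  have h0 : 0 ≤ hF F ξ x :=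
    (show hF F ξ 0 = 0 by simp [hF]) ▸ (h x hx).hF_mono hξ.le le_rfl hx.1 le_rfl
  have h3 : 0 ≤ ξ * F q * (x - q) := mul_nonneg (by positivity) (by linarith)
  refine le_of_tendsto (he.hTot_tendsto h hξ.le) ?_
  filter_upwards [he.ev x hx] with n hn
  have hm := he.mem n
  have hF := (h _ hm).le hq hqx hn
  have h2 := (h _ hm).hF_sub_le' hξ hx.1 hn le_rfl (hpos.trans_le hF)
  have h4 := (h _ hx).mF_ge_lin hξ.le hq hqx le_rfl
  rw [← ENNReal.ofReal_add h0 (by positivity)]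
  refine ENNReal.ofReal_le_ofReal ?_
  have h5 : (ξ * F x * mF F ξ x)⁻¹ ≤ (ξ * F q * (1 + ξ * F q * (x - q)))⁻¹ :=
    inv_anti₀ (by positivity) (mul_le_mul (mul_le_mul_of_nonneg_left hF hξ.le) h4 (by positivity)
      (mul_nonneg hξ.le (hpos.le.trans hF)))
  linarith

end

/-- Compactness: pointwise limits of realised functions are realised. -/
theorem exists_limit {ρ : ℕ → ℝ≥0∞} {F : ℕ → ℝ → ℝ} {χ : ℕ → ℝ → ℝ} {ψ : ℝ → ℝ}
    (hρ : ∀ n, 0 < ρ n) (hF : ∀ n, ∀ X ∈ IsetOf (ρ n), Str (F n) X)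
    (hr : ∀ n, ∀ ξ > 0, Realizes (ρ n) (F n) ξ (χ n ξ))
    (hχ : ∀ ξ > 0, Tendsto (fun n => χ n ξ) atTop (𝓝 (ψ ξ))) :
    ∃ R G, 0 < R ∧ (∀ X ∈ IsetOf R, Str G X) ∧ ∀ ξ > 0, Realizes R G ξ (ψ ξ) := by
  obtain ⟨σ, H, hσ, hH, hrc, hconv, hupper⟩ :=
    helly (fun n => ext (ρ n) (F n)) fun n => ext_mono (hF n)
  set R : ℝ≥0∞ := sSup (ENNReal.ofReal '' {x | H x < ⊤}) with hR
  set G : ℝ → ℝ := fun y => (H y).toReal with hG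
  have hmem : ∀ y ∈ IsetOf R, H y ≠ ⊤ := fun y hy => by
    obtain ⟨_, ⟨x, hx, rfl⟩, hxy⟩ := lt_sSup_iff.1 hy.2
    exact ((hH (ENNReal.ofReal_lt_ofReal_iff'.1 hxy).1.le).trans_lt hx).ne
  have hout : ∀ q, R < ENNReal.ofReal q →
      Tendsto (fun n => ext (ρ (σ n)) (F (σ n)) q) atTop (𝓝 ⊤) := fun q hq => by
    have h1 : ∀ y, R < ENNReal.ofReal y → H y = ⊤ := fun y hy => by
      by_contra h
      exact (le_sSup ⟨y, lt_top_iff_ne_top.2 h, rfl⟩ : ENNReal.ofReal y ≤ R).not_gt hy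
    have h2 : ContinuousAt H q := by
      have : H =ᶠ[𝓝 q] fun _ => ⊤ := by
        filter_upwards [ENNReal.continuous_ofReal.continuousAt.eventually (lt_mem_nhds hq)]
          with y hy using h1 y hy
      exact continuousAt_const.congr this.symm
    exact h1 q hq ▸ hconv q h2
  have hev : ∀ y ∈ IsetOf R, ∃ K, ∀ᶠ n in atTop, y ∈ IsetOf (ρ (σ n)) ∧ F (σ n) y ≤ K := by
    intro y hy
    obtain ⟨c, hc1, hc2⟩ := exists_between (lt_top_iff_ne_top.2 (hmem y hy))
    obtain ⟨y', hy', h⟩ := hupper y c hc1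
    refine ⟨c.toReal, h.mono fun n hn => ?_⟩
    have h1 := (ext_mono (hF (σ n)) hy'.le).trans_lt hn
    have h2 := mem_of_ext hy.1 (h1.trans hc2)
    refine ⟨h2, ?_⟩
    rw [ext_of_mem h2] at h1
    exact (ENNReal.ofReal_le_iff_le_toReal hc2.ne).1 h1.le
  have hstr : ∀ X ∈ IsetOf R, Str G X := fun X hX =>
    { mono := fun a _ b hb hab =>
        ENNReal.toReal_mono (hmem b (iset_down hX hb.1 hb.2)) (hH hab)
      nonneg := ENNReal.toReal_nonneg
      rc := fun t ht => (ENNReal.tendsto_toReal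
        (hmem t (iset_down hX ht.1 ht.2.le))).comp (hrc t) }
  have hcount := hH.countable_not_continuousAt
  have hptc : ∀ t ∈ IsetOf R, ContinuousAt H t →
      Tendsto (fun n => F (σ n) t) atTop (𝓝 (G t)) := fun t ht hc => by
    have h1 := (ENNReal.tendsto_toReal (hmem t ht)).comp (hconv t hc)
    refine h1.congr' ?_
    obtain ⟨K, hK⟩ := hev t ht
    filter_upwards [hK] with n hn
    simp only [Function.comp_apply]
    rw [ext_of_mem hn.1, ENNReal.toReal_ofReal ((hF _ t hn.1).pos ⟨ht.1, le_rfl⟩)]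
  have hhF : ∀ ξ > 0, ∀ x ∈ IsetOf R,
      Tendsto (fun n => Krein.hF (F (σ n)) ξ x) atTop (𝓝 (Krein.hF G ξ x)) := by
    intro ξ hξ x hx
    obtain ⟨K, hK⟩ := hev x hx
    obtain ⟨N, hN⟩ := eventually_atTop.1 hK
    have C : Conv (fun n => F (σ (n + N))) G x K :=
      { X0 := hx.1
        str := fun n => hF _ x (hN (n + N) (by omega)).1
        lim := hstr x hx
        bd := fun n => (hN (n + N) (by omega)).2
        ae := by
          have : ∀ᵐ t, ContinuousAt H t := by
            rw [ae_iff]; exact hcount.measure_zero _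
          filter_upwards [this] with t ht htm
          exact (tendsto_add_atTop_iff_nat N).2 (hptc t (iset_down hx htm.1 htm.2) ht) }
    exact (tendsto_add_atTop_iff_nat N).1 (C.tendsto_hF hξ.le ⟨hx.1, le_rfl⟩)
  set T : ℝ → ℕ → ℝ≥0∞ := fun ξ n => hTot (F (σ n)) (ρ (σ n)) ξ with hTdef
  have hTχ : ∀ ξ > 0, ∀ n, 0 ≤ χ (σ n) ξ ∧ T ξ n = (ENNReal.ofReal (χ (σ n) ξ))⁻¹ :=
    fun ξ hξ n => by
      obtain ⟨φ, v, w⟩ := hr (σ n) ξ hξ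
      exact w.hTot_eq (hρ _) (hF _) hξ
  have hψ0 : ∀ ξ > 0, 0 ≤ ψ ξ := fun ξ hξ =>
    ge_of_tendsto' ((hχ ξ hξ).comp hσ.tendsto_atTop) fun n => (hTχ ξ hξ n).1
  have hT : ∀ ξ > 0, Tendsto (T ξ) atTop (𝓝 (ENNReal.ofReal (ψ ξ))⁻¹) := fun ξ hξ => by
    have h1 := ((continuous_inv (G := ℝ≥0∞)).comp ENNReal.continuous_ofReal).continuousAt.tendsto.comp
      ((hχ ξ hξ).comp hσ.tendsto_atTop)
    exact h1.congr fun n => (hTχ ξ hξ n).2.symm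
  have hinv : ∀ ξ > 0, ∀ q, R < ENNReal.ofReal q → Tendsto
      (fun n => (ENNReal.ofReal ξ * ext (ρ (σ n)) (F (σ n)) q)⁻¹) atTop (𝓝 0) := by
    intro ξ hξ q hq
    have h1 := ENNReal.Tendsto.const_mul (a := ENNReal.ofReal ξ) (hout q hq)
      (Or.inr ENNReal.ofReal_ne_top)
    rw [ENNReal.mul_top (by simpa using hξ)] at h1
    have h2 := (continuous_inv (G := ℝ≥0∞)).continuousAt.tendsto.comp h1
    rwa [ENNReal.inv_top] at h2
  have hR0 : 0 < R := by
    rw [pos_iff_ne_zero]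
    intro h0
    have h1 : ∀ q > 0, (ENNReal.ofReal (ψ 1))⁻¹ ≤ ENNReal.ofReal q := fun q hq => by
      have h2 := (hinv 1 one_pos q (by rw [h0]; simpa using hq)).const_add (ENNReal.ofReal q)
      rw [add_zero] at h2
      refine le_of_tendsto_of_tendsto' (hT 1 one_pos) h2 fun n => ?_
      have := hTot_le (hF (σ n)) one_pos (zero_mem_iset (hρ _)) hq.le
      simpa [Krein.hF] using this
    have h2 : Tendsto (fun q : ℝ => ENNReal.ofReal q) (𝓝[>] 0) (𝓝 0) := by
      have := ENNReal.continuous_ofReal.tendsto 0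
      rw [ENNReal.ofReal_zero] at this
      exact this.mono_left nhdsWithin_le_nhds
    have h3 := ge_of_tendsto h2 (eventually_of_mem self_mem_nhdsWithin fun q hq => h1 q hq)
    simp at h3
  refine ⟨R, G, hR0, hstr, fun ξ hξ => ?_⟩
  suffices h : hTot G R ξ = (ENNReal.ofReal (ψ ξ))⁻¹ from
    ⟨_, _, weyl_of_hTot hR0 hstr hξ (hψ0 ξ hξ) h⟩
  obtain ⟨e, he⟩ := exists_exh hR0
  have hTe := he.hTot_tendsto hstr hξ.le
  have hofF : ∀ x ∈ IsetOf R, Tendsto (fun n => ENNReal.ofReal (Krein.hF (F (σ n)) ξ x)) atTop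
      (𝓝 (ENNReal.ofReal (Krein.hF G ξ x))) := fun x hx => ENNReal.tendsto_ofReal (hhF ξ hξ x hx)
  refine le_antisymm ?_ ?_
  · refine le_of_tendsto' hTe fun k => ?_
    refine le_of_tendsto_of_tendsto (hofF _ (he.mem k)) (hT ξ hξ) ?_
    obtain ⟨K, hK⟩ := hev _ (he.mem k)
    exact hK.mono fun n hn => hTot_ge (hF _) hξ.le hn.1
  by_cases hRt : R = ⊤
  · have hin : ∀ x, 0 ≤ x → x ∈ IsetOf R := fun x hx => by rw [hRt, iset_top]; exact hx
    by_cases hz : ∃ q, 0 ≤ q ∧ 0 < G q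
    · obtain ⟨q₀, hq₀, hGq₀⟩ := hz
      obtain ⟨q, hq, hqq⟩ := (hcount.dense_compl ℝ).exists_gt q₀
      have hqc : ContinuousAt H q := by simpa using hq
      have hq0 : 0 ≤ q := hq₀.trans hqq.le
      have hGq : 0 < G q :=
        hGq₀.trans_le (ENNReal.toReal_mono (hmem q (hin q hq0)) (hH hqq.le))
      have hFq := hptc q (hin q hq0) hqc
      have h1 : ∀ x, q ≤ x → (ENNReal.ofReal (ψ ξ))⁻¹ ≤ ENNReal.ofReal (Krein.hF G ξ x) +
          ENNReal.ofReal ((ξ * G q * (1 + ξ * G q * (x - q)))⁻¹) := fun x hx => by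
        have hx' := hin x (hq0.trans hx)
        have h2 : Tendsto (fun n => (ξ * F (σ n) q * (1 + ξ * F (σ n) q * (x - q)))⁻¹) atTop
            (𝓝 ((ξ * G q * (1 + ξ * G q * (x - q)))⁻¹)) := by
          refine Tendsto.inv₀ ((hFq.const_mul ξ).mul
            (((hFq.const_mul ξ).mul_const _).const_add 1)) ?_
          have : 0 ≤ ξ * G q * (x - q) := mul_nonneg (by positivity) (by linarith)
          positivity
        refine le_of_tendsto_of_tendsto (hT ξ hξ) ((hofF x hx').add (ENNReal.tendsto_ofReal h2)) ?_
        obtain ⟨K, hK⟩ := hev x hx'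
        filter_upwards [hK, hFq.eventually (lt_mem_nhds hGq)] with n hn hn'
        exact hTot_le_tail (hF _) hξ hn.1 hq0 hx hn'
      have h3 : Tendsto (fun k => ENNReal.ofReal ((ξ * G q * (1 + ξ * G q * (e k - q)))⁻¹)) atTop
          (𝓝 0) := by
        rw [← ENNReal.ofReal_zero]
        refine ENNReal.tendsto_ofReal (tendsto_inv_atTop_zero.comp ?_)
        have he' : Tendsto e atTop atTop := (show Exh ⊤ e from hRt ▸ he).tendsto_top
        refine Tendsto.const_mul_atTop (by positivity) (tendsto_atTop_add_const_left _ _ ?_)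
        exact Tendsto.const_mul_atTop (by positivity) (tendsto_atTop_add_const_right _ _ he')
      have h4 := hTe.add h3
      rw [add_zero] at h4
      refine ge_of_tendsto h4 ?_
      filter_upwards [he.ev q (hin q hq0)] with k hk using h1 _ hk
    · push Not at hz
      have h1 : hTot G R ξ = ⊤ := by
        refine ENNReal.eq_top_of_forall_nnreal_le ?_
        intro r
        have hr0 : 0 ≤ (r : ℝ) := r.2
        have h2 := hTot_ge hstr hξ.le (hin r hr0)
        rw [(hstr r (hin r hr0)).hF_of_zero (t := r)
          (le_antisymm (hz r hr0) ENNReal.toReal_nonneg) ⟨hr0, le_rfl⟩] at h2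
        simpa using h2
      rw [h1]; exact le_top
  · have h1 : ∀ k : ℕ, (ENNReal.ofReal (ψ ξ))⁻¹ ≤ ENNReal.ofReal (Krein.hF G ξ (e k)) +
        ENNReal.ofReal (R.toReal + 1 / ((k:ℝ) + 1) - e k) := fun k => by
      have hk := he.mem k
      have hk' := hk
      rw [iset_fin hRt] at hk'
      have hp : 0 < 1 / ((k:ℝ) + 1) := by positivity
      have h2 := ((hofF _ hk).add_const (ENNReal.ofReal (R.toReal + 1 / ((k:ℝ) + 1) - e k))).add
        (hinv ξ hξ (R.toReal + 1 / ((k:ℝ) + 1)) (by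
          rw [ENNReal.lt_ofReal_iff_toReal_lt hRt]; linarith))
      rw [add_zero] at h2
      refine le_of_tendsto_of_tendsto (hT ξ hξ) h2 ?_
      obtain ⟨K, hK⟩ := hev _ hk
      filter_upwards [hK] with n hn
      exact hTot_le (hF _) hξ hn.1 (by linarith [hk'.2])
    have h2 : Tendsto (fun k : ℕ => ENNReal.ofReal (R.toReal + 1 / ((k:ℝ) + 1) - e k)) atTop
        (𝓝 0) := by
      have h3 := (he.tendsto_fin hRt).mono_right nhdsWithin_le_nhds
      have h4 := ((tendsto_const_nhds (x := R.toReal)).add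
        (tendsto_one_div_add_atTop_nhds_zero_nat (𝕜 := ℝ))).sub h3
      simpa using ENNReal.tendsto_ofReal h4
    have h4 := hTe.add h2
    rw [add_zero] at h4
    exact ge_of_tendsto' h4 h1

theorem exists_string {ψ : ℝ → ℝ} (hψ : IsCompleteBernstein ψ) :
    ∃ R G, 0 < R ∧ (∀ X ∈ IsetOf R, Str G X) ∧ ∀ ξ > 0, Realizes R G ξ (ψ ξ) := by
  obtain ⟨ρ, F, χ, h1, h2, h3, h4⟩ := exists_approx hψ
  exact exists_limit h1 h2 h3 h4

/-- The distribution function of a mass distribution. -/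
def dist (a : Measure ℝ) (y : ℝ) : ℝ := (a (Icc 0 y)).toReal

section
variable {F : ℝ → ℝ} {X x y : ℝ} {R : ℝ≥0∞}

theorem exists_measure (hR : 0 < R) (hF : ∀ X ∈ IsetOf R, Str F X) :
    ∃ a : Measure ℝ, LocallyFiniteOnHalf R a ∧ ∀ y ∈ IsetOf R, dist a y = F y := by
  set S : Set ℝ := {c | 0 < c ∧ ∃ t ∈ IsetOf R, c ≤ F t} with hS
  set T : ℝ → Set ℝ := fun c => {t | t ∈ IsetOf R ∧ c ≤ F t} with hT
  set Q : ℝ → ℝ := fun c => sInf (T c) with hQ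
  have hb : ∀ c, BddBelow (T c) := fun c => ⟨0, fun t ht => ht.1.1⟩
  have hne : ∀ c ∈ S, (T c).Nonempty := fun c hc => hc.2
  have hQ0 : ∀ c ∈ S, 0 ≤ Q c := fun c hc => le_csInf (hne c hc) fun t ht => ht.1.1
  have hQI : ∀ c ∈ S, Q c ∈ IsetOf R := fun c hc => by
    obtain ⟨t, ht⟩ := hne c hc
    exact iset_down ht.1 (hQ0 c hc) (csInf_le (hb c) ht)
  have hQle : ∀ c ∈ S, ∀ y ∈ IsetOf R, Q c ≤ y ↔ c ≤ F y := fun c hc y hy => by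
    refine ⟨fun h => ?_, fun h => csInf_le (hb c) ⟨hy, h⟩⟩
    obtain ⟨z, hz, hyz⟩ := iset_succ hy
    have hrc := (hF z hz).rc y ⟨hy.1, hyz⟩
    have h2 : Tendsto F (𝓝[>] y) (𝓝 (F y)) := hrc.mono_left (nhdsWithin_mono _ Ioi_subset_Ici_self)
    refine ge_of_tendsto h2 ?_
    filter_upwards [Ioc_mem_nhdsGT hyz] with r hr
    obtain ⟨t, ht, htr⟩ := (csInf_lt_iff (hb c) (hne c hc)).1 (lt_of_le_of_lt h hr.1)
    exact ht.2.trans ((hF z hz).le ht.1.1 htr.le hr.2)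
  have hSm : S.OrdConnected := ⟨fun a ha b hb c hc =>
    ⟨ha.1.trans_le hc.1, let ⟨t, ht, h⟩ := hb.2; ⟨t, ht, hc.2.trans h⟩⟩⟩
  have hQm : AEMeasurable Q (volume.restrict S) := by
    refine aemeasurable_restrict_of_monotoneOn hSm.measurableSet fun a ha b hb' hab => ?_
    exact csInf_le_csInf (hb a) (hne b hb') fun t ht => ⟨ht.1, hab.trans ht.2⟩
  have hval : ∀ y ∈ IsetOf R, (volume.restrict S).map Q (Icc 0 y) = ENNReal.ofReal (F y) := by
    intro y hy
    rw [Measure.map_apply_of_aemeasurable hQm measurableSet_Icc]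
    have h1 : (volume.restrict S) (Q ⁻¹' Icc 0 y) = (volume.restrict S) (Ioc 0 (F y)) := by
      refine measure_congr ?_
      filter_upwards [ae_restrict_mem hSm.measurableSet] with c hc
      refine propext ?_
      change Q c ∈ Icc 0 y ↔ c ∈ Ioc 0 (F y)
      rw [mem_Icc, mem_Ioc, hQle c hc y hy]
      exact ⟨fun h => ⟨hc.1, h.2⟩, fun h => ⟨hQ0 c hc, h.2⟩⟩
    rw [h1, Measure.restrict_apply measurableSet_Ioc, inter_eq_left.2, Real.volume_Ioc, sub_zero]
    exact fun c hc => ⟨hc.1, y, hy, hc.2⟩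
  refine ⟨(volume.restrict S).map Q, ⟨?_, fun y hy => ?_⟩, fun y hy => ?_⟩
  · rw [Measure.map_apply_of_aemeasurable hQm measurableSet_iset.compl,
      ← nonpos_iff_eq_zero]
    have : (volume.restrict S) (Q ⁻¹' (IsetOf R)ᶜ) = (volume.restrict S) ∅ := by
      refine measure_congr ?_
      filter_upwards [ae_restrict_mem hSm.measurableSet] with c hc
      refine propext ?_
      change Q c ∈ (IsetOf R)ᶜ ↔ c ∈ (∅ : Set ℝ)
      simp [hQI c hc]
    rw [this, measure_empty]
  · rw [hval y hy]; exact ENNReal.ofReal_lt_top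
  · rw [dist, hval y hy, ENNReal.toReal_ofReal ((hF y hy).pos ⟨hy.1, le_rfl⟩)]

end

section
variable {a : Measure ℝ} {X x y y₁ y₂ : ℝ} {R : ℝ≥0∞} {f v : ℝ → ℝ} {f₀ : ℝ}

theorem dist_zero : dist a 0 = (a {0}).toReal := by simp [dist]

theorem str_dist (h : a (Icc 0 X) < ⊤) : Str (dist a) X where
  mono x hx y hy hxy := ENNReal.toReal_mono
    ((measure_mono (Icc_subset_Icc_right hy.2)).trans_lt h).ne
    (measure_mono (Icc_subset_Icc_right hxy))
  nonneg := ENNReal.toReal_nonneg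
  rc t ht := by
    have hfin : a (Icc 0 t) ≠ ⊤ := ((measure_mono (Icc_subset_Icc_right ht.2.le)).trans_lt h).ne
    refine (ENNReal.tendsto_toReal hfin).comp ?_
    have key : Tendsto (fun r => a (Icc 0 r)) (𝓝[>] t) (𝓝 (a (⋂ r > t, Icc 0 r))) :=
      tendsto_measure_biInter_gt (fun i _ => measurableSet_Icc.nullMeasurableSet)
        (fun i j _ hij => Icc_subset_Icc_right hij) ⟨X, ht.2, h.ne⟩
    have h2 : (⋂ r > t, Icc 0 r) = Icc 0 t := by
      ext s
      simp only [gt_iff_lt, mem_iInter, mem_Icc]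
      exact ⟨fun hs => ⟨(hs X ht.2).1, le_of_forall_gt_imp_ge_of_dense fun r hr => (hs r hr).2⟩,
        fun hs r hr => ⟨hs.1, hs.2.trans hr.le⟩⟩
    rw [h2] at key
    rw [← Ioi_insert, nhdsWithin_insert, tendsto_sup]
    exact ⟨tendsto_pure_nhds _ _, key⟩

theorem measure_Ioc (h : a (Icc 0 X) < ⊤) (h1 : 0 ≤ y₁) (h12 : y₁ ≤ y₂) (h2 : y₂ ≤ X) :
    a.real (Ioc y₁ y₂) = dist a y₂ - dist a y₁ := by
  have e : Icc 0 y₂ = Icc 0 y₁ ∪ Ioc y₁ y₂ := (Icc_union_Ioc_eq_Icc h1 h12).symm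
  have d : Disjoint (Icc 0 y₁) (Ioc y₁ y₂) := by
    rw [Set.disjoint_left]; exact fun s hs hs' => hs.2.not_gt hs'.1
  have f1 : a (Icc 0 y₁) ≠ ⊤ :=
    ((measure_mono (Icc_subset_Icc_right (h12.trans h2))).trans_lt h).ne
  have f2 : a (Ioc y₁ y₂) ≠ ⊤ :=
    ((measure_mono (show Ioc y₁ y₂ ⊆ Icc 0 X from fun s hs => ⟨h1.trans hs.1.le, hs.2.trans h2⟩)).trans_lt h).ne
  rw [dist, dist, e, measure_union d measurableSet_Ioc, ENNReal.toReal_add f1 f2, Measure.real]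
  ring

/-- Integration by parts against the mass distribution. -/
theorem int_parts (h : a (Icc 0 X) < ⊤) (hv : IntervalIntegrable v volume 0 X)
    (hf : ∀ t ∈ Icc 0 X, f t = f₀ + ∫ s in (0:ℝ)..t, v s)
    (h1 : 0 ≤ y₁) (h12 : y₁ ≤ y₂) (h2 : y₂ ≤ X) :
    ∫ y in Ioc y₁ y₂, f y ∂a =
      dist a y₂ * f y₂ - dist a y₁ * f y₁ - ∫ s in y₁..y₂, dist a s * v s := by
  have hS := str_dist h
  have hfin : a (Ioc y₁ y₂) < ⊤ :=
    (measure_mono (show Ioc y₁ y₂ ⊆ Icc 0 X from fun s hs => ⟨h1.trans hs.1.le, hs.2.trans h2⟩)).trans_lt h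
  have : IsFiniteMeasure (a.restrict (Ioc y₁ y₂)) := ⟨by simpa using hfin⟩
  have hv12 : IntervalIntegrable v volume y₁ y₂ := sub_int hv h1 h12 h2
  have hv' : Integrable v (volume.restrict (Ioc y₁ y₂)) := hv12.1
  have hX : 0 ≤ X := h1.trans (h12.trans h2)
  have hff : ∀ s ∈ Icc y₁ y₂, f y₂ - f s = ∫ r in s..y₂, v r := fun s hs => by
    have m1 : s ∈ Icc 0 X := ⟨h1.trans hs.1, hs.2.trans h2⟩
    have m2 : y₂ ∈ Icc 0 X := ⟨h1.trans h12, h2⟩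
    rw [hf y₂ m2, hf s m1, add_sub_add_left_eq_sub, intervalIntegral.integral_interval_sub_left
      (sub_int hv le_rfl m2.1 m2.2) (sub_int hv le_rfl m1.1 m1.2)]
  set k : ℝ → ℝ → ℝ := fun y s => (Ici y).indicator v s with hk
  have hkint : Integrable (Function.uncurry k)
      ((a.restrict (Ioc y₁ y₂)).prod (volume.restrict (Ioc y₁ y₂))) := by
    have e : Function.uncurry k = {p : ℝ × ℝ | p.1 ≤ p.2}.indicator (fun p => v p.2) := by
      ext ⟨y, s⟩; simp [k, indicator, Function.uncurry]
    rw [e]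
    exact (hv'.comp_snd _).indicator (measurableSet_le measurable_fst measurable_snd)
  have e1 : ∫ y in Ioc y₁ y₂, f y ∂a = ∫ y in Ioc y₁ y₂, (f y₂ - ∫ s in Ioc y₁ y₂, k y s) ∂a := by
    refine setIntegral_congr_fun measurableSet_Ioc fun y hy => ?_
    have := hff y ⟨hy.1.le, hy.2⟩
    have e : ∫ s in Ioc y₁ y₂, k y s = ∫ r in y..y₂, v r := by
      rw [intervalIntegral.integral_of_le hy.2, ← integral_Icc_eq_integral_Ioc (x := y)]
      simp only [hk]
      rw [setIntegral_indicator measurableSet_Ici]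
      congr 2
      ext s; simp only [mem_inter_iff, mem_Ioc, mem_Ici, mem_Icc]
      exact ⟨fun h => ⟨h.2, h.1.2⟩, fun h => ⟨⟨hy.1.trans_le h.1, h.2⟩, h.1⟩⟩
    simp only [e, ← this]; ring
  have e2 : ∫ y in Ioc y₁ y₂, (∫ s in Ioc y₁ y₂, k y s) ∂a =
      ∫ s in Ioc y₁ y₂, (dist a s - dist a y₁) * v s := by
    rw [integral_integral_swap hkint]
    refine setIntegral_congr_fun measurableSet_Ioc fun s hs => ?_
    have e : ∀ y, k y s = (Iic s).indicator (fun _ => v s) y := fun y => by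
      simp [k, indicator]
    simp only [e]
    rw [setIntegral_indicator measurableSet_Iic, setIntegral_const, smul_eq_mul]
    congr 1
    rw [← measure_Ioc h h1 hs.1.le (hs.2.trans h2)]
    congr 1
    ext y; simp only [mem_inter_iff, mem_Ioc, mem_Iic]
    exact ⟨fun h => ⟨h.1.1, h.2⟩, fun h => ⟨⟨h.1, h.2.trans hs.2⟩, h.2⟩⟩
  have hDv : IntervalIntegrable (fun s => dist a s * v s) volume y₁ y₂ :=
    sub_int (hS.mul_intable hv ⟨hX, le_rfl⟩) h1 h12 h2
  have hki : Integrable (fun y => ∫ s in Ioc y₁ y₂, k y s) (a.restrict (Ioc y₁ y₂)) :=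
    hkint.integral_prod_left
  rw [e1, integral_sub (integrable_const _) hki, e2, setIntegral_const,
    measure_Ioc h h1 h12 h2, ← intervalIntegral.integral_of_le h12]
  simp only [sub_mul]
  rw [intervalIntegral.integral_sub hDv (hv12.const_mul _), intervalIntegral.integral_const_mul,
    ← hff y₁ ⟨le_rfl, h12⟩, smul_eq_mul]
  ring

end

section

variable {a : Measure ℝ} {X x y ξ ψ : ℝ} {R : ℝ≥0∞} {φ f v : ℝ → ℝ}

theorem LocallyFiniteOnHalf.str (ha : LocallyFiniteOnHalf R a) (hX : X ∈ IsetOf R) :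
    Str (dist a) X := str_dist (ha.2 X hX)

theorem integrableOn_mass (h : a (Icc 0 X) < ⊤) (hf : ContinuousOn f (Icc 0 X)) :
    IntegrableOn f (Icc 0 X) a := by
  obtain ⟨C, hC⟩ := isCompact_Icc.exists_bound_of_continuousOn hf
  have : IsFiniteMeasure (a.restrict (Icc 0 X)) := ⟨by simpa using h⟩
  exact Integrable.of_bound (hf.aestronglyMeasurable measurableSet_Icc) C
    (by filter_upwards [ae_restrict_mem measurableSet_Icc] with t ht using hC t ht)

theorem Weyl.isStringSolution (ha : LocallyFiniteOnHalf R a) (hR : 0 < R)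
    (w : Weyl R (dist a) ξ ψ φ v) :
    IsStringSolution R a ξ φ v ∧
      Tendsto v (𝓝[>] 0) (𝓝 (-ψ + ξ * dist a 0)) := by
  have hrc : ∀ y ∈ IsetOf R, ContinuousWithinAt v (Ici y) y := fun y hy => by
    obtain ⟨z, hz, hyz⟩ := iset_succ hy
    exact (w.sol z hz).v_rc (LocallyFiniteOnHalf.str ha hz) ⟨hy.1, hyz⟩
  refine ⟨⟨?_, fun y hy => ?_, fun y hy => ?_, fun y hy _ => hrc y hy, w.bdd, w.bdry,
    fun y hy => ?_, fun y₁ y₂ h1 h12 hy => ?_⟩, ?_⟩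
  · exact (w.sol 0 (zero_mem_iset hR)).f_zero le_rfl
  · exact (intervalIntegrable_iff_integrableOn_Icc_of_le hy.1).1 (w.sol y hy).int
  · exact (w.sol y hy).f_eq y ⟨hy.1, le_rfl⟩
  · exact integrableOn_mass (ha.2 y hy) ((w.sol y hy).f_cont hy.1)
  · have S := w.sol y₂ hy
    have hS := LocallyFiniteOnHalf.str ha hy
    rw [int_parts (ha.2 y₂ hy) S.int S.f_eq h1.le h12 le_rfl, S.v_eq y₂ ⟨h1.le.trans h12, le_rfl⟩,
      S.v_eq y₁ ⟨h1.le, h12⟩]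
    have i2 := hS.mul_intable S.int ⟨h1.le.trans h12, le_rfl⟩
    have i1 := hS.mul_intable S.int ⟨h1.le, h12⟩
    have := intervalIntegral.integral_interval_sub_left i2 i1
    simp only [RCLike.ofReal_real_eq_id, id] at this ⊢
    rw [← this]; ring
  · have h0 := zero_mem_iset hR
    have h1 := (hrc 0 h0).mono_left (nhdsWithin_mono _ Ioi_subset_Ici_self)
    rw [(w.sol 0 h0).v_zero le_rfl] at h1
    simpa using h1

theorem exists_krein {ψ : ℝ → ℝ} (hψ : IsCompleteBernstein ψ) :
    ∃ (R : ℝ≥0∞) (a : Measure ℝ),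
      0 < R ∧ LocallyFiniteOnHalf R a ∧
      (∀ ξ : ℝ, 0 < ξ →
        ∃ (φ v : ℝ → ℝ) (L : ℝ),
          IsStringSolution R a ξ φ v ∧
          Filter.Tendsto v (nhdsWithin 0 (Set.Ioi 0)) (nhds L) ∧
          ψ ξ = -L + (a ({0} : Set ℝ)).toReal * ξ) := by
  obtain ⟨R, G, hR, hG, hr⟩ := exists_string hψ
  obtain ⟨a, ha, hd⟩ := exists_measure hR hG
  refine ⟨R, a, hR, ha, fun ξ hξ => ?_⟩
  obtain ⟨φ, v, w⟩ := hr ξ hξ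
  have w' : Weyl R (dist a) ξ (ψ ξ) φ v :=
    { sol := fun X hX =>
        { int := (w.sol X hX).int
          f_eq := (w.sol X hX).f_eq
          v_eq := fun t ht => by
            rw [(w.sol X hX).v_eq t ht, hd t (iset_down hX ht.1 ht.2)]
            congr 3
            refine intervalIntegral.integral_congr fun s hs => ?_
            rw [uIcc_of_le ht.1] at hs
            rw [hd s (iset_down hX hs.1 (hs.2.trans ht.2))] }
      bdd := w.bdd
      bdry := w.bdry }
  obtain ⟨h1, h2⟩ := w'.isStringSolution ha hR
  exact ⟨φ, v, _, h1, h2, by rw [dist_zero]; ring⟩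

theorem weyl_of_isStringSolution {L : ℝ} (ha : LocallyFiniteOnHalf R a) (hR : 0 < R)
    (h : IsStringSolution R a ξ φ v) (hL : Tendsto v (𝓝[>] 0) (𝓝 L))
    (hψ : ψ = -L + (a {0}).toReal * ξ) :
    Weyl R (dist a) ξ ψ φ (Function.update v 0 L) := by
  have hae : ∀ᵐ t : ℝ, Function.update v 0 L t = v t := by
    filter_upwards [compl_mem_ae_iff.2 (measure_singleton (0:ℝ))] with t ht
    exact Function.update_of_ne ht _ _
  have hii : ∀ g : ℝ → ℝ, ∀ t, ∫ s in (0:ℝ)..t, g s * Function.update v 0 L s =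
      ∫ s in (0:ℝ)..t, g s * v s := fun g t => by
    refine intervalIntegral.integral_congr_ae ?_
    filter_upwards [hae] with s hs _
    rw [hs]
  have hint : ∀ X ∈ IsetOf R, IntervalIntegrable v volume 0 X := fun X hX =>
    (intervalIntegrable_iff_integrableOn_Icc_of_le hX.1).2 (h.deriv_integrable X hX)
  refine ⟨fun X hX => ⟨?_, fun t ht => ?_, fun t ht => ?_⟩, h.bounded, h.boundary⟩
  · refine (hint X hX).congr_ae ?_
    exact (ae_restrict_of_ae hae).mono fun _ => Eq.symm
  · rw [h.locAC t (iset_down hX ht.1 ht.2)]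
    have := hii (fun _ => 1) t
    simpa using this.symm
  · have hS := LocallyFiniteOnHalf.str ha hX
    have hfeq : ∀ s ∈ Icc 0 X, φ s = 1 + ∫ r in (0:ℝ)..s, v r :=
      fun s hs => h.locAC s (iset_down hX hs.1 hs.2)
    have hφc : ContinuousOn φ (Icc 0 X) :=
      (continuousOn_const.add (continuousOn_prim hX.1 (hint X hX))).congr hfeq
    simp only [RCLike.ofReal_real_eq_id, id]
    rw [hii]
    rcases ht.1.eq_or_lt with rfl | ht0
    · simp [h.init, hψ, dist_zero]; ring
    rw [Function.update_of_ne ht0.ne']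
    have hX0 : 0 < X := ht0.trans_le ht.2
    have e : ∀ r ∈ Ioc 0 t, v t - v r = ξ * (dist a t * φ t - dist a r * φ r -
        (∫ s in (0:ℝ)..t, dist a s * v s) + ∫ s in (0:ℝ)..r, dist a s * v s) := fun r hr => by
      rw [h.eqn r t hr.1 hr.2 (iset_down hX ht.1 ht.2),
        int_parts (ha.2 X hX) (hint X hX) hfeq hr.1.le hr.2 ht.2]
      have := intervalIntegral.integral_interval_sub_left
        (hS.mul_intable (hint X hX) ht) (hS.mul_intable (hint X hX) ⟨hr.1.le, hr.2.trans ht.2⟩)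
      simp only [RCLike.ofReal_real_eq_id, id] at this
      rw [← this]; ring
    have m0 : (0:ℝ) ∈ Ico 0 X := ⟨le_rfl, hX0⟩
    have t1 : Tendsto (fun r => dist a r * φ r) (𝓝[>] 0) (𝓝 (dist a 0 * φ 0)) :=
      ((hS.rc 0 m0).mul (ici_of_icc hφc m0)).mono_left (nhdsWithin_mono _ Ioi_subset_Ici_self)
    have t2 : Tendsto (fun r => ∫ s in (0:ℝ)..r, dist a s * v s) (𝓝[>] 0) (𝓝 0) := by
      have := ici_of_icc (continuousOn_prim hX.1 (hS.mul_intable (hint X hX) ⟨hX.1, le_rfl⟩)) m0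
      simpa using this.mono_left (nhdsWithin_mono _ Ioi_subset_Ici_self)
    have t3 := ((((tendsto_const_nhds (x := dist a t * φ t)).sub t1).sub
      (tendsto_const_nhds (x := ∫ s in (0:ℝ)..t, dist a s * v s))).add t2).const_mul ξ
    have t4 := (tendsto_const_nhds (x := v t)).sub hL
    have t5 := tendsto_nhds_unique_of_eventuallyEq t4 t3 (by
      filter_upwards [Ioc_mem_nhdsGT ht0] with r hr using e r hr)
    rw [h.init] at t5
    rw [hψ, ← dist_zero]
    linarith

end

theorem hasDerivAt_comp_max {f : ℝ → ℝ} {f' q : ℝ} (h : HasDerivAt f f' (max q 0))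
    (h0 : q ≤ 0 → f' = 0) : HasDerivAt (fun x => f (max x 0)) f' q := by
  rcases lt_trichotomy q 0 with hq | hq | hq
  · rw [h0 hq.le]
    refine (hasDerivAt_const q (f 0)).congr_of_eventuallyEq ?_
    filter_upwards [Iio_mem_nhds hq] with x hx
    rw [max_eq_right hx.le]
  · have hf := h0 hq.le
    subst hq hf
    rw [max_self] at h
    rw [hasDerivAt_iff_isLittleO] at h ⊢
    have ht : Tendsto (fun x : ℝ => max x 0) (𝓝 0) (𝓝 0) := by
      have : Continuous (fun x : ℝ => max x 0) := by fun_prop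
      simpa using this.tendsto 0
    have := h.comp_tendsto ht
    simp only [Function.comp_def, smul_zero, sub_zero, max_self] at this ⊢
    refine this.trans_isBigO (Asymptotics.IsBigO.of_bound 1 ?_)
    filter_upwards with x
    rw [one_mul, Real.norm_eq_abs, Real.norm_eq_abs, abs_of_nonneg (le_max_right _ _)]
    exact max_le (le_abs_self _) (abs_nonneg _)
  · rw [max_eq_left hq.le] at h
    refine h.congr_of_eventuallyEq ?_
    filter_upwards [Ioi_mem_nhds hq] with x hx
    rw [max_eq_left (le_of_lt hx)]

/-- A `C²` truncation of the logarithm. -/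
def tl (p : ℝ) : ℝ := Real.log (1 + max (p - 1) 0) - max (p - 1) 0 / (1 + max (p - 1) 0) -
  (max (p - 1) 0) ^ 2 / (2 * (1 + max (p - 1) 0) ^ 2)

def tl₁ (p : ℝ) : ℝ := (max (p - 1) 0) ^ 2 / (1 + max (p - 1) 0) ^ 3

def tl₂ (p : ℝ) : ℝ := (2 * max (p - 1) 0 - (max (p - 1) 0) ^ 2) / (1 + max (p - 1) 0) ^ 4

theorem tl_aux {z : ℝ} (hz : 0 ≤ z) :
    HasDerivAt (fun z : ℝ => Real.log (1 + z) - z / (1 + z) - z ^ 2 / (2 * (1 + z) ^ 2))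
      (z ^ 2 / (1 + z) ^ 3) z := by
  have h1 : 1 + z ≠ 0 := by positivity
  have ha : HasDerivAt (fun z : ℝ => 1 + z) 1 z := (hasDerivAt_id z).const_add 1
  have hb := (((ha.log h1).sub ((hasDerivAt_id z).div ha h1)).sub
    (((hasDerivAt_id z).pow 2).div ((ha.pow 2).const_mul 2)
      (mul_ne_zero two_ne_zero (pow_ne_zero 2 h1))))
  refine hb.congr_deriv ?_
  simp only [id_eq, Pi.pow_apply]
  field_simp
  ring

theorem tl₁_aux {z : ℝ} (hz : 0 ≤ z) :
    HasDerivAt (fun z : ℝ => z ^ 2 / (1 + z) ^ 3) ((2 * z - z ^ 2) / (1 + z) ^ 4) z := by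
  have h1 : 1 + z ≠ 0 := by positivity
  have ha : HasDerivAt (fun z : ℝ => 1 + z) 1 z := (hasDerivAt_id z).const_add 1
  refine (((hasDerivAt_id z).pow 2).div (ha.pow 3) (pow_ne_zero 3 h1)).congr_deriv ?_
  simp only [id_eq, Pi.pow_apply]
  field_simp
  ring

theorem tl_deriv (p : ℝ) : HasDerivAt tl (tl₁ p) p := by
  have h := hasDerivAt_comp_max (q := p - 1) (tl_aux (le_max_right _ _)) (fun h => by
    rw [max_eq_right h]; simp)
  exact (h.comp_sub_const p 1 : _)

theorem tl₁_deriv (p : ℝ) : HasDerivAt tl₁ (tl₂ p) p := by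
  have h := hasDerivAt_comp_max (q := p - 1) (tl₁_aux (le_max_right _ _)) (fun h => by
    rw [max_eq_right h]; simp)
  exact (h.comp_sub_const p 1 : _)

theorem tl₂_cont : Continuous tl₂ := by
  unfold tl₂
  refine Continuous.div (by fun_prop) (by fun_prop) fun p => ?_
  have := le_max_right (p - 1) 0
  positivity

theorem tl_cont : Continuous tl := continuous_iff_continuousAt.2 fun p => (tl_deriv p).continuousAt
theorem tl₁_cont : Continuous tl₁ :=
  continuous_iff_continuousAt.2 fun p => (tl₁_deriv p).continuousAt

theorem tl_zero {p : ℝ} (h : p ≤ 1) : tl p = 0 := by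
  have : max (p - 1) 0 = 0 := max_eq_right (by linarith)
  simp [tl, this]

theorem tl_pos {p : ℝ} (h : 1 < p) : 0 < tl p := by
  have hm : StrictMonoOn (fun z : ℝ => Real.log (1 + z) - z / (1 + z) - z ^ 2 / (2 * (1 + z) ^ 2))
      (Ici 0) := by
    refine strictMonoOn_of_deriv_pos (convex_Ici 0)
      (fun z hz => (tl_aux hz).continuousAt.continuousWithinAt) fun z hz => ?_
    rw [interior_Ici] at hz
    have hz' : 0 < z := hz
    rw [(tl_aux hz'.le).deriv]
    positivity
  have h2 : max (p - 1) 0 = p - 1 := max_eq_left (by linarith)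
  have := hm (show (0:ℝ) ∈ Ici 0 by simp) (show p - 1 ∈ Ici 0 by simp; linarith) (show (0:ℝ) < p - 1 by linarith)
  simpa [tl, h2] using this

theorem tl_nonneg (p : ℝ) : 0 ≤ tl p := by
  rcases le_or_gt p 1 with h | h
  · exact (tl_zero h).ge
  · exact (tl_pos h).le

theorem tl_le {p : ℝ} (h : 1 ≤ p) : tl p ≤ Real.log p := by
  have h2 : max (p - 1) 0 = p - 1 := max_eq_left (by linarith)
  have h3 : 0 ≤ (p - 1) / p := div_nonneg (by linarith) (by linarith)
  have h4 : 0 ≤ (p - 1) ^ 2 / (2 * p ^ 2) := by positivity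
  simp only [tl, h2, add_sub_cancel]
  linarith

theorem tl_sub (p : ℝ) : 0 ≤ tl p * (p * tl₂ p + tl₁ p) := by
  rcases le_or_gt p 1 with h | h
  · simp [tl_zero h]
  · refine mul_nonneg (tl_nonneg p) ?_
    have h2 : max (p - 1) 0 = p - 1 := max_eq_left (by linarith)
    have h3 : p ≠ 0 := by linarith
    simp only [tl₁, tl₂, h2, add_sub_cancel]
    have : p * ((2 * (p - 1) - (p - 1) ^ 2) / p ^ 4) + (p - 1) ^ 2 / p ^ 3 =
        2 * (p - 1) / p ^ 3 := by field_simp; ring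
    rw [this]
    have : 0 < p - 1 := by linarith
    positivity

/-- Weighted Wirtinger inequality. -/
theorem wirtinger {f f' k : ℝ → ℝ} {α β c : ℝ} (hαβ : α ≤ β)
    (hf : ∀ x, HasDerivAt f (f' x) x) (hf' : Continuous f') (hk : Continuous k)
    (hk0 : ∀ x, 0 ≤ k x) (hk1 : ∀ x, f x ≠ 0 → k x = 1) (hα : f α = 0) (hβ : f β = 0)
    (hc : 0 ≤ c) (hl : c * ∫ x in α..β, k x ≤ 9 / 10 * Real.pi) :
    c ^ 2 * ∫ x in α..β, f x ^ 2 ≤ ∫ x in α..β, f' x ^ 2 := by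
  have hfc : Continuous f := continuous_iff_continuousAt.2 fun x => (hf x).continuousAt
  set κ : ℝ → ℝ := fun x => c * (∫ y in α..x, k y) + Real.pi / 20
  have hκ : ∀ x, HasDerivAt κ (c * k x) x := fun x =>
    ((intervalIntegral.integral_hasDerivAt_right (hk.intervalIntegrable _ _)
      (hk.stronglyMeasurableAtFilter _ _) hk.continuousAt).const_mul c).add_const _
  have hsin : ∀ x ∈ Icc α β, 0 < Real.sin (κ x) := by
    intro x hx
    have h0 : 0 ≤ ∫ y in α..x, k y := intervalIntegral.integral_nonneg hx.1 fun y _ => hk0 y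
    have h1 : ∫ y in α..x, k y ≤ ∫ y in α..β, k y := by
      rw [← intervalIntegral.integral_add_adjacent_intervals (hk.intervalIntegrable α x)
        (hk.intervalIntegrable x β)]
      have := intervalIntegral.integral_nonneg (μ := volume) hx.2 fun y _ => hk0 y
      linarith
    have h2 := mul_le_mul_of_nonneg_left h1 hc
    have h3 := mul_nonneg hc h0
    apply Real.sin_pos_of_pos_of_lt_pi
    · have := Real.pi_pos
      simp only [κ]; linarith
    · have := Real.pi_pos
      simp only [κ]; linarith
  set G : ℝ → ℝ := fun x => f x ^ 2 * (c * (Real.cos (κ x) / Real.sin (κ x)))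
  set G' : ℝ → ℝ := fun x => 2 * f x * f' x * (c * (Real.cos (κ x) / Real.sin (κ x)))
    - f x ^ 2 * (c ^ 2 + (c * (Real.cos (κ x) / Real.sin (κ x))) ^ 2)
  have hG : ∀ x ∈ Icc α β, HasDerivAt G (G' x) x := by
    intro x hx
    have hs := (hsin x hx).ne'
    refine (((hf x).pow 2).mul ((((hκ x).cos).div (hκ x).sin hs).const_mul c)).congr_deriv ?_
    simp only [G', Pi.pow_apply]
    have hk' : f x ^ 2 * k x = f x ^ 2 := by
      by_cases h : f x = 0
      · simp [h]
      · simp [hk1 x h]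
    have hsc := Real.sin_sq_add_cos_sq (κ x)
    have e1 : c * ((-Real.sin (κ x) * (c * k x) * Real.sin (κ x) -
        Real.cos (κ x) * (Real.cos (κ x) * (c * k x))) / Real.sin (κ x) ^ 2) =
        - k x * (c ^ 2 + (c * (Real.cos (κ x) / Real.sin (κ x))) ^ 2) := by
      field_simp
      ring
    rw [e1]
    simp only [Nat.cast_ofNat, Nat.add_one_sub_one, pow_one, Pi.div_apply]
    linear_combination (-(c ^ 2 + (c * (Real.cos (κ x) / Real.sin (κ x))) ^ 2)) * hk'
  have hκc : Continuous κ := continuous_iff_continuousAt.2 fun x => (hκ x).continuousAt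
  have hq : ContinuousOn (fun x => Real.cos (κ x) / Real.sin (κ x)) (Icc α β) :=
    ContinuousOn.div (by fun_prop) (by fun_prop) fun x hx => (hsin x hx).ne'
  have hG'c : ContinuousOn G' (Icc α β) := by
    simp only [G']
    fun_prop
  have hint : ∫ x in α..β, G' x = 0 := by
    rw [intervalIntegral.integral_eq_sub_of_hasDerivAt (f := G)]
    · simp [G, hα, hβ]
    · rw [uIcc_of_le hαβ]; exact hG
    · exact hG'c.intervalIntegrable_of_Icc hαβ
  have : ∫ x in α..β, (G' x + c ^ 2 * f x ^ 2) ≤ ∫ x in α..β, f' x ^ 2 := by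
    refine intervalIntegral.integral_mono_on hαβ ?_ ?_ fun x _ => ?_
    · exact (hG'c.intervalIntegrable_of_Icc hαβ).add ((by fun_prop : Continuous fun x =>
        c ^ 2 * f x ^ 2).intervalIntegrable _ _)
    · exact (hf'.pow 2).intervalIntegrable _ _
    · simp only [G']
      nlinarith [sq_nonneg (f' x - f x * (c * (Real.cos (κ x) / Real.sin (κ x))))]
  rw [intervalIntegral.integral_add (hG'c.intervalIntegrable_of_Icc hαβ)
    ((by fun_prop : Continuous fun x => c ^ 2 * f x ^ 2).intervalIntegrable _ _), hint,
    intervalIntegral.integral_const_mul, zero_add] at this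
  exact this

section

theorem hasDerivAt_param {f f' : ℝ → ℝ → ℝ} (hf : Continuous f.uncurry)
    (hf' : Continuous f'.uncurry) (h : ∀ t θ, HasDerivAt (fun t => f t θ) (f' t θ) t)
    (a b t : ℝ) :
    HasDerivAt (fun t => ∫ θ in a..b, f t θ) (∫ θ in a..b, f' t θ) t := by
  obtain ⟨C, hC⟩ := (isCompact_Icc.prod isCompact_uIcc).exists_bound_of_continuousOn
    (s := Icc (t - 1) (t + 1) ×ˢ uIcc a b) hf'.continuousOn
  have hc : ∀ t, Continuous (f t) := fun t => hf.comp (by fun_prop : Continuous fun θ => (t, θ))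
  have hc' : ∀ t, Continuous (f' t) := fun t => hf'.comp (by fun_prop : Continuous fun θ => (t, θ))
  refine (intervalIntegral.hasDerivAt_integral_of_dominated_loc_of_deriv_le (bound := fun _ => C)
    (s := Icc (t - 1) (t + 1)) (Icc_mem_nhds (by linarith) (by linarith))
    (Eventually.of_forall fun t => (hc t).aestronglyMeasurable) ((hc t).intervalIntegrable _ _)
    (hc' t).aestronglyMeasurable ?_ intervalIntegrable_const ?_).2
  · exact Eventually.of_forall fun θ hθ x hx => hC (x, θ) ⟨hx, uIoc_subset_uIcc hθ⟩
  · exact Eventually.of_forall fun θ _ x _ => h x θ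

variable {H : ℂ → ℂ}

attribute [local fun_prop] Complex.continuous_re Complex.continuous_im

def pt (t θ : ℝ) : ℂ := t + θ * Complex.I

theorem hd_re (hH : Differentiable ℂ H) (t θ : ℝ) :
    HasDerivAt (fun t => (H (pt t θ)).re) (deriv H (pt t θ)).re t ∧
    HasDerivAt (fun t => (H (pt t θ)).im) (deriv H (pt t θ)).im t ∧
    HasDerivAt (fun θ => (H (pt t θ)).re) (-(deriv H (pt t θ)).im) θ ∧
    HasDerivAt (fun θ => (H (pt t θ)).im) (deriv H (pt t θ)).re θ := by
  have h0 := (hH (pt t θ)).hasDerivAt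
  have h1 : HasDerivAt (fun t : ℝ => pt t θ) 1 t :=
    ((hasDerivAt_id t).ofReal_comp).add_const _
  have h2 : HasDerivAt (fun θ : ℝ => pt t θ) Complex.I θ := by
    have := (((hasDerivAt_id θ).ofReal_comp).mul_const Complex.I).const_add (t : ℂ)
    rw [Complex.ofReal_one, one_mul] at this
    exact this
  have h3 : HasDerivAt (fun t : ℝ => H (pt t θ)) (deriv H (pt t θ)) t := by
    have := HasDerivAt.comp t h0 h1
    rwa [mul_one] at this
  have h4 : HasDerivAt (fun θ : ℝ => H (pt t θ)) (deriv H (pt t θ) * Complex.I) θ :=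
    HasDerivAt.comp θ h0 h2
  refine ⟨?_, ?_, ?_, ?_⟩
  · exact (Complex.reCLM.hasFDerivAt.comp_hasDerivAt t h3)
  · exact (Complex.imCLM.hasFDerivAt.comp_hasDerivAt t h3)
  · refine (Complex.reCLM.hasFDerivAt.comp_hasDerivAt θ h4).congr_deriv ?_
    simp
  · refine (Complex.imCLM.hasFDerivAt.comp_hasDerivAt θ h4).congr_deriv ?_
    simp

/-- `‖H‖²` and its first partial derivatives. -/
def np (H : ℂ → ℂ) (t θ : ℝ) : ℝ := (H (pt t θ)).re ^ 2 + (H (pt t θ)).im ^ 2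
def np_t (H : ℂ → ℂ) (t θ : ℝ) : ℝ := 2 * ((H (pt t θ)).re * (deriv H (pt t θ)).re +
  (H (pt t θ)).im * (deriv H (pt t θ)).im)
def np_θ (H : ℂ → ℂ) (t θ : ℝ) : ℝ := 2 * ((H (pt t θ)).im * (deriv H (pt t θ)).re -
  (H (pt t θ)).re * (deriv H (pt t θ)).im)
def np_a (H : ℂ → ℂ) (t θ : ℝ) : ℝ := 2 * np (deriv H) t θ
def np_b (H : ℂ → ℂ) (t θ : ℝ) : ℝ := 2 * ((H (pt t θ)).re * (deriv (deriv H) (pt t θ)).re +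
  (H (pt t θ)).im * (deriv (deriv H) (pt t θ)).im)

def lu (H : ℂ → ℂ) (t θ : ℝ) : ℝ := tl (np H t θ)
def lu_θ (H : ℂ → ℂ) (t θ : ℝ) : ℝ := tl₁ (np H t θ) * np_θ H t θ
def lu_t (H : ℂ → ℂ) (t θ : ℝ) : ℝ := tl₁ (np H t θ) * np_t H t θ
def lm (H : ℂ → ℂ) (t : ℝ) : ℝ := ∫ θ in (-Real.pi)..Real.pi, lu H t θ ^ 2

theorem np_nonneg (t θ : ℝ) : 0 ≤ np H t θ := by unfold np; positivity

theorem pt_cont : Continuous (Function.uncurry pt) := by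
  unfold pt Function.uncurry
  fun_prop

attribute [local fun_prop] pt_cont

theorem np_eq (t θ : ℝ) : np H t θ = ‖H (pt t θ)‖ ^ 2 := by
  rw [Complex.sq_norm, Complex.normSq_apply, np]; ring

theorem lu_cont (hH : Differentiable ℂ H) : Continuous (lu H).uncurry := by
  have h0 := hH.continuous
  have : Continuous fun q : ℝ × ℝ => np H q.1 q.2 := by unfold np; fun_prop
  exact tl_cont.comp this

theorem lu_hd (hH : Differentiable ℂ H) (t θ : ℝ) :
    HasDerivAt (fun θ => lu H t θ) (lu_θ H t θ) θ := by
  obtain ⟨-, -, h3, h4⟩ := hd_re hH t θ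
  have : HasDerivAt (fun θ => np H t θ) (np_θ H t θ) θ := by
    refine ((h3.pow 2).add (h4.pow 2)).congr_deriv ?_
    simp [np_θ]; ring
  exact (tl_deriv _).comp θ this

theorem lu_θ_cont (hH : Differentiable ℂ H) (t : ℝ) : Continuous (lu_θ H t) := by
  have h0 := hH.continuous
  have h1 := hH.deriv.continuous
  have : Continuous fun θ => np H t θ := by unfold np; fun_prop
  have := tl₁_cont.comp this
  unfold lu_θ np_θ
  simp only [Function.comp_def] at this
  fun_prop

theorem carleman (hH : Differentiable ℂ H) (hp : ∀ w, H (w + 2 * Real.pi * Complex.I) = H w) :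
    ∃ m₁ m₂ : ℝ → ℝ, ∀ t, HasDerivAt (lm H) (m₁ t) t ∧ HasDerivAt m₁ (m₂ t) t ∧
      0 ≤ ∫ θ in (-Real.pi)..Real.pi, lu_t H t θ ^ 2 ∧
      m₁ t ^ 2 ≤ 4 * lm H t * (∫ θ in (-Real.pi)..Real.pi, lu_t H t θ ^ 2) ∧
      2 * (∫ θ in (-Real.pi)..Real.pi, lu_t H t θ ^ 2) +
        2 * (∫ θ in (-Real.pi)..Real.pi, lu_θ H t θ ^ 2) ≤ m₂ t := by
  have hH1 : Differentiable ℂ (deriv H) := hH.deriv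
  have hH2 : Differentiable ℂ (deriv (deriv H)) := hH1.deriv
  have c0 := hH.continuous
  have c1 := hH1.continuous
  have c2 := hH2.continuous
  have cp : Continuous fun q : ℝ × ℝ => np H q.1 q.2 := by unfold np; fun_prop
  have cpt : Continuous fun q : ℝ × ℝ => np_t H q.1 q.2 := by unfold np_t; fun_prop
  have cpθ : Continuous fun q : ℝ × ℝ => np_θ H q.1 q.2 := by unfold np_θ; fun_prop
  have cpa : Continuous fun q : ℝ × ℝ => np_a H q.1 q.2 := by unfold np_a np; fun_prop
  have cpb : Continuous fun q : ℝ × ℝ => np_b H q.1 q.2 := by unfold np_b; fun_prop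
  have t0 := tl_cont.comp cp
  have t1 := tl₁_cont.comp cp
  have t2 := tl₂_cont.comp cp
  simp only [Function.comp_def] at t0 t1 t2
  have dpt : ∀ t θ, HasDerivAt (fun t => np H t θ) (np_t H t θ) t := fun t θ => by
    obtain ⟨h1, h2, -, -⟩ := hd_re hH t θ
    refine ((h1.pow 2).add (h2.pow 2)).congr_deriv ?_
    simp [np_t]; ring
  have dpθ : ∀ t θ, HasDerivAt (fun θ => np H t θ) (np_θ H t θ) θ := fun t θ => by
    obtain ⟨-, -, h3, h4⟩ := hd_re hH t θ
    refine ((h3.pow 2).add (h4.pow 2)).congr_deriv ?_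
    simp [np_θ]; ring
  have dptt : ∀ t θ, HasDerivAt (fun t => np_t H t θ) (np_a H t θ + np_b H t θ) t := fun t θ => by
    obtain ⟨h1, h2, -, -⟩ := hd_re hH t θ
    obtain ⟨g1, g2, -, -⟩ := hd_re hH1 t θ
    refine (((h1.mul g1).add (h2.mul g2)).const_mul 2).congr_deriv ?_
    simp [np_a, np_b, np]; ring
  have dpθθ : ∀ t θ, HasDerivAt (fun θ => np_θ H t θ) (np_a H t θ - np_b H t θ) θ := fun t θ => by
    obtain ⟨-, -, h1, h2⟩ := hd_re hH t θ
    obtain ⟨-, -, g1, g2⟩ := hd_re hH1 t θ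
    refine (((h2.mul g1).sub (h1.mul g2)).const_mul 2).congr_deriv ?_
    simp [np_a, np_b, np]; ring
  set W : ℝ → ℝ → ℝ := fun t θ => lu H t θ ^ 2 with hW
  set W1 : ℝ → ℝ → ℝ := fun t θ => 2 * (lu H t θ * lu_t H t θ) with hW1
  set W2 : ℝ → ℝ → ℝ := fun t θ => 2 * ((tl₁ (np H t θ) ^ 2 + tl (np H t θ) * tl₂ (np H t θ)) *
    np_t H t θ ^ 2 + tl (np H t θ) * tl₁ (np H t θ) * (np_a H t θ + np_b H t θ)) with hW2
  set V1 : ℝ → ℝ → ℝ := fun t θ => 2 * (lu H t θ * lu_θ H t θ) with hV1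
  set V2 : ℝ → ℝ → ℝ := fun t θ => 2 * ((tl₁ (np H t θ) ^ 2 + tl (np H t θ) * tl₂ (np H t θ)) *
    np_θ H t θ ^ 2 + tl (np H t θ) * tl₁ (np H t θ) * (np_a H t θ - np_b H t θ)) with hV2
  have cW : Continuous W.uncurry := by
    simp only [hW, Function.uncurry_def, lu]; fun_prop
  have cW1 : Continuous W1.uncurry := by
    simp only [hW1, Function.uncurry_def, lu, lu_t]; fun_prop
  have cW2 : Continuous W2.uncurry := by
    simp only [hW2, Function.uncurry_def]; fun_prop
  have cV2 : Continuous V2.uncurry := by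
    simp only [hV2, Function.uncurry_def]; fun_prop
  have ct : Continuous (lu_t H).uncurry := by
    simp only [Function.uncurry_def]; unfold lu_t; fun_prop
  have cθ : Continuous (lu_θ H).uncurry := by
    simp only [Function.uncurry_def]; unfold lu_θ; fun_prop
  have sl : ∀ {f : ℝ → ℝ → ℝ}, Continuous f.uncurry → ∀ t, Continuous (f t) := fun hf t =>
    hf.comp (by fun_prop : Continuous fun θ => (t, θ))
  have dW : ∀ t θ, HasDerivAt (fun t => W t θ) (W1 t θ) t := fun t θ => by
    refine (((tl_deriv _).comp t (dpt t θ)).pow 2).congr_deriv ?_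
    simp [hW1, lu, lu_t]; ring
  have dW1 : ∀ t θ, HasDerivAt (fun t => W1 t θ) (W2 t θ) t := fun t θ => by
    refine ((((tl_deriv _).comp t (dpt t θ)).mul
      (((tl₁_deriv _).comp t (dpt t θ)).mul (dptt t θ))).const_mul 2).congr_deriv ?_
    simp [hW2]; ring
  have dV1 : ∀ t θ, HasDerivAt (fun θ => V1 t θ) (V2 t θ) θ := fun t θ => by
    refine ((((tl_deriv _).comp θ (dpθ t θ)).mul
      (((tl₁_deriv _).comp θ (dpθ t θ)).mul (dpθθ t θ))).const_mul 2).congr_deriv ?_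
    simp [hV2]; ring
  have hper : ∀ t, pt t Real.pi = pt t (-Real.pi) + 2 * Real.pi * Complex.I := fun t => by
    simp [pt]; ring
  have hp' : ∀ w, deriv H (w + 2 * Real.pi * Complex.I) = deriv H w := fun w => by
    have : (fun w => H (w + 2 * Real.pi * Complex.I)) = H := funext hp
    rw [← deriv_comp_add_const, this]
  have iV2 : ∀ t, ∫ θ in (-Real.pi)..Real.pi, V2 t θ = 0 := fun t => by
    rw [intervalIntegral.integral_eq_sub_of_hasDerivAt (fun θ _ => dV1 t θ)
      ((sl cV2 t).intervalIntegrable _ _)]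
    simp only [hV1, lu, lu_θ, np, np_θ, hper, hp, hp', sub_self]
  refine ⟨fun t => ∫ θ in (-Real.pi)..Real.pi, W1 t θ, fun t => ∫ θ in (-Real.pi)..Real.pi, W2 t θ,
    fun t => ⟨hasDerivAt_param cW cW1 dW _ _ t, hasDerivAt_param cW1 cW2 dW1 _ _ t, ?_, ?_, ?_⟩⟩
  · exact intervalIntegral.integral_nonneg (by linarith [Real.pi_pos]) fun _ _ => sq_nonneg _
  · have hq : ∀ r : ℝ, 0 ≤ lm H t * (r * r) + (∫ θ in (-Real.pi)..Real.pi, W1 t θ) * r +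
        ∫ θ in (-Real.pi)..Real.pi, lu_t H t θ ^ 2 := fun r => by
      have : 0 ≤ ∫ θ in (-Real.pi)..Real.pi, (r * lu H t θ + lu_t H t θ) ^ 2 :=
        intervalIntegral.integral_nonneg (by linarith [Real.pi_pos]) fun _ _ => sq_nonneg _
      have cu := sl (lu_cont hH) t
      have cut := sl ct t
      have cw := sl cW1 t
      have e : (fun θ => (r * lu H t θ + lu_t H t θ) ^ 2) =
          fun θ => (r * r) * lu H t θ ^ 2 + r * W1 t θ + lu_t H t θ ^ 2 := by
        ext θ; simp only [hW1]; ring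
      rw [e, intervalIntegral.integral_add, intervalIntegral.integral_add,
        intervalIntegral.integral_const_mul, intervalIntegral.integral_const_mul] at this
      · simp only [lm]; linarith
      all_goals exact Continuous.intervalIntegrable (by fun_prop) _ _
    have := discrim_le_zero hq
    unfold discrim at this
    linarith
  · have : (∫ θ in (-Real.pi)..Real.pi, (2 * lu_t H t θ ^ 2 + 2 * lu_θ H t θ ^ 2)) ≤
        ∫ θ in (-Real.pi)..Real.pi, (W2 t θ + V2 t θ) := by
      have cu := sl ct t
      have cut := sl cθ t
      have cw := sl cW2 t
      have cw' := sl cV2 t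
      refine intervalIntegral.integral_mono_on (by linarith [Real.pi_pos])
        (Continuous.intervalIntegrable (by fun_prop) _ _)
        (Continuous.intervalIntegrable (by fun_prop) _ _) fun θ _ => ?_
      have hk := tl_sub (np H t θ)
      have hpp : np_t H t θ ^ 2 + np_θ H t θ ^ 2 = 2 * np H t θ * np_a H t θ := by
        simp only [np_t, np_θ, np, np_a]; ring
      have ha : 0 ≤ np_a H t θ := by
        unfold np_a; linarith [np_nonneg (H := deriv H) t θ]
      have := mul_nonneg hk ha
      simp only [hW2, hV2, lu_t, lu_θ]
      have e := congrArg (fun z => 2 * tl (np H t θ) * tl₂ (np H t θ) * z) hpp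
      nlinarith
    have cu := sl ct t
    have cut := sl cθ t
    have cw := sl cW2 t
    have cw' := sl cV2 t
    rw [intervalIntegral.integral_add, intervalIntegral.integral_add, iV2,
      intervalIntegral.integral_const_mul, intervalIntegral.integral_const_mul, add_zero] at this
    · exact this
    all_goals exact Continuous.intervalIntegrable (by fun_prop) _ _

end

theorem riccati_false {m m₁ m₂ n n₁ n₂ : ℝ → ℝ} {t₀ K : ℝ}
    (hm : ∀ t, HasDerivAt m (m₁ t) t) (hm₁ : ∀ t, HasDerivAt m₁ (m₂ t) t)
    (hn : ∀ t, HasDerivAt n (n₁ t) t) (hn₁ : ∀ t, HasDerivAt n₁ (n₂ t) t)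
    (mpos : ∀ t, t₀ ≤ t → 0 < m t) (npos : ∀ t, t₀ ≤ t → 0 < n t)
    (m₁pos : ∀ t, t₀ ≤ t → 0 ≤ m₁ t) (n₁pos : ∀ t, t₀ ≤ t → 0 ≤ n₁ t)
    (hab : ∀ t, t₀ ≤ t → ∃ α β : ℝ, 121 / 100 ≤ α + β ∧
      m₁ t ^ 2 / 2 + 2 * α * m t ^ 2 ≤ m t * m₂ t ∧ n₁ t ^ 2 / 2 + 2 * β * n t ^ 2 ≤ n t * n₂ t)
    (hmK : ∀ t, t₀ ≤ t → m t ≤ K * Real.exp t) (hnK : ∀ t, t₀ ≤ t → n t ≤ K * Real.exp t) :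
    False := by
  set w : ℝ → ℝ := fun t => Real.sqrt (m t * n t) with hw
  set Y : ℝ → ℝ := fun t => (m₁ t / m t + n₁ t / n t) / 2 with hY
  set Y' : ℝ → ℝ := fun t => ((m₂ t * m t - m₁ t * m₁ t) / m t ^ 2 +
    (n₂ t * n t - n₁ t * n₁ t) / n t ^ 2) / 2 with hY'
  have wpos : ∀ t, t₀ ≤ t → 0 < w t := fun t ht => Real.sqrt_pos.2 (mul_pos (mpos t ht) (npos t ht))
  have Ypos : ∀ t, t₀ ≤ t → 0 ≤ Y t := fun t ht => by
    have := div_nonneg (m₁pos t ht) (mpos t ht).le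
    have := div_nonneg (n₁pos t ht) (npos t ht).le
    simp only [hY]; linarith
  have dw : ∀ t, t₀ ≤ t → HasDerivAt w (Y t * w t) t := fun t ht => by
    have h1 := mpos t ht
    have h2 := npos t ht
    have hs : w t ^ 2 = m t * n t := Real.sq_sqrt (mul_pos h1 h2).le
    have h3 := wpos t ht
    refine (((hm t).mul (hn t)).sqrt (mul_pos h1 h2).ne').congr_deriv ?_
    change _ / (2 * w t) = _
    simp only [hY]
    rw [div_eq_iff (by positivity)]
    have : (m₁ t / m t + n₁ t / n t) / 2 * w t * (2 * w t) =
        (m₁ t / m t + n₁ t / n t) * w t ^ 2 := by ring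
    rw [this, hs]
    field_simp

  have dY : ∀ t, t₀ ≤ t → HasDerivAt Y (Y' t) t := fun t ht =>
    (((hm₁ t).div (hm t) (mpos t ht).ne').add ((hn₁ t).div (hn t) (npos t ht).ne')).div_const 2
  have hYY : ∀ t, t₀ ≤ t → 121 / 100 ≤ Y' t + Y t ^ 2 := fun t ht => by
    obtain ⟨α, β, h, h1, h2⟩ := hab t ht
    have hm0 := mpos t ht
    have hn0 := npos t ht
    have e1 : 2 * α - (m₁ t / m t) ^ 2 / 2 ≤ (m₂ t * m t - m₁ t * m₁ t) / m t ^ 2 := by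
      rw [le_div_iff₀ (by positivity)]
      have : (2 * α - (m₁ t / m t) ^ 2 / 2) * m t ^ 2 = 2 * α * m t ^ 2 - m₁ t ^ 2 / 2 := by
        field_simp
      rw [this]; linarith
    have e2 : 2 * β - (n₁ t / n t) ^ 2 / 2 ≤ (n₂ t * n t - n₁ t * n₁ t) / n t ^ 2 := by
      rw [le_div_iff₀ (by positivity)]
      have : (2 * β - (n₁ t / n t) ^ 2 / 2) * n t ^ 2 = 2 * β * n t ^ 2 - n₁ t ^ 2 / 2 := by
        field_simp
      rw [this]; linarith
    have p1 := div_nonneg (m₁pos t ht) hm0.le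
    have p2 := div_nonneg (n₁pos t ht) hn0.le
    have p3 := mul_nonneg p1 p2
    simp only [hY', hY]
    nlinarith
  set Q : ℝ → ℝ := fun t => (Y t + 11 / 10) * w t * Real.exp (-(11 / 10) * t) with hQ
  have dE : ∀ (c t : ℝ), HasDerivAt (fun t => Real.exp (c * t)) (c * Real.exp (c * t)) t :=
    fun c t => by
      have := ((hasDerivAt_id t).const_mul c).exp
      refine this.congr_deriv ?_
      simp; ring
  have dQ : ∀ t, t₀ ≤ t → HasDerivAt Q ((Y' t + Y t ^ 2 - 121 / 100) *
      (w t * Real.exp (-(11 / 10) * t))) t := fun t ht => by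
    refine ((((dY t ht).add_const (11 / 10)).mul (dw t ht)).mul (dE _ t)).congr_deriv ?_
    simp only [Pi.mul_apply]
    ring
  have Qmono : MonotoneOn Q (Ici t₀) := by
    refine monotoneOn_of_deriv_nonneg (convex_Ici _)
      (fun t ht => (dQ t ht).continuousAt.continuousWithinAt)
      (fun t ht => (dQ t (interior_subset ht)).differentiableAt.differentiableWithinAt)
      fun t ht => ?_
    have ht' : t₀ ≤ t := interior_subset (s := Ici t₀) ht
    rw [(dQ t ht').deriv]
    have := hYY t ht'
    have := wpos t ht'
    exact mul_nonneg (by linarith) (by positivity)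
  have hc : 0 < Q t₀ := by
    have := wpos t₀ le_rfl
    have := Ypos t₀ le_rfl
    simp only [hQ]
    positivity
  set c := Q t₀
  set Z : ℝ → ℝ := fun t => w t * Real.exp (11 / 10 * t) - c / (22 / 10) * Real.exp (22 / 10 * t)
  have dZ : ∀ t, t₀ ≤ t → HasDerivAt Z ((Y t + 11 / 10) * w t * Real.exp (11 / 10 * t) -
      c * Real.exp (22 / 10 * t)) t := fun t ht => by
    refine (((dw t ht).mul (dE _ t)).sub ((dE _ t).const_mul _)).congr_deriv ?_
    ring
  have Zmono : MonotoneOn Z (Ici t₀) := by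
    refine monotoneOn_of_deriv_nonneg (convex_Ici _)
      (fun t ht => (dZ t ht).continuousAt.continuousWithinAt)
      (fun t ht => (dZ t (interior_subset ht)).differentiableAt.differentiableWithinAt)
      fun t ht => ?_
    have ht' : t₀ ≤ t := interior_subset (s := Ici t₀) ht
    rw [(dZ t ht').deriv]
    have h1 : c ≤ Q t := Qmono self_mem_Ici ht' ht'
    have h2 : Real.exp (22 / 10 * t) = Real.exp (11 / 10 * t) * Real.exp (11 / 10 * t) := by
      rw [← Real.exp_add]; ring_nf
    have h3 : Real.exp (-(11 / 10) * t) * Real.exp (11 / 10 * t) = 1 := by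
      rw [← Real.exp_add]; ring_nf; simp
    have h4 := mul_le_mul_of_nonneg_right h1 (Real.exp_pos (22 / 10 * t)).le
    have h5 : Q t * Real.exp (22 / 10 * t) = (Y t + 11 / 10) * w t * Real.exp (11 / 10 * t) := by
      rw [h2]; simp only [hQ]
      linear_combination ((Y t + 11 / 10) * w t * Real.exp (11 / 10 * t)) * h3
    linarith
  have hwK : ∀ t, t₀ ≤ t → w t ≤ K * Real.exp t := fun t ht => by
    have h1 := hmK t ht
    have h2 := hnK t ht
    have h0 := mpos t ht
    refine Real.sqrt_le_iff.2 ⟨by linarith, ?_⟩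
    rw [sq]
    exact mul_le_mul h1 h2 (npos t ht).le (by linarith)
  have hfin : ∀ t, max t₀ 0 ≤ t → c / (22 / 10) * Real.exp (1 / 10 * t) ≤ K + |Z t₀| := fun t ht => by
    have h1 : Z t₀ ≤ Z t := Zmono self_mem_Ici (le_of_max_le_left ht) (le_of_max_le_left ht)
    have h2 := hwK t (le_of_max_le_left ht)
    have ht0 : 0 ≤ t := le_of_max_le_right ht
    have h3 : w t * Real.exp (11 / 10 * t) ≤ K * Real.exp (21 / 10 * t) := by
      have := mul_le_mul_of_nonneg_right h2 (Real.exp_pos (11 / 10 * t)).le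
      rwa [mul_assoc, ← Real.exp_add, show t + 11 / 10 * t = 21 / 10 * t by ring] at this
    have h4 : Real.exp (22 / 10 * t) = Real.exp (1 / 10 * t) * Real.exp (21 / 10 * t) := by
      rw [← Real.exp_add]; ring_nf
    have h5 : 1 ≤ Real.exp (21 / 10 * t) := Real.one_le_exp (by linarith)
    have h6 : c / (22 / 10) * Real.exp (1 / 10 * t) * Real.exp (21 / 10 * t) ≤
        (K + |Z t₀|) * Real.exp (21 / 10 * t) := by
      have : Z t = w t * Real.exp (11 / 10 * t) - c / (22 / 10) * Real.exp (22 / 10 * t) := rfl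
      rw [h4] at this
      nlinarith [neg_abs_le (Z t₀), abs_nonneg (Z t₀)]
    exact le_of_mul_le_mul_right h6 (by linarith)
  have : Tendsto (fun t : ℝ => c / (22 / 10) * Real.exp (1 / 10 * t)) atTop atTop :=
    (Real.tendsto_exp_atTop.comp (tendsto_id.const_mul_atTop (by norm_num))).const_mul_atTop
      (by positivity)
  obtain ⟨t, h1, h2⟩ := ((this.eventually_gt_atTop (K + |Z t₀|)).and
    (eventually_ge_atTop (max t₀ 0))).exists
  exact absurd (hfin t h2) (not_le.2 h1)

theorem monotone_of_convex_bdd {m m₁ m₂ : ℝ → ℝ} {K : ℝ}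
    (hm : ∀ t, HasDerivAt m (m₁ t) t) (hm₁ : ∀ t, HasDerivAt m₁ (m₂ t) t) (h2 : ∀ t, 0 ≤ m₂ t)
    (hK : ∀ t ≤ 0, m t ≤ K) (t : ℝ) : 0 ≤ m₁ t := by
  by_contra! h
  have mono : Monotone m₁ := monotone_of_deriv_nonneg (fun t => (hm₁ t).differentiableAt)
    fun t => by rw [(hm₁ t).deriv]; exact h2 t
  have key : ∀ s ≤ t, m t + m₁ t * (s - t) ≤ m s := fun s hs => by
    rcases hs.eq_or_lt with rfl | hs
    · simp
    obtain ⟨x, hx, he⟩ := exists_hasDerivAt_eq_slope m m₁ hs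
      (fun x _ => (hm x).continuousAt.continuousWithinAt) fun x _ => hm x
    have hx' := mono hx.2.le
    rw [he, div_le_iff₀ (by linarith)] at hx'
    linarith
  have h3 := key (min t (min 0 (t + (K - m t + 1) / m₁ t))) (min_le_left _ _)
  have h4 := hK (min t (min 0 (t + (K - m t + 1) / m₁ t)))
    ((min_le_right _ _).trans (min_le_left _ _))
  have h5 : min t (min 0 (t + (K - m t + 1) / m₁ t)) - t ≤ (K - m t + 1) / m₁ t := by
    have := (min_le_right t (min 0 (t + (K - m t + 1) / m₁ t))).trans (min_le_right _ _)
    linarith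
  have h6 := mul_le_mul_of_nonpos_left h5 h.le
  rw [mul_div_cancel₀ _ h.ne] at h6
  linarith

section

variable {A B H : ℂ → ℂ} {K ρ C c t : ℝ}

/-- The complement of a small sector around the negative half-axis. -/
def Off (ζ : ℂ) : Prop := -Real.cos (Real.pi / 10) * ‖ζ‖ ≤ ζ.re

def expc (A : ℂ → ℂ) (c : ℝ) (w : ℂ) : ℂ := A (Complex.exp w) / c

theorem expc_diff (hA : Differentiable ℂ A) : Differentiable ℂ (expc A c) := by
  unfold expc
  exact (hA.comp Complex.differentiable_exp).div_const _

theorem expc_per (w : ℂ) : expc A c (w + 2 * Real.pi * Complex.I) = expc A c w := by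
  unfold expc
  rw [Complex.exp_periodic w]

theorem norm_exp_pt (t θ : ℝ) : ‖Complex.exp (pt t θ)‖ = Real.exp t := by
  rw [Complex.norm_exp]; simp [pt]

theorem re_exp_pt (t θ : ℝ) : (Complex.exp (pt t θ)).re = Real.exp t * Real.cos θ := by
  rw [Complex.exp_re]; simp [pt]

theorem slice_cont {f : ℝ → ℝ → ℝ} (hf : Continuous f.uncurry) (t : ℝ) : Continuous (f t) :=
  hf.comp (by fun_prop : Continuous fun θ => (t, θ))

theorem lu_le (hc : 1 ≤ c) (hK : 0 ≤ K) (hA : ∀ ζ, ‖A ζ‖ ≤ Real.exp (K * (1 + √‖ζ‖)))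
    (t θ : ℝ) : lu (expc A c) t θ ≤ 2 * K * (1 + Real.exp (t / 2)) := by
  have h0 : 0 ≤ 2 * K * (1 + Real.exp (t / 2)) := by positivity
  unfold lu
  rcases le_or_gt (np (expc A c) t θ) 1 with h | h
  · rwa [tl_zero h]
  refine (tl_le h.le).trans ?_
  rw [Real.log_le_iff_le_exp (by linarith), np_eq]
  have h1 := hA (Complex.exp (pt t θ))
  rw [norm_exp_pt, show √(Real.exp t) = Real.exp (t / 2) from (Real.exp_half t).symm] at h1
  have h2 : ‖expc A c (pt t θ)‖ ≤ Real.exp (K * (1 + Real.exp (t / 2))) := by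
    unfold expc
    rw [norm_div, Complex.norm_real, Real.norm_of_nonneg (by linarith)]
    exact (div_le_self (norm_nonneg _) hc).trans h1
  calc _ ≤ Real.exp (K * (1 + Real.exp (t / 2))) ^ 2 := by gcongr
    _ = _ := by rw [← Real.exp_nat_mul]; push_cast; ring_nf

theorem lm_le (hd : Differentiable ℂ A) (hc : 1 ≤ c) (hK : 0 ≤ K)
    (hA : ∀ ζ, ‖A ζ‖ ≤ Real.exp (K * (1 + √‖ζ‖))) (t : ℝ) :
    lm (expc A c) t ≤ 16 * Real.pi * K ^ 2 * (1 + Real.exp t) := by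
  have hcu : Continuous (lu (expc A c) t) := slice_cont (lu_cont (expc_diff hd)) t
  have : lm (expc A c) t ≤ ∫ _ in (-Real.pi)..Real.pi, 8 * K ^ 2 * (1 + Real.exp t) := by
    unfold lm
    refine intervalIntegral.integral_mono_on (by linarith [Real.pi_pos])
      ((hcu.pow 2).intervalIntegrable _ _) intervalIntegrable_const fun θ _ => ?_
    have h1 := lu_le hc hK hA t θ
    have h2 : 0 ≤ lu (expc A c) t θ := tl_nonneg _
    have h3 : Real.exp t = Real.exp (t / 2) ^ 2 := by
      rw [← Real.exp_nat_mul]; push_cast; ring_nf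
    rw [h3]
    calc _ ≤ (2 * K * (1 + Real.exp (t / 2))) ^ 2 := pow_le_pow_left₀ h2 h1 2
      _ ≤ _ := by nlinarith [mul_nonneg (sq_nonneg K) (sq_nonneg (1 - Real.exp (t / 2)))]
  refine this.trans (le_of_eq ?_)
  rw [intervalIntegral.integral_const, smul_eq_mul]; ring

theorem lm_pos (hd : Differentiable ℂ A) (hc : 0 < c) (hA : ¬ ∃ z, ∀ ζ, A ζ = z) :
    ∃ t, 0 < lm (expc A c) t := by
  by_contra! h
  apply hA
  have hcu : ∀ t, Continuous (lu (expc A c) t) := fun t =>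
    slice_cont (lu_cont (expc_diff hd)) t
  have hb : ∀ ζ, ζ ≠ 0 → ‖A ζ‖ ≤ c := by
    intro ζ hζ
    by_contra! hlt
    have e : pt (Complex.log ζ).re (Complex.log ζ).im = Complex.log ζ := Complex.re_add_im _
    have hpos : 0 < lm (expc A c) (Complex.log ζ).re := by
      unfold lm
      refine intervalIntegral.integral_pos (by linarith [Real.pi_pos])
        (by have := hcu (Complex.log ζ).re; fun_prop) (fun _ _ => sq_nonneg _)
        ⟨(Complex.log ζ).im, ⟨(Complex.neg_pi_lt_log_im ζ).le, Complex.log_im_le_pi ζ⟩, ?_⟩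
      have : 0 < lu (expc A c) (Complex.log ζ).re (Complex.log ζ).im := by
        refine tl_pos ?_
        rw [np_eq, e, expc, Complex.exp_log hζ, norm_div, Complex.norm_real,
          Real.norm_of_nonneg hc.le]
        exact one_lt_pow₀ ((one_lt_div hc).2 hlt) two_ne_zero
      positivity
    exact absurd (h _) (not_le.2 hpos)
  refine hd.exists_const_forall_eq_of_bounded ?_
  rw [isBounded_iff_forall_norm_le]
  refine ⟨max c ‖A 0‖, ?_⟩
  rintro _ ⟨ζ, rfl⟩
  by_cases hζ : ζ = 0
  · subst hζ; exact le_max_right _ _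
  · exact (hb ζ hζ).trans (le_max_left _ _)

/-- A continuous indicator of `{‖H‖ > 1/2}` on circles. -/
def ck (H : ℂ → ℂ) (t θ : ℝ) : ℝ := min 1 (max 0 (2 * ‖H (pt t θ)‖ - 1))

theorem ck_nonneg (θ : ℝ) : 0 ≤ ck H t θ := le_min zero_le_one (le_max_left _ _)
theorem ck_le (θ : ℝ) : ck H t θ ≤ 1 := min_le_left _ _
theorem ck_cont (hH : Continuous H) : Continuous (ck H t) := by
  have : Continuous (pt t) := pt_cont.comp (by fun_prop : Continuous fun θ => (t, θ))
  unfold ck; fun_prop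
theorem ck_one {θ : ℝ} (h : lu H t θ ≠ 0) : ck H t θ = 1 := by
  have h1 : 1 < np H t θ := by
    by_contra! h'
    exact h (tl_zero h')
  rw [np_eq] at h1
  have h2 : 1 < ‖H (pt t θ)‖ := by
    by_contra! h'
    exact absurd (pow_le_one₀ (norm_nonneg _) h') (not_le.2 h1)
  refine min_eq_left (le_trans ?_ (le_max_right _ _))
  linarith
theorem ck_zero {θ : ℝ} (h : ‖H (pt t θ)‖ ≤ 1 / 2) : ck H t θ = 0 := by
  unfold ck
  rw [max_eq_left (by linarith), min_eq_right zero_le_one]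

theorem lm_wirtinger (hH : Differentiable ℂ H) (hp : ∀ w, H (w + 2 * Real.pi * Complex.I) = H w)
    {θ₀ : ℝ} (h0 : lu H t θ₀ = 0) (hc : 0 ≤ c)
    (hl : c * ∫ θ in (-Real.pi)..Real.pi, ck H t θ ≤ 9 / 10 * Real.pi) :
    c ^ 2 * lm H t ≤ ∫ θ in (-Real.pi)..Real.pi, lu_θ H t θ ^ 2 := by
  have hpt : ∀ θ, pt t (θ + 2 * Real.pi) = pt t θ + 2 * Real.pi * Complex.I := fun θ => by
    simp [pt]; ring
  have hp' : ∀ w, deriv H (w + 2 * Real.pi * Complex.I) = deriv H w := fun w => by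
    have : (fun w => H (w + 2 * Real.pi * Complex.I)) = H := funext hp
    rw [← deriv_comp_add_const, this]
  have shift : ∀ f : ℝ → ℝ, Function.Periodic f (2 * Real.pi) →
      ∫ θ in (-Real.pi)..Real.pi, f θ = ∫ θ in θ₀..(θ₀ + 2 * Real.pi), f θ := fun f hf => by
    rw [← hf.intervalIntegral_add_eq (-Real.pi) θ₀, show -Real.pi + 2 * Real.pi = Real.pi by ring]
  have pu : Function.Periodic (lu H t) (2 * Real.pi) := fun θ => by
    simp [lu, np, hpt, hp]
  have puθ : Function.Periodic (lu_θ H t) (2 * Real.pi) := fun θ => by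
    simp [lu_θ, np_θ, np, hpt, hp, hp']
  have pk : Function.Periodic (ck H t) (2 * Real.pi) := fun θ => by
    simp [ck, hpt, hp]
  rw [shift _ pk] at hl
  rw [lm, shift (fun θ => lu H t θ ^ 2) fun θ => by simp only [pu θ],
    shift (fun θ => lu_θ H t θ ^ 2) fun θ => by simp only [puθ θ]]
  exact wirtinger (by linarith [Real.pi_pos]) (lu_hd hH t) (lu_θ_cont hH t) (ck_cont hH.continuous)
    ck_nonneg (fun θ h => ck_one h) h0 (by rw [pu θ₀, h0]) hc hl

theorem ck_full (h : ∀ θ, lu H t θ ≠ 0) :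
    ∫ θ in (-Real.pi)..Real.pi, ck H t θ = 2 * Real.pi := by
  simp only [fun θ => ck_one (h θ)]
  rw [intervalIntegral.integral_const, smul_eq_mul]; ring

end

section

variable {A B H G : ℂ → ℂ} {K ρ C c t : ℝ}

theorem eigen_sum (hH : Differentiable ℂ H) (hp : ∀ w, H (w + 2 * Real.pi * Complex.I) = H w)
    (hG : Differentiable ℂ G) (hq : ∀ w, G (w + 2 * Real.pi * Complex.I) = G w)
    (hmin : ∀ θ, |θ| ≤ 9 / 10 * Real.pi → ‖H (pt t θ)‖ ≤ 1 / 2 ∨ ‖G (pt t θ)‖ ≤ 1 / 2) :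
    ∃ α β : ℝ, 121 / 100 ≤ α + β ∧
      α * lm H t ≤ ∫ θ in (-Real.pi)..Real.pi, lu_θ H t θ ^ 2 ∧
      β * lm G t ≤ ∫ θ in (-Real.pi)..Real.pi, lu_θ G t θ ^ 2 := by
  have hπ := Real.pi_pos
  have ch : Continuous (ck H t) := ck_cont hH.continuous
  have cg : Continuous (ck G t) := ck_cont hG.continuous
  set x := ∫ θ in (-Real.pi)..Real.pi, ck H t θ with hx
  set y := ∫ θ in (-Real.pi)..Real.pi, ck G t θ with hy
  have hsum : x + y ≤ 22 / 10 * Real.pi := by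
    have hi : ∀ a b, IntervalIntegrable (fun θ => ck H t θ + ck G t θ) volume a b := fun a b =>
      (by fun_prop : Continuous fun θ => ck H t θ + ck G t θ).intervalIntegrable _ _
    have e : x + y = ∫ θ in (-Real.pi)..Real.pi, (ck H t θ + ck G t θ) :=
      (intervalIntegral.integral_add (ch.intervalIntegrable _ _) (cg.intervalIntegrable _ _)).symm
    rw [e, ← intervalIntegral.integral_add_adjacent_intervals (hi _ (-(9 / 10 * Real.pi))) (hi _ _),
      ← intervalIntegral.integral_add_adjacent_intervals
        (hi (-(9 / 10 * Real.pi)) (9 / 10 * Real.pi)) (hi _ _)]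
    have b1 : ∀ a b : ℝ, a ≤ b → ∫ θ in a..b, (ck H t θ + ck G t θ) ≤ 2 * (b - a) := fun a b h => by
      have : ∫ θ in a..b, (ck H t θ + ck G t θ) ≤ ∫ _ in a..b, (2 : ℝ) :=
        intervalIntegral.integral_mono_on h (hi _ _) intervalIntegrable_const fun θ _ => by
          linarith [ck_le (H := H) (t := t) θ, ck_le (H := G) (t := t) θ]
      refine this.trans (le_of_eq ?_)
      rw [intervalIntegral.integral_const, smul_eq_mul]; ring
    have b2 : ∫ θ in (-(9 / 10 * Real.pi))..(9 / 10 * Real.pi), (ck H t θ + ck G t θ) ≤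
        18 / 10 * Real.pi := by
      have : ∫ θ in (-(9 / 10 * Real.pi))..(9 / 10 * Real.pi), (ck H t θ + ck G t θ) ≤
          ∫ _ in (-(9 / 10 * Real.pi))..(9 / 10 * Real.pi), (1 : ℝ) := by
        refine intervalIntegral.integral_mono_on (by linarith) (hi _ _)
          intervalIntegrable_const fun θ hθ => ?_
        rcases hmin θ (abs_le.2 hθ) with h | h
        · rw [ck_zero h]; linarith [ck_le (H := G) (t := t) θ]
        · rw [ck_zero h]; linarith [ck_le (H := H) (t := t) θ]
      refine this.trans (le_of_eq ?_)
      rw [intervalIntegral.integral_const, smul_eq_mul]; ring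
    have b3 := b1 (-Real.pi) (-(9 / 10 * Real.pi)) (by linarith)
    have b4 := b1 (9 / 10 * Real.pi) Real.pi (by linarith)
    linarith
  have hx0 : 0 ≤ x := intervalIntegral.integral_nonneg (by linarith) fun θ _ => ck_nonneg θ
  have hy0 : 0 ≤ y := intervalIntegral.integral_nonneg (by linarith) fun θ _ => ck_nonneg θ
  have zH : x < 2 * Real.pi → ∃ θ, lu H t θ = 0 := fun h => by
    by_contra! h'
    exact h.ne (ck_full h')
  have zG : y < 2 * Real.pi → ∃ θ, lu G t θ = 0 := fun h => by
    by_contra! h'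
    exact h.ne (ck_full h')
  have nn : ∀ f : ℝ → ℝ, 0 ≤ ∫ θ in (-Real.pi)..Real.pi, f θ ^ 2 := fun f =>
    intervalIntegral.integral_nonneg (by linarith) fun _ _ => sq_nonneg _
  rcases le_or_gt x (2 / 10 * Real.pi) with h1 | h1
  · obtain ⟨θ₀, h0⟩ := zH (by linarith)
    exact ⟨(11 / 10) ^ 2, 0, by norm_num, lm_wirtinger hH hp h0 (by norm_num) (by linarith),
      by rw [zero_mul]; exact nn _⟩
  rcases le_or_gt y (2 / 10 * Real.pi) with h2 | h2
  · obtain ⟨θ₀, h0⟩ := zG (by linarith)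
    exact ⟨0, (11 / 10) ^ 2, by norm_num, by rw [zero_mul]; exact nn _,
      lm_wirtinger hG hq h0 (by norm_num) (by linarith)⟩
  obtain ⟨θ₁, h3⟩ := zH (by linarith)
  obtain ⟨θ₂, h4⟩ := zG (by linarith)
  have hxp : 0 < x := by linarith
  have hyp : 0 < y := by linarith
  refine ⟨(9 / 10 * Real.pi / x) ^ 2, (9 / 10 * Real.pi / y) ^ 2, ?_,
    lm_wirtinger hH hp h3 (by positivity) (by rw [← hx, div_mul_cancel₀ _ hxp.ne']),
    lm_wirtinger hG hq h4 (by positivity) (by rw [← hy, div_mul_cancel₀ _ hyp.ne'])⟩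
  have tan : ∀ z : ℝ, 0 < z → 18 / 11 - 90 / 121 * (z / Real.pi) ≤
      9 / 10 * Real.pi / z := fun z hz => by
    rw [le_div_iff₀ hz]
    have : z = (z / Real.pi) * Real.pi := by field_simp
    set q := z / Real.pi
    rw [this]
    nlinarith [mul_nonneg (sq_nonneg (q - 11 / 10)) hπ.le]
  have t1 := tan x hxp
  have t2 := tan y hyp
  have t3 : x / Real.pi + y / Real.pi ≤ 22 / 10 := by
    rw [← add_div, div_le_iff₀ hπ]; linarith
  have t4 : 16 / 10 ≤ 9 / 10 * Real.pi / x + 9 / 10 * Real.pi / y := by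
    linarith
  nlinarith [sq_nonneg (9 / 10 * Real.pi / x - 9 / 10 * Real.pi / y)]

/-- Two entire functions of order at most `1/2` with essentially disjoint tracts: one of them is
constant. -/
theorem two_tract (hA : Differentiable ℂ A) (hB : Differentiable ℂ B)
    (gA : ∀ ζ, ‖A ζ‖ ≤ Real.exp (K * (1 + √‖ζ‖))) (gB : ∀ ζ, ‖B ζ‖ ≤ Real.exp (K * (1 + √‖ζ‖)))
    (hmin : ∀ ζ, ρ ≤ ‖ζ‖ → Off ζ → ‖A ζ‖ ≤ C ∨ ‖B ζ‖ ≤ C) :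
    (∃ c, ∀ ζ, A ζ = c) ∨ ∃ c, ∀ ζ, B ζ = c := by
  by_contra! hne
  obtain ⟨nA, nB⟩ := hne
  have nA' : ¬ ∃ c, ∀ ζ, A ζ = c := by push Not; exact nA
  have nB' : ¬ ∃ c, ∀ ζ, B ζ = c := by push Not; exact nB
  set c : ℝ := 2 * max C 1 with hc
  have hc1 : 1 ≤ c := by linarith [le_max_right C 1]
  have hC : C ≤ c / 2 := by linarith [le_max_left C 1]
  have hc0 : 0 < c := by linarith
  set K' := max K 0 with hK'
  have hK0 : 0 ≤ K' := le_max_right _ _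
  have up : ∀ ζ : ℂ, Real.exp (K * (1 + √‖ζ‖)) ≤ Real.exp (K' * (1 + √‖ζ‖)) := fun ζ =>
    Real.exp_le_exp.2 (mul_le_mul_of_nonneg_right (le_max_left _ _) (by positivity))
  have uA : ∀ t, lm (expc A c) t ≤ 16 * Real.pi * K' ^ 2 * (1 + Real.exp t) :=
    lm_le hA hc1 hK0 fun ζ => (gA ζ).trans (up ζ)
  have uB : ∀ t, lm (expc B c) t ≤ 16 * Real.pi * K' ^ 2 * (1 + Real.exp t) :=
    lm_le hB hc1 hK0 fun ζ => (gB ζ).trans (up ζ)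
  have core : ∀ {F : ℂ → ℂ}, Differentiable ℂ F → (¬ ∃ c, ∀ ζ, F ζ = c) →
      (∀ t, lm (expc F c) t ≤ 16 * Real.pi * K' ^ 2 * (1 + Real.exp t)) →
      ∃ m₁ m₂ : ℝ → ℝ, ∃ t₁, (∀ t, HasDerivAt (lm (expc F c)) (m₁ t) t) ∧
        (∀ t, HasDerivAt m₁ (m₂ t) t) ∧ (∀ t, t₁ ≤ t → 0 < lm (expc F c) t) ∧ (∀ t, 0 ≤ m₁ t) ∧
        ∀ t, t₁ ≤ t → ∀ α, α * lm (expc F c) t ≤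
          ∫ θ in (-Real.pi)..Real.pi, lu_θ (expc F c) t θ ^ 2 →
          m₁ t ^ 2 / 2 + 2 * α * lm (expc F c) t ^ 2 ≤ lm (expc F c) t * m₂ t := by
    intro F hF nF uF
    obtain ⟨m₁, m₂, h⟩ := carleman (expc_diff (c := c) hF) expc_per
    obtain ⟨t₁, ht₁⟩ := lm_pos hF hc0 nF
    have nn : ∀ f : ℝ → ℝ, 0 ≤ ∫ θ in (-Real.pi)..Real.pi, f θ ^ 2 := fun f =>
      intervalIntegral.integral_nonneg (by linarith [Real.pi_pos]) fun _ _ => sq_nonneg _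
    have m₁nn : ∀ t, 0 ≤ m₁ t := by
      refine monotone_of_convex_bdd (K := 16 * Real.pi * K' ^ 2 * 2) (fun t => (h t).1)
        (fun t => (h t).2.1) (fun t => ?_) fun t ht => (uF t).trans ?_
      · have := (h t).2.2.2.2
        have := nn (lu_t (expc F c) t)
        have := nn (lu_θ (expc F c) t)
        linarith
      · have : Real.exp t ≤ 1 := Real.exp_le_one_iff.2 ht
        have := Real.pi_pos
        gcongr
        linarith
    have mono : Monotone (lm (expc F c)) :=
      monotone_of_deriv_nonneg (fun t => (h t).1.differentiableAt)
        fun t => by rw [(h t).1.deriv]; exact m₁nn t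
    have pos : ∀ t, t₁ ≤ t → 0 < lm (expc F c) t := fun t ht => ht₁.trans_le (mono ht)
    refine ⟨m₁, m₂, t₁, fun t => (h t).1, fun t => (h t).2.1, pos, m₁nn, fun t ht α hα => ?_⟩
    obtain ⟨-, -, -, h3, h4⟩ := h t
    have hp := pos t ht
    have := mul_le_mul_of_nonneg_left h4 hp.le
    have := mul_le_mul_of_nonneg_left hα hp.le
    nlinarith
  obtain ⟨m₁, m₂, s, a1, a2, a3, a4, a5⟩ := core hA nA' uA
  obtain ⟨n₁, n₂, s', b1, b2, b3, b4, b5⟩ := core hB nB' uB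
  set t₀ := max (max s s') (max 0 (Real.log (max ρ 1))) with ht₀
  have es : ∀ t, t₀ ≤ t → s ≤ t := fun t ht =>
    ((le_max_left _ _).trans (le_max_left _ _)).trans ht
  have es' : ∀ t, t₀ ≤ t → s' ≤ t := fun t ht =>
    ((le_max_right _ _).trans (le_max_left _ _)).trans ht
  have e0 : ∀ t, t₀ ≤ t → 0 ≤ t := fun t ht =>
    ((le_max_left _ _).trans (le_max_right _ _)).trans ht
  have eρ : ∀ t, t₀ ≤ t → ρ ≤ Real.exp t := fun t ht => by
    have h1 : Real.log (max ρ 1) ≤ t := ((le_max_right _ _).trans (le_max_right _ _)).trans ht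
    have h2 : 0 < max ρ 1 := lt_max_of_lt_right one_pos
    exact (le_max_left _ _).trans ((Real.log_le_iff_le_exp h2).1 h1)
  have fin : ∀ t, t₀ ≤ t → 16 * Real.pi * K' ^ 2 * (1 + Real.exp t) ≤
      32 * Real.pi * K' ^ 2 * Real.exp t := fun t ht => by
    have h1 : 1 ≤ Real.exp t := Real.one_le_exp (e0 t ht)
    have h2 : 0 ≤ 16 * Real.pi * K' ^ 2 := by have := Real.pi_pos; positivity
    nlinarith
  refine riccati_false (t₀ := t₀) (K := 32 * Real.pi * K' ^ 2) a1 a2 b1 b2 (fun t ht => a3 t (es t ht))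
    (fun t ht => b3 t (es' t ht)) (fun t _ => a4 t) (fun t _ => b4 t) (fun t ht => ?_)
    (fun t ht => (uA t).trans (fin t ht)) fun t ht => (uB t).trans (fin t ht)
  obtain ⟨α, β, h1, h2, h3⟩ := eigen_sum (t := t) (expc_diff (c := c) hA) expc_per
    (expc_diff (c := c) hB) expc_per fun θ hθ => by
      have hoff : Off (Complex.exp (pt t θ)) := by
        unfold Off
        rw [norm_exp_pt, re_exp_pt]
        have : -Real.cos (Real.pi / 10) ≤ Real.cos θ := by
          rw [← Real.cos_pi_sub, ← Real.cos_abs θ]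
          exact Real.cos_le_cos_of_nonneg_of_le_pi (abs_nonneg _) (by linarith [Real.pi_pos])
            (by linarith)
        have := mul_le_mul_of_nonneg_right this (Real.exp_pos t).le
        linarith
      have key : ∀ F : ℂ → ℂ, ‖F (Complex.exp (pt t θ))‖ ≤ C → ‖expc F c (pt t θ)‖ ≤ 1 / 2 :=
        fun F hF => by
          rw [expc, norm_div, Complex.norm_real, Real.norm_of_nonneg hc0.le, div_le_iff₀ hc0]
          linarith
      exact (hmin _ (by rw [norm_exp_pt]; exact eρ t ht) hoff).imp (key A) (key B)
  exact ⟨α, β, h1, a5 t (es t ht) α h2, b5 t (es' t ht) β h3⟩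

end

section
variable {F g : ℝ → ℝ} {X x t ζ c f₀ : ℝ} {f v : ℝ → ℝ} {a : Measure ℝ}

theorem Str.ser_differentiable (hF : Str F X) (hg : Str g X) (ht : t ∈ Icc 0 X) :
    Differentiable ℂ fun z : ℂ => ser F g z t := by
  have hX : X ∈ Icc (0:ℝ) X := ⟨ht.1.trans ht.2, le_rfl⟩
  intro z
  have h := Complex.differentiableOn_tsum_of_summable_norm
    (u := fun n : ℕ => g X * (((‖z‖ + 1) * (F X * X)) ^ n / (n.factorial : ℝ) ^ 2))
    (U := Metric.ball 0 (‖z‖ + 1)) (F := fun n (w : ℂ) => w ^ n * ((vit F g n t : ℝ) : ℂ))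
    ((summable_fact _).mul_left _) (fun n => by fun_prop)
    (Metric.isOpen_ball (x := (0:ℂ)) (ε := ‖z‖ + 1)) (fun n w hw => by
      refine (hF.norm_it_le hg w n ht).trans ?_
      have h1 : ‖w‖ ≤ ‖z‖ + 1 := by simpa using (Metric.mem_ball.1 hw).le
      have h2 := hF.pos hX
      have h3 := hg.pos hX
      have h4 := hX.1
      gcongr)
  exact (h z (by simp)).differentiableAt (Metric.isOpen_ball.mem_nhds (by simp))

theorem ser_cast (F g : ℝ → ℝ) (z t : ℝ) : ser F g (z : ℂ) t = ((ser F g z t : ℝ) : ℂ) := by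
  simp only [ser, Complex.ofReal_tsum]
  refine tsum_congr fun n => ?_
  push_cast
  simp

theorem Str.ser_continuous (hF : Str F X) (hg : Str g X) (ht : t ∈ Icc 0 X) :
    Continuous fun z : ℝ => ser F g z t := by
  have h1 := Complex.continuous_re.comp
    ((hF.ser_differentiable hg ht).continuous.comp Complex.continuous_ofReal)
  refine h1.congr fun z => ?_
  simp [ser_cast]

theorem solV_cast (F : ℝ → ℝ) (z c f₀ t : ℝ) :
    solV F (z : ℂ) (c : ℂ) (f₀ : ℂ) t = ((solV F z c f₀ t : ℝ) : ℂ) := by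
  simp [solV, ser_cast]

theorem solF_cast (F : ℝ → ℝ) (z c f₀ t : ℝ) :
    solF F (z : ℂ) (c : ℂ) (f₀ : ℂ) t = ((solF F z c f₀ t : ℝ) : ℂ) := by
  simp only [solF, solV_cast]
  rw [intervalIntegral.integral_ofReal]
  push_cast; rfl

theorem Sol.sub_eq (h : a (Icc 0 X) < ⊤) (S : Sol (dist a) X ζ c f₀ f v) {y₁ y₂ : ℝ}
    (h1 : 0 ≤ y₁) (h12 : y₁ ≤ y₂) (h2 : y₂ ≤ X) :
    v y₂ - v y₁ = ζ * ∫ y in Ioc y₁ y₂, f y ∂a := by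
  have hF := str_dist h
  rw [int_parts h S.int S.f_eq h1 h12 h2, S.v_eq y₂ ⟨h1.trans h12, h2⟩,
    S.v_eq y₁ ⟨h1, h12.trans h2⟩]
  have e := intervalIntegral.integral_interval_sub_left
    (hF.mul_intable S.int ⟨h1.trans h12, h2⟩) (hF.mul_intable S.int ⟨h1, h12.trans h2⟩)
  simp only [RCLike.ofReal_real_eq_id, id] at *
  rw [← e]; ring

theorem Str.prim_prim (hF : Str F X) (hv : IntervalIntegrable v volume 0 X) (hX : 0 ≤ X)
    (hc : ∀ t ∈ Ico 0 X, ContinuousWithinAt v (Ici t) t) :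
    ∫ t in (0:ℝ)..X, (∫ s in (0:ℝ)..t, F s * v s) = ∫ s in (0:ℝ)..X, (X - s) * (F s * v s) := by
  have i1 : IntervalIntegrable (fun s => F s * v s) volume 0 X := by
    simpa using hF.mul_intable hv ⟨hX, le_rfl⟩
  have c1 := continuousOn_prim hX i1
  have i2 : IntervalIntegrable (fun t => ∫ s in (0:ℝ)..t, F s * v s) volume 0 X :=
    ContinuousOn.intervalIntegrable (by rwa [uIcc_of_le hX])
  have i3 : IntervalIntegrable (fun s => (X - s) * (F s * v s)) volume 0 X :=
    i1.continuousOn_mul (by fun_prop)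
  have key := constant_of_has_deriv_right_zero (a := 0) (b := X)
    (f := fun t => (∫ r in (0:ℝ)..t, ∫ s in (0:ℝ)..r, F s * v s) +
      (X - t) * (∫ s in (0:ℝ)..t, F s * v s) - ∫ s in (0:ℝ)..t, (X - s) * (F s * v s))
    (((continuousOn_prim hX i2).add (ContinuousOn.mul (by fun_prop) c1)).sub
      (continuousOn_prim hX i3))
    (fun t ht => by
      have d1 := deriv_prim i2 ht (ici_of_icc c1 ht)
      have c2 : ContinuousWithinAt (fun s => F s * v s) (Ici t) t := (hF.rc t ht).mul (hc t ht)
      have d2 := deriv_prim i1 ht c2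
      have d3 := deriv_prim i3 ht ((by fun_prop : ContinuousWithinAt (fun s => X - s) _ _).mul c2)
      refine ((d1.add ((((hasDerivWithinAt_id t (Ici t))).const_sub X).mul d2)).sub d3).congr_deriv ?_
      simp) X ⟨hX, le_rfl⟩
  simp at key
  linarith

theorem Sol.meas_eq (h : a (Icc 0 X) < ⊤) (S : Sol (dist a) X ζ c f₀ f v) (hx : x ∈ Icc 0 X) :
    f x = f₀ + c * x + ζ * ∫ y in Icc 0 x, (x - y) * f y ∂a := by
  have hF := str_dist h
  have hX := hx.1.trans hx.2
  have hFx : Str (dist a) x := hF.restrict hx.2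
  have S' := S.restrict hx.1 hx.2
  have h' : a (Icc 0 x) < ⊤ := (measure_mono (Icc_subset_Icc_right hx.2)).trans_lt h
  have iFv : IntervalIntegrable (fun s => dist a s * v s) volume 0 x := by
    simpa using hFx.mul_intable S'.int ⟨hx.1, le_rfl⟩
  have cf := S'.f_cont hx.1
  have if' : IntervalIntegrable f volume 0 x :=
    ContinuousOn.intervalIntegrable (by rwa [uIcc_of_le hx.1])
  have iFf : IntervalIntegrable (fun s => dist a s * f s) volume 0 x := by
    simpa using hFx.mul_intable if' ⟨hx.1, le_rfl⟩
  have ixv : IntervalIntegrable (fun s => (x - s) * v s) volume 0 x :=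
    S'.int.continuousOn_mul (by fun_prop)
  have ixFv : IntervalIntegrable (fun s => (x - s) * (dist a s * v s)) volume 0 x :=
    iFv.continuousOn_mul (by fun_prop)
  have ig : IntervalIntegrable (fun s => -f s + (x - s) * v s) volume 0 x := if'.neg.add ixv
  have hg : ∀ t ∈ Icc 0 x, (x - t) * f t = x * f₀ + ∫ s in (0:ℝ)..t, (-f s + (x - s) * v s) := by
    intro t ht
    have key := constant_of_has_deriv_right_zero (a := 0) (b := x)
      (f := fun t => (x - t) * f t - ∫ s in (0:ℝ)..t, (-f s + (x - s) * v s))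
      ((ContinuousOn.mul (by fun_prop) cf).sub (continuousOn_prim hx.1 ig))
      (fun t ht => by
        have d3 := deriv_prim ig ht ((ici_of_icc cf ht).neg.add
          ((by fun_prop : ContinuousWithinAt (fun s => x - s) _ _).mul (S'.v_rc hFx ht)))
        refine ((((hasDerivWithinAt_id t (Ici t)).const_sub x).mul
          (S'.f_deriv hFx ht)).sub d3).congr_deriv ?_
        simp) t ht
    simp [S'.f_zero hx.1] at key
    linarith
  have e1 := int_parts h' ig hg le_rfl hx.1 le_rfl
  have e0 : ∫ y in Icc 0 x, (x - y) * f y ∂a =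
      dist a 0 * (x * f₀) + ∫ y in Ioc 0 x, (x - y) * f y ∂a := by
    have io : IntegrableOn (fun y => (x - y) * f y) (Icc 0 x) a :=
      integrableOn_mass h' (ContinuousOn.mul (by fun_prop) cf)
    rw [← Icc_union_Ioc_eq_Icc le_rfl hx.1, setIntegral_union, Icc_self, dist_zero]
    · simp [integral_singleton, S'.f_zero hx.1, measureReal_def]
    · rw [Icc_self, disjoint_singleton_left]; simp
    · exact measurableSet_Ioc
    · exact io.mono_set (Icc_subset_Icc_right hx.1)
    · exact io.mono_set Ioc_subset_Icc_self
  have e2 := hFx.prim_prim S'.int hx.1 (fun t ht => S'.v_rc hFx ht)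
  have e3 : ∫ s in (0:ℝ)..x, v s = ∫ s in (0:ℝ)..x,
      (c + ζ * (dist a s * f s - ∫ r in (0:ℝ)..s, dist a r * v r)) := by
    apply intervalIntegral.integral_congr
    intro s hs
    rw [uIcc_of_le hx.1] at hs
    simpa using S'.v_eq s hs
  have e4 : ∫ s in (0:ℝ)..x, dist a s * (-f s + (x - s) * v s) =
      -(∫ s in (0:ℝ)..x, dist a s * f s) + ∫ s in (0:ℝ)..x, (x - s) * (dist a s * v s) := by
    rw [← intervalIntegral.integral_neg, ← intervalIntegral.integral_add (by exact iFf.neg) ixFv]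
    apply intervalIntegral.integral_congr
    intro s _; simp only; ring
  have iP : IntervalIntegrable (fun t => ∫ s in (0:ℝ)..t, dist a s * v s) volume 0 x :=
    ContinuousOn.intervalIntegrable (by
      rw [uIcc_of_le hx.1]; exact continuousOn_prim hx.1 iFv)
  rw [intervalIntegral.integral_add intervalIntegrable_const ((iFf.sub iP).const_mul _),
    intervalIntegral.integral_const_mul, intervalIntegral.integral_sub iFf iP,
    intervalIntegral.integral_const] at e3
  rw [S.f_eq x hx, e3, e2, e0, e1, e4, S'.f_zero hx.1]
  simp
  ring

end

section
variable {X x y t s ξ η ψ ψ' c : ℝ} {φ v χ w : ℝ → ℝ} {a : Measure ℝ} {R : ℝ≥0∞}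

namespace Weyl

theorem nonneg (h : Weyl R (dist a) ξ ψ φ v) (ha : LocallyFiniteOnHalf R a) (hR : 0 < R)
    (hξ : 0 < ξ) (ht : t ∈ IsetOf R) : 0 ≤ φ t := by
  have hs := fun X (hX : X ∈ IsetOf R) => LocallyFiniteOnHalf.str ha hX
  obtain ⟨hψ, hH⟩ := h.hTot_eq hR hs hξ
  obtain ⟨x, hx⟩ := exists_exh hR
  rw [(h.sol t ht).eq_mul (hs t ht) hξ.le ⟨ht.1, le_rfl⟩]
  have h1 := (hs t ht).mF_ge hξ.le ⟨ht.1, le_rfl⟩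
  refine mul_nonneg (by linarith) (sub_nonneg.2 ?_)
  rcases hψ.eq_or_lt with h0 | h0
  · simp [← h0]
  have h2 : ENNReal.ofReal (hF (dist a) ξ t) ≤ (ENNReal.ofReal ψ)⁻¹ := by
    rw [← hH, (hs t ht).ofReal_hF ht.1 hξ.le]
    exact lintegral_mono_set fun y hy => iset_down ht hy.1 hy.2
  rw [← ENNReal.ofReal_inv_of_pos h0, ENNReal.ofReal_le_ofReal_iff (by positivity)] at h2
  calc ψ * hF (dist a) ξ t ≤ ψ * ψ⁻¹ := by gcongr
    _ = 1 := mul_inv_cancel₀ h0.ne'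

theorem v_mono (h : Weyl R (dist a) ξ ψ φ v) (ha : LocallyFiniteOnHalf R a) (hR : 0 < R)
    (hξ : 0 < ξ) (hs : 0 ≤ s) (hst : s ≤ t) (ht : t ∈ IsetOf R) : v s ≤ v t := by
  have h1 := (h.sol t ht).sub_eq (ha.2 t ht) hs hst le_rfl
  have h2 : 0 ≤ ∫ y in Ioc s t, φ y ∂a := setIntegral_nonneg measurableSet_Ioc fun y hy =>
    h.nonneg ha hR hξ (iset_down ht (hs.trans hy.1.le) hy.2)
  nlinarith [mul_nonneg hξ.le h2]

theorem v_nonpos (h : Weyl R (dist a) ξ ψ φ v) (ha : LocallyFiniteOnHalf R a) (hR : 0 < R)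
    (hξ : 0 < ξ) (ht : t ∈ IsetOf R) : v t ≤ 0 := by
  by_contra! hc
  have key : ∀ s ∈ IsetOf R, t ≤ s → v t * (s - t) ≤ φ s := by
    intro s hs hts
    have hF := LocallyFiniteOnHalf.str ha hs
    have := le_of_rderiv (f := fun r => φ r - v t * (r - t)) (f' := fun r => v r - v t) hts
      ((((h.sol s hs).f_cont hs.1).mono (Icc_subset_Icc_left ht.1)).sub (by fun_prop))
      (fun r hr => by
        refine (((h.sol s hs).f_deriv hF ⟨ht.1.trans hr.1, hr.2⟩).sub
          (((hasDerivWithinAt_id r _).sub_const t).const_mul (v t))).congr_deriv ?_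
        simp)
      (fun r hr => sub_nonneg.2 (h.v_mono ha hR hξ ht.1 hr.1
        (iset_down hs (ht.1.trans hr.1) hr.2.le)))
    have h0 := h.nonneg ha hR hξ ht
    simp at this
    linarith
  obtain ⟨x, hx⟩ := exists_exh hR
  by_cases hT : R = ⊤
  · subst hT
    obtain ⟨B, hB⟩ := h.bdd
    have hm : t + (|B| + 1) / v t ∈ IsetOf ⊤ := by
      rw [iset_top]; exact add_nonneg ht.1 (by positivity)
    have h1 := key _ hm (by linarith [show 0 ≤ (|B| + 1) / v t by positivity])
    have h2 := (le_abs_self _).trans (hB _ hm)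
    have h3 : v t * (t + (|B| + 1) / v t - t) = |B| + 1 := by field_simp; ring
    linarith [le_abs_self B]
  · obtain ⟨u, hu, htu⟩ := iset_succ ht
    have h1 := (h.bdry hT).comp (hx.tendsto_fin hT)
    have h2 : v t * (u - t) ≤ 0 := by
      refine ge_of_tendsto h1 ?_
      filter_upwards [hx.ev u hu] with n hn
      refine le_trans ?_ (key (x n) (hx.mem n) (htu.le.trans hn))
      gcongr
    nlinarith

theorem anti (h : Weyl R (dist a) ξ ψ φ v) (ha : LocallyFiniteOnHalf R a) (hR : 0 < R)
    (hξ : 0 < ξ) (hs : 0 ≤ s) (hst : s ≤ t) (ht : t ∈ IsetOf R) : φ t ≤ φ s := by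
  have := le_of_rderiv (f := fun r => -φ r) (f' := fun r => -v r) hst
      (((h.sol t ht).f_cont ht.1).mono (Icc_subset_Icc_left hs)).neg
      (fun r hr => ((h.sol t ht).f_deriv (LocallyFiniteOnHalf.str ha ht) ⟨hs.trans hr.1, hr.2⟩).neg)
      (fun r hr => neg_nonneg.2 (h.v_nonpos ha hR hξ (iset_down ht (hs.trans hr.1) hr.2.le)))
  linarith

theorem le_one (h : Weyl R (dist a) ξ ψ φ v) (ha : LocallyFiniteOnHalf R a) (hR : 0 < R)
    (hξ : 0 < ξ) (ht : t ∈ IsetOf R) : φ t ≤ 1 :=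
  (h.anti ha hR hξ le_rfl ht.1 ht).trans ((h.sol t ht).f_zero ht.1).le

theorem pos (h : Weyl R (dist a) ξ ψ φ v) (ha : LocallyFiniteOnHalf R a) (hR : 0 < R)
    (hξ : 0 < ξ) (ht : t ∈ IsetOf R) : 0 < φ t := by
  refine (h.nonneg ha hR hξ ht).lt_of_ne fun hz => ?_
  obtain ⟨u, hu, htu⟩ := iset_succ ht
  have e : ∀ s ∈ Icc t u, φ s = 0 := fun s hs =>
    have hm := iset_down hu (ht.1.trans hs.1) hs.2
    le_antisymm ((h.anti ha hR hξ ht.1 hs.1 hm).trans hz.symm.le) (h.nonneg ha hR hξ hm)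
  have hF := LocallyFiniteOnHalf.str ha hu
  have d1 := (h.sol u hu).f_deriv hF ⟨ht.1, htu⟩
  have d2 : HasDerivWithinAt φ 0 (Ici t) t := by
    refine (hasDerivWithinAt_const t (Ici t) (0:ℝ)).congr_of_eventuallyEq ?_ hz.symm
    filter_upwards [Icc_mem_nhdsGE htu] with s hs using e s hs
  have hv : v t = 0 := (uniqueDiffWithinAt_Ici t).eq_deriv _ d1 d2
  have hw := (hF.sol hu.1 (ζ := ξ) (c := 1) (f₀ := 0)).wronskian (h.sol u hu) hF ⟨ht.1, htu.le⟩
  rw [hv, ← hz] at hw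
  norm_num at hw

theorem v_mul_tendsto (h : Weyl R (dist a) ξ ψ φ v) (h' : Weyl R (dist a) η ψ' χ w)
    (ha : LocallyFiniteOnHalf R a) (hR : 0 < R) (hξ : 0 < ξ) (hη : 0 < η) {x : ℕ → ℝ}
    (hx : Exh R x) : Tendsto (fun n => v (x n) * χ (x n)) atTop (𝓝 0) := by
  by_cases hT : R = ⊤
  · subst hT
    have h1 : ∀ᶠ n in atTop, ‖v (x n) * χ (x n)‖ ≤ (x n)⁻¹ := by
      filter_upwards [hx.tendsto_top.eventually_gt_atTop 0] with n hn
      have hm := hx.mem n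
      have hF := LocallyFiniteOnHalf.str ha hm
      have k := le_of_rderiv (f := fun r => v (x n) * r - φ r) (f' := fun r => v (x n) - v r) hn.le
        ((by fun_prop : ContinuousOn (fun r => v (x n) * r) _).sub ((h.sol _ hm).f_cont hm.1))
        (fun r hr => by
          refine (((hasDerivWithinAt_id r _).const_mul (v (x n))).sub
            ((h.sol _ hm).f_deriv hF hr)).congr_deriv ?_
          simp)
        (fun r hr => sub_nonneg.2 (h.v_mono ha hR hξ hr.1 hr.2.le hm))
      simp only [(h.sol _ hm).f_zero hm.1] at k
      have k1 := h.nonneg ha hR hξ hm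
      have k2 := h.v_nonpos ha hR hξ hm
      have k3 := h'.nonneg ha hR hη hm
      have k4 := h'.le_one ha hR hη hm
      rw [norm_mul, Real.norm_of_nonpos k2, Real.norm_of_nonneg k3]
      have k5 : -v (x n) ≤ (x n)⁻¹ := by
        rw [← one_div, le_div_iff₀ hn]; linarith
      calc _ ≤ (x n)⁻¹ * 1 := by gcongr
        _ = _ := mul_one _
    exact squeeze_zero_norm' h1 (tendsto_inv_atTop_zero.comp hx.tendsto_top)
  · have h1 := (h'.bdry hT).comp (hx.tendsto_fin hT)
    refine squeeze_zero_norm (a := fun n => |v 0| * χ (x n)) (fun n => ?_) (by simpa using h1.const_mul |v 0|)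
    have hm := hx.mem n
    have k1 := h.v_mono ha hR hξ le_rfl hm.1 hm
    have k2 := h.v_nonpos ha hR hξ hm
    have k3 := h'.nonneg ha hR hη hm
    rw [norm_mul, Real.norm_of_nonneg k3]
    gcongr
    rw [Real.norm_eq_abs, abs_of_nonpos k2, abs_of_nonpos (k1.trans k2)]
    linarith

end Weyl

theorem Sol.mul_intable {c' f₀ f₀' : ℝ} (S : Sol (dist a) X ξ c f₀ φ v)
    (S' : Sol (dist a) X η c' f₀' χ w)
    (hF : Str (dist a) X) (hX : 0 ≤ X) : IntervalIntegrable (fun t => v t * w t) volume 0 X := by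
  obtain ⟨B, hB⟩ := S.v_bdd hF hX
  have i := S'.int
  rw [intervalIntegrable_iff_integrableOn_Ioc_of_le hX] at i ⊢
  refine Integrable.bdd_mul (c := B) i ?_ ?_
  · exact S.int.1.aestronglyMeasurable
  · filter_upwards [ae_restrict_mem measurableSet_Ioc] with s hs
    exact hB s ⟨hs.1.le, hs.2⟩

theorem Sol.green {c' f₀ f₀' : ℝ} (S : Sol (dist a) X ξ c f₀ φ v)
    (S' : Sol (dist a) X η c' f₀' χ w)
    (hF : Str (dist a) X) (hX : 0 ≤ X) :
    (η - ξ) * ∫ t in (0:ℝ)..X, v t * w t =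
      η * (v X * χ X) - ξ * (w X * φ X) - η * (c * f₀') + ξ * (c' * f₀) := by
  have i := S.mul_intable S' hF hX
  have key := constant_of_has_deriv_right_zero (a := 0) (b := X)
    (f := fun t => η * ((v t - ξ * (dist a t * φ t)) * χ t) -
      ξ * ((w t - η * (dist a t * χ t)) * φ t) - (η - ξ) * ∫ s in (0:ℝ)..t, v s * w s)
    ((((((S.p_cont hF hX)).mul (S'.f_cont hX)).const_mul η).sub
      (((S'.p_cont hF hX).mul (S.f_cont hX)).const_mul ξ)).sub
      ((continuousOn_prim hX i).const_mul _))
    (fun t ht => by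
      have d := deriv_prim i ht ((S.v_rc hF ht).mul (S'.v_rc hF ht))
      refine ((((S.p_deriv hF ht).mul (S'.f_deriv hF ht)).const_mul η).sub
        (((S'.p_deriv hF ht).mul (S.f_deriv hF ht)).const_mul ξ)).sub (d.const_mul _)
        |>.congr_deriv ?_
      simp only [RCLike.ofReal_real_eq_id, id]
      ring) X ⟨hX, le_rfl⟩
  simp only [S.f_zero hX, S'.f_zero hX, S.v_zero hX, S'.v_zero hX, RCLike.ofReal_real_eq_id, id,
    intervalIntegral.integral_same] at key
  linear_combination -key

end

/-- The function `c ξ + ∫ ξ / (ξ + s) μ(ds)`. -/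
def psi (c : ℝ) (μ : Measure ℝ) (ξ : ℝ) : ℝ := c * ξ + ∫ s, ξ / (ξ + s) ∂μ

/-- The string `(R, a)` has the characteristic function `psi c μ`. -/
structure Rep (R : ℝ≥0∞) (a : Measure ℝ) (c : ℝ) (μ : Measure ℝ) : Prop where
  pos : 0 < R
  fin : LocallyFiniteOnHalf R a
  supp : μ (Iio 0) = 0
  int : Integrable (fun s : ℝ => (1 + s)⁻¹) μ
  weyl : ∀ ξ, 0 < ξ → Weyl R (dist a) ξ (psi c μ ξ)
    (solF (dist a) ξ (-psi c μ ξ) 1) (solV (dist a) ξ (-psi c μ ξ) 1)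

section
variable {X x y t s ξ η c : ℝ} {a μ : Measure ℝ} {R : ℝ≥0∞}

theorem frac_le (hξ : 0 < ξ) (hs : 0 ≤ s) : ξ / (ξ + s) ≤ (ξ + 1) * (1 + s)⁻¹ := by
  rw [← div_eq_mul_inv, div_le_div_iff₀ (by positivity) (by positivity)]
  nlinarith

theorem frac_nonneg (hξ : 0 < ξ) (hs : 0 ≤ s) : 0 ≤ ξ / (ξ + s) := by positivity

theorem frac_le_one (hξ : 0 < ξ) (hs : 0 ≤ s) : ξ / (ξ + s) ≤ 1 :=
  (div_le_one (by positivity)).2 (by linarith)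

namespace Rep

theorem ae_nonneg (h : Rep R a c μ) : ∀ᵐ s ∂μ, 0 ≤ s := by
  rw [ae_iff]
  simpa [Iio] using h.supp

theorem int_frac (h : Rep R a c μ) (hξ : 0 < ξ) : Integrable (fun s => ξ / (ξ + s)) μ := by
  refine (h.int.const_mul (ξ + 1)).mono' (by fun_prop : Measurable _).aestronglyMeasurable ?_
  filter_upwards [h.ae_nonneg] with s hs
  rw [Real.norm_of_nonneg (frac_nonneg hξ hs)]
  exact frac_le hξ hs

theorem int_mul (h : Rep R a c μ) (hξ : 0 < ξ) (hη : 0 < η) :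
    Integrable (fun s => ξ / (ξ + s) * (η / (η + s))) μ := by
  refine (h.int_frac hξ).mono' (by fun_prop : Measurable _).aestronglyMeasurable ?_
  filter_upwards [h.ae_nonneg] with s hs
  rw [Real.norm_of_nonneg (mul_nonneg (frac_nonneg hξ hs) (frac_nonneg hη hs))]
  exact mul_le_of_le_one_right (frac_nonneg hξ hs) (frac_le_one hη hs)

theorem psi_gram (h : Rep R a c μ) (hξ : 0 < ξ) (hη : 0 < η) :
    ξ * psi c μ η - η * psi c μ ξ = (ξ - η) * ∫ s, ξ / (ξ + s) * (η / (η + s)) ∂μ := by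
  have e : ξ * psi c μ η - η * psi c μ ξ =
      (∫ s, ξ * (η / (η + s)) ∂μ) - ∫ s, η * (ξ / (ξ + s)) ∂μ := by
    simp only [psi]
    rw [integral_const_mul, integral_const_mul]
    ring
  rw [e, ← integral_sub ((h.int_frac hη).const_mul ξ) ((h.int_frac hξ).const_mul η),
    ← integral_const_mul]
  apply integral_congr_ae
  filter_upwards [h.ae_nonneg] with s hs
  have h1 : ξ + s ≠ 0 := by positivity
  have h2 : η + s ≠ 0 := by positivity
  field_simp
  ring

theorem psi_cont (h : Rep R a c μ) (hξ : 0 < ξ) : ContinuousAt (psi c μ) ξ := by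
  refine ContinuousAt.add (by fun_prop) ?_
  apply continuousAt_of_dominated (bound := fun s => (ξ + 2) * (1 + s)⁻¹)
  · exact Eventually.of_forall fun η => (by fun_prop : Measurable _).aestronglyMeasurable
  · filter_upwards [lt_mem_nhds hξ, gt_mem_nhds (show ξ < ξ + 1 by linarith)] with η h0 h1
    filter_upwards [h.ae_nonneg] with s hs
    rw [Real.norm_of_nonneg (frac_nonneg h0 hs)]
    refine (frac_le h0 hs).trans ?_
    exact mul_le_mul_of_nonneg_right (by linarith) (by positivity)
  · exact h.int.const_mul _
  · filter_upwards [h.ae_nonneg] with s hs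
    exact continuousAt_id.div (by fun_prop) (by positivity)

theorem gram_cont (h : Rep R a c μ) (hξ : 0 < ξ) :
    ContinuousAt (fun η => ∫ s, ξ / (ξ + s) * (η / (η + s)) ∂μ) ξ := by
  apply continuousAt_of_dominated (bound := fun s => ξ / (ξ + s))
  · exact Eventually.of_forall fun η => (by fun_prop : Measurable _).aestronglyMeasurable
  · filter_upwards [lt_mem_nhds hξ] with η hη
    filter_upwards [h.ae_nonneg] with s hs
    rw [Real.norm_of_nonneg (mul_nonneg (frac_nonneg hξ hs) (frac_nonneg hη hs))]
    exact mul_le_of_le_one_right (frac_nonneg hξ hs) (frac_le_one hη hs)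
  · exact h.int_frac hξ
  · filter_upwards [h.ae_nonneg] with s hs
    exact continuousAt_const.mul (continuousAt_id.div (by fun_prop) (by positivity))

/-- The decaying solution. -/
abbrev _root_.Krein.ph (a : Measure ℝ) (c : ℝ) (μ : Measure ℝ) (ξ : ℝ) : ℝ → ℝ :=
  solF (dist a) ξ (-psi c μ ξ) 1

/-- The right derivative of the decaying solution. -/
abbrev _root_.Krein.pv (a : Measure ℝ) (c : ℝ) (μ : Measure ℝ) (ξ : ℝ) : ℝ → ℝ :=
  solV (dist a) ξ (-psi c μ ξ) 1

theorem str (h : Rep R a c μ) (hX : X ∈ IsetOf R) : Str (dist a) X :=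
  LocallyFiniteOnHalf.str h.fin hX

theorem mul_nonneg (h : Rep R a c μ) (hξ : 0 < ξ) (hη : 0 < η) (ht : t ∈ IsetOf R) :
    0 ≤ pv a c μ ξ t * pv a c μ η t :=
  mul_nonneg_of_nonpos_of_nonpos ((h.weyl ξ hξ).v_nonpos h.fin h.pos hξ ht)
    ((h.weyl η hη).v_nonpos h.fin h.pos hη ht)

theorem mul_intable (h : Rep R a c μ) (hξ : 0 < ξ) (hη : 0 < η) (hX : X ∈ IsetOf R) :
    IntervalIntegrable (fun t => pv a c μ ξ t * pv a c μ η t) volume 0 X :=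
  ((h.weyl ξ hξ).sol X hX).mul_intable ((h.weyl η hη).sol X hX) (h.str hX) hX.1

theorem gram_le_of_ne (h : Rep R a c μ) (hξ : 0 < ξ) (hη : 0 < η) (hne : ξ ≠ η)
    {x : ℕ → ℝ} (hx : Exh R x) :
    Tendsto (fun n => ∫ t in (0:ℝ)..x n, pv a c μ ξ t * pv a c μ η t) atTop
      (𝓝 (∫ s, ξ / (ξ + s) * (η / (η + s)) ∂μ)) := by
  have hne' : ξ - η ≠ 0 := sub_ne_zero.2 hne
  have w := h.weyl ξ hξ
  have w' := h.weyl η hη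
  have l1 := w.v_mul_tendsto w' h.fin h.pos hξ hη hx
  have l2 := w'.v_mul_tendsto w h.fin h.pos hη hξ hx
  have e : ∀ n, ∫ t in (0:ℝ)..x n, pv a c μ ξ t * pv a c μ η t =
      (ξ - η)⁻¹ * (ξ * (pv a c μ η (x n) * ph a c μ ξ (x n)) -
        η * (pv a c μ ξ (x n) * ph a c μ η (x n)) +
        (ξ - η) * ∫ s, ξ / (ξ + s) * (η / (η + s)) ∂μ) := fun n => by
    have hm := hx.mem n
    have g := (w.sol _ hm).green (w'.sol _ hm) (h.str hm) hm.1
    rw [← h.psi_gram hξ hη]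
    field_simp
    linear_combination -g
  simp only [e]
  have := (((l2.const_mul ξ).sub (l1.const_mul η)).add_const
    ((ξ - η) * ∫ s, ξ / (ξ + s) * (η / (η + s)) ∂μ)).const_mul (ξ - η)⁻¹
  convert this using 2
  field_simp
  ring

theorem intVal_mono (h : Rep R a c μ) (hξ : 0 < ξ) (hη : 0 < η) (hX : X ∈ IsetOf R)
    (hY : 0 ≤ y) (hyX : y ≤ X) :
    ∫ t in (0:ℝ)..y, pv a c μ ξ t * pv a c μ η t ≤
      ∫ t in (0:ℝ)..X, pv a c μ ξ t * pv a c μ η t := by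
  apply intervalIntegral.integral_mono_interval le_rfl hY hyX _ (h.mul_intable hξ hη hX)
  filter_upwards [ae_restrict_mem measurableSet_Ioc] with s hs
  exact h.mul_nonneg hξ hη (iset_down hX hs.1.le hs.2)

theorem pv_cont (h : Rep R a c μ) (hξ : 0 < ξ) (ht : t ∈ IsetOf R) :
    ContinuousAt (fun η => pv a c μ η t) ξ := by
  have hF := h.str ht
  have hm : t ∈ Icc 0 t := ⟨ht.1, le_rfl⟩
  exact ((h.psi_cont hξ).neg.mul (hF.ser_continuous Str.one hm).continuousAt).add
    ((continuousAt_id.mul continuousAt_const).mul (hF.ser_continuous hF hm).continuousAt)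

theorem gram_le (h : Rep R a c μ) (hξ : 0 < ξ) (hX : X ∈ IsetOf R) :
    ∫ t in (0:ℝ)..X, pv a c μ ξ t * pv a c μ ξ t ≤ ∫ s, ξ / (ξ + s) * (ξ / (ξ + s)) ∂μ := by
  obtain ⟨x, hx⟩ := exists_exh h.pos
  have key : ∀ᶠ η in 𝓝[≠] ξ, ∫ t in (0:ℝ)..X, pv a c μ ξ t * pv a c μ η t ≤
      ∫ s, ξ / (ξ + s) * (η / (η + s)) ∂μ := by
    filter_upwards [self_mem_nhdsWithin, mem_nhdsWithin_of_mem_nhds (lt_mem_nhds hξ)] with η h1 h2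
    refine ge_of_tendsto (h.gram_le_of_ne hξ h2 (Ne.symm h1) hx) ?_
    filter_upwards [hx.ev X hX] with n hn
    exact h.intVal_mono hξ h2 (hx.mem n) hX.1 hn
  refine le_of_tendsto_of_tendsto ?_ ((h.gram_cont hξ).tendsto.mono_left nhdsWithin_le_nhds) key
  have hS := (h.weyl ξ hξ).sol X hX
  refine Tendsto.mono_left ?_ nhdsWithin_le_nhds
  apply intervalIntegral.tendsto_integral_filter_of_dominated_convergence
    (bound := fun t => (psi c μ ξ) * (psi c μ ξ + 1))
  · filter_upwards [lt_mem_nhds hξ] with η hη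
    rw [uIoc_of_le hX.1]
    exact (h.mul_intable hξ hη hX).1.aestronglyMeasurable
  · have : ∀ᶠ η in 𝓝 ξ, psi c μ η < psi c μ ξ + 1 := (h.psi_cont hξ).eventually_lt_const (by linarith)
    have h0 : ∀ η, 0 < η → ∀ t ∈ Ioc 0 X, |pv a c μ η t| ≤ psi c μ η := by
      intro η hη t ht
      have hm := iset_down hX ht.1.le ht.2
      have w := h.weyl η hη
      have k1 := w.v_mono h.fin h.pos hη le_rfl hm.1 hm
      have k2 := w.v_nonpos h.fin h.pos hη hm
      have k3 := (w.sol t hm).v_zero hm.1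
      rw [abs_of_nonpos k2]
      have k4 : 0 ≤ dist a 0 := ENNReal.toReal_nonneg
      simp at k3
      nlinarith [_root_.mul_nonneg hη.le k4]
    filter_upwards [lt_mem_nhds hξ, this] with η hη h2
    refine ae_of_all _ fun t ht => ?_
    rw [uIoc_of_le hX.1] at ht
    have k1 := h0 ξ hξ t ht
    have k2 := h0 η hη t ht
    rw [norm_mul, Real.norm_eq_abs, Real.norm_eq_abs]
    have := (abs_nonneg _).trans k1
    gcongr
    linarith
  · exact intervalIntegrable_const
  · refine ae_of_all _ fun t ht => ?_
    rw [uIoc_of_le hX.1] at ht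
    exact ((h.pv_cont hξ (iset_down hX ht.1.le ht.2)).tendsto).const_mul _

end Rep
end

section
variable {μ : Measure ℝ} {w : ℝ → ℝ}

open BoundedContinuousFunction in
/-- A continuous bounded injection of `ℝ` that agrees with `(1 + s)⁻¹` for `s ≥ 0`. -/
def tau : ℝ →ᵇ ℝ := ofNormedAddCommGroup (fun s => 1 - s / (1 + |s|))
  (by fun_prop (disch := intro; positivity)) 2 (fun s => by
    have h : |s / (1 + |s|)| ≤ 1 := by
      rw [abs_div, div_le_one (by positivity), abs_of_pos (show 0 < 1 + |s| by positivity)]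
      linarith
    refine (norm_sub_le _ _).trans ?_
    rw [Real.norm_eq_abs, Real.norm_eq_abs, abs_one]
    linarith)

theorem tau_apply (s : ℝ) : tau s = 1 - s / (1 + |s|) := rfl

theorem tau_of_nonneg {s : ℝ} (hs : 0 ≤ s) : tau s = (1 + s)⁻¹ := by
  rw [tau_apply, abs_of_nonneg hs]
  field_simp
  ring

theorem tau_injective : Function.Injective tau := by
  intro x y h
  rw [tau_apply, tau_apply] at h
  have h : x / (1 + |x|) = y / (1 + |y|) := by linarith
  rw [div_eq_div_iff (by positivity) (by positivity)] at h
  rcases le_total 0 x with hx | hx <;> rcases le_total 0 y with hy | hy <;>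
  simp only [abs_of_nonneg, abs_of_nonpos, hx, hy] at h <;> nlinarith

theorem ae_zero_of_moments (hw : Integrable w μ) (h : ∀ n : ℕ, ∫ s, w s * tau s ^ n ∂μ = 0) :
    w =ᵐ[μ] 0 := by
  have f1 := isFiniteMeasure_withDensity_ofReal hw.2
  have f2 := isFiniteMeasure_withDensity_ofReal hw.neg.2
  have key : μ.withDensity (fun x => ENNReal.ofReal (w x)) =
      μ.withDensity (fun x => ENNReal.ofReal ((-w) x)) := by
    let A : StarSubalgebra ℝ (BoundedContinuousFunction ℝ ℝ) :=
      { toSubalgebra := (Polynomial.aeval (R := ℝ) tau).range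
        star_mem' := fun {g} hg => by
          have : star g = g := by ext; simp
          rw [this]; exact hg }
    refine ext_of_forall_mem_subalgebra_integral_eq_of_pseudoEMetric_complete_countable
      (A := A) (𝕜 := ℝ) ?_ ?_
    · intro x y hxy
      refine ⟨_, ⟨_, ⟨tau, ⟨Polynomial.X, by simp⟩, rfl⟩, rfl⟩, ?_⟩
      exact fun hh => hxy (tau_injective hh)
    · rintro g ⟨p, rfl⟩
      have e : ∀ u : ℝ → ℝ, Integrable u μ → ∀ g : BoundedContinuousFunction ℝ ℝ,
          ∫ x, g x ∂(μ.withDensity fun x => ENNReal.ofReal (u x)) = ∫ x, max (u x) 0 * g x ∂μ := by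
        intro u hu g
        rw [integral_withDensity_eq_integral_toReal_smul₀ hu.1.aemeasurable.ennreal_ofReal
          (ae_of_all _ fun x => ENNReal.ofReal_lt_top)]
        simp [ENNReal.toReal_ofReal']
      have i : ∀ u : ℝ → ℝ, Integrable u μ → ∀ g : BoundedContinuousFunction ℝ ℝ,
          Integrable (fun x => u x * g x) μ := fun u hu g =>
        hu.mul_bdd (c := ‖g‖) g.continuous.aestronglyMeasurable
          (ae_of_all _ fun x => g.norm_coe_le_norm x)
      erw [e w hw, e (-w) hw.neg]
      rw [← sub_eq_zero, ← integral_sub (i _ hw.pos_part _) (i _ hw.neg.pos_part _)]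
      have : ∀ x, max (w x) 0 * (Polynomial.aeval tau p) x -
          max ((-w) x) 0 * (Polynomial.aeval tau p) x = w x * (Polynomial.aeval tau p) x := by
        intro x
        rw [← sub_mul]
        congr 1
        simp only [Pi.neg_apply]
        rcases le_total 0 (w x) with h | h
        · rw [max_eq_left h, max_eq_right (by linarith)]; ring
        · rw [max_eq_right h, max_eq_left (by linarith)]; ring
      erw [integral_congr_ae (ae_of_all _ this)]
      induction p using Polynomial.induction_on' with
      | add p q hp hq =>
        simp only [map_add, BoundedContinuousFunction.add_apply, mul_add]
        rw [integral_add (i _ hw _) (i _ hw _)]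
        have hp := hp (fun x => by
          rw [← sub_mul]
          congr 1
          simp only [Pi.neg_apply]
          rcases le_total 0 (w x) with h | h
          · rw [max_eq_left h, max_eq_right (by linarith)]; ring
          · rw [max_eq_right h, max_eq_left (by linarith)]; ring)
        have hq := hq (fun x => by
          rw [← sub_mul]
          congr 1
          simp only [Pi.neg_apply]
          rcases le_total 0 (w x) with h | h
          · rw [max_eq_left h, max_eq_right (by linarith)]; ring
          · rw [max_eq_right h, max_eq_left (by linarith)]; ring)
        rw [hp, hq, add_zero]
      | monomial n c =>
        have : ∀ x, w x * (Polynomial.aeval tau (Polynomial.monomial n c)) x =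
            c * (w x * tau x ^ n) := by
          intro x
          rw [Polynomial.aeval_monomial]
          simp [Algebra.algebraMap_eq_smul_one]
          ring
        simp only [this]
        rw [integral_const_mul, h n, mul_zero]
  rw [withDensity_eq_iff hw.1.aemeasurable.ennreal_ofReal hw.neg.1.aemeasurable.ennreal_ofReal] at key
  · filter_upwards [key] with x hx
    simp only [Pi.zero_apply, Pi.neg_apply] at hx ⊢
    rcases le_total 0 (w x) with h | h
    · rw [ENNReal.ofReal_of_nonpos (show -w x ≤ 0 by linarith)] at hx
      exact le_antisymm (ENNReal.ofReal_eq_zero.1 hx) h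
    · rw [ENNReal.ofReal_of_nonpos h] at hx
      have := ENNReal.ofReal_eq_zero.1 hx.symm
      linarith
  · exact ((lintegral_mono fun x => Real.ofReal_le_enorm (w x)).trans_lt hw.2).ne

theorem ae_zero_of_frac (hμ : ∀ᵐ s ∂μ, 0 ≤ s) (hw : Integrable w μ)
    (h : ∀ ξ : ℝ, 1 < ξ → ∫ s, w s * ((1 + s) / (ξ + s)) ∂μ = 0) : w =ᵐ[μ] 0 := by
  have i : ∀ (n : ℕ) (b : ℝ), 0 ≤ b →
      Integrable (fun s => w s * (tau s ^ n * ((1 + s) / (1 + b + s)))) μ := by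
    intro n b hb
    refine hw.mul_bdd (c := ‖tau‖ ^ n) ?_ ?_
    · exact ((tau.continuous.measurable.pow_const n).mul (by fun_prop)).aestronglyMeasurable
    · filter_upwards [hμ] with s hs
      rw [norm_mul, norm_pow]
      have : ‖(1 + s) / (1 + b + s)‖ ≤ 1 := by
        rw [Real.norm_of_nonneg (by positivity)]
        exact (div_le_one (by positivity)).2 (by linarith)
      calc _ ≤ ‖tau‖ ^ n * 1 := by
            gcongr
            exact tau.norm_coe_le_norm s
        _ = _ := mul_one _
  have key : ∀ n : ℕ, (∀ b : ℝ, 0 < b →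
      ∫ s, w s * (tau s ^ n * ((1 + s) / (1 + b + s))) ∂μ = 0) →
      ∫ s, w s * tau s ^ n ∂μ = 0 := by
    intro n hn
    have hlim : Tendsto (fun b : ℝ => ∫ s, w s * (tau s ^ n * ((1 + s) / (1 + b + s))) ∂μ) (𝓝[>] 0)
        (𝓝 (∫ s, w s * tau s ^ n ∂μ)) := by
      apply tendsto_integral_filter_of_dominated_convergence (fun s => ‖w s‖ * ‖tau‖ ^ n)
      · filter_upwards [self_mem_nhdsWithin] with b hb using (i n b (le_of_lt hb)).1
      · filter_upwards [self_mem_nhdsWithin] with b hb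
        have hb : 0 < b := hb
        filter_upwards [hμ] with s hs
        rw [norm_mul, norm_mul, norm_pow]
        have : ‖(1 + s) / (1 + b + s)‖ ≤ 1 := by
          rw [Real.norm_of_nonneg (by positivity)]
          exact (div_le_one (by positivity)).2 (by linarith)
        have h2 := tau.norm_coe_le_norm s
        calc _ ≤ ‖w s‖ * (‖tau‖ ^ n * 1) := by gcongr
          _ = _ := by rw [mul_one]
      · exact hw.norm.mul_const _
      · filter_upwards [hμ] with s hs
        have h1 : Tendsto (fun b : ℝ => w s * (tau s ^ n * ((1 + s) / (1 + b + s)))) (𝓝 0)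
            (𝓝 (w s * (tau s ^ n * ((1 + s) / (1 + 0 + s))))) := by
          have : (1 + 0 + s) ≠ 0 := by positivity
          have hc : ContinuousAt (fun b : ℝ => w s * (tau s ^ n * ((1 + s) / (1 + b + s)))) 0 :=
            continuousAt_const.mul (continuousAt_const.mul
              (continuousAt_const.div (by fun_prop) this))
          exact hc.tendsto
        rw [add_zero, div_self (by positivity), mul_one] at h1
        exact h1.mono_left nhdsWithin_le_nhds
    refine tendsto_nhds_unique hlim ?_
    refine tendsto_const_nhds.congr' ?_
    filter_upwards [self_mem_nhdsWithin] with b hb using (hn b hb).symm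
  have all : ∀ n : ℕ, ∀ b : ℝ, 0 < b →
      ∫ s, w s * (tau s ^ n * ((1 + s) / (1 + b + s))) ∂μ = 0 := by
    intro n
    induction n with
    | zero =>
      intro b hb
      simpa using h (1 + b) (by linarith)
    | succ n ih =>
      intro b hb
      have h1 := key n ih
      have h2 := ih b hb
      have i1 := i n 0 le_rfl
      have e : ∫ s, w s * (tau s ^ (n + 1) * ((1 + s) / (1 + b + s))) ∂μ =
          ∫ s, b⁻¹ * (w s * tau s ^ n - w s * (tau s ^ n * ((1 + s) / (1 + b + s)))) ∂μ := by
        apply integral_congr_ae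
        filter_upwards [hμ] with s hs
        have hq : tau s * (1 + s) = 1 := by
          rw [tau_of_nonneg hs]
          exact inv_mul_cancel₀ (by positivity)
        have : 1 + b + s ≠ 0 := by positivity
        rw [pow_succ]
        field_simp
        linear_combination (b * w s * tau s ^ n) * hq
      rw [e, integral_const_mul, integral_sub ?_ (i n b hb.le), h1, h2]
      · simp
      · refine i1.congr ?_
        filter_upwards [hμ] with s hs
        rw [add_zero, div_self (by positivity), mul_one]
  exact ae_zero_of_moments hw fun n => key n (all n)

/-- Riesz representation for a bounded assignment on the span of a family. -/
theorem riesz_family {ι H : Type*} [NormedAddCommGroup H] [InnerProductSpace ℝ H] [CompleteSpace H]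
    (g : ι → H) (ℓ : ι → ℝ) (C : ℝ) (hC : 0 ≤ C)
    (h : ∀ c : ι →₀ ℝ, |c.sum fun i r => r * ℓ i| ≤ C * ‖c.sum fun i r => r • g i‖) :
    ∃ k : H, ‖k‖ ≤ C ∧ ∀ i, inner ℝ k (g i) = ℓ i := by
  let T : (ι →₀ ℝ) →ₗ[ℝ] H := Finsupp.linearCombination ℝ g
  let L : (ι →₀ ℝ) →ₗ[ℝ] ℝ := Finsupp.linearCombination ℝ ℓ
  have hb : ∀ c, |L c| ≤ C * ‖T c‖ := fun c => h c
  obtain ⟨S, hS⟩ := T.rangeRestrict.exists_rightInverse_of_surjective T.range_rangeRestrict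
  have hTS : ∀ y, T (S y) = y := fun y => by
    have := congrArg (fun f => ((f y : LinearMap.range T) : H)) hS
    simpa using this
  have hLS : ∀ c, L (S (T.rangeRestrict c)) = L c := fun c => by
    have := hb (S (T.rangeRestrict c) - c)
    rw [map_sub, map_sub, hTS] at this
    simp at this
    linarith
  let f : StrongDual ℝ (LinearMap.range T) := (L ∘ₗ S).mkContinuous C fun y => by
    simpa [hTS] using hb (S y)
  obtain ⟨k', hk1, hk2⟩ := exists_extension_norm_eq (LinearMap.range T) f
  refine ⟨(InnerProductSpace.toDual ℝ H).symm k', ?_, fun i => ?_⟩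
  · rw [LinearIsometryEquiv.norm_map, hk2]
    exact LinearMap.mkContinuous_norm_le _ hC _
  · rw [InnerProductSpace.toDual_symm_apply]
    have e : g i = (T.rangeRestrict (Finsupp.single i 1) : H) := by simp [T]
    rw [e, hk1]
    change L (S _) = _
    rw [hLS]
    simp [L]

end

section
variable {X x y t s ξ η c : ℝ} {a μ : Measure ℝ} {R : ℝ≥0∞}

theorem ii_sum {ι : Type*} (S : Finset ι) {f : ι → ℝ → ℝ} {A B : ℝ}
    (h : ∀ i ∈ S, IntervalIntegrable (f i) volume A B) :
    IntervalIntegrable (fun t => ∑ i ∈ S, f i t) volume A B := by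
  have := IntervalIntegrable.sum S h
  have e : (∑ i ∈ S, fun t => f i t) = fun t => ∑ i ∈ S, f i t := by
    ext t
    simp
  rwa [← e]

namespace Rep

theorem memLp_frac (h : Rep R a c μ) (hξ : 0 < ξ) : MemLp (fun s => ξ / (ξ + s)) 2 μ := by
  rw [memLp_two_iff_integrable_sq (by fun_prop : Measurable _).aestronglyMeasurable]
  simpa only [pow_two] using h.int_mul hξ hξ

/-- The function `ξ / (ξ + s)` as an element of `L²`. -/
def gL (h : Rep R a c μ) (i : Ioi (0 : ℝ)) : Lp ℝ 2 μ := (h.memLp_frac i.2).toLp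

theorem inner_gL (h : Rep R a c μ) (u : Lp ℝ 2 μ) (i : Ioi (0 : ℝ)) :
    inner ℝ u (h.gL i) = ∫ s, u s * (i / (i + s)) ∂μ := by
  rw [L2.inner_def]
  apply integral_congr_ae
  filter_upwards [(h.memLp_frac i.2).coeFn_toLp] with s hs
  rw [gL, hs]
  simp [mul_comm]

theorem inner_gL_gL (h : Rep R a c μ) (i j : Ioi (0 : ℝ)) :
    inner ℝ (h.gL i) (h.gL j) = ∫ s, i / (i + s) * (j / (j + s)) ∂μ := by
  rw [inner_gL]
  apply integral_congr_ae
  filter_upwards [(h.memLp_frac i.2).coeFn_toLp] with s hs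
  rw [gL, hs]

theorem int_mul_frac (h : Rep R a c μ) {u : ℝ → ℝ} (hu : MemLp u 2 μ) (hξ : 0 < ξ) :
    Integrable (fun s => u s * (ξ / (ξ + s))) μ :=
  hu.integrable_mul (h.memLp_frac hξ)

theorem eq_zero_of_inner (h : Rep R a c μ) (u : Lp ℝ 2 μ)
    (hu : ∀ i : Ioi (0 : ℝ), inner ℝ u (h.gL i) = 0) : u = 0 := by
  have i1 := h.int_mul_frac (Lp.memLp u) one_pos
  have := ae_zero_of_frac h.ae_nonneg i1 fun ξ hξ => by
    have hξ0 : 0 < ξ := by linarith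
    have := hu ⟨ξ, hξ0⟩
    rw [inner_gL] at this
    have e : ∫ s, u s * (1 / (1 + s)) * ((1 + s) / (ξ + s)) ∂μ =
        ∫ s, ξ⁻¹ * (u s * (ξ / (ξ + s))) ∂μ := by
      apply integral_congr_ae
      filter_upwards [h.ae_nonneg] with s hs
      field_simp
    rw [e, integral_const_mul, this, mul_zero]
  rw [Lp.eq_zero_iff_ae_eq_zero]
  filter_upwards [this, h.ae_nonneg] with s h1 h2
  simp only [Pi.zero_apply] at h1 ⊢
  rcases mul_eq_zero.1 h1 with h | h
  · exact h
  · exact absurd h (by positivity)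

theorem sum_sq_le (h : Rep R a c μ) (hX : X ∈ IsetOf R) (C : Ioi (0 : ℝ) →₀ ℝ) :
    ∫ t in (0:ℝ)..X, (C.sum fun i r => r * pv a c μ i t) ^ 2 ≤
      ‖C.sum fun i r => r • h.gL i‖ ^ 2 := by
  obtain ⟨x, hx⟩ := exists_exh h.pos
  have expand : ∀ t, (C.sum fun i r => r * pv a c μ i t) ^ 2 =
      ∑ i ∈ C.support, ∑ j ∈ C.support, C i * C j * (pv a c μ i t * pv a c μ j t) := by
    intro t
    rw [pow_two, Finsupp.sum, Finset.sum_mul_sum]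
    exact Finset.sum_congr rfl fun i _ => Finset.sum_congr rfl fun j _ => by ring
  have ii : ∀ Y ∈ IsetOf R, ∀ i j : Ioi (0 : ℝ), IntervalIntegrable
      (fun t => C i * C j * (pv a c μ i t * pv a c μ j t)) volume 0 Y := fun Y hY i j =>
    (h.mul_intable i.2 j.2 hY).const_mul _
  have ints : ∀ Y ∈ IsetOf R, IntervalIntegrable
      (fun t => (C.sum fun i r => r * pv a c μ i t) ^ 2) volume 0 Y := by
    intro Y hY
    simp only [expand]
    exact ii_sum C.support fun i _ => ii_sum C.support fun j _ => ii Y hY i j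
  have val : ∀ Y ∈ IsetOf R, ∫ t in (0:ℝ)..Y, (C.sum fun i r => r * pv a c μ i t) ^ 2 =
      ∑ i ∈ C.support, ∑ j ∈ C.support, C i * C j *
        ∫ t in (0:ℝ)..Y, pv a c μ i t * pv a c μ j t := by
    intro Y hY
    simp only [expand]
    rw [intervalIntegral.integral_finsetSum fun i _ =>
      ii_sum C.support fun j _ => ii Y hY i j]
    refine Finset.sum_congr rfl fun i _ => ?_
    rw [intervalIntegral.integral_finsetSum fun j _ => ii Y hY i j]
    exact Finset.sum_congr rfl fun j _ => intervalIntegral.integral_const_mul _ _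
  have rhs : ‖C.sum fun i r => r • h.gL i‖ ^ 2 =
      ∑ i ∈ C.support, ∑ j ∈ C.support, C i * C j *
        ∫ s, (i : ℝ) / (i + s) * (j / (j + s)) ∂μ := by
    rw [← real_inner_self_eq_norm_sq, Finsupp.sum, sum_inner]
    refine Finset.sum_congr rfl fun i _ => ?_
    rw [inner_sum]
    refine Finset.sum_congr rfl fun j _ => ?_
    rw [real_inner_smul_left, real_inner_smul_right, inner_gL_gL]
    ring
  let b : ℕ → Ioi (0 : ℝ) → Ioi (0 : ℝ) → ℝ := fun n i j =>
    if i = j then ∫ s, (i : ℝ) / (i + s) * (j / (j + s)) ∂μ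
    else ∫ t in (0:ℝ)..x n, pv a c μ i t * pv a c μ j t
  have lim : Tendsto (fun n => ∑ i ∈ C.support, ∑ j ∈ C.support, C i * C j * b n i j) atTop
      (𝓝 (‖C.sum fun i r => r • h.gL i‖ ^ 2)) := by
    rw [rhs]
    refine tendsto_finsetSum _ fun i _ => tendsto_finsetSum _ fun j _ => ?_
    refine Tendsto.const_mul _ ?_
    by_cases hij : i = j
    · simp only [b, hij, if_true]
      exact tendsto_const_nhds
    · simp only [b, hij, if_false]
      exact h.gram_le_of_ne i.2 j.2 (fun e => hij (Subtype.ext e)) hx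
  refine ge_of_tendsto lim ?_
  filter_upwards [hx.ev X hX] with n hn
  calc _ ≤ ∫ t in (0:ℝ)..x n, (C.sum fun i r => r * pv a c μ i t) ^ 2 := by
        apply intervalIntegral.integral_mono_interval le_rfl hX.1 hn _ (ints _ (hx.mem n))
        exact ae_of_all _ fun t => sq_nonneg _
    _ = _ := val _ (hx.mem n)
    _ ≤ _ := by
        refine Finset.sum_le_sum fun i _ => Finset.sum_le_sum fun j _ => ?_
        by_cases hij : i = j
        · subst hij
          simp only [b, if_true]
          exact mul_le_mul_of_nonneg_left (h.gram_le i.2 (hx.mem n)) (mul_self_nonneg _)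
        · simp only [b, hij, if_false, le_refl]

end Rep

theorem sq_intervalIntegral_le {f : ℝ → ℝ} {A B : ℝ} (hAB : A ≤ B)
    (h1 : IntervalIntegrable f volume A B)
    (h2 : IntervalIntegrable (fun t => f t ^ 2) volume A B) :
    (∫ t in A..B, f t) ^ 2 ≤ (B - A) * ∫ t in A..B, f t ^ 2 := by
  rcases hAB.eq_or_lt with rfl | hlt
  · simp
  set I := ∫ t in A..B, f t with hI
  have h0 : 0 ≤ ∫ t in A..B, (f t - I / (B - A)) ^ 2 :=
    intervalIntegral.integral_nonneg hAB fun t _ => sq_nonneg _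
  have e : ∫ t in A..B, (f t - I / (B - A)) ^ 2 =
      (∫ t in A..B, f t ^ 2) - I ^ 2 / (B - A) := by
    have : ∀ t, (f t - I / (B - A)) ^ 2 =
        f t ^ 2 - (2 * (I / (B - A))) * f t + (I / (B - A)) ^ 2 := fun t => by ring
    simp only [this]
    rw [intervalIntegral.integral_add (h2.sub (h1.const_mul _)) intervalIntegrable_const,
      intervalIntegral.integral_sub h2 (h1.const_mul _), intervalIntegral.integral_const_mul,
      intervalIntegral.integral_const, ← hI, smul_eq_mul]
    have : B - A ≠ 0 := by linarith
    field_simp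
    ring
  rw [e] at h0
  have hp : 0 < B - A := by linarith
  have := mul_le_mul_of_nonneg_left (sub_nonneg.1 h0) hp.le
  rwa [mul_div_cancel₀ _ hp.ne'] at this

namespace Rep

theorem sum_sub_le (h : Rep R a c μ) (hx : x ∈ IsetOf R) (hy0 : 0 ≤ y) (hyx : y ≤ x)
    (C : Ioi (0 : ℝ) →₀ ℝ) :
    |C.sum fun i r => r * (ph a c μ i y - ph a c μ i x)| ≤
      √(x - y) * ‖C.sum fun i r => r • h.gL i‖ := by
  have hyI := iset_down hx hy0 hyx
  have hs := h.sum_sq_le hx C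
  have i1 : ∀ i : Ioi (0 : ℝ), ∀ Y ∈ IsetOf R, IntervalIntegrable (pv a c μ i) volume 0 Y :=
    fun i Y hY => ((h.weyl i i.2).sol Y hY).int
  have e : ∫ t in y..x, (C.sum fun i r => r * pv a c μ i t) =
      -(C.sum fun i r => r * (ph a c μ i y - ph a c μ i x)) := by
    simp only [Finsupp.sum]
    have i2 : ∀ i : Ioi (0 : ℝ), IntervalIntegrable (pv a c μ i) volume y x := fun i =>
      (i1 i y hyI).symm.trans (i1 i x hx)
    rw [intervalIntegral.integral_finsetSum fun i _ => (i2 i).const_mul _,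
      ← Finset.sum_neg_distrib]
    refine Finset.sum_congr rfl fun i _ => ?_
    rw [intervalIntegral.integral_const_mul,
      ← intervalIntegral.integral_interval_sub_left (i1 i x hx) (i1 i y hyI)]
    simp only [ph, pv, solF]
    ring
  have i3 : ∀ Y ∈ IsetOf R,
      IntervalIntegrable (fun t => C.sum fun i r => r * pv a c μ i t) volume 0 Y := by
    intro Y hY
    exact ii_sum C.support fun i _ => (i1 i Y hY).const_mul (C i)
  have i4 : ∀ Y ∈ IsetOf R,
      IntervalIntegrable (fun t => (C.sum fun i r => r * pv a c μ i t) ^ 2) volume 0 Y := by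
    intro Y hY
    refine (ii_sum C.support fun i _ => ii_sum C.support fun j _ =>
        (h.mul_intable i.2 j.2 hY).const_mul (C i * C j)).congr fun t _ => ?_
    rw [pow_two, Finsupp.sum, Finset.sum_mul_sum]
    exact Finset.sum_congr rfl fun i _ => Finset.sum_congr rfl fun j _ => by ring
  have cs := sq_intervalIntegral_le hyx ((i3 y hyI).symm.trans (i3 x hx))
    ((i4 y hyI).symm.trans (i4 x hx))
  rw [e, neg_sq] at cs
  have m : ∫ t in y..x, (C.sum fun i r => r * pv a c μ i t) ^ 2 ≤
      ∫ t in (0:ℝ)..x, (C.sum fun i r => r * pv a c μ i t) ^ 2 := by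
    apply intervalIntegral.integral_mono_interval hy0 hyx le_rfl _ (i4 x hx)
    exact ae_of_all _ fun t => sq_nonneg _
  apply abs_le_of_sq_le_sq _ (by positivity)
  rw [mul_pow, Real.sq_sqrt (by linarith)]
  exact cs.trans (mul_le_mul_of_nonneg_left (m.trans hs) (by linarith))

theorem exists_kernel (h : Rep R a c μ) :
    ∃ k : ℝ → Lp ℝ 2 μ, (∀ x ∈ IsetOf R, ∀ i : Ioi (0 : ℝ),
        inner ℝ (k x) (h.gL i) = 1 - ph a c μ i x) ∧
      ∀ x ∈ IsetOf R, ∀ y, 0 ≤ y → y ≤ x → ‖k x - k y‖ ≤ √(x - y) := by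
  have main : ∀ x ∈ IsetOf R, ∀ y, 0 ≤ y → y ≤ x → ∃ k : Lp ℝ 2 μ, ‖k‖ ≤ √(x - y) ∧
      ∀ i, inner ℝ k (h.gL i) = ph a c μ i y - ph a c μ i x := fun x hx y hy hyx =>
    riesz_family h.gL _ _ (Real.sqrt_nonneg _) (h.sum_sub_le hx hy hyx)
  have m0 : ∀ x, ∃ k : Lp ℝ 2 μ, x ∈ IsetOf R → ∀ i, inner ℝ k (h.gL i) = 1 - ph a c μ i x := by
    intro x
    by_cases hx : x ∈ IsetOf R
    · obtain ⟨k, -, hk⟩ := main x hx 0 le_rfl hx.1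
      refine ⟨k, fun _ i => ?_⟩
      rw [hk i]
      simp [ph, solF]
    · exact ⟨0, fun hx' => absurd hx' hx⟩
  choose k hk using m0
  refine ⟨k, hk, fun x hx y hy hyx => ?_⟩
  obtain ⟨k', h1, h2⟩ := main x hx y hy hyx
  have : k x - k y - k' = 0 := h.eq_zero_of_inner _ fun i => by
    rw [inner_sub_left, inner_sub_left, hk x hx, hk y (iset_down hx hy hyx), h2]
    ring
  rw [sub_eq_zero.1 this]
  exact h1

end Rep
end

section
variable {X x y t s ξ η c N : ℝ} {a μ : Measure ℝ} {R : ℝ≥0∞} {F : ℝ → ℝ}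

theorem fact_term_le {r : ℝ} (hr : 0 ≤ r) (n : ℕ) :
    r ^ n / (n.factorial : ℝ) ^ 2 ≤ Real.exp (√r) * (√r ^ n / n.factorial) := by
  have e : r ^ n / (n.factorial : ℝ) ^ 2 = √r ^ n / n.factorial * (√r ^ n / n.factorial) := by
    rw [div_mul_div_comm, ← mul_pow, Real.mul_self_sqrt hr, pow_two]
  rw [e]
  exact mul_le_mul_of_nonneg_right (Real.pow_div_factorial_le_exp _ (Real.sqrt_nonneg _) n)
    (by positivity)

theorem tsum_fact_le {r : ℝ} (hr : 0 ≤ r) :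
    ∑' n : ℕ, r ^ n / (n.factorial : ℝ) ^ 2 ≤ Real.exp (2 * √r) := by
  have h2 := NormedSpace.expSeries_div_hasSum_exp (𝔸 := ℝ) (√r)
  rw [← Real.exp_eq_exp_ℝ] at h2
  have := (summable_fact r).tsum_le_of_sum_le (a₂ := Real.exp (√r) * Real.exp (√r)) fun S => by
    calc _ ≤ ∑ n ∈ S, Real.exp (√r) * (√r ^ n / n.factorial) :=
          Finset.sum_le_sum fun n _ => fact_term_le hr n
      _ = Real.exp (√r) * ∑ n ∈ S, √r ^ n / n.factorial := by rw [Finset.mul_sum]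
      _ ≤ _ := by
          refine mul_le_mul_of_nonneg_left ?_ (Real.exp_nonneg _)
          exact sum_le_hasSum _ (fun n _ => by positivity) h2
  refine this.trans_eq ?_
  rw [← Real.exp_add]
  ring_nf

section
variable {𝕜 : Type*} [RCLike 𝕜] {ζ : 𝕜}

theorem Str.norm_ser_one_le (hF : Str F X) (ζ : 𝕜) (ht : t ∈ Icc 0 X) :
    ‖ser F (fun _ => 1) ζ t‖ ≤ Real.exp (2 * √(‖ζ‖ * (F X * X))) := by
  refine (hF.norm_ser_le Str.one ζ ht).trans ?_
  simp only [one_mul]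
  exact tsum_fact_le (_root_.mul_nonneg (norm_nonneg _)
    (_root_.mul_nonneg (hF.pos ⟨ht.1.trans ht.2, le_rfl⟩) (ht.1.trans ht.2)))

theorem solV_one (F : ℝ → ℝ) (ζ : 𝕜) : solV F ζ 1 0 = ser F (fun _ => 1) ζ := by
  funext t
  simp [solV]

theorem Str.theta_sub_le (hF : Str F X) (ζ : 𝕜) (hy : 0 ≤ y) (hyx : y ≤ x) (hx : x ≤ X) :
    ‖solF F ζ 1 0 x - solF F ζ 1 0 y‖ ≤ Real.exp (2 * √(‖ζ‖ * (F X * X))) * (x - y) := by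
  have e : solF F ζ 1 0 x - solF F ζ 1 0 y = ∫ t in y..x, solV F ζ 1 0 t := by
    rw [← intervalIntegral.integral_interval_sub_left
      ((hF.restrict hx).solV_intable (hy.trans hyx)) ((hF.restrict (hyx.trans hx)).solV_intable hy)]
    simp [solF]
  rw [e]
  have := intervalIntegral.norm_integral_le_of_norm_le_const (a := y) (b := x)
    (f := solV F ζ 1 0) (C := Real.exp (2 * √(‖ζ‖ * (F X * X)))) fun t ht => by
      rw [uIoc_of_le hyx] at ht
      rw [solV_one]
      exact hF.norm_ser_one_le ζ ⟨hy.trans ht.1.le, ht.2.trans hx⟩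
  rwa [abs_of_nonneg (by linarith)] at this

theorem Str.theta_le (hF : Str F X) (ζ : 𝕜) (hx : x ∈ Icc 0 X) :
    ‖solF F ζ 1 0 x‖ ≤ Real.exp (2 * √(‖ζ‖ * (F X * X))) * x := by
  have := hF.theta_sub_le ζ le_rfl hx.1 hx.2
  simpa [solF] using this

end

theorem Str.theta_differentiable (hF : Str F X) (hx : x ∈ Icc 0 X) :
    Differentiable ℂ fun ζ : ℂ => solF F ζ 1 0 x := by
  have hxm : x ∈ Icc 0 x := ⟨hx.1, le_rfl⟩
  have hFx : Str F x := hF.restrict hx.2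
  have e : ∀ ζ : ℂ, solF F ζ 1 0 x = ∑' n : ℕ, ζ ^ n * ((∫ s in (0:ℝ)..x, vit F (fun _ => 1) n s : ℝ) : ℂ) := by
    intro ζ
    have := (hFx.hasSum_int Str.one ζ hxm (w := fun _ => 1) (B := 1) intervalIntegrable_const
      (by simp)).tsum_eq
    simp only [one_mul, RCLike.ofReal_one] at this
    rw [solF, solV_one, zero_add, ← this]
    rfl
  simp only [e]
  intro z
  have h := Complex.differentiableOn_tsum_of_summable_norm
    (u := fun n : ℕ => x * (((‖z‖ + 1) * (F x * x)) ^ n / (n.factorial : ℝ) ^ 2))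
    (U := Metric.ball 0 (‖z‖ + 1))
    (F := fun n (w : ℂ) => w ^ n * ((∫ s in (0:ℝ)..x, vit F (fun _ => 1) n s : ℝ) : ℂ))
    ((summable_fact _).mul_left _) (fun n => by fun_prop)
    (Metric.isOpen_ball (x := (0:ℂ)) (ε := ‖z‖ + 1)) (fun n w hw => by
      have h1 : ‖w‖ ≤ ‖z‖ + 1 := by simpa using (Metric.mem_ball.1 hw).le
      have h2 := hFx.pos hxm
      have h4 := hx.1
      have h3 : ‖∫ s in (0:ℝ)..x, vit F (fun _ => 1) n s‖ ≤ (F x * x) ^ n / (n.factorial : ℝ) ^ 2 * |x - 0| := by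
        apply intervalIntegral.norm_integral_le_of_norm_le_const
        intro t ht
        rw [uIoc_of_le hx.1] at ht
        have ht' : t ∈ Icc 0 x := ⟨ht.1.le, ht.2⟩
        rw [Real.norm_of_nonneg ((hFx.iter Str.one n).pos ht')]
        simpa using hFx.it_le' Str.one n ht'
      rw [sub_zero, abs_of_nonneg hx.1] at h3
      rw [norm_mul, norm_pow, Complex.norm_real]
      calc _ ≤ (‖z‖ + 1) ^ n * ((F x * x) ^ n / (n.factorial : ℝ) ^ 2 * x) := by gcongr
        _ = _ := by rw [mul_pow (‖z‖ + 1)]; ring)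
  exact (h z (by simp)).differentiableAt (Metric.isOpen_ball.mem_nhds (by simp))

/-- The solution of the string equation at `-s` that vanishes at `0` with slope `1`. -/
abbrev thn (a : Measure ℝ) (s x : ℝ) : ℝ := solF (dist a) (-s) 1 0 x

theorem solF_one_cast (F : ℝ → ℝ) (z x : ℝ) :
    solF F (z : ℂ) 1 0 x = ((solF F z 1 0 x : ℝ) : ℂ) := by
  rw [← solF_cast]
  simp

theorem Str.thn_continuous (hF : Str (dist a) X) (hx : x ∈ Icc 0 X) :
    Continuous fun s => thn a s x := by
  have h1 := Complex.continuous_re.comp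
    ((hF.theta_differentiable hx).continuous.comp (Complex.continuous_ofReal.comp continuous_neg))
  refine h1.congr fun z => ?_
  have := solF_one_cast (dist a) (-z) x
  simp only [Function.comp]
  rw [this, Complex.ofReal_re]

theorem Str.thn_continuousOn (hF : Str (dist a) X) (N : ℝ) :
    ContinuousOn (fun p : ℝ × ℝ => thn a p.1 p.2) (Icc 0 N ×ˢ Icc 0 X) := by
  set K := Real.exp (2 * √(N * (dist a X * X))) with hK
  refine continuousOn_prod_of_continuousOn_lipschitzOnWith' _ K.toNNReal ?_ ?_
  · intro s hs
    refine LipschitzOnWith.of_dist_le_mul fun x hx y hy => ?_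
    rw [Real.dist_eq, Real.dist_eq]
    wlog hyx : y ≤ x generalizing x y
    · rw [abs_sub_comm, abs_sub_comm x]
      exact this y hy x hx (le_of_not_ge hyx)
    rw [abs_of_nonneg (show 0 ≤ x - y by linarith),
      Real.coe_toNNReal _ (Real.exp_nonneg _)]
    refine (hF.theta_sub_le (-s) hy.1 hyx hx.2).trans ?_
    refine mul_le_mul_of_nonneg_right ?_ (by linarith)
    have h2 := hF.pos ⟨hx.1.trans hx.2, le_rfl⟩
    have h3 := hx.1.trans hx.2
    rw [norm_neg, Real.norm_of_nonneg hs.1]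
    gcongr
    exact hs.2
  · intro x hx
    exact (hF.thn_continuous hx).continuousOn

theorem thn_meas_eq (h : a (Icc 0 X) < ⊤) (hX : x ∈ Icc 0 X) (s : ℝ) :
    thn a s x = x - s * ∫ y in Icc 0 x, (x - y) * thn a s y ∂a := by
  have := ((str_dist h).sol (ζ := -s) (c := 1) (f₀ := 0) (hX.1.trans hX.2)).meas_eq h hX
  rw [thn, this]
  ring

theorem iter_zero (h : a (Icc 0 X) < ⊤) {D : ℕ → ℝ → ℝ} {C N : ℝ} (hC : 0 ≤ C) (hN : 0 ≤ N)
    (hb : ∀ n, ∀ y ∈ Icc 0 X, |D n y| ≤ C * N ^ n)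
    (hr : ∀ n, ∀ x ∈ Icc 0 X, D n x = -∫ y in Icc 0 x, (x - y) * D (n + 1) y ∂a)
    (hx : x ∈ Icc 0 X) : D 0 x = 0 := by
  have hF0 : 0 ≤ dist a X := ENNReal.toReal_nonneg
  have key : ∀ j n, ∀ x ∈ Icc 0 X,
      |D n x| ≤ C * N ^ (n + j) * (dist a X ^ j * x ^ j / j.factorial) := by
    intro j
    induction j with
    | zero => intro n x hx; simpa using hb n x hx
    | succ j ih =>
      intro n x hx
      have hx0 := hx.1
      have hfin : a (Icc 0 x) < ⊤ := (measure_mono (Icc_subset_Icc_right hx.2)).trans_lt h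
      rw [hr n x hx, abs_neg]
      have := norm_setIntegral_le_of_norm_le_const (μ := a) (s := Icc 0 x) hfin
        (f := fun y => (x - y) * D (n + 1) y)
        (C := C * N ^ (n + 1 + j) * (dist a X ^ j / j.factorial) * (x ^ (j + 1) / (j + 1)))
        (fun y hy => by
          have h1 := ih (n + 1) y ⟨hy.1, hy.2.trans hx.2⟩
          have h2 := sub_mul_pow_le j hy.1 hy.2
          rw [← le_div_iff₀ (by positivity)] at h2
          rw [norm_mul, Real.norm_of_nonneg (sub_nonneg.2 hy.2), Real.norm_eq_abs]
          have h3 := sub_nonneg.2 hy.2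
          calc _ ≤ (x - y) * (C * N ^ (n + 1 + j) * (dist a X ^ j * y ^ j / j.factorial)) := by
                gcongr
            _ = C * N ^ (n + 1 + j) * (dist a X ^ j / j.factorial) * ((x - y) * y ^ j) := by ring
            _ ≤ _ := by gcongr)
      rw [← Real.norm_eq_abs]
      refine this.trans ?_
      have hd : a.real (Icc 0 x) ≤ dist a X :=
        ENNReal.toReal_mono h.ne (measure_mono (Icc_subset_Icc_right hx.2))
      calc _ ≤ C * N ^ (n + 1 + j) * (dist a X ^ j / j.factorial) * (x ^ (j + 1) / (j + 1)) *
            dist a X := by gcongr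
        _ = _ := by
          rw [Nat.factorial_succ, show n + (j + 1) = n + 1 + j by ring]
          push_cast
          field_simp
          ring
  have lim : Tendsto (fun j : ℕ => C * ((N * (dist a X * x)) ^ j / (j.factorial : ℝ))) atTop
      (𝓝 (C * 0)) :=
    (FloorSemiring.tendsto_pow_div_factorial_atTop _).const_mul _
  rw [mul_zero] at lim
  have : |D 0 x| ≤ 0 := ge_of_tendsto' lim fun j => by
    refine (key j 0 x hx).trans_eq ?_
    rw [mul_pow, mul_pow, zero_add]
    ring
  exact abs_eq_zero.1 (le_antisymm this (abs_nonneg _))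

end

section
variable {X x y t s ξ η c N : ℝ} {a μ : Measure ℝ} {R : ℝ≥0∞} {F : ℝ → ℝ}

theorem integrable_compact {ν α : Measure ℝ} {f : ℝ × ℝ → ℝ} (hν : ν (Icc 0 N) < ⊤)
    (hα : α (Icc 0 x) < ⊤) (hf : ContinuousOn f (Icc 0 N ×ˢ Icc 0 x)) :
    Integrable f ((ν.restrict (Icc 0 N)).prod (α.restrict (Icc 0 x))) := by
  have f1 : IsFiniteMeasure (ν.restrict (Icc 0 N)) := ⟨by simpa using hν⟩
  have f2 : IsFiniteMeasure (α.restrict (Icc 0 x)) := ⟨by simpa using hα⟩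
  have e : (ν.restrict (Icc 0 N)).prod (α.restrict (Icc 0 x)) =
      ((ν.restrict (Icc 0 N)).prod (α.restrict (Icc 0 x))).restrict (Icc 0 N ×ˢ Icc 0 x) := by
    rw [← Measure.prod_restrict]
    simp
  obtain ⟨C, hC⟩ := (isCompact_Icc.prod isCompact_Icc).exists_bound_of_continuousOn hf
  have hm : MeasurableSet (Icc (0:ℝ) N ×ˢ Icc (0:ℝ) x) := measurableSet_Icc.prod measurableSet_Icc
  rw [e]
  exact Integrable.of_bound (hf.aestronglyMeasurable hm) C
    (by filter_upwards [ae_restrict_mem hm] with p hp using hC p hp)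

theorem swap_compact {ν α : Measure ℝ} {f : ℝ → ℝ → ℝ} (hν : ν (Icc 0 N) < ⊤)
    (hα : α (Icc 0 x) < ⊤) (hf : ContinuousOn f.uncurry (Icc 0 N ×ˢ Icc 0 x)) :
    ∫ s in Icc 0 N, ∫ y in Icc 0 x, f s y ∂α ∂ν = ∫ y in Icc 0 x, ∫ s in Icc 0 N, f s y ∂ν ∂α := by
  have f1 : IsFiniteMeasure (ν.restrict (Icc 0 N)) := ⟨by simpa using hν⟩
  have f2 : IsFiniteMeasure (α.restrict (Icc 0 x)) := ⟨by simpa using hα⟩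
  exact integral_integral_swap (integrable_compact hν hα hf)

namespace Rep

theorem measure_Icc_lt (h : Rep R a c μ) (hN : 0 ≤ N) : μ (Icc 0 N) < ⊤ := by
  have hN' : 0 < (1 + N)⁻¹ := by positivity
  have := h.int.measure_norm_ge_lt_top hN'
  refine (measure_mono fun s hs => ?_).trans_lt this
  have h0 := hs.1
  simp only [mem_setOf_eq]
  rw [Real.norm_of_nonneg (by positivity)]
  exact inv_anti₀ (by positivity) (by linarith [hs.2])

/-- A representing kernel for the values of the decaying solutions. -/
def ker (h : Rep R a c μ) : ℝ → Lp ℝ 2 μ := h.exists_kernel.choose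

theorem inner_ker (h : Rep R a c μ) (hx : x ∈ IsetOf R) (i : Ioi (0:ℝ)) :
    inner ℝ (h.ker x) (h.gL i) = 1 - ph a c μ i x := h.exists_kernel.choose_spec.1 x hx i

theorem norm_ker_sub_le (h : Rep R a c μ) (hx : x ∈ IsetOf R) (hy : 0 ≤ y) (hyx : y ≤ x) :
    ‖h.ker x - h.ker y‖ ≤ √(x - y) := h.exists_kernel.choose_spec.2 x hx y hy hyx

theorem ker_zero (h : Rep R a c μ) : h.ker 0 = 0 :=
  h.eq_zero_of_inner _ fun i => by
    rw [h.inner_ker (zero_mem_iset h.pos)]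
    simp [ph, solF]

theorem norm_ker_le (h : Rep R a c μ) (hx : x ∈ IsetOf R) : ‖h.ker x‖ ≤ √x := by
  have := h.norm_ker_sub_le hx le_rfl hx.1
  simpa [h.ker_zero] using this

theorem ker_cont (h : Rep R a c μ) (hX : X ∈ IsetOf R) : ContinuousOn h.ker (Icc 0 X) := by
  intro x hx
  have h1 : ∀ y ∈ Icc 0 X, ‖h.ker y - h.ker x‖ ≤ √|y - x| := by
    intro y hy
    rcases le_total x y with hxy | hxy
    · rw [abs_of_nonneg (by linarith)]
      exact h.norm_ker_sub_le (iset_down hX hy.1 hy.2) hx.1 hxy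
    · rw [abs_of_nonpos (by linarith), norm_sub_rev, neg_sub]
      exact h.norm_ker_sub_le (iset_down hX hx.1 hx.2) hy.1 hxy
  rw [ContinuousWithinAt, tendsto_iff_norm_sub_tendsto_zero]
  refine squeeze_zero' (Eventually.of_forall fun y => norm_nonneg _)
    (by filter_upwards [self_mem_nhdsWithin] with y hy using h1 y hy) ?_
  have : ContinuousAt (fun y => √|y - x|) x := by fun_prop
  simpa using this.tendsto.mono_left nhdsWithin_le_nhds

/-- The double integral of the kernel against the mass. -/
def kerI (h : Rep R a c μ) (x : ℝ) : Lp ℝ 2 μ := ∫ y in Icc 0 x, (x - y) • h.ker y ∂a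

theorem ker_integrableOn (h : Rep R a c μ) (hx : x ∈ IsetOf R) :
    IntegrableOn (fun y => (x - y) • h.ker y) (Icc 0 x) a := by
  have hf : ContinuousOn (fun y => (x - y) • h.ker y) (Icc 0 x) :=
    ContinuousOn.smul (f := fun y => x - y) (by fun_prop) (h.ker_cont hx)
  obtain ⟨C, hC⟩ := isCompact_Icc.exists_bound_of_continuousOn hf
  have : IsFiniteMeasure (a.restrict (Icc 0 x)) := ⟨by simpa using h.fin.2 x hx⟩
  exact Integrable.of_bound (hf.aestronglyMeasurable measurableSet_Icc) C
    (by filter_upwards [ae_restrict_mem measurableSet_Icc] with t ht using hC t ht)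

theorem inner_kerI (h : Rep R a c μ) (hx : x ∈ IsetOf R) (u : Lp ℝ 2 μ) :
    inner ℝ u (h.kerI x) = ∫ y in Icc 0 x, (x - y) * inner ℝ u (h.ker y) ∂a := by
  rw [kerI, ← integral_inner (h.ker_integrableOn hx)]
  simp only [real_inner_smul_right]

theorem ker_eq (h : Rep R a c μ) (hx : x ∈ IsetOf R) :
    ∀ᵐ s ∂μ, h.ker x s + s * h.kerI x s = x := by
  have i0 : ∀ u : Lp ℝ 2 μ, Integrable (fun s => u s * (1 / (1 + s))) μ := fun u =>
    h.int_mul_frac (Lp.memLp u) one_pos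
  have bd : Integrable (fun s => h.ker x s * (1 / (1 + s)) * (1 / (1 + s)) +
      h.kerI x s * (1 / (1 + s)) * (s * (1 / (1 + s))) -
      x * (1 / (1 + s) * (1 / (1 + s)))) μ := by
    refine (((i0 _).mul_bdd (c := 1) (by fun_prop : Measurable _).aestronglyMeasurable ?_).add
      ((i0 _).mul_bdd (c := 1) (by fun_prop : Measurable _).aestronglyMeasurable ?_)).sub
      ((h.int_mul one_pos one_pos).const_mul x)
    · filter_upwards [h.ae_nonneg] with s hs
      rw [Real.norm_of_nonneg (by positivity)]
      exact frac_le_one one_pos hs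
    · filter_upwards [h.ae_nonneg] with s hs
      rw [Real.norm_of_nonneg (by positivity), mul_one_div]
      exact (div_le_one (by positivity)).2 (by linarith)
  have := ae_zero_of_frac h.ae_nonneg bd fun ξ hξ => by
    have hξ0 : 0 < ξ := by linarith
    have hx1 : ξ - 1 ≠ 0 := by linarith
    let i1 : Ioi (0:ℝ) := ⟨1, mem_Ioi.2 one_pos⟩
    let iξ : Ioi (0:ℝ) := ⟨ξ, hξ0⟩
    have a1 := h.inner_ker hx i1
    have aξ := h.inner_ker hx iξ
    have b1 := h.inner_kerI hx (h.gL i1)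
    have bξ := h.inner_kerI hx (h.gL iξ)
    have m1 := ((h.weyl 1 one_pos).sol x hx).meas_eq (h.fin.2 x hx) ⟨hx.1, le_rfl⟩
    have mξ := ((h.weyl ξ hξ0).sol x hx).meas_eq (h.fin.2 x hx) ⟨hx.1, le_rfl⟩
    have k : ∀ i : Ioi (0:ℝ), ∫ y in Icc 0 x, (x - y) * inner ℝ (h.gL i) (h.ker y) ∂a =
        (∫ y in Icc 0 x, (x - y) ∂a) - ∫ y in Icc 0 x, (x - y) * ph a c μ i y ∂a := by
      intro i
      have c1 : ContinuousOn (fun y => x - y) (Icc 0 x) := by fun_prop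
      have c2 : ContinuousOn (fun y => (x - y) * ph a c μ i y) (Icc 0 x) :=
        c1.mul (((h.weyl i i.2).sol x hx).f_cont hx.1)
      rw [← integral_sub (integrableOn_mass (h.fin.2 x hx) c1)
        (integrableOn_mass (h.fin.2 x hx) c2)]
      refine setIntegral_congr_fun measurableSet_Icc fun y hy => ?_
      rw [real_inner_comm, h.inner_ker (iset_down hx hy.1 hy.2)]
      ring
    have g := h.psi_gram hξ0 one_pos
    rw [k, real_inner_comm, h.inner_gL] at b1 bξ
    rw [h.inner_gL] at a1 aξ
    simp only [i1, iξ, ph] at a1 aξ b1 bξ m1 mξ g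
    have e : ∫ s, (h.ker x s * (1 / (1 + s)) * (1 / (1 + s)) +
        h.kerI x s * (1 / (1 + s)) * (s * (1 / (1 + s))) -
        x * (1 / (1 + s) * (1 / (1 + s)))) * ((1 + s) / (ξ + s)) ∂μ =
        ∫ s, ((ξ - 1)⁻¹ * (h.ker x s * (1 / (1 + s))) - ((ξ - 1)⁻¹ * ξ⁻¹) *
          (h.ker x s * (ξ / (ξ + s))) + (ξ - 1)⁻¹ * (h.kerI x s * (ξ / (ξ + s))) -
          (ξ - 1)⁻¹ * (h.kerI x s * (1 / (1 + s))) - (x * ξ⁻¹) *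
          (ξ / (ξ + s) * (1 / (1 + s)))) ∂μ := by
      apply integral_congr_ae
      filter_upwards [h.ae_nonneg] with s hs
      field_simp
      ring
    have j1 := (h.int_mul_frac (Lp.memLp (h.ker x)) one_pos).const_mul (ξ - 1)⁻¹
    have j2 := (h.int_mul_frac (Lp.memLp (h.ker x)) hξ0).const_mul ((ξ - 1)⁻¹ * ξ⁻¹)
    have j3 := (h.int_mul_frac (Lp.memLp (h.kerI x)) hξ0).const_mul (ξ - 1)⁻¹
    have j4 := (h.int_mul_frac (Lp.memLp (h.kerI x)) one_pos).const_mul (ξ - 1)⁻¹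
    have j5 := (h.int_mul hξ0 one_pos).const_mul (x * ξ⁻¹)
    rw [e, integral_sub (by exact ((j1.sub j2).add j3).sub j4) j5,
      integral_sub (by exact (j1.sub j2).add j3) j4, integral_add (by exact j1.sub j2) j3,
      integral_sub j1 j2, integral_const_mul, integral_const_mul,
      integral_const_mul, integral_const_mul, integral_const_mul, a1, aξ, b1, bξ]
    rw [m1, mξ]
    generalize (∫ s, ξ / (ξ + s) * (1 / (1 + s)) ∂μ) = G at g ⊢
    field_simp
    linear_combination (x * g)
  filter_upwards [this, h.ae_nonneg] with s h1 h2
  have h3 : (1 + s) ≠ 0 := by positivity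
  simp only [Pi.zero_apply] at h1
  field_simp at h1
  linarith

end Rep
end

section
variable {X x y t s ξ η c N : ℝ} {a μ : Measure ℝ} {R : ℝ≥0∞} {F : ℝ → ℝ}

namespace Rep

theorem memLp_pow (h : Rep R a c μ) (hN : 0 ≤ N) {S : Set ℝ} (hS : MeasurableSet S)
    (hSN : S ⊆ Icc 0 N) (n : ℕ) : MemLp (S.indicator fun s => s ^ n) 2 μ := by
  rw [memLp_indicator_iff_restrict hS]
  have hf : IsFiniteMeasure (μ.restrict S) :=
    ⟨by simpa using (measure_mono hSN).trans_lt (h.measure_Icc_lt hN)⟩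
  refine MemLp.of_bound (by fun_prop : Measurable _).aestronglyMeasurable (N ^ n) ?_
  filter_upwards [ae_restrict_mem hS] with s hs
  rw [norm_pow, Real.norm_of_nonneg (hSN hs).1]
  exact pow_le_pow_left₀ (hSN hs).1 (hSN hs).2 n

theorem inner_memLp_pow (h : Rep R a c μ) (hN : 0 ≤ N) {S : Set ℝ} (hS : MeasurableSet S)
    (hSN : S ⊆ Icc 0 N) (n : ℕ) (u : Lp ℝ 2 μ) :
    inner ℝ ((h.memLp_pow hN hS hSN n).toLp) u = ∫ s in S, s ^ n * u s ∂μ := by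
  rw [L2.inner_def, ← integral_indicator hS]
  apply integral_congr_ae
  filter_upwards [(h.memLp_pow hN hS hSN n).coeFn_toLp] with s hs
  rw [hs]
  by_cases hm : s ∈ S
  · simp [hm, mul_comm]
  · simp [hm]

theorem setIntegral_ker_sub (h : Rep R a c μ) (hX : X ∈ IsetOf R) (hN : 0 ≤ N) {T : Set ℝ}
    (hT : MeasurableSet T) : ∫ s in Icc 0 N ∩ T, (h.ker X s - thn a s X) ∂μ = 0 := by
  set S := Icc 0 N ∩ T with hSdef
  have hS : MeasurableSet S := measurableSet_Icc.inter hT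
  have hSN : S ⊆ Icc 0 N := inter_subset_left
  have hfin : μ S < ⊤ := (measure_mono hSN).trans_lt (h.measure_Icc_lt hN)
  have hf : IsFiniteMeasure (μ.restrict S) := ⟨by simpa using hfin⟩
  have hst := h.str hX
  have haX := h.fin.2 X hX
  have hS2 : μ.restrict S = (μ.restrict T).restrict (Icc 0 N) := by
    rw [Measure.restrict_restrict measurableSet_Icc]
  have hTN : (μ.restrict T) (Icc 0 N) < ⊤ :=
    (Measure.restrict_apply_le _ _).trans_lt (h.measure_Icc_lt hN)
  let q : ℕ → Lp ℝ 2 μ := fun n => (h.memLp_pow hN hS hSN n).toLp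
  set B := Real.exp (2 * √(N * (dist a X * X))) * X with hB
  have hF0 : 0 ≤ dist a X := ENNReal.toReal_nonneg
  have hX0 := hX.1
  have hBth : ∀ y ∈ Icc 0 X, ∀ s ∈ S, |thn a s y| ≤ B := by
    intro y hy s hs
    refine (hst.theta_le (-s) hy).trans ?_
    have h1 := (hSN hs).1
    rw [norm_neg, Real.norm_of_nonneg h1, hB]
    have hy0 := hy.1
    gcongr
    · exact (hSN hs).2
    · exact hy.2
  have hB0 : 0 ≤ B := by positivity
  have bnd : ∀ n, ∀ y ∈ Icc 0 X, ∀ s ∈ S, ‖s ^ n * thn a s y‖ ≤ N ^ n * B := by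
    intro n y hy s hs
    rw [norm_mul, norm_pow, Real.norm_of_nonneg (hSN hs).1]
    exact mul_le_mul (pow_le_pow_left₀ (hSN hs).1 (hSN hs).2 n) (hBth y hy s hs) (norm_nonneg _)
      (by positivity)
  have cth : ∀ y ∈ Icc 0 X, Continuous fun s => thn a s y := fun y hy => hst.thn_continuous hy
  have ith : ∀ n, ∀ y ∈ Icc 0 X, IntegrableOn (fun s => s ^ n * thn a s y) S μ := by
    intro n y hy
    have := cth y hy
    refine Integrable.of_bound (by fun_prop : Continuous _).aestronglyMeasurable (N ^ n * B) ?_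
    filter_upwards [ae_restrict_mem hS] with s hs using bnd n y hy s hs
  have ipow : ∀ n, IntegrableOn (fun s => s ^ n) S μ := by
    intro n
    refine Integrable.of_bound (by fun_prop : Continuous _).aestronglyMeasurable (N ^ n) ?_
    filter_upwards [ae_restrict_mem hS] with s hs
    rw [norm_pow, Real.norm_of_nonneg (hSN hs).1]
    exact pow_le_pow_left₀ (hSN hs).1 (hSN hs).2 n
  let D : ℕ → ℝ → ℝ := fun n y => inner ℝ (q n) (h.ker y) - ∫ s in S, s ^ n * thn a s y ∂μ
  have hr : ∀ n, ∀ x ∈ Icc 0 X, D n x = -∫ y in Icc 0 x, (x - y) * D (n + 1) y ∂a := by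
    intro n x hx
    have hxI := iset_down hX hx.1 hx.2
    have hax := h.fin.2 x hxI
    have hcont : ContinuousOn (fun p : ℝ × ℝ => (x - p.2) * (p.1 ^ (n + 1) * thn a p.1 p.2))
        (Icc 0 N ×ˢ Icc 0 x) := by
      refine ContinuousOn.mul (by fun_prop) (ContinuousOn.mul (by fun_prop) ?_)
      exact (h.str hxI).thn_continuousOn N
    have sw := swap_compact (f := fun s y => (x - y) * (s ^ (n + 1) * thn a s y)) hTN hax hcont
    rw [← hS2] at sw
    have ip : IntegrableOn (fun y => (x - y) * ∫ s in S, s ^ (n + 1) * thn a s y ∂μ)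
        (Icc 0 x) a := by
      have f2 : IsFiniteMeasure (a.restrict (Icc 0 x)) := ⟨by simpa using hax⟩
      have f3 : IsFiniteMeasure ((μ.restrict T).restrict (Icc 0 N)) := ⟨by simpa using hTN⟩
      have := (integrable_compact hTN hax hcont).integral_prod_right
      rw [← hS2] at this
      simp only [integral_const_mul] at this
      exact this
    have ik : IntegrableOn (fun y => (x - y) * inner ℝ (q (n + 1)) (h.ker y)) (Icc 0 x) a := by
      refine integrableOn_mass hax (ContinuousOn.mul (by fun_prop) ?_)
      exact ContinuousOn.inner continuousOn_const (h.ker_cont hxI)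
    have e1 : inner ℝ (q n) (h.ker x) = x * (∫ s in S, s ^ n ∂μ) -
        ∫ y in Icc 0 x, (x - y) * inner ℝ (q (n + 1)) (h.ker y) ∂a := by
      rw [← h.inner_kerI hxI, h.inner_memLp_pow hN hS hSN, h.inner_memLp_pow hN hS hSN,
        ← integral_const_mul, ← integral_sub ((ipow n).const_mul x)]
      · apply integral_congr_ae
        filter_upwards [ae_restrict_of_ae (h.ker_eq hxI)] with s hs
        rw [pow_succ]
        linear_combination (s ^ n) * hs
      · have := L2.integrable_inner (𝕜 := ℝ) (q (n + 1)) (h.kerI x)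
        refine (this.integrableOn (s := S)).congr ?_
        filter_upwards [ae_restrict_of_ae (h.memLp_pow hN hS hSN (n + 1)).coeFn_toLp,
          ae_restrict_mem hS] with s hs hm
        simp only [q]
        rw [hs]
        simp [hm, mul_comm]
    have e2 : ∫ s in S, s ^ n * thn a s x ∂μ = x * (∫ s in S, s ^ n ∂μ) -
        ∫ y in Icc 0 x, (x - y) * ∫ s in S, s ^ (n + 1) * thn a s y ∂μ ∂a := by
      simp only [← integral_const_mul (_ - _)]
      rw [← sw]
      have : ∀ s, s ^ n * thn a s x =
          x * s ^ n - ∫ y in Icc 0 x, (x - y) * (s ^ (n + 1) * thn a s y) ∂a := by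
        intro s
        rw [thn_meas_eq haX hx s]
        have : ∀ y, (x - y) * (s ^ (n + 1) * thn a s y) =
            s ^ (n + 1) * ((x - y) * thn a s y) := fun y => by ring
        simp only [this]
        rw [integral_const_mul, pow_succ]
        ring
      simp only [this]
      rw [integral_sub ((ipow n).const_mul x), integral_const_mul]
      have := (ith n x hx).sub ((ipow n).const_mul x)
      refine this.neg.congr (ae_of_all _ fun s => ?_)
      simp only [Pi.neg_apply, Pi.sub_apply]
      rw [‹∀ s, s ^ n * thn a s x = _› s]
      ring
    simp only [D]
    rw [e1, e2]
    simp only [mul_sub]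
    rw [integral_sub ik ip]
    ring
  have hq : ∀ n, ‖q n‖ ≤ N ^ n * ‖q 0‖ := by
    intro n
    refine Lp.norm_le_mul_norm_of_ae_le_mul ?_
    filter_upwards [(h.memLp_pow hN hS hSN n).coeFn_toLp,
      (h.memLp_pow hN hS hSN 0).coeFn_toLp] with s h1 h2
    simp only [q]
    rw [h1, h2]
    by_cases hm : s ∈ S
    · simp only [hm, indicator_of_mem, pow_zero, norm_one, mul_one]
      rw [norm_pow, Real.norm_of_nonneg (hSN hm).1]
      exact pow_le_pow_left₀ (hSN hm).1 (hSN hm).2 n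
    · simp [hm]
  have hD := iter_zero haX (D := D) (C := ‖q 0‖ * √X + B * μ.real S) (N := N)
    (by positivity) hN (fun n y hy => by
      have h1 := abs_real_inner_le_norm (q n) (h.ker y)
      have h2 := h.norm_ker_le (iset_down hX hy.1 hy.2)
      have h3 := norm_setIntegral_le_of_norm_le_const hfin (bnd n y hy)
      have h4 := hq n
      have h5 : √y ≤ √X := Real.sqrt_le_sqrt hy.2
      have h6 : |inner ℝ (q n) (h.ker y)| ≤ N ^ n * ‖q 0‖ * √X :=
        h1.trans (mul_le_mul h4 (h2.trans h5) (norm_nonneg _) (by positivity))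
      rw [Real.norm_eq_abs] at h3
      refine (abs_sub _ _).trans ((add_le_add h6 h3).trans_eq ?_)
      ring) hr (x := X) ⟨hX0, le_rfl⟩
  have hXX : X ∈ Icc 0 X := ⟨hX0, le_rfl⟩
  simp only [D, q] at hD
  rw [h.inner_memLp_pow hN hS hSN] at hD
  simp only [pow_zero, one_mul] at hD
  have i1 : IntegrableOn (fun s => h.ker X s) S μ := by
    have := L2.integrable_inner (𝕜 := ℝ) (q 0) (h.ker X)
    refine (this.integrableOn (s := S)).congr ?_
    filter_upwards [ae_restrict_of_ae (h.memLp_pow hN hS hSN 0).coeFn_toLp,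
      ae_restrict_mem hS] with s hs hm
    simp only [q]
    rw [hs]
    simp [hm]
  have i2 := ith 0 X hXX
  simp only [pow_zero, one_mul] at i2
  rw [integral_sub i1 i2]
  exact hD

theorem ker_ae (h : Rep R a c μ) (hX : X ∈ IsetOf R) :
    ∀ᵐ s ∂μ, h.ker X s = thn a s X := by
  have key : ∀ N : ℕ, ∀ᵐ s ∂μ.restrict (Icc 0 (N : ℝ)), h.ker X s = thn a s X := by
    intro N
    have hN : (0:ℝ) ≤ N := Nat.cast_nonneg N
    have hf : IsFiniteMeasure (μ.restrict (Icc 0 (N:ℝ))) :=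
      ⟨by simpa using h.measure_Icc_lt hN⟩
    have i1 : Integrable (fun s => h.ker X s) (μ.restrict (Icc 0 (N:ℝ))) :=
      ((Lp.memLp (h.ker X)).restrict _).integrable one_le_two
    have hXX : X ∈ Icc 0 X := ⟨hX.1, le_rfl⟩
    have i2 : Integrable (fun s => thn a s X) (μ.restrict (Icc 0 (N:ℝ))) :=
      integrableOn_mass (h.measure_Icc_lt hN) ((h.str hX).thn_continuous hXX).continuousOn
    have := (i1.sub i2).ae_eq_zero_of_forall_setIntegral_eq_zero fun T hT _ => by
      rw [Measure.restrict_restrict hT, inter_comm]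
      exact h.setIntegral_ker_sub hX hN hT
    filter_upwards [this] with s hs
    exact sub_eq_zero.1 hs
  have key' := ae_all_iff.2 fun N => (ae_restrict_iff' measurableSet_Icc).1 (key N)
  filter_upwards [key', h.ae_nonneg] with s h1 h2
  obtain ⟨N, hN⟩ := exists_nat_ge s
  exact h1 N ⟨h2, hN⟩

theorem thn_memLp (h : Rep R a c μ) (hx : x ∈ IsetOf R) : MemLp (fun s => thn a s x) 2 μ :=
  (memLp_congr_ae (h.ker_ae hx)).1 (Lp.memLp _)

theorem ph_eq (h : Rep R a c μ) (hx : x ∈ IsetOf R) (hξ : 0 < ξ) :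
    ph a c μ ξ x = 1 - ∫ s, thn a s x * (ξ / (ξ + s)) ∂μ := by
  have h1 := h.inner_ker hx ⟨ξ, hξ⟩
  rw [h.inner_gL] at h1
  have e : ∫ s, h.ker x s * (ξ / (ξ + s)) ∂μ = ∫ s, thn a s x * (ξ / (ξ + s)) ∂μ := by
    apply integral_congr_ae
    filter_upwards [h.ker_ae hx] with s hs
    rw [hs]
  simp only [e] at h1
  linarith

theorem integral_thn_sub_sq_le (h : Rep R a c μ) (hx : x ∈ IsetOf R) (hy : 0 ≤ y) (hyx : y ≤ x) :
    ∫ s, (thn a s x - thn a s y) ^ 2 ∂μ ≤ x - y := by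
  have h1 := h.norm_ker_sub_le hx hy hyx
  have h2 : ‖h.ker x - h.ker y‖ ^ 2 ≤ x - y := by
    refine (pow_le_pow_left₀ (norm_nonneg _) h1 2).trans_eq (Real.sq_sqrt (by linarith))
  rw [← real_inner_self_eq_norm_sq, L2.inner_def] at h2
  refine le_trans (le_of_eq ?_) h2
  apply integral_congr_ae
  filter_upwards [h.ker_ae hx, h.ker_ae (iset_down hx hy hyx),
    Lp.coeFn_sub (h.ker x) (h.ker y)] with s e1 e2 e3
  rw [e3, Pi.sub_apply, e1, e2]
  simp [pow_two]

theorem integral_thn_sq_le (h : Rep R a c μ) (hx : x ∈ IsetOf R) :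
    ∫ s, thn a s x ^ 2 ∂μ ≤ x := by
  simpa [solF] using h.integral_thn_sub_sq_le hx le_rfl hx.1

end Rep
end

section
variable {X x y t s δ κ : ℝ} {a : Measure ℝ} {ζ : ℂ} {f v : ℝ → ℂ}

/-- The quantitative avoidance of the negative half-line by `ζ`. -/
def Sect (δ : ℝ) (ζ : ℂ) : Prop := ∀ P Q : ℝ, 0 ≤ P → 0 ≤ Q →
  δ * P ^ 2 ≤ ‖(P : ℂ) + ζ * Q‖ ^ 2 ∧ δ * (‖ζ‖ * Q) ^ 2 ≤ ‖(P : ℂ) + ζ * Q‖ ^ 2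

theorem sect_of_re (hκ : 0 ≤ κ) (h : -κ * ‖ζ‖ ≤ ζ.re) : Sect (1 - κ ^ 2) ζ := by
  intro P Q hP hQ
  have e : ‖(P : ℂ) + ζ * Q‖ ^ 2 = P ^ 2 + 2 * (P * Q) * ζ.re + (‖ζ‖ * Q) ^ 2 := by
    rw [mul_pow, ← Complex.normSq_eq_norm_sq, ← Complex.normSq_eq_norm_sq, Complex.normSq_apply,
      Complex.normSq_apply]
    simp
    ring
  have h1 : -(κ * ‖ζ‖) * (P * Q) ≤ ζ.re * (P * Q) :=
    mul_le_mul_of_nonneg_right (by linarith) (mul_nonneg hP hQ)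
  rw [e]
  constructor
  · nlinarith [sq_nonneg (κ * P - ‖ζ‖ * Q)]
  · nlinarith [sq_nonneg (P - κ * (‖ζ‖ * Q))]

theorem exists_sect (h : ζ ∈ Complex.slitPlane) : ∃ δ > 0, ∀ᶠ z in 𝓝 ζ, Sect δ z := by
  have hz : ζ ≠ 0 := Complex.slitPlane_ne_zero h
  have hn : 0 < ‖ζ‖ := norm_pos_iff.2 hz
  have h1 : -‖ζ‖ < ζ.re := by
    rcases h with h | h
    · linarith
    · have := Complex.abs_re_lt_norm.2 h
      exact (abs_lt.1 this).1
  obtain ⟨q, hq1, hq2⟩ := exists_between (show max 0 (-ζ.re / ‖ζ‖) < 1 by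
    rw [max_lt_iff]; exact ⟨one_pos, (div_lt_one hn).2 (by linarith)⟩)
  have hq0 : 0 ≤ q := (le_max_left _ _).trans hq1.le
  have hq3 : -ζ.re / ‖ζ‖ < q := (le_max_right _ _).trans_lt hq1
  have h2 : -q * ‖ζ‖ < ζ.re := by
    rw [div_lt_iff₀ hn] at hq3
    linarith
  refine ⟨1 - q ^ 2, by nlinarith, ?_⟩
  have hc : ContinuousAt (fun z : ℂ => z.re + q * ‖z‖) ζ := by fun_prop
  filter_upwards [hc.eventually (lt_mem_nhds (show 0 < ζ.re + q * ‖ζ‖ by linarith))] with z hz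
  exact sect_of_re hq0 (by linarith)

theorem Sol.norm_sq_intable (S : Sol (dist a) X ζ 1 0 f v) (h : a (Icc 0 X) < ⊤) (hX : 0 ≤ X) :
    IntervalIntegrable (fun t => ‖v t‖ ^ 2) volume 0 X := by
  obtain ⟨B, hB⟩ := S.v_bdd (str_dist h) hX
  rw [intervalIntegrable_iff_integrableOn_Ioc_of_le hX]
  have i := S.int
  rw [intervalIntegrable_iff_integrableOn_Ioc_of_le hX] at i
  refine Integrable.of_bound (C := B ^ 2) (i.aestronglyMeasurable.norm.pow 2) ?_
  filter_upwards [ae_restrict_mem measurableSet_Ioc] with s hs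
  rw [norm_pow, norm_norm]
  exact pow_le_pow_left₀ (norm_nonneg _) (hB s ⟨hs.1.le, hs.2⟩) 2

theorem Sol.energy (S : Sol (dist a) X ζ 1 0 f v) (h : a (Icc 0 X) < ⊤) (hX : 0 ≤ X) :
    ∃ Q : ℝ, 0 ≤ Q ∧
      v X * (starRingEnd ℂ) (f X) = ((∫ t in (0:ℝ)..X, ‖v t‖ ^ 2 : ℝ) : ℂ) + ζ * Q := by
  have hF := str_dist h
  have hXX : X ∈ Icc 0 X := ⟨hX, le_rfl⟩
  let r : ℝ → ℝ := fun t => 2 * ((v t).re * (f t).re + (v t).im * (f t).im)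
  have fc := S.f_cont hX
  have ir : IntervalIntegrable r volume 0 X := by
    have h1 : IntervalIntegrable (fun t => (v t).re) volume 0 X := ⟨S.int.1.re, S.int.2.re⟩
    have h2 : IntervalIntegrable (fun t => (v t).im) volume 0 X := ⟨S.int.1.im, S.int.2.im⟩
    rw [← uIcc_of_le hX] at fc
    exact ((h1.mul_continuousOn (Complex.continuous_re.comp_continuousOn fc)).add
      (h2.mul_continuousOn (Complex.continuous_im.comp_continuousOn fc))).const_mul 2
  have iFr : IntervalIntegrable (fun t => dist a t * r t) volume 0 X := by
    simpa using hF.mul_intable ir hXX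
  have dre : ∀ t ∈ Ico 0 X, HasDerivWithinAt (fun t => (f t).re) (v t).re (Ici t) t :=
    fun t ht => Complex.reCLM.hasFDerivAt.comp_hasDerivWithinAt t (S.f_deriv hF ht)
  have dim : ∀ t ∈ Ico 0 X, HasDerivWithinAt (fun t => (f t).im) (v t).im (Ici t) t :=
    fun t ht => Complex.imCLM.hasFDerivAt.comp_hasDerivWithinAt t (S.f_deriv hF ht)
  have dcj : ∀ t ∈ Ico 0 X, HasDerivWithinAt (fun t => (starRingEnd ℂ) (f t))
      ((starRingEnd ℂ) (v t)) (Ici t) t :=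
    fun t ht => Complex.conjCLE.toContinuousLinearMap.hasFDerivAt.comp_hasDerivWithinAt t
      (S.f_deriv hF ht)
  have hf0 : f 0 = 0 := S.f_zero hX
  let n : ℝ → ℝ := fun t => (f t).re ^ 2 + (f t).im ^ 2
  have n_eq : ∀ t ∈ Icc 0 X, n t = 0 + ∫ s in (0:ℝ)..t, r s := by
    intro t ht
    rw [intervalIntegral.integral_eq_sub_of_hasDeriv_right_of_le (f := n) ht.1]
    · simp [n, hf0]
    · have := fc.mono (Icc_subset_Icc_right ht.2)
      exact ((Complex.continuous_re.comp_continuousOn this).pow 2).add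
        ((Complex.continuous_im.comp_continuousOn this).pow 2)
    · intro s hs
      have hs' : s ∈ Ico 0 X := ⟨hs.1.le, hs.2.trans_le ht.2⟩
      refine HasDerivWithinAt.mono ?_ Ioi_subset_Ici_self
      refine (((dre s hs').pow 2).add ((dim s hs').pow 2)).congr_deriv ?_
      simp only [r]
      ring
    · exact sub_int ir le_rfl ht.1 ht.2
  have ip := int_parts h ir n_eq le_rfl hX le_rfl
  have n0 : n 0 = 0 := by simp [n, hf0]
  rw [n0, mul_zero, sub_zero] at ip
  have hp : (v X - ζ * (dist a X * f X)) * (starRingEnd ℂ) (f X) =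
      ∫ t in (0:ℝ)..X, (((‖v t‖ ^ 2 : ℝ) : ℂ) - ζ * ((dist a t * r t : ℝ) : ℂ)) := by
    have iv := S.norm_sq_intable h hX
    have iv' : IntervalIntegrable (fun t => ((‖v t‖ ^ 2 : ℝ) : ℂ)) volume 0 X :=
      ⟨iv.1.ofReal, iv.2.ofReal⟩
    have iFr' : IntervalIntegrable (fun t => ((dist a t * r t : ℝ) : ℂ)) volume 0 X :=
      ⟨iFr.1.ofReal, iFr.2.ofReal⟩
    rw [intervalIntegral.integral_eq_sub_of_hasDeriv_right_of_le
      (f := fun t => (v t - ζ * (dist a t * f t)) * (starRingEnd ℂ) (f t)) hX]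
    · simp [hf0]
    · exact (S.p_cont hF hX).mul (Complex.continuous_conj.comp_continuousOn fc)
    · intro s hs
      have hs' : s ∈ Ico 0 X := ⟨hs.1.le, hs.2⟩
      refine HasDerivWithinAt.mono ?_ Ioi_subset_Ici_self
      refine ((S.p_deriv hF hs').mul (dcj s hs')).congr_deriv ?_
      have e1 : ((‖v s‖ ^ 2 : ℝ) : ℂ) = v s * (starRingEnd ℂ) (v s) := by
        rw [Complex.mul_conj, Complex.normSq_eq_norm_sq]
      have e2 : ((r s : ℝ) : ℂ) =
          v s * (starRingEnd ℂ) (f s) + f s * (starRingEnd ℂ) (v s) := by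
        apply Complex.ext <;> simp [r] <;> ring
      rw [e1]
      push_cast
      rw [e2]
      have e4 : ∀ x : ℝ, (RCLike.ofReal x : ℂ) = (x : ℂ) := fun _ => rfl
      simp only [e4]
      ring
    · exact iv'.sub (iFr'.const_mul ζ)
  have hsplit : ∫ t in (0:ℝ)..X, (((‖v t‖ ^ 2 : ℝ) : ℂ) - ζ * ((dist a t * r t : ℝ) : ℂ)) =
      ((∫ t in (0:ℝ)..X, ‖v t‖ ^ 2 : ℝ) : ℂ) - ζ * ((∫ t in (0:ℝ)..X, dist a t * r t : ℝ) : ℂ) := by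
    have iv := S.norm_sq_intable h hX
    have iv' : IntervalIntegrable (fun t => ((‖v t‖ ^ 2 : ℝ) : ℂ)) volume 0 X :=
      ⟨iv.1.ofReal, iv.2.ofReal⟩
    have iFr' : IntervalIntegrable (fun t => ((dist a t * r t : ℝ) : ℂ)) volume 0 X :=
      ⟨iFr.1.ofReal, iFr.2.ofReal⟩
    rw [intervalIntegral.integral_sub iv' (iFr'.const_mul ζ), intervalIntegral.integral_const_mul,
      intervalIntegral.integral_ofReal, intervalIntegral.integral_ofReal]
  refine ⟨∫ y in Ioc 0 X, n y ∂a, integral_nonneg fun t => by simp only [n, Pi.zero_apply]; positivity, ?_⟩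
  rw [ip]
  have e3 : ((n X : ℝ) : ℂ) = f X * (starRingEnd ℂ) (f X) := by
    rw [Complex.mul_conj, Complex.normSq_apply]
    simp only [n]
    congr 1
    ring
  push_cast
  rw [e3]
  push_cast at hp hsplit
  linear_combination hp.trans hsplit

end

section
variable {X x y t s δ κ : ℝ} {a : Measure ℝ} {ζ : ℂ}

/-- The solution with `θ 0 = 0`, `θ' 0 = 1`. -/
abbrev th (a : Measure ℝ) (ζ : ℂ) : ℝ → ℂ := solF (dist a) ζ 1 0

/-- The solution with value `1` and vanishing quasi-derivative at `0`. -/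
abbrev mm (a : Measure ℝ) (ζ : ℂ) : ℝ → ℂ := solF (dist a) ζ 0 1

/-- The Dirichlet energy of `th a ζ` on `[0, t]`. -/
def En (a : Measure ℝ) (ζ : ℂ) (t : ℝ) : ℝ := ∫ s in (0:ℝ)..t, ‖solV (dist a) ζ 1 0 s‖ ^ 2

theorem th_sol (h : a (Icc 0 X) < ⊤) (hX : 0 ≤ X) (ζ : ℂ) :
    Sol (dist a) X ζ 1 0 (th a ζ) (solV (dist a) ζ 1 0) := (str_dist h).sol hX

theorem icc_lt (h : a (Icc 0 X) < ⊤) (hx : x ≤ X) : a (Icc 0 x) < ⊤ :=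
  (measure_mono (Icc_subset_Icc_right hx)).trans_lt h

theorem norm_th_sq_le (h : a (Icc 0 t) < ⊤) (ht : 0 ≤ t) (ζ : ℂ) :
    ‖th a ζ t‖ ^ 2 ≤ t * En a ζ t := by
  have S := th_sol h ht ζ
  have h1 : ‖th a ζ t‖ ≤ ∫ s in (0:ℝ)..t, ‖solV (dist a) ζ 1 0 s‖ := by
    rw [S.f_eq t ⟨ht, le_rfl⟩, zero_add]
    exact intervalIntegral.norm_integral_le_integral_norm ht
  have h2 := sq_intervalIntegral_le ht S.int.norm (S.norm_sq_intable h ht)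
  rw [sub_zero] at h2
  exact (pow_le_pow_left₀ (norm_nonneg _) h1 2).trans h2

theorem En_mono (h : a (Icc 0 t) < ⊤) (hs : 0 ≤ s) (hst : s ≤ t) (ζ : ℂ) :
    En a ζ s ≤ En a ζ t := by
  apply intervalIntegral.integral_mono_interval le_rfl hs hst
  · exact ae_of_all _ fun s => by simp only [Pi.zero_apply]; positivity
  · exact (th_sol h (hs.trans hst) ζ).norm_sq_intable h (hs.trans hst)

theorem En_pos (h : a (Icc 0 t) < ⊤) (ht : 0 < t) (ζ : ℂ) : 0 < En a ζ t := by
  by_contra! hle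
  have S := th_sol h ht.le ζ
  have hz : ∀ s ∈ Icc 0 t, th a ζ s = 0 := by
    intro s hs
    have h1 := norm_th_sq_le (icc_lt h hs.2) hs.1 ζ
    have h2 : s * En a ζ s ≤ 0 :=
      mul_nonpos_of_nonneg_of_nonpos hs.1 ((En_mono h hs.1 hs.2 ζ).trans hle)
    have h3 : ‖th a ζ s‖ ^ 2 = 0 := le_antisymm (h1.trans h2) (sq_nonneg _)
    simpa using h3
  have d := S.f_deriv (str_dist h) ⟨le_rfl, ht⟩
  rw [S.v_zero ht.le] at d
  have d2 : HasDerivWithinAt (th a ζ) 0 (Ici 0) 0 := by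
    refine (hasDerivWithinAt_const (0:ℝ) (Ici 0) (0:ℂ)).congr_of_eventuallyEq ?_
      (hz 0 ⟨le_rfl, ht.le⟩)
    filter_upwards [Icc_mem_nhdsGE ht] with s hs using hz s hs
  have := (uniqueDiffWithinAt_Ici (0:ℝ)).eq_deriv _ d d2
  simp at this

theorem En_sq_le (h : a (Icc 0 t) < ⊤) (ht : 0 ≤ t) (hζ : Sect δ ζ) :
    δ * En a ζ t ^ 2 ≤ ‖solV (dist a) ζ 1 0 t‖ ^ 2 * ‖th a ζ t‖ ^ 2 := by
  obtain ⟨Q, hQ, e⟩ := (th_sol h ht ζ).energy h ht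
  have hE : 0 ≤ En a ζ t :=
    intervalIntegral.integral_nonneg ht fun _ _ => by positivity
  have h1 := (hζ _ Q hE hQ).1
  unfold En at h1 ⊢
  rw [← e, norm_mul, RCLike.norm_conj, mul_pow] at h1
  exact h1

theorem th_ne_zero (h : a (Icc 0 t) < ⊤) (ht : 0 < t) (hδ : 0 < δ) (hζ : Sect δ ζ) :
    th a ζ t ≠ 0 := by
  intro h0
  have h1 := En_sq_le h ht.le hζ
  have h2 := En_pos h ht ζ
  rw [h0] at h1
  have : 0 < δ * En a ζ t ^ 2 := by positivity
  simp at h1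
  linarith

theorem norm_ratio_sub_le (h : a (Icc 0 X) < ⊤) (hx : 0 < x) (hxX : x ≤ X) (hδ : 0 < δ)
    (hζ : Sect δ ζ) : ‖mm a ζ X / th a ζ X - mm a ζ x / th a ζ x‖ ≤
      δ⁻¹ * ((En a ζ x)⁻¹ - (En a ζ X)⁻¹) := by
  have hX : 0 ≤ X := hx.le.trans hxX
  have hF := str_dist h
  have S := th_sol h hX ζ
  have S' : Sol (dist a) X ζ 0 1 (mm a ζ) (solV (dist a) ζ 0 1) := hF.sol hX
  have hne : ∀ t ∈ Icc x X, th a ζ t ≠ 0 := fun t ht =>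
    th_ne_zero (icc_lt h ht.2) (hx.trans_le ht.1) hδ hζ
  have hEp : ∀ t ∈ Icc x X, 0 < En a ζ t := fun t ht =>
    En_pos (icc_lt h ht.2) (hx.trans_le ht.1) ζ
  have hsub : Icc x X ⊆ Icc 0 X := Icc_subset_Icc_left hx.le
  have iv := S.norm_sq_intable h hX
  refine image_norm_le_of_norm_deriv_right_le_deriv_boundary'
    (f := fun t => mm a ζ t / th a ζ t - mm a ζ x / th a ζ x)
    (f' := fun t => -(th a ζ t ^ 2)⁻¹)
    (B := fun t => δ⁻¹ * ((En a ζ x)⁻¹ - (En a ζ t)⁻¹))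
    (B' := fun t => δ⁻¹ * (‖solV (dist a) ζ 1 0 t‖ ^ 2 / En a ζ t ^ 2)) ?_ ?_ ?_ ?_ ?_ ?_
    ⟨hxX, le_rfl⟩
  · exact ContinuousOn.sub (((S'.f_cont hX).mono hsub).div ((S.f_cont hX).mono hsub) hne)
      continuousOn_const
  · intro t ht
    have ht' : t ∈ Ico 0 X := ⟨hx.le.trans ht.1, ht.2⟩
    have hn := hne t ⟨ht.1, ht.2.le⟩
    refine (((S'.f_deriv hF ht').div (S.f_deriv hF ht') hn).sub_const _).congr_deriv ?_
    have w := S.wronskian S' hF (t := t) ⟨ht'.1, ht'.2.le⟩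
    rw [div_eq_iff (pow_ne_zero 2 hn), neg_mul, inv_mul_cancel₀ (pow_ne_zero 2 hn)]
    linear_combination -w
  · simp
  · refine continuousOn_const.mul (continuousOn_const.sub (ContinuousOn.inv₀ ?_ fun t ht =>
      (hEp t ht).ne'))
    exact (continuousOn_prim hX iv).mono hsub
  · intro t ht
    have ht' : t ∈ Ico 0 X := ⟨hx.le.trans ht.1, ht.2⟩
    have hc : ContinuousWithinAt (fun t => ‖solV (dist a) ζ 1 0 t‖ ^ 2) (Ici t) t :=
      (S.v_rc hF ht').norm.pow 2
    have d := deriv_prim iv ht' hc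
    have hn : En a ζ t ≠ 0 := (hEp t ⟨ht.1, ht.2.le⟩).ne'
    refine (((d.inv hn).const_sub _).const_mul _).congr_deriv ?_
    simp only [En]
    ring
  · intro t ht
    have ht' : t ∈ Icc x X := ⟨ht.1, ht.2.le⟩
    have h1 := En_sq_le (icc_lt h ht.2.le) (hx.le.trans ht.1) hζ
    have h2 : 0 < ‖th a ζ t‖ := norm_pos_iff.2 (hne t ht')
    have h3 := hEp t ht'
    rw [norm_neg, norm_inv, norm_pow, inv_mul_eq_div, inv_eq_one_div, div_div,
      div_le_div_iff₀ (by positivity) (by positivity)]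
    linarith

end

section

theorem differentiableAt_integral {α : Type*} [MeasurableSpace α] {μ : Measure α}
    {k : ℂ → α → ℂ} {z₀ : ℂ} {ε : ℝ} {g : α → ℝ} (hε : 0 < ε)
    (hm : ∀ z ∈ Metric.ball z₀ ε, AEStronglyMeasurable (k z) μ) (hg : Integrable g μ)
    (hk : ∀ᵐ s ∂μ, DifferentiableOn ℂ (fun z => k z s) (Metric.ball z₀ ε) ∧
      ∀ z ∈ Metric.ball z₀ ε, ‖k z s‖ ≤ g s) :
    DifferentiableAt ℂ (fun z => ∫ s, k z s ∂μ) z₀ := by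
  have h0 : z₀ ∈ Metric.ball z₀ ε := Metric.mem_ball_self hε
  have hmem : Metric.ball z₀ ε ∈ 𝓝 z₀ := Metric.ball_mem_nhds _ hε
  have hd : ∀ᵐ s ∂μ, ∀ z ∈ Metric.ball z₀ ε, HasDerivAt (fun z => k z s) (deriv (fun z => k z s) z) z := by
    filter_upwards [hk] with s hs z hz
    exact (hs.1.differentiableAt (Metric.isOpen_ball.mem_nhds hz)).hasDerivAt
  have hsub : Metric.ball z₀ (ε / 2) ⊆ Metric.ball z₀ ε := Metric.ball_subset_ball (by linarith)
  refine (hasDerivAt_integral_of_dominated_loc_of_deriv_le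
    (F' := fun z s => deriv (fun z => k z s) z) (bound := fun s => g s / (ε / 4))
    (Metric.ball_mem_nhds z₀ (half_pos hε)) ?_ ?_ ?_ ?_ ?_ ?_).2.differentiableAt
  · filter_upwards [hmem] with z hz using hm z hz
  · refine hg.mono' (hm z₀ h0) ?_
    filter_upwards [hk] with s hs using hs.2 z₀ h0
  · have hseq : Tendsto (fun n : ℕ => z₀ + ((ε / 2 / (n + 1) : ℝ) : ℂ)) atTop (𝓝[≠] z₀) := by
      refine tendsto_nhdsWithin_iff.2 ⟨?_, Eventually.of_forall fun n => ?_⟩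
      · have h1 : Tendsto (fun n : ℕ => ε / 2 / ((n:ℝ) + 1)) atTop (𝓝 0) :=
          tendsto_const_nhds.div_atTop (tendsto_natCast_atTop_atTop.atTop_add tendsto_const_nhds)
        have h2 := ((Complex.continuous_ofReal.tendsto 0).comp h1).const_add z₀
        simpa using h2
      · have : (0:ℝ) < ε / 2 / (n + 1) := by positivity
        simp only [mem_compl_iff, mem_singleton_iff, add_eq_left]
        exact_mod_cast this.ne'
    refine aestronglyMeasurable_of_tendsto_ae atTop
      (f := fun n s => slope (fun z => k z s) z₀ (z₀ + ((ε / 2 / ((n:ℕ) + 1) : ℝ) : ℂ))) ?_ ?_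
    · intro n
      have hz : z₀ + ((ε / 2 / (n + 1) : ℝ) : ℂ) ∈ Metric.ball z₀ ε := by
        have h1 : (0:ℝ) < ε / 2 / (n + 1) := by positivity
        have h2 : ε / 2 / ((n:ℝ) + 1) ≤ ε / 2 := div_le_self (by positivity) (by
          have := n.cast_nonneg (α := ℝ); linarith)
        rw [Metric.mem_ball, dist_eq_norm, add_sub_cancel_left, Complex.norm_real,
          Real.norm_of_nonneg h1.le]
        linarith
      simp only [slope_def_module]
      exact AEStronglyMeasurable.const_smul (𝕜 := ℂ) ((hm _ hz).sub (hm _ h0)) _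
    · filter_upwards [hd] with s hs
      exact (hasDerivAt_iff_tendsto_slope.1 (hs z₀ h0)).comp hseq
  · filter_upwards [hk] with s hs z hz
    have hsb : Metric.closedBall z (ε / 4) ⊆ Metric.ball z₀ ε := by
      intro w hw
      rw [Metric.mem_closedBall] at hw
      rw [Metric.mem_ball] at hz ⊢
      linarith [dist_triangle w z z₀]
    refine Complex.norm_deriv_le_of_forall_mem_sphere_norm_le (by positivity) ?_ ?_
    · refine DifferentiableOn.diffContOnCl ?_
      exact hs.1.mono (Metric.closure_ball_subset_closedBall.trans hsb)
    · intro w hw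
      exact hs.2 w (hsb (Metric.sphere_subset_closedBall hw))
  · exact hg.div_const _
  · filter_upwards [hd] with s hs z hz using hs z (hsub hz)

theorem differentiableOn_of_tendsto {f : ℕ → ℂ → ℂ} {g : ℂ → ℂ} {U : Set ℂ} (hU : IsOpen U)
    (hf : ∀ n, DifferentiableOn ℂ (f n) U)
    (hb : ∀ z ∈ U, ∃ C : ℝ, ∀ᶠ w in 𝓝 z, ∀ n, ‖f n w‖ ≤ C)
    (hl : ∀ z ∈ U, Tendsto (fun n => f n z) atTop (𝓝 (g z))) : DifferentiableOn ℂ g U := by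
  intro z₀ hz₀
  refine DifferentiableAt.differentiableWithinAt ?_
  obtain ⟨C, hC⟩ := hb z₀ hz₀
  obtain ⟨ε, hε, hεU⟩ := Metric.eventually_nhds_iff_ball.1 (hC.and (hU.mem_nhds hz₀))
  obtain ⟨r, hr0, hr⟩ : ∃ r : NNReal, 0 < (r:ℝ) ∧ (r:ℝ) < ε :=
    ⟨⟨ε / 2, by positivity⟩, half_pos hε, half_lt_self hε⟩
  have hsub : Metric.closedBall z₀ r ⊆ Metric.ball z₀ ε :=
    Metric.closedBall_subset_ball hr
  have hgm : Measurable fun t => g (circleMap z₀ r t) := by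
    refine measurable_of_tendsto_metrizable (f := fun n t => f n (circleMap z₀ r t))
      (fun n => ?_) (tendsto_pi_nhds.2 fun t => ?_)
    · refine Continuous.measurable ?_
      exact (hf n).continuousOn.comp_continuous (continuous_circleMap _ _)
        fun t => (hεU _ (hsub (circleMap_mem_closedBall _ hr0.le _))).2
    · exact hl _ (hεU _ (hsub (circleMap_mem_closedBall _ hr0.le _))).2
  have hgb : ∀ t, ‖g (circleMap z₀ r t)‖ ≤ C := fun t =>
    le_of_tendsto (hl _ (hεU _ (hsub (circleMap_mem_closedBall _ hr0.le _))).2).norm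
      (Eventually.of_forall fun n => (hεU _ (hsub (circleMap_mem_closedBall _ hr0.le _))).1 n)
  have hgi : CircleIntegrable g z₀ r := by
    rw [CircleIntegrable, intervalIntegrable_iff, uIoc_of_le Real.two_pi_pos.le]
    exact Integrable.of_bound hgm.aestronglyMeasurable C (ae_of_all _ hgb)
  have key := (hasFPowerSeriesOn_cauchy_integral hgi hr0).hasFPowerSeriesAt.analyticAt.differentiableAt
  refine key.congr_of_eventuallyEq ?_
  filter_upwards [Metric.ball_mem_nhds z₀ hr0] with w hw
  have hwU : w ∈ U := (hεU w (hsub (Metric.ball_subset_closedBall hw))).2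
  refine tendsto_nhds_unique (hl w hwU) ?_
  have hcf : ∀ n, (2 * Real.pi * Complex.I : ℂ)⁻¹ • (∮ z in C(z₀, r), (z - w)⁻¹ • f n z) = f n w := by
    intro n
    have hd : DifferentiableOn ℂ (f n) (Metric.closedBall z₀ r) :=
      (hf n).mono fun z hz => (hεU z (hsub hz)).2
    rw [hd.circleIntegral_sub_inv_smul hw, smul_smul, inv_mul_cancel₀, one_smul]
    exact Complex.two_pi_I_ne_zero
  simp only [← hcf]
  refine Tendsto.const_smul ?_ _
  have hw' : ‖w - z₀‖ < r := mem_ball_iff_norm.1 hw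
  have hlow : ∀ t, (r:ℝ) - ‖w - z₀‖ ≤ ‖circleMap z₀ r t - w‖ := by
    intro t
    have h1 : ‖circleMap z₀ r t - z₀‖ = r := by
      simp [circleMap]
    have h2 := norm_sub_le_norm_sub_add_norm_sub (circleMap z₀ r t) w z₀
    linarith
  refine intervalIntegral.tendsto_integral_filter_of_dominated_convergence
    (fun _ => r * (((r:ℝ) - ‖w - z₀‖)⁻¹ * C)) ?_ ?_ ?_ ?_
  · refine Eventually.of_forall fun n => Continuous.aestronglyMeasurable ?_
    have hwn : ∀ t, circleMap z₀ r t - w ≠ 0 := fun t => by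
      rw [← norm_pos_iff]; linarith [hlow t]
    have hfc : Continuous fun t => f n (circleMap z₀ r t) :=
      (hf n).continuousOn.comp_continuous (continuous_circleMap _ _)
        fun t => (hεU _ (hsub (circleMap_mem_closedBall _ hr0.le _))).2
    simp only [deriv_circleMap]
    have hcm := continuous_circleMap 0 (r:ℝ)
    have hcm' := continuous_circleMap z₀ (r:ℝ)
    exact (hcm.mul continuous_const).smul (((hcm'.sub continuous_const).inv₀ hwn).smul hfc)
  · refine Eventually.of_forall fun n => ae_of_all _ fun t _ => ?_
    rw [norm_smul, norm_smul, norm_inv, deriv_circleMap]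
    have h1 := (hεU _ (hsub (circleMap_mem_closedBall z₀ hr0.le t))).1 n
    have h2 : ‖circleMap 0 r t * Complex.I‖ = r := by simp
    rw [h2]
    have h3 := sub_pos.2 hw'
    gcongr
    exact hlow t
  · exact intervalIntegrable_const
  · refine ae_of_all _ fun t _ => ?_
    exact ((hl _ (hεU _ (hsub (circleMap_mem_closedBall z₀ hr0.le t))).2).const_smul _).const_smul _

end

section
variable {F g : ℝ → ℝ} {X x s δ ρ : ℝ} {ζ z : ℂ}

theorem Str.norm_ser_le_exp (hF : Str F X) (hg : Str g X) (ζ : ℂ) {t : ℝ} (ht : t ∈ Icc 0 X) :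
    ‖ser F g ζ t‖ ≤ g X * Real.exp (2 * √(‖ζ‖ * (F X * X))) := by
  have hX : X ∈ Icc (0:ℝ) X := ⟨ht.1.trans ht.2, le_rfl⟩
  refine (hF.norm_ser_le hg ζ ht).trans ?_
  rw [tsum_mul_left]
  exact mul_le_mul_of_nonneg_left (tsum_fact_le (_root_.mul_nonneg (norm_nonneg _)
    (_root_.mul_nonneg (hF.pos hX) hX.1))) (hg.pos hX)

theorem Str.ser_int_differentiable (hF : Str F X) (hg : Str g X) (hx : x ∈ Icc 0 X) :
    Differentiable ℂ fun ζ : ℂ => ∫ t in (0:ℝ)..x, ser F g ζ t := by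
  intro z
  have hX : X ∈ Icc (0:ℝ) X := ⟨hx.1.trans hx.2, le_rfl⟩
  simp only [intervalIntegral.integral_of_le hx.1]
  refine differentiableAt_integral (ε := 1) (g := fun _ =>
    g X * Real.exp (2 * √((‖z‖ + 1) * (F X * X)))) one_pos (fun w _ => ?_)
    (integrable_const _) ?_
  · exact ((intervalIntegrable_iff_integrableOn_Ioc_of_le hx.1).1 (hF.ser_intable hg w hx)).1
  · filter_upwards [ae_restrict_mem measurableSet_Ioc] with t ht
    have ht' : t ∈ Icc 0 X := ⟨ht.1.le, ht.2.trans hx.2⟩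
    refine ⟨(hF.ser_differentiable hg ht').differentiableOn, fun w hw => ?_⟩
    refine (hF.norm_ser_le_exp hg w ht').trans ?_
    have h1 : ‖w‖ ≤ ‖z‖ + 1 := by
      have := mem_ball_iff_norm.1 hw
      have := norm_le_norm_add_norm_sub' w z
      linarith
    have h2 := hg.pos hX
    have h3 := _root_.mul_nonneg (hF.pos hX) hX.1
    gcongr

theorem Str.mm_differentiable (hF : Str F X) (hx : x ∈ Icc 0 X) :
    Differentiable ℂ fun ζ : ℂ => solF F ζ 0 1 x := by
  have e : (fun ζ : ℂ => solF F ζ 0 1 x) = fun ζ => 1 + ζ * ∫ t in (0:ℝ)..x, ser F F ζ t := by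
    funext ζ
    simp [solF, solV]
  rw [e]
  exact (differentiable_const _).add (differentiable_id.mul (hF.ser_int_differentiable hF hx))

theorem Sect.mul_le_norm (h : Sect δ ζ) (hs : 0 ≤ s) : √δ * s ≤ ‖ζ + s‖ := by
  have h1 := (h s 1 hs zero_le_one).1
  rw [Complex.ofReal_one, mul_one, add_comm] at h1
  have h2 : √(δ * s ^ 2) = √δ * s := by rw [Real.sqrt_mul' _ (sq_nonneg s), Real.sqrt_sq hs]
  exact h2 ▸ Real.sqrt_le_iff.2 ⟨norm_nonneg _, h1⟩

theorem Sect.norm_mul_le_norm (h : Sect δ ζ) (hs : 0 ≤ s) : √δ * ‖ζ‖ ≤ ‖ζ + s‖ := by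
  have h1 := (h s 1 hs zero_le_one).2
  rw [Complex.ofReal_one, mul_one, mul_one, add_comm] at h1
  have h2 : √(δ * ‖ζ‖ ^ 2) = √δ * ‖ζ‖ := by
    rw [Real.sqrt_mul' _ (sq_nonneg _), Real.sqrt_sq (norm_nonneg _)]
  exact h2 ▸ Real.sqrt_le_iff.2 ⟨norm_nonneg _, h1⟩

theorem Sect.norm_div_le' (h : Sect δ ζ) (hδ : 0 < δ) (hs : 0 ≤ s) :
    ‖(s : ℂ) / (ζ + s)‖ ≤ (√δ)⁻¹ := by
  rw [norm_div, inv_eq_one_div, Complex.norm_of_nonneg hs]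
  have hm : 0 < √δ := Real.sqrt_pos.2 hδ
  refine div_le_of_le_mul₀ (norm_nonneg _) (by positivity) ?_
  rw [div_mul_eq_mul_div, one_mul, le_div_iff₀ hm, mul_comm]
  exact h.mul_le_norm hs

theorem Sect.norm_div_le_mul (h : Sect δ ζ) (hδ : 0 < δ) (hρ : 0 < ρ) (hζ : ρ ≤ ‖ζ‖) (hs : 0 ≤ s) :
    ‖ζ / (ζ + s)‖ ≤ ‖ζ‖ * (1 + ρ⁻¹) / √δ * (1 + s)⁻¹ := by
  have hm : 0 < √δ := Real.sqrt_pos.2 hδ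
  have h1 := h.mul_le_norm hs
  have h2 := h.norm_mul_le_norm hs
  have h3 : √δ ≤ ‖ζ + s‖ * ρ⁻¹ := by
    rw [← div_eq_mul_inv, le_div_iff₀ hρ]
    exact (mul_le_mul_of_nonneg_left hζ hm.le).trans h2
  have h4 : √δ * (1 + s) ≤ ‖ζ + s‖ * (1 + ρ⁻¹) := by linarith
  have h5 : 0 < ‖ζ + s‖ * (1 + ρ⁻¹) := lt_of_lt_of_le (by positivity) h4
  have h6 : 0 < ‖ζ + s‖ := pos_of_mul_pos_left h5 (by positivity)
  rw [norm_div, ← div_eq_mul_inv, div_div, div_le_div_iff₀ h6 (by positivity)]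
  nlinarith [mul_le_mul_of_nonneg_left h4 (norm_nonneg ζ)]

theorem ne_zero_of_slit (h : ζ ∈ Complex.slitPlane) (hs : 0 ≤ s) : ζ + s ≠ 0 := by
  intro h0
  have : ζ = ((-s : ℝ) : ℂ) := by push_cast; linear_combination h0
  rw [this, Complex.ofReal_mem_slitPlane] at h
  linarith

end

section
variable {μ : Measure ℝ} {u : ℝ → ℝ} {ζ : ℂ}

/-- The Cauchy-type transform of `u μ`. -/
def cauchyT (μ : Measure ℝ) (u : ℝ → ℝ) (ζ : ℂ) : ℂ := ∫ s, (u s : ℂ) * (ζ / (ζ + s)) ∂μ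

theorem cauchyT_ofReal (ξ : ℝ) : cauchyT μ u ξ = ((∫ s, u s * (ξ / (ξ + s)) ∂μ : ℝ) : ℂ) := by
  rw [cauchyT, ← integral_complex_ofReal]
  simp

theorem aesm_cauchyT (hm : AEStronglyMeasurable u μ) (ζ : ℂ) :
    AEStronglyMeasurable (fun s : ℝ => (u s : ℂ) * (ζ / (ζ + s))) μ :=
  (Complex.continuous_ofReal.comp_aestronglyMeasurable hm).mul
    (by fun_prop : Measurable _).aestronglyMeasurable

theorem cauchyT_differentiableOn (hm : AEStronglyMeasurable u μ)
    (hu : Integrable (fun s => u s * (1 + s)⁻¹) μ) (h0 : ∀ᵐ s ∂μ, 0 ≤ s) :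
    DifferentiableOn ℂ (cauchyT μ u) Complex.slitPlane := by
  intro ζ hζ
  refine DifferentiableAt.differentiableWithinAt ?_
  obtain ⟨δ, hδ, hev⟩ := exists_sect hζ
  have hn : 0 < ‖ζ‖ := norm_pos_iff.2 (Complex.slitPlane_ne_zero hζ)
  have hev2 : ∀ᶠ z in 𝓝 ζ, ‖ζ‖ / 2 < ‖z‖ :=
    continuous_norm.continuousAt.eventually (lt_mem_nhds (half_lt_self hn))
  have hev3 : ∀ᶠ z in 𝓝 ζ, ‖z‖ < ‖ζ‖ + 1 :=
    continuous_norm.continuousAt.eventually (gt_mem_nhds (lt_add_one _))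
  obtain ⟨ε, hε, hb⟩ := Metric.eventually_nhds_iff_ball.1
    (((hev.and hev2).and hev3).and (Complex.isOpen_slitPlane.mem_nhds hζ))
  refine differentiableAt_integral hε (fun z _ => aesm_cauchyT hm z)
    (g := fun s => (‖ζ‖ + 1) * (1 + (‖ζ‖ / 2)⁻¹) / √δ * ‖u s * (1 + s)⁻¹‖) (hu.norm.const_mul _) ?_
  filter_upwards [h0] with s hs
  constructor
  · intro z hz
    have := ne_zero_of_slit (hb z hz).2 hs
    fun_prop (disch := assumption)
  · intro z hz
    obtain ⟨⟨⟨h1, h2⟩, h3⟩, -⟩ := hb z hz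
    rw [norm_mul, norm_mul, Complex.norm_real, Real.norm_of_nonneg (by positivity : 0 ≤ (1 + s)⁻¹)]
    have h4 := h1.norm_div_le_mul hδ (half_pos hn) h2.le hs
    have h5 := Real.sqrt_pos.2 hδ
    calc _ ≤ ‖u s‖ * (‖z‖ * (1 + (‖ζ‖ / 2)⁻¹) / √δ * (1 + s)⁻¹) := by gcongr
      _ ≤ ‖u s‖ * ((‖ζ‖ + 1) * (1 + (‖ζ‖ / 2)⁻¹) / √δ * (1 + s)⁻¹) := by gcongr
      _ = _ := by ring

end

section
variable {F : ℝ → ℝ} {X x y ξ δ c : ℝ} {a μ : Measure ℝ} {ζ : ℂ} {R : ℝ≥0∞}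

theorem Str.theta_sub_ge (hF : Str F X) (hξ : 0 ≤ ξ) (hx : 0 ≤ x) (hxy : x ≤ y) (hy : y ≤ X) :
    y - x ≤ solF F ξ 1 0 y - solF F ξ 1 0 x := by
  have h0 := hx.trans hxy
  have i1 := (hF.restrict hy).solV_intable (ζ := ξ) (c := 1) (f₀ := 0) h0
  have i2 := (hF.restrict (hxy.trans hy)).solV_intable (ζ := ξ) (c := 1) (f₀ := 0) hx
  have e : solF F ξ 1 0 y - solF F ξ 1 0 x = ∫ t in x..y, solV F ξ 1 0 t := by
    rw [← intervalIntegral.integral_interval_sub_left i1 i2]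
    simp [solF]
  rw [e]
  have := intervalIntegral.integral_mono_on (f := fun _ => (1:ℝ)) (g := solV F ξ 1 0) hxy
    intervalIntegrable_const (i2.symm.trans i1) fun t ht => by
      rw [solV_one]
      exact hF.ser_ge Str.one hξ ⟨hx.trans ht.1, ht.2.trans hy⟩
  simpa using this

theorem Str.theta_ge (hF : Str F X) (hξ : 0 ≤ ξ) (hx : x ∈ Icc 0 X) : x ≤ solF F ξ 1 0 x := by
  simpa [solF] using hF.theta_sub_ge hξ le_rfl hx.1 hx.2

theorem Str.solF_split (hF : Str F X) (hX : 0 ≤ X) :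
    solF F ξ c 1 X = solF F ξ 0 1 X + c * solF F ξ 1 0 X := by
  have i1 := hF.ser_intable Str.one ξ ⟨hX, le_rfl⟩
  have i2 := hF.ser_intable hF ξ ⟨hX, le_rfl⟩
  simp only [solF, solV, zero_mul, mul_zero, add_zero, zero_add, one_mul, mul_one]
  rw [intervalIntegral.integral_add (i1.const_mul c) (i2.const_mul ξ),
    intervalIntegral.integral_const_mul, intervalIntegral.integral_const_mul]
  ring

theorem mm_cast (a : Measure ℝ) (ξ x : ℝ) : mm a ξ x = ((solF (dist a) ξ 0 1 x : ℝ) : ℂ) := by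
  rw [← solF_cast]
  simp

theorem Rep.ratio_tendsto (h : Rep R a c μ) (hξ : 0 < ξ) {xs : ℕ → ℝ} (hxs : Exh R xs)
    (hx : 0 < x) (hxs0 : ∀ n, x ≤ xs n) :
    Tendsto (fun n => mm a ξ (xs n) / th a ξ (xs n)) atTop (𝓝 (psi c μ ξ : ℂ)) := by
  have hθ : ∀ n, xs n ≤ solF (dist a) ξ 1 0 (xs n) := fun n =>
    (h.str (hxs.mem n)).theta_ge hξ.le ⟨hx.le.trans (hxs0 n), le_rfl⟩
  have key : Tendsto (fun n => solF (dist a) ξ 0 1 (xs n) / solF (dist a) ξ 1 0 (xs n)) atTop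
      (𝓝 (psi c μ ξ)) := by
    have e : ∀ n, solF (dist a) ξ 0 1 (xs n) / solF (dist a) ξ 1 0 (xs n) =
        psi c μ ξ + ph a c μ ξ (xs n) / solF (dist a) ξ 1 0 (xs n) := by
      intro n
      have h0 := hx.le.trans (hxs0 n)
      have h1 : 0 < solF (dist a) ξ 1 0 (xs n) := (hx.trans_le (hxs0 n)).trans_le (hθ n)
      rw [ph, (h.str (hxs.mem n)).solF_split (c := -psi c μ ξ) h0]
      field_simp
      ring
    simp only [e]
    have w := h.weyl ξ hξ
    have hlim : Tendsto (fun n => ph a c μ ξ (xs n) / solF (dist a) ξ 1 0 (xs n)) atTop (𝓝 0) := by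
      have hb : ∀ n, ‖ph a c μ ξ (xs n) / solF (dist a) ξ 1 0 (xs n)‖ ≤
          ph a c μ ξ (xs n) * (xs n)⁻¹ := by
        intro n
        have h1 : 0 < xs n := hx.trans_le (hxs0 n)
        have h2 := w.nonneg h.fin h.pos hξ (hxs.mem n)
        rw [norm_div, Real.norm_of_nonneg h2, Real.norm_of_nonneg (h1.le.trans (hθ n)),
          div_eq_mul_inv]
        have := hθ n
        gcongr
      refine squeeze_zero_norm hb ?_
      by_cases hR : R = ⊤
      · subst hR
        refine squeeze_zero (fun n => ?_) (fun n => ?_) (tendsto_inv_atTop_zero.comp hxs.tendsto_top)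
        · exact _root_.mul_nonneg (w.nonneg h.fin h.pos hξ (hxs.mem n))
            (inv_nonneg.2 (hx.le.trans (hxs0 n)))
        · exact mul_le_of_le_one_left (inv_nonneg.2 (hx.le.trans (hxs0 n)))
            (w.le_one h.fin h.pos hξ (hxs.mem n))
      · have h1 := (w.bdry hR).comp (hxs.tendsto_fin hR)
        refine squeeze_zero (fun n => ?_) (fun n => ?_) (by simpa using h1.mul_const x⁻¹)
        · exact _root_.mul_nonneg (w.nonneg h.fin h.pos hξ (hxs.mem n))
            (inv_nonneg.2 (hx.le.trans (hxs0 n)))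
        · exact mul_le_mul_of_nonneg_left (inv_anti₀ hx (hxs0 n))
            (w.nonneg h.fin h.pos hξ (hxs.mem n))
    simpa using hlim.const_add (psi c μ ξ)
  have := (Complex.continuous_ofReal.tendsto _).comp key
  refine this.congr fun n => ?_
  simp only [Function.comp]
  rw [mm_cast, th, solF_one_cast]
  push_cast; rfl

/-- The analytic continuation of the decaying solution. -/
def pc (a μ : Measure ℝ) (x : ℝ) (ζ : ℂ) : ℂ := 1 - cauchyT μ (fun s => thn a s x) ζ

theorem Rep.pc_ofReal (h : Rep R a c μ) (hx : x ∈ IsetOf R) (hξ : 0 < ξ) :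
    pc a μ x ξ = (ph a c μ ξ x : ℂ) := by
  rw [pc, cauchyT_ofReal, h.ph_eq hx hξ]
  push_cast; rfl

theorem Rep.thn_int (h : Rep R a c μ) (hx : x ∈ IsetOf R) :
    Integrable (fun s => thn a s x * (1 + s)⁻¹) μ := by
  have := (h.thn_memLp hx).integrable_mul (h.memLp_frac one_pos)
  refine this.congr (ae_of_all _ fun s => ?_)
  simp

theorem Rep.pc_differentiableOn (h : Rep R a c μ) (hx : x ∈ IsetOf R) :
    DifferentiableOn ℂ (pc a μ x) Complex.slitPlane :=
  (differentiableOn_const _).sub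
    (cauchyT_differentiableOn (h.thn_memLp hx).1 (h.thn_int hx) h.ae_nonneg)

theorem Exh.max {xs : ℕ → ℝ} (h : Exh R xs) (hx : x ∈ IsetOf R) : Exh R fun n => max x (xs n) where
  mono m n hmn := max_le_max le_rfl (h.mono hmn)
  mem n := by
    rcases max_choice x (xs n) with e | e <;> rw [e]
    exacts [hx, h.mem n]
  ev y hy := (h.ev y hy).mono fun n hn => hn.trans (le_max_right _ _)

/-- The limit circle collapses to a point off the negative half-line. -/
theorem Rep.ratio_cauchy (h : Rep R a c μ) {xs : ℕ → ℝ} (hxs : Exh R xs)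
    (hx : 0 < x) (hxs0 : ∀ n, x ≤ xs n) (hδ : 0 < δ) (hζ : Sect δ ζ) :
    CauchySeq fun n => mm a ζ (xs n) / th a ζ (xs n) := by
  have hp : ∀ n, 0 < En a ζ (xs n) := fun n =>
    En_pos (h.fin.2 _ (hxs.mem n)) (hx.trans_le (hxs0 n)) ζ
  have hanti : Antitone fun n => (En a ζ (xs n))⁻¹ := fun m n hmn =>
    inv_anti₀ (hp m) (En_mono (h.fin.2 _ (hxs.mem n)) (hx.le.trans (hxs0 m)) (hxs.mono hmn) ζ)
  have hbdd : BddBelow (range fun n => (En a ζ (xs n))⁻¹) :=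
    ⟨0, by rintro _ ⟨n, rfl⟩; exact (inv_pos.2 (hp n)).le⟩
  have hlim := tendsto_atTop_ciInf hanti hbdd
  refine cauchySeq_of_le_tendsto_0' (fun n => δ⁻¹ * ((En a ζ (xs n))⁻¹ - ⨅ n, (En a ζ (xs n))⁻¹))
    ?_ ?_
  · intro m n hmn
    rw [dist_comm, dist_eq_norm]
    refine (norm_ratio_sub_le (h.fin.2 _ (hxs.mem n)) (hx.trans_le (hxs0 m)) (hxs.mono hmn)
      hδ hζ).trans ?_
    have := ciInf_le hbdd n
    gcongr
  · simpa using (hlim.sub_const (⨅ n, (En a ζ (xs n))⁻¹)).const_mul δ⁻¹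

theorem Rep.norm_green_le (h : Rep R a c μ) (hx : 0 < x) (hxR : x ∈ IsetOf R) (hδ : 0 < δ)
    (hζs : ζ ∈ Complex.slitPlane) (hζ : Sect δ ζ) : ‖th a ζ x * pc a μ x ζ‖ ≤ x / δ := by
  obtain ⟨xs', hxs'⟩ := exists_exh h.pos
  have hxs := hxs'.max hxR
  set xs : ℕ → ℝ := fun n => Max.max x (xs' n) with hxsdef
  have hxs0 : ∀ n, x ≤ xs n := fun n => le_max_left _ _
  have hfin := fun n => h.fin.2 _ (hxs.mem n)
  have hF := h.str hxR
  have hxm : x ∈ Icc 0 x := ⟨hx.le, le_rfl⟩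
  set G : ℕ → ℂ → ℂ := fun n ζ =>
    th a ζ x ^ 2 * (mm a ζ (xs n) / th a ζ (xs n) - mm a ζ x / th a ζ x) with hG
  have hbound : ∀ n {δ : ℝ} {z : ℂ}, 0 < δ → Sect δ z → ‖G n z‖ ≤ x / δ := by
    intro n δ z hδ hz
    have h1 := norm_ratio_sub_le (hfin n) hx (hxs0 n) hδ hz
    have h2 := norm_th_sq_le (h.fin.2 x hxR) hx.le z
    have h3 := En_pos (h.fin.2 x hxR) hx z
    have h4 := En_pos (hfin n) (hx.trans_le (hxs0 n)) z
    rw [hG, norm_mul, norm_pow]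
    calc _ ≤ (x * En a z x) * (δ⁻¹ * ((En a z x)⁻¹ - (En a z (xs n))⁻¹)) := by gcongr
      _ ≤ (x * En a z x) * (δ⁻¹ * (En a z x)⁻¹) := by
          have := inv_pos.2 h4
          gcongr
          linarith
      _ = x / δ := by field_simp
  have hlim : ∀ z ∈ Complex.slitPlane, ∃ l, Tendsto (fun n => G n z) atTop (𝓝 l) := by
    intro z hz
    obtain ⟨δ, hδ, hs⟩ := exists_sect hz
    obtain ⟨l, hl⟩ := cauchySeq_tendsto_of_complete (h.ratio_cauchy hxs hx hxs0 hδ hs.self_of_nhds)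
    exact ⟨_, (hl.sub_const _).const_mul _⟩
  choose! L hL using hlim
  have hdiffT : ∀ y ∈ IsetOf R, Differentiable ℂ fun z : ℂ => th a z y := fun y hy =>
    (h.str hy).theta_differentiable ⟨hy.1, le_rfl⟩
  have hdiffM : ∀ y ∈ IsetOf R, Differentiable ℂ fun z : ℂ => mm a z y := fun y hy =>
    (h.str hy).mm_differentiable ⟨hy.1, le_rfl⟩
  have hne : ∀ y ∈ IsetOf R, 0 < y → ∀ z ∈ Complex.slitPlane, th a z y ≠ 0 := by
    intro y hy hy0 z hz
    obtain ⟨δ, hδ, hs⟩ := exists_sect hz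
    exact th_ne_zero (h.fin.2 y hy) hy0 hδ hs.self_of_nhds
  have hLd : DifferentiableOn ℂ L Complex.slitPlane := by
    refine differentiableOn_of_tendsto Complex.isOpen_slitPlane (f := G) (fun n => ?_) ?_ hL
    · refine ((hdiffT x hxR).differentiableOn.pow 2).mul (DifferentiableOn.sub ?_ ?_)
      · exact (hdiffM _ (hxs.mem n)).differentiableOn.div (hdiffT _ (hxs.mem n)).differentiableOn
          (hne _ (hxs.mem n) (hx.trans_le (hxs0 n)))
      · exact (hdiffM x hxR).differentiableOn.div (hdiffT x hxR).differentiableOn (hne x hxR hx)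
    · intro z hz
      obtain ⟨δ, hδ, hs⟩ := exists_sect hz
      exact ⟨x / δ, hs.mono fun w hw n => hbound n hδ hw⟩
  have hLreal : ∀ ξ : ℝ, 0 < ξ → L ξ = -(th a ξ x * pc a μ x ξ) := by
    intro ξ hξ
    have hm : (ξ : ℂ) ∈ Complex.slitPlane := Complex.ofReal_mem_slitPlane.2 hξ
    refine tendsto_nhds_unique (hL _ hm) ?_
    have h1 := ((h.ratio_tendsto hξ hxs hx hxs0).sub_const (mm a ξ x / th a ξ x)).const_mul
      (th a ξ x ^ 2)
    refine h1.trans_eq ?_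
    congr 1
    have h2 := hne x hxR hx _ hm
    rw [h.pc_ofReal hxR hξ, ph, hF.solF_split hx.le]
    push_cast
    rw [← solF_one_cast, ← mm_cast]
    field_simp
    ring
  have hcongr : EqOn L (fun z => -(th a z x * pc a μ x z)) Complex.slitPlane := by
    refine AnalyticOnNhd.eqOn_of_preconnected_of_frequently_eq (z₀ := 1)
      (hLd.analyticOnNhd Complex.isOpen_slitPlane) (DifferentiableOn.analyticOnNhd
        (((hdiffT x hxR).differentiableOn.mul (h.pc_differentiableOn hxR)).neg)
        Complex.isOpen_slitPlane) ?_ (by simp) ?_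
    · exact (Complex.starConvex_one_slitPlane.isPathConnected (by simp)).isConnected.isPreconnected
    · have hseq : Tendsto (fun n : ℕ => ((1 + 1 / ((n:ℝ) + 1) : ℝ) : ℂ)) atTop (𝓝[≠] 1) := by
        refine tendsto_nhdsWithin_iff.2 ⟨?_, Eventually.of_forall fun n => ?_⟩
        · have h1 := (tendsto_one_div_add_atTop_nhds_zero_nat (𝕜 := ℝ)).const_add 1
          have h2 := (Complex.continuous_ofReal.tendsto _).comp h1
          simpa [Function.comp_def] using h2
        · have : (0:ℝ) < 1 / ((n:ℝ) + 1) := by positivity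
          simp only [mem_compl_iff, mem_singleton_iff]
          intro h0
          have h1 : (1 + 1 / ((n:ℝ) + 1)) = 1 := by exact_mod_cast h0
          linarith
      refine hseq.frequently (Eventually.of_forall fun n => hLreal _ ?_).frequently
      positivity
  have := le_of_tendsto (hL ζ hζs).norm (Eventually.of_forall fun n => hbound n hδ hζ)
  rwa [hcongr hζs, norm_neg] at this

end

section
variable {μ : Measure ℝ} {u v : ℝ → ℝ} {f : ℂ → ℂ} {M : ℝ → ℝ} {ζ : ℂ} {s r : ℝ}

/-- The integral of `u` against the difference quotients of `f` at the points `-s`. -/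
def dqT (μ : Measure ℝ) (u : ℝ → ℝ) (f : ℂ → ℂ) (ζ : ℂ) : ℂ :=
  ∫ s, (u s : ℂ) * dslope f (-(s : ℂ)) ζ ∂μ

theorem dslope_neg_of_ne (h : ζ + s ≠ 0) : dslope f (-(s : ℂ)) ζ = (f ζ - f (-s)) / (ζ + s) := by
  rw [dslope_of_ne, slope_def_field, sub_neg_eq_add]
  intro e
  exact h (by rw [e]; ring)

theorem norm_dslope_le_of_one_le (hM : Monotone M) (hf : ∀ z, ‖f z‖ ≤ M ‖z‖)
    (hv : ‖f (-s)‖ = |v s|) (hr : ‖ζ‖ ≤ r) (h1 : 1 ≤ ‖ζ + s‖) :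
    ‖dslope f (-(s : ℂ)) ζ‖ ≤ (M r + |v s|) / ‖ζ + s‖ := by
  have h0 : ζ + s ≠ 0 := norm_pos_iff.1 (by linarith)
  rw [dslope_neg_of_ne h0, norm_div]
  have h2 : ‖f ζ - f (-s)‖ ≤ M r + |v s| :=
    (norm_sub_le _ _).trans (by rw [hv]; exact add_le_add ((hf ζ).trans (hM hr)) le_rfl)
  gcongr

theorem norm_dslope_le (hfd : Differentiable ℂ f) (hM : Monotone M) (hf : ∀ z, ‖f z‖ ≤ M ‖z‖)
    (hv : ‖f (-s)‖ = |v s|) (hs : 0 ≤ s) (hr : ‖ζ‖ ≤ r) :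
    ‖dslope f (-(s : ℂ)) ζ‖ ≤ (2 * r + 2) * (1 + s)⁻¹ * (M (r + 2) + |v s|) := by
  have hr0 : 0 ≤ r := (norm_nonneg _).trans hr
  have hM0 : 0 ≤ M r := (norm_nonneg _).trans ((hf ζ).trans (hM hr))
  have hM2 : M r ≤ M (r + 2) := hM (by linarith)
  have hP : 0 ≤ M (r + 2) + |v s| := add_nonneg (hM0.trans hM2) (abs_nonneg _)
  by_cases h1 : 1 ≤ ‖ζ + s‖
  · refine (norm_dslope_le_of_one_le hM hf hv hr h1).trans ?_
    have h2 : 1 + s ≤ (2 * r + 2) * ‖ζ + s‖ := by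
      by_cases h3 : s ≤ 2 * r + 1
      · nlinarith
      · have h4 : s - r ≤ ‖ζ + s‖ := by
          have := norm_sub_norm_le (s : ℂ) (-ζ)
          rw [norm_neg, Complex.norm_of_nonneg hs, sub_neg_eq_add, add_comm (s : ℂ)] at this
          linarith
        nlinarith
    calc _ ≤ (M (r + 2) + |v s|) / ‖ζ + s‖ := by gcongr
      _ ≤ _ := by
        rw [← div_eq_mul_inv, div_mul_eq_mul_div, div_le_div_iff₀ (by linarith) (by linarith)]
        nlinarith
  · push Not at h1
    have hs1 : s ≤ r + 1 := by
      have := norm_sub_norm_le (s : ℂ) (-ζ)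
      rw [norm_neg, Complex.norm_of_nonneg hs, sub_neg_eq_add, add_comm (s : ℂ)] at this
      linarith
    have hd : Differentiable ℂ (dslope f (-(s : ℂ))) :=
      differentiableOn_univ.1 ((Complex.differentiableOn_dslope univ_mem).2 hfd.differentiableOn)
    have h2 : ‖dslope f (-(s : ℂ)) ζ‖ ≤ M (r + 2) + |v s| := by
      refine Complex.norm_le_of_forall_mem_frontier_norm_le (U := Metric.ball ζ 2)
        Metric.isBounded_ball hd.diffContOnCl (fun w hw => ?_)
        (subset_closure (Metric.mem_ball_self two_pos))
      rw [frontier_ball _ two_ne_zero, mem_sphere_iff_norm] at hw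
      have h3 : 1 ≤ ‖w + s‖ := by
        have := norm_sub_norm_le (w - ζ) (-(ζ + s))
        rw [norm_neg, hw] at this
        have e : w - ζ - -(ζ + s) = w + s := by ring
        rw [e] at this
        linarith
      have h4 : ‖w‖ ≤ r + 2 := by
        have := norm_le_norm_add_norm_sub' w ζ
        linarith
      refine (norm_dslope_le_of_one_le hM hf hv h4 h3).trans (div_le_self hP h3)
    refine h2.trans (le_mul_of_one_le_left hP ?_)
    rw [← div_eq_mul_inv, le_div_iff₀ (by linarith)]
    linarith

theorem measurable_dslope (hfd : Differentiable ℂ f) (ζ : ℂ) :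
    Measurable fun s : ℝ => dslope f (-(s : ℂ)) ζ := by
  have e : (fun s : ℝ => dslope f (-(s : ℂ)) ζ) =
      fun s : ℝ => if ζ + s = 0 then deriv f ζ else (f ζ - f (-s)) / (ζ + s) := by
    funext s
    split_ifs with h
    · have : -(s : ℂ) = ζ := by linear_combination -h
      rw [this, dslope_same]
    · exact dslope_neg_of_ne h
  rw [e]
  refine Measurable.ite ?_ measurable_const ?_
  · exact (by fun_prop : Measurable fun s : ℝ => ζ + (s : ℂ)) (measurableSet_singleton 0)
  · have := hfd.continuous
    exact Measurable.div (Continuous.measurable (by fun_prop)) (by fun_prop)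

variable (hfd : Differentiable ℂ f) (hM : Monotone M) (hf : ∀ z, ‖f z‖ ≤ M ‖z‖)
  (hv : ∀ s : ℝ, f (-s) = (v s : ℂ)) (h0 : ∀ᵐ s ∂μ, 0 ≤ s) (hum : AEStronglyMeasurable u μ)
  (hu : Integrable (fun s => u s * (1 + s)⁻¹) μ) (huv : Integrable (fun s => u s * v s) μ)

include hfd hM hf hv h0 in
theorem ae_dslope_le (u : ℝ → ℝ) : ∀ᵐ s ∂μ, ∀ ζ : ℂ, ‖ζ‖ ≤ r →
    ‖(u s : ℂ) * dslope f (-(s : ℂ)) ζ‖ ≤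
      (2 * r + 2) * (M (r + 2) * ‖u s * (1 + s)⁻¹‖ + ‖u s * v s‖) := by
  filter_upwards [h0] with s hs ζ hr
  have hr0 : 0 ≤ r := (norm_nonneg _).trans hr
  have h1 := norm_dslope_le (v := v) hfd hM hf (by rw [hv]; simp) hs hr
  have h2 : (1 + s)⁻¹ ≤ 1 := inv_le_one_of_one_le₀ (by linarith)
  rw [norm_mul, norm_mul, norm_mul, Complex.norm_real,
    Real.norm_of_nonneg (by positivity : 0 ≤ (1 + s)⁻¹), Real.norm_eq_abs (v s)]
  calc _ ≤ ‖u s‖ * ((2 * r + 2) * (1 + s)⁻¹ * (M (r + 2) + |v s|)) := by gcongr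
    _ = (2 * r + 2) * (M (r + 2) * (‖u s‖ * (1 + s)⁻¹) + ‖u s‖ * (|v s| * (1 + s)⁻¹)) := by ring
    _ ≤ _ := by
      have := mul_le_of_le_one_right (abs_nonneg (v s)) h2
      gcongr

include hfd hM hf hv h0 hum hu huv in
theorem dqT_differentiable : Differentiable ℂ (dqT μ u f) := by
  intro z
  refine differentiableAt_integral (ε := 1) one_pos (fun w _ => ?_)
    (g := fun s => (2 * (‖z‖ + 1) + 2) *
      (M (‖z‖ + 1 + 2) * ‖u s * (1 + s)⁻¹‖ + ‖u s * v s‖))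
    (((hu.norm.const_mul _).add huv.norm).const_mul _) ?_
  · exact (Complex.continuous_ofReal.comp_aestronglyMeasurable hum).mul
      (measurable_dslope hfd w).aestronglyMeasurable
  · filter_upwards [ae_dslope_le (r := ‖z‖ + 1) hfd hM hf hv h0 u] with s hs
    refine ⟨DifferentiableOn.const_mul (((Complex.differentiableOn_dslope univ_mem).2
      hfd.differentiableOn).mono (subset_univ _)) _, fun w hw => hs w ?_⟩
    have := mem_ball_iff_norm.1 hw
    have := norm_le_norm_add_norm_sub' w z
    linarith

include hfd hM hf hv h0 hu huv in
theorem norm_dqT_le (ζ : ℂ) : ‖dqT μ u f ζ‖ ≤ (2 * ‖ζ‖ + 2) *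
    (M (‖ζ‖ + 2) * (∫ s, ‖u s * (1 + s)⁻¹‖ ∂μ) + ∫ s, ‖u s * v s‖ ∂μ) := by
  have i := ((hu.norm.const_mul (M (‖ζ‖ + 2))).add huv.norm).const_mul (2 * ‖ζ‖ + 2)
  refine (norm_integral_le_of_norm_le i ?_).trans_eq ?_
  · filter_upwards [ae_dslope_le (r := ‖ζ‖) hfd hM hf hv h0 u] with s hs using hs ζ le_rfl
  · rw [integral_const_mul]
    congr 1
    rw [← integral_const_mul]
    exact integral_add (hu.norm.const_mul _) huv.norm

theorem integrable_cauchyT (hum : AEStronglyMeasurable u μ)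
    (hu : Integrable (fun s => u s * (1 + s)⁻¹) μ) (h0 : ∀ᵐ s ∂μ, 0 ≤ s)
    (hζ : ζ ∈ Complex.slitPlane) : Integrable (fun s : ℝ => (u s : ℂ) * (ζ / (ζ + s))) μ := by
  obtain ⟨δ, hδ, hs⟩ := exists_sect hζ
  have hn : 0 < ‖ζ‖ := norm_pos_iff.2 (Complex.slitPlane_ne_zero hζ)
  refine (hu.norm.const_mul (‖ζ‖ * (1 + ‖ζ‖⁻¹) / √δ)).mono' (aesm_cauchyT hum ζ) ?_
  filter_upwards [h0] with s hs0
  rw [norm_mul, norm_mul, Complex.norm_real, Real.norm_of_nonneg (by positivity : 0 ≤ (1 + s)⁻¹)]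
  have h4 := hs.self_of_nhds.norm_div_le_mul hδ hn le_rfl hs0
  calc _ ≤ ‖u s‖ * (‖ζ‖ * (1 + ‖ζ‖⁻¹) / √δ * (1 + s)⁻¹) := by gcongr
    _ = _ := by ring

theorem integrable_mul_inv (h0 : ∀ᵐ s ∂μ, 0 ≤ s) (hu : Integrable u μ) :
    Integrable (fun s => u s * (1 + s)⁻¹) μ := by
  refine hu.norm.mono' (hu.1.mul (by fun_prop : Measurable _).aestronglyMeasurable) ?_
  filter_upwards [h0] with s hs
  rw [norm_mul, Real.norm_of_nonneg (by positivity : 0 ≤ (1 + s)⁻¹)]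
  exact mul_le_of_le_one_right (norm_nonneg _) (inv_le_one_of_one_le₀ (by linarith))

include hv h0 hum hu huv in
theorem mul_dqT (hζ : ζ ∈ Complex.slitPlane) :
    ζ * dqT μ u f ζ = f ζ * cauchyT μ u ζ - cauchyT μ (fun s => u s * v s) ζ := by
  have i1 := integrable_cauchyT hum hu h0 hζ
  have i2 := integrable_cauchyT huv.1 (integrable_mul_inv h0 huv) h0 hζ
  rw [dqT, cauchyT, cauchyT, ← integral_const_mul, ← integral_const_mul,
    ← integral_sub (i1.const_mul _) i2]
  apply integral_congr_ae
  filter_upwards [h0] with s hs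
  have := ne_zero_of_slit hζ hs
  rw [dslope_neg_of_ne this, hv]
  push_cast
  field_simp

end

section
variable {a a' μ : Measure ℝ} {R R' : ℝ≥0∞} {c x y δ ξ : ℝ} {ζ : ℂ}

theorem sq_integral_mul_le {f g : ℝ → ℝ} (hf : MemLp f 2 μ) (hg : MemLp g 2 μ) :
    (∫ s, f s * g s ∂μ) ^ 2 ≤ (∫ s, f s ^ 2 ∂μ) * ∫ s, g s ^ 2 ∂μ := by
  have key : ∀ {f g : ℝ → ℝ} (hf : MemLp f 2 μ) (hg : MemLp g 2 μ),
      inner ℝ hf.toLp hg.toLp = ∫ s, f s * g s ∂μ := by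
    intro f g hf hg
    rw [L2.inner_def]
    apply integral_congr_ae
    filter_upwards [hf.coeFn_toLp, hg.coeFn_toLp] with s h1 h2
    rw [h1, h2]
    simp [mul_comm]
  have := real_inner_mul_inner_self_le hf.toLp hg.toLp
  rw [key, key, key] at this
  simpa only [pow_two] using this

/-- The mixed second moment of two kernels. -/
def NN (a a' μ : Measure ℝ) (x y : ℝ) : ℝ := ∫ s, thn a s x * thn a' s y ∂μ

/-- The mixed Green function of two kernels. -/
def EE (a a' μ : Measure ℝ) (x y : ℝ) (ζ : ℂ) : ℂ :=
  NN a a' μ x y - cauchyT μ (fun s => thn a s x * thn a' s y) ζ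

/-- The entire comparison function of two strings. -/
def AA (a a' μ : Measure ℝ) (x y : ℝ) (ζ : ℂ) : ℂ :=
  NN a a' μ x y - th a ζ x + ζ * dqT μ (fun s => thn a' s y) (fun z => th a z x) ζ

theorem NN_comm : NN a a' μ x y = NN a' a μ y x := by
  simp only [NN, mul_comm]

theorem EE_comm : EE a a' μ x y ζ = EE a' a μ y x ζ := by
  rw [EE, EE, NN_comm]
  simp only [mul_comm (thn a _ x)]

theorem th_zero (hF : Str (dist a) x) (hx : 0 ≤ x) : th a 0 x = x := by
  have e : ∀ t, ser (dist a) (fun _ => 1) (0:ℂ) t = 1 := by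
    intro t
    rw [ser, tsum_eq_single 0 (fun n hn => by simp [hn])]
    simp [vit]
  simp [th, solF, solV_one, e]

theorem norm_th_le (hF : Str (dist a) x) (hx : 0 ≤ x) (ζ : ℂ) :
    ‖th a ζ x‖ ≤ Real.exp (2 * √(‖ζ‖ * (dist a x * x))) * x :=
  hF.theta_le ζ ⟨hx, le_rfl⟩

theorem thn_cast (a : Measure ℝ) (s x : ℝ) : th a (-(s : ℂ)) x = (thn a s x : ℂ) := by
  rw [thn, ← solF_one_cast]
  push_cast; rfl

theorem exp_growth {N κ x U V : ℝ} (hN : 0 ≤ N) (hκ : 0 ≤ κ) (hx : 0 ≤ x) (hU : 0 ≤ U)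
    (hV : 0 ≤ V) : ∃ K, ∀ r, 0 ≤ r → N + Real.exp (2 * √(r * κ)) * x +
      r * ((2 * r + 2) * (Real.exp (2 * √((r + 2) * κ)) * x * U + V)) ≤
        Real.exp (K * (1 + √r)) := by
  set C := N + x + 2 * (x * U + V) with hC
  have hC0 : 0 ≤ C := by positivity
  refine ⟨C + 4 + 4 * √κ, fun r hr => ?_⟩
  set e := Real.exp (2 * √((r + 2) * κ)) with he
  have he1 : 1 ≤ e := Real.one_le_exp (by positivity)
  have h1 : Real.exp (2 * √(r * κ)) ≤ e := by
    apply Real.exp_le_exp.2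
    gcongr
    linarith
  have h2 : N + Real.exp (2 * √(r * κ)) * x + r * ((2 * r + 2) * (e * x * U + V)) ≤
      e * (1 + r) ^ 2 * C := by
    have p1 : N ≤ e * (1 + r) ^ 2 * N := by
      apply le_mul_of_one_le_left hN
      nlinarith
    have p2 : Real.exp (2 * √(r * κ)) * x ≤ e * (1 + r) ^ 2 * x := by
      exact mul_le_mul_of_nonneg_right
        (h1.trans (le_mul_of_one_le_right (by positivity) (by nlinarith))) hx
    have p3 : r * ((2 * r + 2) * (e * x * U + V)) ≤ e * (1 + r) ^ 2 * (2 * (x * U + V)) := by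
      have q1 : e * x * U + V ≤ e * (x * U + V) := by nlinarith
      have q2 : 0 ≤ e * (x * U + V) := by positivity
      calc _ ≤ r * ((2 * r + 2) * (e * (x * U + V))) := by gcongr
        _ ≤ _ := by nlinarith
    rw [hC]
    linarith
  refine h2.trans ?_
  have h3 : (1 + r) ^ 2 ≤ Real.exp (4 * √r) := by
    have : 1 + r ≤ Real.exp (2 * √r) := by
      have q := Real.add_one_le_exp (√r)
      have q2 := Real.sq_sqrt hr
      have q3 := Real.sqrt_nonneg r
      have e2 : Real.exp (2 * √r) = Real.exp (√r) ^ 2 := by rw [← Real.exp_nat_mul]; norm_num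
      rw [e2]
      nlinarith
    calc _ ≤ Real.exp (2 * √r) ^ 2 := by gcongr
      _ = _ := by rw [← Real.exp_nat_mul]; ring_nf
  have h4 : C ≤ Real.exp C := by linarith [Real.add_one_le_exp C]
  have h5 : √((r + 2) * κ) ≤ (√r + 2) * √κ := by
    rw [Real.sqrt_mul (by linarith)]
    gcongr
    rw [Real.sqrt_le_left (by positivity)]
    nlinarith [Real.sq_sqrt hr, Real.sqrt_nonneg r]
  calc _ ≤ e * Real.exp (4 * √r) * Real.exp C := by gcongr
    _ = Real.exp (2 * √((r + 2) * κ) + 4 * √r + C) := by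
      rw [Real.exp_add _ C, Real.exp_add (2 * √((r + 2) * κ))]
    _ ≤ _ := by
      apply Real.exp_le_exp.2
      have p1 : 0 ≤ C * √r := by positivity
      have p2 : 0 ≤ √κ * √r := by positivity
      nlinarith [Real.sqrt_nonneg r, Real.sqrt_nonneg κ]

end

section
variable {a a' μ : Measure ℝ} {R R' : ℝ≥0∞} {c x y δ ξ : ℝ} {ζ : ℂ}
variable (h : Rep R a c μ) (h' : Rep R' a' c μ) (hx : x ∈ IsetOf R) (hy : y ∈ IsetOf R')

include h h' hx hy

theorem thn_mul_int : Integrable (fun s => thn a s x * thn a' s y) μ :=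
  (h.thn_memLp hx).integrable_mul (h'.thn_memLp hy)

theorem NN_sq_le : NN a a' μ x y ^ 2 ≤ x * y :=
  (sq_integral_mul_le (h.thn_memLp hx) (h'.thn_memLp hy)).trans
    (mul_le_mul (h.integral_thn_sq_le hx) (h'.integral_thn_sq_le hy)
      (integral_nonneg fun _ => sq_nonneg _) hx.1)

theorem AA_differentiable : Differentiable ℂ (AA a a' μ x y) := by
  have hF := h.str hx
  have hd : Differentiable ℂ fun z : ℂ => th a z x := hF.theta_differentiable ⟨hx.1, le_rfl⟩
  refine ((differentiable_const _).sub hd).add (differentiable_id.mul ?_)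
  have h1 := hF.pos ⟨hx.1, le_rfl⟩
  exact dqT_differentiable (M := fun r => Real.exp (2 * √(r * (dist a x * x))) * x)
    (v := fun s => thn a s x) hd
    (fun r r' hr => by
      have := _root_.mul_nonneg h1 hx.1
      have := hx.1
      dsimp only
      gcongr)
    (norm_th_le hF hx.1) (fun s => thn_cast a s x) h.ae_nonneg (h'.thn_memLp hy).1
    (h'.thn_int hy) (thn_mul_int h' h hy hx)

theorem AA_growth : ∃ K, ∀ ζ, ‖AA a a' μ x y ζ‖ ≤ Real.exp (K * (1 + √‖ζ‖)) := by
  have hF := h.str hx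
  have hd : Differentiable ℂ fun z : ℂ => th a z x := hF.theta_differentiable ⟨hx.1, le_rfl⟩
  have h1 := hF.pos ⟨hx.1, le_rfl⟩
  have hκ := _root_.mul_nonneg h1 hx.1
  obtain ⟨K, hK⟩ := exp_growth (abs_nonneg (NN a a' μ x y)) hκ hx.1
    (integral_nonneg (μ := μ) fun s => norm_nonneg (thn a' s y * (1 + s)⁻¹))
    (integral_nonneg (μ := μ) fun s => norm_nonneg (thn a' s y * thn a s x))
  refine ⟨K, fun ζ => le_trans ?_ (hK ‖ζ‖ (norm_nonneg _))⟩
  have b := norm_dqT_le (M := fun r => Real.exp (2 * √(r * (dist a x * x))) * x)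
    (v := fun s => thn a s x) hd
    (fun r r' hr => by
      have := hx.1
      dsimp only
      gcongr)
    (norm_th_le hF hx.1) (fun s => thn_cast a s x) h.ae_nonneg
    (h'.thn_int hy) (thn_mul_int h' h hy hx) ζ
  rw [AA]
  refine (norm_add_le _ _).trans (add_le_add ((norm_sub_le _ _).trans (add_le_add ?_ ?_)) ?_)
  · simp
  · exact norm_th_le hF hx.1 ζ
  · rw [norm_mul]
    exact mul_le_mul_of_nonneg_left b (norm_nonneg _)

theorem AA_eq (hζ : ζ ∈ Complex.slitPlane) :
    AA a a' μ x y ζ = EE a a' μ x y ζ - th a ζ x * pc a' μ y ζ := by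
  rw [AA, mul_dqT (v := fun s => thn a s x) (fun s => thn_cast a s x) h.ae_nonneg
    (h'.thn_memLp hy).1 (h'.thn_int hy) (thn_mul_int h' h hy hx) hζ, EE, pc]
  simp only [mul_comm (thn a' _ y)]
  ring

omit h' hy in
theorem AA_zero : AA a a' μ x y 0 = NN a a' μ x y - x := by
  rw [AA, th_zero (h.str hx) hx.1, zero_mul, add_zero]

theorem EE_eq (hζ : ζ ∈ Complex.slitPlane) :
    EE a a' μ x y ζ = ∫ s, ((thn a s x * thn a' s y : ℝ) : ℂ) * (s / (ζ + s)) ∂μ := by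
  have i := thn_mul_int h h' hx hy
  have i2 := integrable_cauchyT i.1 (integrable_mul_inv h.ae_nonneg i) h.ae_nonneg hζ
  have i1 : Integrable (fun s => ((thn a s x * thn a' s y : ℝ) : ℂ)) μ := i.ofReal
  rw [EE, NN, cauchyT, ← integral_complex_ofReal, ← integral_sub i1 i2]
  apply integral_congr_ae
  filter_upwards [h.ae_nonneg] with s hs
  have := ne_zero_of_slit hζ hs
  field_simp
  ring

theorem norm_EE_le (hζ : ζ ∈ Complex.slitPlane) (hδ : 0 < δ) (hS : Sect δ ζ) :
    ‖EE a a' μ x y ζ‖ ≤ (√δ)⁻¹ * ∫ s, ‖thn a s x * thn a' s y‖ ∂μ := by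
  have i := thn_mul_int h h' hx hy
  rw [EE_eq h h' hx hy hζ, ← integral_const_mul]
  refine norm_integral_le_of_norm_le (i.norm.const_mul _) ?_
  filter_upwards [h.ae_nonneg] with s hs
  rw [norm_mul, Complex.norm_real, mul_comm]
  exact mul_le_mul_of_nonneg_right (hS.norm_div_le' hδ hs) (norm_nonneg _)

theorem EE_tendsto (hδ : 0 < δ) {S : Set ℂ} (hS : ∀ ζ ∈ S, ζ ∈ Complex.slitPlane ∧ Sect δ ζ) :
    Tendsto (EE a a' μ x y) (comap norm atTop ⊓ 𝓟 S) (𝓝 0) := by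
  have i := thn_mul_int h h' hx hy
  have hev : ∀ᶠ ζ in comap (norm : ℂ → ℝ) atTop ⊓ 𝓟 S, ζ ∈ S :=
    mem_inf_of_right (mem_principal_self S)
  have key : Tendsto (fun ζ : ℂ => ∫ s, ((thn a s x * thn a' s y : ℝ) : ℂ) * (s / (ζ + s)) ∂μ)
      (comap norm atTop ⊓ 𝓟 S) (𝓝 (∫ s, 0 ∂μ)) := by
    refine tendsto_integral_filter_of_dominated_convergence
      (fun s => (√δ)⁻¹ * ‖thn a s x * thn a' s y‖) ?_ ?_ (i.norm.const_mul _) ?_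
    · exact Eventually.of_forall fun ζ => (Complex.continuous_ofReal.comp_aestronglyMeasurable i.1).mul
        (by fun_prop : Measurable _).aestronglyMeasurable
    · filter_upwards [hev] with ζ hζ
      filter_upwards [h.ae_nonneg] with s hs
      rw [norm_mul, Complex.norm_real, mul_comm]
      exact mul_le_mul_of_nonneg_right ((hS ζ hζ).2.norm_div_le' hδ hs) (norm_nonneg _)
    · filter_upwards [h.ae_nonneg] with s hs
      rw [← mul_zero ((thn a s x * thn a' s y : ℝ) : ℂ)]
      refine Tendsto.const_mul _ ?_
      have hn : Tendsto (fun ζ : ℂ => ‖ζ‖) (comap norm atTop ⊓ 𝓟 S) atTop :=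
        tendsto_comap.mono_left inf_le_left
      refine squeeze_zero_norm' (a := fun ζ : ℂ => s / (√δ * ‖ζ‖)) ?_
        (tendsto_const_nhds.div_atTop (hn.const_mul_atTop (Real.sqrt_pos.2 hδ)))
      filter_upwards [hev, hn.eventually_gt_atTop 0] with ζ hζ h0
      rw [norm_div, Complex.norm_of_nonneg hs]
      have := Real.sqrt_pos.2 hδ
      exact div_le_div_of_nonneg_left hs (by positivity) ((hS ζ hζ).2.norm_mul_le_norm hs)
  rw [integral_zero] at key
  refine key.congr' ?_
  filter_upwards [hev] with ζ hζ using (EE_eq h h' hx hy (hS ζ hζ).1).symm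

end

theorem cos_pi_div_ten : 0 < Real.cos (Real.pi / 10) ∧ Real.cos (Real.pi / 10) < 1 := by
  have hp := Real.pi_pos
  refine ⟨Real.cos_pos_of_mem_Ioo ⟨by linarith, by linarith⟩, ?_⟩
  rw [← Real.cos_zero]
  exact Real.cos_lt_cos_of_nonneg_of_le_pi le_rfl (by linarith) (by positivity)

theorem exists_off_sect : ∃ δ > 0, ∀ ζ : ℂ, Off ζ → ζ ≠ 0 → ζ ∈ Complex.slitPlane ∧ Sect δ ζ := by
  obtain ⟨h0, h1⟩ := cos_pi_div_ten
  refine ⟨1 - Real.cos (Real.pi / 10) ^ 2, by nlinarith, fun ζ hζ hne => ⟨?_, sect_of_re h0.le hζ⟩⟩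
  rw [Complex.mem_slitPlane_iff]
  by_contra! hc
  have hn : ‖ζ‖ = -ζ.re := by
    rw [← Complex.abs_re_eq_norm.2 hc.2, abs_of_nonpos hc.1]
  have hp := norm_pos_iff.2 hne
  have hζ : -Real.cos (Real.pi / 10) * ‖ζ‖ ≤ ζ.re := hζ
  nlinarith

section
variable {a a' μ : Measure ℝ} {R R' : ℝ≥0∞} {c x y δ ξ : ℝ} {ζ κ : ℂ}
variable (h : Rep R a c μ) (h' : Rep R' a' c μ) (hx : x ∈ IsetOf R) (hy : y ∈ IsetOf R')
variable (hx0 : 0 < x) (hy0 : 0 < y)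

include h h' hx hy hx0 hy0

theorem norm_sub_mul_sub_le (hδ : 0 < δ) (hζ : ζ ∈ Complex.slitPlane) (hS : Sect δ ζ) :
    ‖AA a a' μ x y ζ - EE a a' μ x y ζ‖ * ‖AA a' a μ y x ζ - EE a a' μ x y ζ‖ ≤
      ((x + y) / δ) ^ 2 := by
  have e : (AA a a' μ x y ζ - EE a a' μ x y ζ) * (AA a' a μ y x ζ - EE a a' μ x y ζ) =
      (th a ζ x * pc a μ x ζ) * (th a' ζ y * pc a' μ y ζ) := by
    rw [AA_eq h h' hx hy hζ, AA_eq h' h hy hx hζ, ← EE_comm (a := a)]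
    ring
  rw [← norm_mul, e, norm_mul]
  calc _ ≤ x / δ * (y / δ) := by
        gcongr
        · exact h.norm_green_le hx0 hx hδ hζ hS
        · exact h'.norm_green_le hy0 hy hδ hζ hS
    _ ≤ _ := by
        rw [div_mul_div_comm, div_pow, ← pow_two δ]
        gcongr
        nlinarith

theorem AA_const_of_const (hκ : κ ≠ 0) (hA : ∀ ζ, AA a a' μ x y ζ = κ) :
    ∃ d, ∀ ζ, AA a' a μ y x ζ = d := by
  obtain ⟨δ, hδ, hoff⟩ := exists_off_sect
  have hev := (EE_tendsto h h' hx hy hδ (S := {ζ | Off ζ ∧ ζ ≠ 0})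
    (fun ζ hζ => hoff ζ hζ.1 hζ.2)).norm.eventually_lt_const
      (show ‖(0:ℂ)‖ < ‖κ‖ / 2 by simpa using hκ)
  rw [eventually_inf_principal, eventually_comap] at hev
  obtain ⟨ρ, hρ⟩ := eventually_atTop.1 hev
  obtain ⟨K, hK⟩ := AA_growth h' h hy hx
  have hκ' := norm_pos_iff.2 hκ
  have hg : ∀ ζ : ℂ, ‖ζ‖ ≤ Real.exp (max K 2 * (1 + √‖ζ‖)) := by
    intro ζ
    have h1 := Real.add_one_le_exp (√‖ζ‖)
    have h2 := Real.sq_sqrt (norm_nonneg ζ)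
    have h3 := Real.sqrt_nonneg ‖ζ‖
    calc ‖ζ‖ ≤ Real.exp (√‖ζ‖) ^ 2 := by nlinarith
      _ = Real.exp (2 * √‖ζ‖) := by rw [← Real.exp_nat_mul]; norm_num
      _ ≤ _ := by
        apply Real.exp_le_exp.2
        nlinarith [le_max_right K 2]
  have hg' : ∀ ζ : ℂ, ‖AA a' a μ y x ζ‖ ≤ Real.exp (max K 2 * (1 + √‖ζ‖)) := fun ζ =>
    (hK ζ).trans (Real.exp_le_exp.2 (mul_le_mul_of_nonneg_right (le_max_left _ _) (by positivity)))
  have hmin : ∀ ζ : ℂ, max ρ 1 ≤ ‖ζ‖ → Off ζ →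
      ‖AA a' a μ y x ζ‖ ≤ ((x + y) / δ) ^ 2 / (‖κ‖ / 2) + ‖κ‖ / 2 := by
    intro ζ hζ ho
    have hζ0 : ζ ≠ 0 := by
      rw [← norm_pos_iff]
      exact one_pos.trans_le ((le_max_right _ _).trans hζ)
    have hE := hρ ‖ζ‖ ((le_max_left _ _).trans hζ) ζ rfl ⟨ho, hζ0⟩
    obtain ⟨hs, hS⟩ := hoff ζ ho hζ0
    have hp := norm_sub_mul_sub_le h h' hx hy hx0 hy0 hδ hs hS
    have hAE : ‖κ‖ / 2 ≤ ‖AA a a' μ x y ζ - EE a a' μ x y ζ‖ := by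
      rw [hA]
      linarith [norm_sub_norm_le κ (EE a a' μ x y ζ)]
    have hBE : ‖AA a' a μ y x ζ - EE a a' μ x y ζ‖ ≤ ((x + y) / δ) ^ 2 / (‖κ‖ / 2) := by
      rw [le_div_iff₀ (by positivity)]
      nlinarith [norm_nonneg (AA a' a μ y x ζ - EE a a' μ x y ζ)]
    linarith [norm_sub_norm_le (AA a' a μ y x ζ) (EE a a' μ x y ζ)]
  rcases two_tract differentiable_id (AA_differentiable h' h hy hx) hg hg'
    (fun ζ hζ ho => Or.inr (hmin ζ hζ ho)) with ⟨c, hc⟩ | hc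
  · have := (hc 0).trans (hc 1).symm
    simp at this
  · exact hc

theorem AA_const_or_const : (∃ d, ∀ ζ, AA a a' μ x y ζ = d) ∨ ∃ d, ∀ ζ, AA a' a μ y x ζ = d := by
  obtain ⟨δ, hδ, hoff⟩ := exists_off_sect
  obtain ⟨K, hK⟩ := AA_growth h h' hx hy
  obtain ⟨K', hK'⟩ := AA_growth h' h hy hx
  set M := (√δ)⁻¹ * ∫ s, ‖thn a s x * thn a' s y‖ ∂μ with hM
  refine two_tract (ρ := 1) (C := (x + y) / δ + M) (K := max K K')
    (AA_differentiable h h' hx hy) (AA_differentiable h' h hy hx)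
    (fun ζ => (hK ζ).trans (Real.exp_le_exp.2
      (mul_le_mul_of_nonneg_right (le_max_left _ _) (by positivity))))
    (fun ζ => (hK' ζ).trans (Real.exp_le_exp.2
      (mul_le_mul_of_nonneg_right (le_max_right _ _) (by positivity)))) fun ζ hζ ho => ?_
  have hζ0 : ζ ≠ 0 := norm_pos_iff.1 (one_pos.trans_le hζ)
  obtain ⟨hs, hS⟩ := hoff ζ ho hζ0
  have hp := norm_sub_mul_sub_le h h' hx hy hx0 hy0 hδ hs hS
  have hE := norm_EE_le h h' hx hy hs hδ hS
  by_contra! hc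
  have h1 : (x + y) / δ < ‖AA a a' μ x y ζ - EE a a' μ x y ζ‖ := by
    linarith [norm_sub_norm_le (AA a a' μ x y ζ) (EE a a' μ x y ζ)]
  have h2 : (x + y) / δ < ‖AA a' a μ y x ζ - EE a a' μ x y ζ‖ := by
    linarith [norm_sub_norm_le (AA a' a μ y x ζ) (EE a a' μ x y ζ)]
  have h3 : 0 < (x + y) / δ := by positivity
  nlinarith

/-- Either one of the comparison functions vanishes or the Green functions are compatible. -/
theorem AA_alternative : (∀ ζ, AA a a' μ x y ζ = 0) ∨ (∀ ζ, AA a' a μ y x ζ = 0) ∨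
    ∀ ξ, 0 < ξ → solF (dist a) ξ 1 0 x * ph a' c μ ξ y - solF (dist a') ξ 1 0 y * ph a c μ ξ x =
      x - y := by
  by_cases h1 : ∀ ζ, AA a a' μ x y ζ = 0
  · exact Or.inl h1
  by_cases h2 : ∀ ζ, AA a' a μ y x ζ = 0
  · exact Or.inr (Or.inl h2)
  refine Or.inr (Or.inr ?_)
  have hboth : (∃ d, ∀ ζ, AA a a' μ x y ζ = d) ∧ ∃ d, ∀ ζ, AA a' a μ y x ζ = d := by
    rcases AA_const_or_const h h' hx hy hx0 hy0 with ⟨d, hd⟩ | ⟨d, hd⟩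
    · exact ⟨⟨d, hd⟩, AA_const_of_const h h' hx hy hx0 hy0
        (by rintro rfl; exact h1 hd) hd⟩
    · exact ⟨AA_const_of_const h' h hy hx hy0 hx0 (by rintro rfl; exact h2 hd) hd, d, hd⟩
  obtain ⟨⟨d, hd⟩, d', hd'⟩ := hboth
  intro ξ hξ
  have hs : (ξ : ℂ) ∈ Complex.slitPlane := Or.inl hξ
  have e1 := AA_eq h h' hx hy hs
  have e2 := AA_eq h' h hy hx hs
  have z1 := AA_zero (a' := a') (y := y) h hx
  have z2 := AA_zero (a' := a) (y := x) h' hy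
  rw [hd] at e1 z1
  rw [hd'] at e2 z2
  rw [h'.pc_ofReal hy hξ, th, solF_one_cast] at e1
  rw [h.pc_ofReal hx hξ, th, solF_one_cast, ← EE_comm] at e2
  rw [← NN_comm] at z2
  have : ((solF (dist a) ξ 1 0 x * ph a' c μ ξ y - solF (dist a') ξ 1 0 y * ph a c μ ξ x : ℝ) : ℂ) =
      ((x - y : ℝ) : ℂ) := by
    push_cast
    linear_combination e1 - e2 - z1 + z2
  exact_mod_cast this

end

section
variable {a a' μ : Measure ℝ} {R R' : ℝ≥0∞} {c x y y' δ ξ s : ℝ} {ζ : ℂ}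

theorem norm_frac_le_one (hξ : 0 < ξ) (hs : 0 ≤ s) : ‖(s : ℂ) / ((ξ : ℂ) + s)‖ ≤ 1 := by
  rw [← Complex.ofReal_add, ← Complex.ofReal_div, Complex.norm_real,
    Real.norm_of_nonneg (by positivity)]
  exact (div_le_one (by positivity)).2 (by linarith)

variable (h : Rep R a c μ) (h' : Rep R' a' c μ) (hx : x ∈ IsetOf R) (hy : y ∈ IsetOf R')

include h h' hx hy

theorem integrable_EE (hξ : 0 < ξ) :
    Integrable (fun s : ℝ => ((thn a s x * thn a' s y : ℝ) : ℂ) * (s / ((ξ : ℂ) + s))) μ := by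
  have i := thn_mul_int h h' hx hy
  refine i.norm.mono' ((Complex.continuous_ofReal.comp_aestronglyMeasurable i.1).mul
    (by fun_prop : Measurable _).aestronglyMeasurable) ?_
  filter_upwards [h.ae_nonneg] with s hs
  rw [norm_mul, Complex.norm_real]
  exact mul_le_of_le_one_right (norm_nonneg _) (norm_frac_le_one hξ hs)

theorem norm_EE_sub_sq_le (hξ : 0 < ξ) (hy' : 0 ≤ y') (hyy : y' ≤ y) :
    ‖EE a a' μ x y ξ - EE a a' μ x y' ξ‖ ^ 2 ≤ x * (y - y') := by
  have hs : (ξ : ℂ) ∈ Complex.slitPlane := Or.inl hξ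
  have hm := iset_down hy hy' hyy
  have hd : MemLp (fun s => thn a' s y - thn a' s y') 2 μ :=
    (h'.thn_memLp hy).sub (h'.thn_memLp hm)
  have key : ‖EE a a' μ x y ξ - EE a a' μ x y' ξ‖ ≤
      ∫ s, ‖thn a s x‖ * ‖thn a' s y - thn a' s y'‖ ∂μ := by
    rw [EE_eq h h' hx hy hs, EE_eq h h' hx hm hs,
      ← integral_sub (integrable_EE h h' hx hy hξ) (integrable_EE h h' hx hm hξ)]
    refine norm_integral_le_of_norm_le ((h.thn_memLp hx).norm.integrable_mul hd.norm) ?_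
    filter_upwards [h.ae_nonneg] with s hs
    rw [← sub_mul, ← Complex.ofReal_sub, ← mul_sub, norm_mul, Complex.norm_real, norm_mul]
    exact mul_le_of_le_one_right (by positivity) (norm_frac_le_one hξ hs)
  have h2 := sq_integral_mul_le (h.thn_memLp hx).norm hd.norm
  simp only [Real.norm_eq_abs, sq_abs] at h2 key
  calc _ ≤ _ := pow_le_pow_left₀ (norm_nonneg _) key 2
    _ ≤ _ := h2
    _ ≤ _ := mul_le_mul (h.integral_thn_sq_le hx) (h'.integral_thn_sub_sq_le hy hy' hyy)
      (integral_nonneg fun _ => sq_nonneg _) hx.1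

theorem EE_continuousWithinAt (hξ : 0 < ξ) :
    ContinuousWithinAt (fun z => EE a a' μ x z ξ) (IsetOf R') y := by
  rw [ContinuousWithinAt, tendsto_iff_norm_sub_tendsto_zero]
  have key : Tendsto (fun z => √(x * |z - y|)) (𝓝[IsetOf R'] y) (𝓝 0) := by
    have : Continuous fun z => √(x * |z - y|) := by fun_prop
    simpa using (this.tendsto y).mono_left nhdsWithin_le_nhds
  refine squeeze_zero' (Eventually.of_forall fun _ => norm_nonneg _) ?_ key
  filter_upwards [self_mem_nhdsWithin] with z hz
  apply Real.le_sqrt_of_sq_le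
  rcases le_total y z with hzy | hzy
  · rw [abs_of_nonneg (by linarith)]
    exact norm_EE_sub_sq_le h h' hx hz hξ hy.1 hzy
  · rw [norm_sub_rev, abs_of_nonpos (by linarith), neg_sub]
    exact norm_EE_sub_sq_le h h' hx hy hξ hz.1 hzy

theorem le_of_AA_eq_zero (hx0 : 0 < x) (hA : ∀ ζ, AA a a' μ x y ζ = 0) : x ≤ y := by
  have h0 := AA_zero (a' := a') (y := y) h hx
  rw [hA, eq_comm, sub_eq_zero] at h0
  have h1 : NN a a' μ x y = x := by exact_mod_cast h0
  have h2 := NN_sq_le h h' hx hy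
  rw [h1] at h2
  nlinarith

theorem EE_of_AA_eq_zero (hξ : 0 < ξ) (hA : ∀ ζ, AA a a' μ x y ζ = 0) :
    EE a a' μ x y ξ = ((solF (dist a) ξ 1 0 x * ph a' c μ ξ y : ℝ) : ℂ) := by
  have h1 := AA_eq h h' hx hy (ζ := ξ) (Or.inl hξ)
  rw [hA, h'.pc_ofReal hy hξ, th, solF_one_cast, eq_comm, sub_eq_zero] at h1
  rw [h1]
  push_cast; rfl

end

section
variable {a a' μ : Measure ℝ} {R R' : ℝ≥0∞} {c x y y' δ ξ s : ℝ} {ζ : ℂ}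

theorem Rep.ph_cont (h : Rep R a c μ) (hx : x ∈ IsetOf R) (hx0 : 0 < x) (hξ : 0 < ξ) :
    ContinuousAt (ph a c μ ξ) x := by
  obtain ⟨Y, hY, hxY⟩ := iset_succ hx
  exact (((h.weyl ξ hξ).sol Y hY).f_cont hY.1).continuousAt (Icc_mem_nhds hx0 hxY)

theorem Rep.theta_cont (h : Rep R a c μ) (hx : x ∈ IsetOf R) (hx0 : 0 < x) (ξ : ℝ) :
    ContinuousAt (solF (dist a) ξ 1 0) x := by
  obtain ⟨Y, hY, hxY⟩ := iset_succ hx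
  exact (((h.str hY).sol (ζ := ξ) (c := 1) (f₀ := 0) hY.1).f_cont hY.1).continuousAt (Icc_mem_nhds hx0 hxY)

/-- The ratios of the two fundamental solutions agree for two strings with the same data. -/
theorem Rep.cross_eq (h : Rep R a c μ) (h' : Rep R' a' c μ) (hx : x ∈ IsetOf R)
    (hx' : x ∈ IsetOf R') (hx0 : 0 < x) (hξ : 0 < ξ) :
    solF (dist a) ξ 1 0 x * ph a' c μ ξ x = solF (dist a') ξ 1 0 x * ph a c μ ξ x := by
  have hn : IsetOf R' ∈ 𝓝 x := by
    obtain ⟨Y, hY, hxY⟩ := iset_succ hx'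
    exact mem_of_superset (Icc_mem_nhds hx0 hxY) fun z hz => iset_down hY hz.1 hz.2
  have c1 : ContinuousAt (fun y => solF (dist a) ξ 1 0 x * ph a' c μ ξ y) x :=
    (h'.ph_cont hx' hx0 hξ).const_mul _
  have c2 : ContinuousAt (fun y => solF (dist a') ξ 1 0 y * ph a c μ ξ x) x :=
    (h'.theta_cont hx' hx0 ξ).mul_const _
  have cE : ContinuousAt (fun z => EE a a' μ x z ξ) x :=
    (EE_continuousWithinAt h h' hx hx' hξ).continuousAt hn
  by_cases hfr : ∃ᶠ y in 𝓝 x, solF (dist a) ξ 1 0 x * ph a' c μ ξ y -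
      solF (dist a') ξ 1 0 y * ph a c μ ξ x - (x - y) = 0
  · have c3 := (c1.sub c2).sub (continuousAt_const.sub continuousAt_id : ContinuousAt (fun y => x - y) x)
    have := isClosed_singleton.mem_of_frequently_of_tendsto hfr c3
    simp only [mem_singleton_iff, Pi.sub_apply, sub_self] at this
    linarith
  · rw [not_frequently] at hfr
    have hev : ∀ᶠ y in 𝓝 x, (x < y → EE a a' μ x y ξ =
          ((solF (dist a) ξ 1 0 x * ph a' c μ ξ y : ℝ) : ℂ)) ∧
        (y < x → EE a a' μ x y ξ = ((solF (dist a') ξ 1 0 y * ph a c μ ξ x : ℝ) : ℂ)) := by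
      filter_upwards [hfr, hn, lt_mem_nhds hx0] with y hD hy hy0
      rcases AA_alternative h h' hx hy hx0 hy0 with hA | hB | hC
      · exact ⟨fun _ => EE_of_AA_eq_zero h h' hx hy hξ hA,
          fun hlt => absurd (le_of_AA_eq_zero h h' hx hy hx0 hA) hlt.not_ge⟩
      · refine ⟨fun hlt => absurd (le_of_AA_eq_zero h' h hy hx hy0 hB) hlt.not_ge, fun _ => ?_⟩
        rw [EE_comm]
        exact EE_of_AA_eq_zero h' h hy hx hξ hB
      · exact absurd (sub_eq_zero.2 (hC ξ hξ)) hD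
    have r1 : EE a a' μ x x ξ = ((solF (dist a) ξ 1 0 x * ph a' c μ ξ x : ℝ) : ℂ) := by
      refine tendsto_nhds_unique_of_eventuallyEq
        (cE.tendsto.mono_left (nhdsWithin_le_nhds (s := Ioi x)))
        ((Complex.continuous_ofReal.continuousAt.comp c1).tendsto.mono_left nhdsWithin_le_nhds) ?_
      filter_upwards [nhdsWithin_le_nhds hev, self_mem_nhdsWithin] with y hy hlt using hy.1 hlt
    have r2 : EE a a' μ x x ξ = ((solF (dist a') ξ 1 0 x * ph a c μ ξ x : ℝ) : ℂ) := by
      refine tendsto_nhds_unique_of_eventuallyEq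
        (cE.tendsto.mono_left (nhdsWithin_le_nhds (s := Iio x)))
        ((Complex.continuous_ofReal.continuousAt.comp c2).tendsto.mono_left nhdsWithin_le_nhds) ?_
      filter_upwards [nhdsWithin_le_nhds hev, self_mem_nhdsWithin] with y hy hlt using hy.2 hlt
    exact_mod_cast r1.symm.trans r2

end

section
variable {a a' μ : Measure ℝ} {R R' : ℝ≥0∞} {c x y X t ξ ψ ψ' : ℝ} {φ v v' : ℝ → ℝ}

theorem Rep.theta_pos (h : Rep R a c μ) (hx : x ∈ IsetOf R) (hx0 : 0 < x) (hξ : 0 < ξ) :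
    0 < solF (dist a) ξ 1 0 x :=
  hx0.trans_le ((h.str hx).theta_ge hξ.le ⟨hx.1, le_rfl⟩)

theorem Rep.theta_eq (h : Rep R a c μ) (h' : Rep R' a' c μ) (hx : x ∈ IsetOf R)
    (hx' : x ∈ IsetOf R') (hx0 : 0 < x) (hξ : 0 < ξ) :
    solF (dist a) ξ 1 0 x = solF (dist a') ξ 1 0 x := by
  obtain ⟨Y, hY, hxY⟩ := iset_succ hx
  obtain ⟨Y', hY', hxY'⟩ := iset_succ hx'
  have S1 := (h.str hY).sol (ζ := ξ) (c := 1) (f₀ := 0) hY.1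
  have S1' := (h'.str hY').sol (ζ := ξ) (c := 1) (f₀ := 0) hY'.1
  have S2 := (h.weyl ξ hξ).sol Y hY
  have S2' := (h'.weyl ξ hξ).sol Y' hY'
  have w := S1.wronskian S2 (h.str hY) ⟨hx.1, hxY.le⟩
  have w' := S1'.wronskian S2' (h'.str hY') ⟨hx.1, hxY'.le⟩
  have d := (S1.f_deriv (h.str hY) ⟨hx.1, hxY⟩).mul (S2'.f_deriv (h'.str hY') ⟨hx.1, hxY'⟩)
  have d' := (S1'.f_deriv (h'.str hY') ⟨hx.1, hxY'⟩).mul (S2.f_deriv (h.str hY) ⟨hx.1, hxY⟩)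
  have hev : (solF (dist a) ξ 1 0 * ph a' c μ ξ) =ᶠ[𝓝[Ici x] x]
      (solF (dist a') ξ 1 0 * ph a c μ ξ) := by
    filter_upwards [Icc_mem_nhdsGE hxY, Icc_mem_nhdsGE hxY'] with z hz hz'
    exact h.cross_eq h' (iset_down hY (hx.1.trans hz.1) hz.2)
      (iset_down hY' (hx.1.trans hz.1) hz'.2) (hx0.trans_le hz.1) hξ
  have e := h.cross_eq h' hx hx' hx0 hξ
  have e' := (uniqueDiffOn_Ici x x self_mem_Ici).eq_deriv _ d
    (d'.congr_of_eventuallyEq hev e)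
  have p := h.theta_pos hx hx0 hξ
  have p' := h'.theta_pos hx' hx0 hξ
  simp only [ph] at e
  set θ := solF (dist a) ξ 1 0 x
  set θ' := solF (dist a') ξ 1 0 x
  have : θ ^ 2 = θ' ^ 2 := by
    generalize solF (dist a) ξ (-psi c μ ξ) 1 x = f at *
    generalize solF (dist a') ξ (-psi c μ ξ) 1 x = f' at *
    generalize solV (dist a) ξ (-psi c μ ξ) 1 x = g at *
    generalize solV (dist a') ξ (-psi c μ ξ) 1 x = g' at *
    generalize solV (dist a) ξ 1 0 x = q at *
    generalize solV (dist a') ξ 1 0 x = q' at *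
    linear_combination (-θ * θ') * e' - θ ^ 2 * w' + θ' ^ 2 * w + (q * θ' + q' * θ) * e
  exact (pow_left_inj₀ p.le p'.le two_ne_zero).1 this

theorem Rep.ph_eq_ph (h : Rep R a c μ) (h' : Rep R' a' c μ) (hx : x ∈ IsetOf R)
    (hx' : x ∈ IsetOf R') (hξ : 0 < ξ) : ph a c μ ξ x = ph a' c μ ξ x := by
  rcases hx.1.eq_or_lt with rfl | hx0
  · simp [ph, solF]
  · have e := h.cross_eq h' hx hx' hx0 hξ
    rw [← h.theta_eq h' hx hx' hx0 hξ] at e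
    exact (mul_left_cancel₀ (h.theta_pos hx hx0 hξ).ne' e).symm

/-- A string is determined by a nonvanishing solution. -/
theorem dist_eq_of_sol {F F' : ℝ → ℝ} (hF : Str F X) (hF' : Str F' X) (hξ : ξ ≠ 0)
    {f v v' : ℝ → ℝ} {c₀ : ℝ} (S : Sol F X ξ c₀ 1 f v) (S' : Sol F' X ξ c₀ 1 f v')
    (hv : ∀ t ∈ Ico 0 X, v t = v' t) (hf : ∀ t ∈ Icc 0 X, f t ≠ 0) (ht : t ∈ Ico 0 X) :
    F t = F' t := by
  have hX : 0 ≤ X := ht.1.trans ht.2.le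
  have key : ∀ t ∈ Ico 0 X, (F t - F' t) * f t = ∫ s in (0:ℝ)..t, (F s - F' s) * v s := by
    intro t ht
    have htt : t ∈ Icc 0 X := ⟨ht.1, ht.2.le⟩
    have e1 := S.v_eq t htt
    have e2 := S'.v_eq t htt
    have e3 : ∫ s in (0:ℝ)..t, F' s * v' s = ∫ s in (0:ℝ)..t, F' s * v s := by
      apply intervalIntegral.integral_congr
      intro s hs
      rw [uIcc_of_le ht.1] at hs
      simp only [hv s ⟨hs.1, hs.2.trans_lt ht.2⟩]
    have i1 := hF.mul_intable S.int htt
    have i2 := hF'.mul_intable S.int htt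
    simp only [RCLike.ofReal_real_eq_id, id] at e1 e2 i1 i2
    have e4 : ∫ s in (0:ℝ)..t, (F s - F' s) * v s =
        (∫ s in (0:ℝ)..t, F s * v s) - ∫ s in (0:ℝ)..t, F' s * v s := by
      rw [← intervalIntegral.integral_sub i1 i2]
      simp only [sub_mul]
    rw [hv t ht, e2, e3] at e1
    rw [e4]
    have : ξ * ((F t - F' t) * f t - ((∫ s in (0:ℝ)..t, F s * v s) -
        ∫ s in (0:ℝ)..t, F' s * v s)) = 0 := by linear_combination -e1
    rcases mul_eq_zero.1 this with h0 | h0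
    · exact absurd h0 hξ
    · linarith
  set I : ℝ → ℝ := fun t => ∫ s in (0:ℝ)..t, (F s - F' s) * v s with hI
  have hint : IntervalIntegrable (fun s => (F s - F' s) * v s) volume 0 X := by
    have := (hF.mul_intable S.int ⟨hX, le_rfl⟩).sub (hF'.mul_intable S.int ⟨hX, le_rfl⟩)
    simp only [RCLike.ofReal_real_eq_id, id] at this
    simpa only [sub_mul] using this
  have hc := constant_of_has_deriv_right_zero (f := fun t => I t / f t) (a := 0) (b := X)
    ((continuousOn_prim hX hint).div (S.f_cont hX) hf) (fun s hs => ?_) t ⟨ht.1, ht.2.le⟩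
  · have h0 := key t ht
    have e : I 0 = 0 := by simp [hI]
    rw [e, zero_div, div_eq_zero_iff, or_iff_left (hf t ⟨ht.1, ht.2.le⟩)] at hc
    change _ = I t at h0
    rw [hc, mul_eq_zero, or_iff_left (hf t ⟨ht.1, ht.2.le⟩)] at h0
    linarith
  · have hfs := hf s ⟨hs.1, hs.2.le⟩
    have d1 := deriv_prim hint hs (((hF.rc s hs).sub (hF'.rc s hs)).mul (S.v_rc hF hs))
    have d := d1.div (S.f_deriv hF hs) hfs
    refine d.congr_deriv ?_
    rw [← key s hs]
    field_simp
    ring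

theorem Rep.dist_eq (h : Rep R a c μ) (h' : Rep R' a' c μ) (hx : x ∈ IsetOf R)
    (hx' : x ∈ IsetOf R') : dist a x = dist a' x := by
  obtain ⟨Y, hY, hxY⟩ := iset_succ hx
  obtain ⟨Y', hY', hxY'⟩ := iset_succ hx'
  set Z := min Y Y' with hZ
  have hxZ : x < Z := lt_min hxY hxY'
  have mZ : Z ∈ IsetOf R := iset_down hY (hx.1.trans hxZ.le) (min_le_left _ _)
  have mZ' : Z ∈ IsetOf R' := iset_down hY' (hx.1.trans hxZ.le) (min_le_right _ _)
  have S := (h.weyl 1 one_pos).sol Z mZ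
  have S' := (h'.weyl 1 one_pos).sol Z mZ'
  have he : ∀ t ∈ Icc 0 Z, ph a c μ 1 t = ph a' c μ 1 t := fun t ht =>
    h.ph_eq_ph h' (iset_down mZ ht.1 ht.2) (iset_down mZ' ht.1 ht.2) one_pos
  have hv : ∀ t ∈ Ico 0 Z, pv a c μ 1 t = pv a' c μ 1 t := fun t ht => by
    refine (uniqueDiffOn_Ici t t self_mem_Ici).eq_deriv _ (S.f_deriv (h.str mZ) ht)
      ((S'.f_deriv (h'.str mZ') ht).congr_of_eventuallyEq ?_ (he t ⟨ht.1, ht.2.le⟩))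
    filter_upwards [Icc_mem_nhdsGE ht.2] with z hz using he z ⟨ht.1.trans hz.1, hz.2⟩
  refine dist_eq_of_sol (h.str mZ) (h'.str mZ') one_ne_zero S
    (S' := ⟨S'.int, fun t ht => (he t ht).trans (S'.f_eq t ht), fun t ht => ?_⟩) hv
    (fun t ht => ((h.weyl 1 one_pos).pos h.fin h.pos one_pos (iset_down mZ ht.1 ht.2)).ne')
    ⟨hx.1, hxZ⟩
  have := he t ht
  simp only [ph] at this
  rw [this]
  exact S'.v_eq t ht

theorem Rep.length_le (h : Rep R a c μ) (h' : Rep R' a' c μ) : R' ≤ R := by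
  by_contra! hlt
  have hR : R ≠ ⊤ := hlt.ne_top
  set r := R.toReal with hr
  have hr0 : 0 < r := ENNReal.toReal_pos h.pos.ne' hR
  have hm : r ∈ IsetOf R' := ⟨hr0.le, by rwa [hr, ENNReal.ofReal_toReal hR]⟩
  have l1 := (h.weyl 1 one_pos).bdry hR
  have l2 := (h'.ph_cont hm hr0 one_pos).tendsto.mono_left (nhdsWithin_le_nhds (s := Iio r))
  have hpos := (h'.weyl 1 one_pos).pos h'.fin h'.pos one_pos hm
  refine hpos.ne' (tendsto_nhds_unique_of_eventuallyEq l2 l1 ?_)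
  filter_upwards [Ico_mem_nhdsLT hr0] with t ht
  exact (h.ph_eq_ph h' (by rw [iset_fin hR]; exact ht) (iset_down hm ht.1 ht.2.le) one_pos).symm

theorem measure_eq_of_dist_eq (hR : 0 < R) (ha : LocallyFiniteOnHalf R a)
    (ha' : LocallyFiniteOnHalf R a') (hd : ∀ x ∈ IsetOf R, dist a x = dist a' x) : a = a' := by
  obtain ⟨x, hx⟩ := exists_exh hR
  have e : ∀ y ∈ IsetOf R, a (Icc 0 y) = a' (Icc 0 y) := fun y hy =>
    (ENNReal.toReal_eq_toReal_iff' (ha.2 y hy).ne (ha'.2 y hy).ne).1 (hd y hy)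
  have r1 : a.restrict (IsetOf R) = a := Measure.restrict_eq_self_of_ae_mem (by
    rw [ae_iff]; exact ha.1)
  have r2 : a'.restrict (IsetOf R) = a' := Measure.restrict_eq_self_of_ae_mem (by
    rw [ae_iff]; exact ha'.1)
  rw [← r1, ← r2, ← hx.iUnion, Measure.restrict_iUnion_congr]
  intro n
  have : IsFiniteMeasure (a.restrict (Icc 0 (x n))) := ⟨by simpa using ha.2 _ (hx.mem n)⟩
  refine Measure.ext_of_Iic _ _ fun t => ?_
  rw [Measure.restrict_apply measurableSet_Iic, Measure.restrict_apply measurableSet_Iic,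
    show Iic t ∩ Icc 0 (x n) = Icc 0 (min (x n) t) by ext; simp; tauto]
  rcases lt_or_ge (min (x n) t) 0 with hlt | hge
  · rw [Icc_eq_empty hlt.not_ge]
    simp
  · exact e _ (iset_down (hx.mem n) hge (min_le_left _ _))

/-- The characteristic function determines the string. -/
theorem Rep.unique (h : Rep R a c μ) (h' : Rep R' a' c μ) : R' = R ∧ a' = a := by
  obtain rfl : R' = R := le_antisymm (h.length_le h') (h'.length_le h)
  exact ⟨rfl, measure_eq_of_dist_eq h.pos h'.fin h.fin fun x hx => h'.dist_eq h hx hx⟩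

/-- A string with characteristic function `c₁ + c₂ ξ + ∫ ξ / (ξ + s) μ(ds)` has the data
`c₂` and `c₁ δ₀ + μ`. -/
theorem rep_of_isStringSolution {Ψ : ℝ → ℝ} {c₁ c₂ : ℝ} (hc₁ : 0 ≤ c₁) (hμ : μ (Iic 0) = 0)
    (hΨ : ∀ ξ : ℝ, 0 < ξ → Integrable (fun s : ℝ => ξ / (ξ + s)) μ ∧
      Ψ ξ = c₁ + c₂ * ξ + ∫ s : ℝ, ξ / (ξ + s) ∂μ)
    (hR : 0 < R) (ha : LocallyFiniteOnHalf R a)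
    (hsol : ∀ ξ : ℝ, 0 < ξ → ∃ (φ v : ℝ → ℝ) (L : ℝ), IsStringSolution R a ξ φ v ∧
      Tendsto v (𝓝[>] 0) (𝓝 L) ∧ Ψ ξ = -L + (a ({0} : Set ℝ)).toReal * ξ) :
    Rep R a c₂ (μ + ENNReal.ofReal c₁ • Measure.dirac 0) where
  pos := hR
  fin := ha
  supp := by
    have : μ (Iio 0) = 0 := measure_mono_null Iio_subset_Iic_self hμ
    simp [this]
  int := by
    have h1 := (hΨ 1 one_pos).1
    simp only [one_div] at h1
    exact h1.add_measure ((integrable_dirac (by simp)).smul_measure ENNReal.ofReal_ne_top)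
  weyl := by
    intro ξ hξ
    have hs := fun X (hX : X ∈ IsetOf R) => LocallyFiniteOnHalf.str ha hX
    obtain ⟨φ, v, L, h1, h2, h3⟩ := hsol ξ hξ
    obtain ⟨p, q⟩ := (weyl_of_isStringSolution ha hR h1 h2 h3).hTot_eq hR hs hξ
    have e : psi c₂ (μ + ENNReal.ofReal c₁ • Measure.dirac 0) ξ = Ψ ξ := by
      rw [psi, (hΨ ξ hξ).2, integral_add_measure (hΨ ξ hξ).1
        ((integrable_dirac (by simp)).smul_measure ENNReal.ofReal_ne_top),
        integral_smul_measure, integral_dirac, ENNReal.toReal_ofReal hc₁]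
      simp [hξ.ne']
      ring
    rw [e]
    exact weyl_of_hTot hR hs hξ p q

end

end Krein

/-- For every complete Bernstein function `ψ` there exist a unique
`R ∈ (0, ∞]` and a unique locally finite nonnegative Borel measure `a` on `[0, R)`
(a Krein string) such that `ψ(ξ) = −φ_ξ′(0⁺) + a({0}) ξ` for every `ξ > 0`, where `φ_ξ`
is the unique solution of the string equation for `(R, a, ξ)`. -/
theorem statement11 (ψ : ℝ → ℝ) (hψ : IsCompleteBernstein ψ) :
    ∃ (R : ℝ≥0∞) (a : Measure ℝ),
      0 < R ∧ LocallyFiniteOnHalf R a ∧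
      (∀ ξ : ℝ, 0 < ξ →
        ∃ (φ v : ℝ → ℝ) (L : ℝ),
          IsStringSolution R a ξ φ v ∧
          Filter.Tendsto v (nhdsWithin 0 (Set.Ioi 0)) (nhds L) ∧
          ψ ξ = -L + (a ({0} : Set ℝ)).toReal * ξ) ∧
      (∀ (R' : ℝ≥0∞) (a' : Measure ℝ),
        0 < R' → LocallyFiniteOnHalf R' a' →
        (∀ ξ : ℝ, 0 < ξ →
          ∃ (φ v : ℝ → ℝ) (L : ℝ),
            IsStringSolution R' a' ξ φ v ∧
            Filter.Tendsto v (nhdsWithin 0 (Set.Ioi 0)) (nhds L) ∧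
            ψ ξ = -L + (a' ({0} : Set ℝ)).toReal * ξ) →
        R' = R ∧ a' = a) := by
  obtain ⟨R, a, hR, ha, hsol⟩ := Krein.exists_krein hψ
  obtain ⟨c₁, c₂, μ, hc₁, -, hμ, -, hΨ⟩ := hψ
  exact ⟨R, a, hR, ha, hsol, fun R' a' hR' ha' hsol' =>
    (Krein.rep_of_isStringSolution hc₁ hμ hΨ hR ha hsol).unique
      (Krein.rep_of_isStringSolution hc₁ hμ hΨ hR' ha' hsol')⟩
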